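/- Let N ≥ 3, m > 1, T > 0, and let ρ satisfy the weight condition. Let u and v be non-negative very weak solutions of ρ u_t = Δ(u^m) in ℝ^N×(0,T) such that for every φ ∈ C_c(ℝ^N), esslim_{t→0} ∫_{ℝ^N} [u(x,t) − v(x,t)] φ(x) ρ(x) dx = 0. Then u = v almost everywhere in ℝ^N×(0,T). -/

import Mathlib

open MeasureTheory Set Metric Filter
open scoped ENNReal Topology

noncomputable section

abbrev Eu (N : ℕ) := EuclideanSpace ℝ (Fin N)

/-- Signed power `a^q = |a|^{q-1} a`. -/
def spow (a q : ℝ) : ℝ := |a| ^ (q - 1) * a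

/-- The weight condition \eqref{weight-cond}: `ρ` is measurable and
`C̲ (1+|x|)^{-γ} ≤ ρ(x) ≤ C̄ |x|^{-γ}` for a.e. `x`, with `γ ∈ [0,2)` and `0 < C̲ < C̄`. -/
def WeightCond (N : ℕ) (γ Cl Cu : ℝ) (ρ : Eu N → ℝ) : Prop :=
  Measurable ρ ∧ 0 ≤ γ ∧ γ < 2 ∧ 0 < Cl ∧ Cl < Cu ∧
    ∀ᵐ x ∂(volume : Measure (Eu N)), Cl * (1 + ‖x‖) ^ (-γ) ≤ ρ x ∧ ρ x ≤ Cu * ‖x‖ ^ (-γ)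

/-- Time derivative `ψ_t` of a space-time test function. -/
def ptder {N : ℕ} (ψ : Eu N × ℝ → ℝ) (p : Eu N × ℝ) : ℝ := fderiv ℝ ψ p (0, 1)

/-- Spatial Laplacian `Δψ` of a space-time test function. -/
def lapX {N : ℕ} (ψ : Eu N × ℝ → ℝ) (p : Eu N × ℝ) : ℝ :=
  ∑ i : Fin N, fderiv ℝ (fun q => fderiv ℝ ψ q (EuclideanSpace.single i 1, 0)) p
    (EuclideanSpace.single i 1, 0)

/-- Very weak solution of `ρ u_t = Δ(u^m)` in `Ω × (τ₁, τ₂)` (Definitions 2.6 / 2.8). -/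
structure VWS {N : ℕ} (ρ : Eu N → ℝ) (m : ℝ) (Ω : Set (Eu N)) (τ₁ τ₂ : ℝ)
    (u : Eu N → ℝ → ℝ) : Prop where
  aemeas : AEMeasurable (fun p : Eu N × ℝ => u p.1 p.2)
    (volume.restrict (Ω ×ˢ Ioo τ₁ τ₂))
  locint : ∀ K : Set (Eu N × ℝ), IsCompact K → K ⊆ Ω ×ˢ Ioo τ₁ τ₂ →
    IntegrableOn (fun p : Eu N × ℝ => |u p.1 p.2| * ρ p.1) K ∧
      IntegrableOn (fun p : Eu N × ℝ => |u p.1 p.2| ^ m) K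
  weak : ∀ ψ : Eu N × ℝ → ℝ, ContDiff ℝ (⊤ : ℕ∞) ψ → HasCompactSupport ψ →
    tsupport ψ ⊆ Ω ×ˢ Ioo τ₁ τ₂ →
    ∫ p in Ω ×ˢ Ioo τ₁ τ₂,
      (u p.1 p.2 * ptder ψ p * ρ p.1 + spow (u p.1 p.2) m * lapX ψ p) = 0

/-- `u ∈ L^∞_loc(Ω × (τ₁,τ₂))`. -/
def LinftyLoc {N : ℕ} (Ω : Set (Eu N)) (τ₁ τ₂ : ℝ) (u : Eu N → ℝ → ℝ) : Prop :=
  ∀ K : Set (Eu N × ℝ), IsCompact K → K ⊆ Ω ×ˢ Ioo τ₁ τ₂ →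
    ∃ M : ℝ, ∀ᵐ p ∂(volume.restrict K : Measure (Eu N × ℝ)), |u p.1 p.2| ≤ M

section

open scoped ContDiff
open ENNReal (ofReal)

variable {N : ℕ} {ρ f g Q Ψ : Eu N → ℝ} {u v : Eu N → ℝ → ℝ} {χ κ : ℝ → ℝ} {x : Eu N}
  {m T T1 T2 T3 γ Cl Cu σ τ μ r a b q n t s C R K C0 C1 Bc lam : ℝ}

lemma lt_or_lt_of_notMem_Icc (h : t ∉ Icc a b) : t < a ∨ b < t := by
  rwa [mem_Icc, not_and_or, not_le, not_le] at h

/-- Cutoff vanishing for `q ≤ 1/4` and equal to `1` for `1 ≤ q`. -/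
def kcut (q : ℝ) : ℝ := Real.smoothTransition ((4 * q - 1) / 3)

lemma kcut_contDiff : ContDiff ℝ ∞ kcut :=
  Real.smoothTransition.contDiff.comp (by fun_prop)

lemma kcut_zero (h : q ≤ 1 / 4) : kcut q = 0 :=
  Real.smoothTransition.zero_of_nonpos (by linarith)

lemma kcut_one (h : 1 ≤ q) : kcut q = 1 :=
  Real.smoothTransition.one_of_one_le (by linarith)

lemma kcut_nonneg (q : ℝ) : 0 ≤ kcut q := Real.smoothTransition.nonneg _
lemma kcut_le_one (q : ℝ) : kcut q ≤ 1 := Real.smoothTransition.le_one _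
lemma kcut_mono : Monotone kcut := fun a b h =>
  Real.smoothTransition.monotone (by linarith)

/-- Minus the derivative of the truncated Newton profile. -/
def kh (n : ℝ) (q : ℝ) : ℝ := (n / 2 - 1) * (kcut q * q ^ (-(n / 2)) + (1 - kcut q))

/-- Profile `q ↦ Φ(q)` with `Φ(q) = q^{1-n/2}` for `1 ≤ q`, smooth on the whole line. -/
def kb (n : ℝ) (q : ℝ) : ℝ := 1 + ∫ s in q..1, kh n s

/-- Minus the Laplacian of `z ↦ kb n (‖z‖²)`, as a function of `‖z‖²`. -/
def kth (n : ℝ) (q : ℝ) : ℝ := 4 * q * deriv (kh n) q + 2 * n * kh n q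

lemma kh_eq_of_le (h : q ≤ 1 / 4) : kh n q = n / 2 - 1 := by
  simp [kh, kcut_zero h]

lemma kh_eq_of_ge (h : 1 ≤ q) : kh n q = (n / 2 - 1) * q ^ (-(n / 2)) := by
  simp [kh, kcut_one h]

lemma kh_contDiff (n : ℝ) : ContDiff ℝ ∞ (kh n) := by
  rw [contDiff_iff_contDiffAt]
  intro q
  rcases lt_or_ge q (1 / 4) with h | h
  · have : kh n =ᶠ[𝓝 q] fun _ => n / 2 - 1 := by
      filter_upwards [Iio_mem_nhds h] with y hy using kh_eq_of_le hy.le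
    exact contDiffAt_const.congr_of_eventuallyEq this
  · have hq : q ≠ 0 := by linarith
    unfold kh
    exact contDiffAt_const.mul ((kcut_contDiff.contDiffAt.mul
      (contDiffAt_id.rpow_const_of_ne hq)).add (contDiffAt_const.sub kcut_contDiff.contDiffAt))

lemma kh_continuous (n : ℝ) : Continuous (kh n) := (kh_contDiff n).continuous

lemma kb_hasDerivAt (n q : ℝ) : HasDerivAt (kb n) (-kh n q) q := by
  unfold kb
  exact (intervalIntegral.integral_hasDerivAt_left ((kh_continuous n).intervalIntegrable _ _)
    ((kh_continuous n).stronglyMeasurableAtFilter _ _) (kh_continuous n).continuousAt).const_add 1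

lemma kh_hasDerivAt (n q : ℝ) : HasDerivAt (kh n) (deriv (kh n) q) q :=
  ((kh_contDiff n).differentiable (by simp) q).hasDerivAt

lemma deriv_kh_continuous (n : ℝ) : Continuous (deriv (kh n)) :=
  (kh_contDiff n).continuous_deriv (by simp)

lemma kb_contDiff (n : ℝ) : ContDiff ℝ ∞ (kb n) := by
  rw [contDiff_infty_iff_deriv]
  refine ⟨fun q => (kb_hasDerivAt n q).differentiableAt, ?_⟩
  have : deriv (kb n) = fun q => -kh n q := funext fun q => (kb_hasDerivAt n q).deriv
  rw [this]; exact (kh_contDiff n).neg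

lemma kth_continuous (n : ℝ) : Continuous (kth n) := by
  unfold kth
  have := deriv_kh_continuous n
  have := kh_continuous n
  fun_prop

lemma kth_formula (hq : 0 < q) :
    kth n q = 4 * (n / 2 - 1) *
      (deriv kcut q * (q ^ (1 - n / 2) - q) + (1 - kcut q) * (n / 2)) := by
  have hk : HasDerivAt kcut (deriv kcut q) q :=
    (kcut_contDiff.differentiable (by simp) q).hasDerivAt
  have h1 : HasDerivAt (kh n) ((n / 2 - 1) * ((deriv kcut q * q ^ (-(n / 2)) +
      kcut q * (-(n / 2) * q ^ (-(n / 2) - 1))) + (0 - deriv kcut q))) q := by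
    have h2 := (hk.mul (Real.hasDerivAt_rpow_const (p := -(n / 2)) (Or.inl hq.ne'))).add
      ((hasDerivAt_const q (1 : ℝ)).sub hk)
    exact h2.const_mul _
  have e1 : q ^ (1 - n / 2) = q * q ^ (-(n / 2)) := by
    rw [show 1 - n / 2 = 1 + -(n / 2) by ring, Real.rpow_add hq, Real.rpow_one]
  have e2 : q ^ (-(n / 2)) = q * q ^ (-(n / 2) - 1) := by
    rw [Real.rpow_sub_one hq.ne']; field_simp
  unfold kth
  rw [h1.deriv, kh, e1, e2]
  ring

lemma deriv_kcut_nonneg (q : ℝ) : 0 ≤ deriv kcut q := kcut_mono.deriv_nonneg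

lemma kth_of_lt (h : q < 1 / 4) : kth n q = 2 * n * (n / 2 - 1) := by
  have : kh n =ᶠ[𝓝 q] fun _ => n / 2 - 1 := by
    filter_upwards [Iio_mem_nhds h] with y hy using kh_eq_of_le (le_of_lt hy)
  rw [kth, this.deriv_eq, kh_eq_of_le h.le]; simp

lemma kth_nonneg (hn : 2 < n) (q : ℝ) (h1 : q ≤ 1) : 0 ≤ kth n q := by
  rcases lt_or_ge q (1 / 4) with h | h
  · rw [kth_of_lt h]
    have : 0 ≤ n / 2 - 1 := by linarith
    positivity
  · have hq : 0 < q := by linarith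
    rw [kth_formula hq]
    have a1 : 0 ≤ n / 2 - 1 := by linarith
    have a2 := deriv_kcut_nonneg q
    have a3 := kcut_le_one q
    have a4 : q ≤ q ^ (1 - n / 2) := by
      calc q = q ^ (1 : ℝ) := (Real.rpow_one q).symm
        _ ≤ q ^ (1 - n / 2) := Real.rpow_le_rpow_of_exponent_ge hq h1 (by linarith)
    have a5 : 0 ≤ deriv kcut q * (q ^ (1 - n / 2) - q) := mul_nonneg a2 (by linarith)
    have a6 : 0 ≤ (1 - kcut q) * (n / 2) := mul_nonneg (by linarith) (by linarith)
    positivity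

lemma kth_eq_zero (h : 1 ≤ q) : kth n q = 0 := by
  have key : ∀ q : ℝ, 1 < q → kth n q = 0 := by
    intro q h
    have hd : kcut =ᶠ[𝓝 q] fun _ => 1 := by
      filter_upwards [Ioi_mem_nhds h] with y hy using kcut_one (le_of_lt hy)
    rw [kth_formula (by linarith), hd.deriv_eq, kcut_one h.le]; simp
  rcases h.lt_or_eq with h | h
  · exact key q h
  · subst h
    have h1 : Tendsto (kth n) (𝓝[>] 1) (𝓝 (kth n 1)) :=
      (kth_continuous n).continuousAt.tendsto.mono_left nhdsWithin_le_nhds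
    have h2 : Tendsto (kth n) (𝓝[>] 1) (𝓝 0) :=
      tendsto_const_nhds.congr' (by
        filter_upwards [self_mem_nhdsWithin] with y hy using (key y hy).symm)
    exact tendsto_nhds_unique h1 h2

lemma kth_nonneg' (hn : 2 < n) (q : ℝ) : 0 ≤ kth n q := by
  rcases le_total q 1 with h | h
  · exact kth_nonneg hn q h
  · rw [kth_eq_zero h]

lemma exists_kth_bound (n : ℝ) : ∃ C, 0 < C ∧ ∀ q, 0 ≤ q → |kth n q| ≤ C := by
  obtain ⟨C, hC⟩ := (isCompact_Icc (a := (0 : ℝ)) (b := 1)).exists_bound_of_continuousOn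
    (kth_continuous n).continuousOn
  refine ⟨max C 1, by positivity, fun q hq => ?_⟩
  rcases le_total q 1 with h | h
  · exact (hC q ⟨hq, h⟩).trans (le_max_left _ _)
  · rw [kth_eq_zero h]; simp

lemma kb_eq_of_ge (h : 1 ≤ q) : kb n q = q ^ (1 - n / 2) := by
  have hd : ∀ y ∈ uIcc 1 q, HasDerivAt (fun y : ℝ => y ^ (1 - n / 2)) (-kh n y) y := by
    intro y hy
    rw [uIcc_of_le h] at hy
    have hy0 : y ≠ 0 := by have := hy.1; positivity
    have := Real.hasDerivAt_rpow_const (x := y) (p := 1 - n / 2) (Or.inl hy0)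
    rw [kh_eq_of_ge hy.1]
    convert this using 1
    rw [show 1 - n / 2 - 1 = -(n / 2) by ring]; ring
  have := intervalIntegral.integral_eq_sub_of_hasDerivAt hd
    ((kh_continuous n).neg.intervalIntegrable _ _)
  rw [intervalIntegral.integral_neg, Real.one_rpow] at this
  rw [kb, intervalIntegral.integral_symm]
  linarith

lemma kb_le (hn : 2 < n) (h : 0 < q) : kb n q ≤ q ^ (1 - n / 2) := by
  rcases le_total 1 q with h1 | h1
  · exact (kb_eq_of_ge h1).le
  have hpos : ∀ y ∈ uIcc q 1, 0 < y := by
    intro y hy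
    rw [uIcc_of_le h1] at hy
    exact h.trans_le hy.1
  have hd : ∀ y ∈ uIcc q 1, HasDerivAt (fun y : ℝ => -y ^ (1 - n / 2))
      ((n / 2 - 1) * y ^ (-(n / 2))) y := by
    intro y hy
    have := (Real.hasDerivAt_rpow_const (x := y) (p := 1 - n / 2) (Or.inl (hpos y hy).ne')).neg
    refine this.congr_deriv ?_
    rw [show 1 - n / 2 - 1 = -(n / 2) by ring]; ring
  have hint : IntervalIntegrable (fun y : ℝ => (n / 2 - 1) * y ^ (-(n / 2))) volume q 1 := by
    apply ContinuousOn.intervalIntegrable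
    intro y hy
    exact (continuousAt_const.mul
      (Real.continuousAt_rpow_const _ _ (Or.inl (hpos y hy).ne'))).continuousWithinAt
  have h3 := intervalIntegral.integral_eq_sub_of_hasDerivAt hd hint
  have h4 : ∫ s in q..1, kh n s ≤ ∫ s in q..1, (n / 2 - 1) * s ^ (-(n / 2)) := by
    apply intervalIntegral.integral_mono_on h1 ((kh_continuous n).intervalIntegrable _ _) hint
    intro y hy
    have hy0 : 0 < y := h.trans_le hy.1
    have a1 : 1 ≤ y ^ (-(n / 2)) :=
      Real.one_le_rpow_of_pos_of_le_one_of_nonpos hy0 hy.2 (by linarith)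
    have a2 := kcut_le_one y
    unfold kh
    apply mul_le_mul_of_nonneg_left _ (by linarith)
    nlinarith
  rw [h3, Real.one_rpow] at h4
  unfold kb
  linarith

lemma kh_le_kb (hn : 2 < n) (q : ℝ) : q * kh n q ≤ (n / 2 - 1) * kb n q := by
  rcases le_total 1 q with h1 | h1
  · have hq : 0 < q := by linarith
    rw [kh_eq_of_ge h1, kb_eq_of_ge h1, show 1 - n / 2 = 1 + -(n / 2) by ring,
      Real.rpow_add hq, Real.rpow_one]
    exact le_of_eq (by ring)
  have hd : ∀ y, HasDerivAt (fun y => y * kh n y - (n / 2 - 1) * kb n y)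
      (1 / 4 * kth n y) y := by
    intro y
    have := ((hasDerivAt_id y).mul (kh_hasDerivAt n y)).sub
      ((kb_hasDerivAt n y).const_mul (n / 2 - 1))
    refine this.congr_deriv ?_
    unfold kth; simp; ring
  have hm : Monotone (fun y => y * kh n y - (n / 2 - 1) * kb n y) := by
    apply monotone_of_deriv_nonneg (fun y => (hd y).differentiableAt)
    intro y
    rw [(hd y).deriv]
    have := kth_nonneg' hn y
    positivity
  have h2 := hm h1
  simp only [kh_eq_of_ge le_rfl, kb_eq_of_ge le_rfl, Real.one_rpow] at h2
  linarith

/-- The truncated Newton profile at scale `r`. -/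
def kB (n r q : ℝ) : ℝ := r ^ (2 - n) * kb n (q / r ^ 2)

lemma kB_eq_of_ge (hr : 0 < r) (h : r ^ 2 ≤ q) : kB n r q = q ^ (1 - n / 2) := by
  have hq : 0 < q := lt_of_lt_of_le (by positivity) h
  rw [kB, kb_eq_of_ge ((one_le_div (by positivity)).2 h), Real.div_rpow hq.le (by positivity),
    ← Real.rpow_natCast r 2, ← Real.rpow_mul hr.le,
    show ((2 : ℕ) : ℝ) * (1 - n / 2) = 2 - n by push_cast; ring]
  have : 0 < r ^ (2 - n) := Real.rpow_pos_of_pos hr _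
  field_simp

lemma kB_le (hn : 2 < n) (hr : 0 < r) (hq : 0 < q) : kB n r q ≤ q ^ (1 - n / 2) := by
  have h1 := kb_le hn (show 0 < q / r ^ 2 by positivity)
  have h2 : 0 < r ^ (2 - n) := Real.rpow_pos_of_pos hr _
  have h3 : (q / r ^ 2) ^ (1 - n / 2) = q ^ (1 - n / 2) / r ^ (2 - n) := by
    rw [Real.div_rpow hq.le (by positivity), ← Real.rpow_natCast r 2, ← Real.rpow_mul hr.le,
      show ((2 : ℕ) : ℝ) * (1 - n / 2) = 2 - n by push_cast; ring]
  rw [h3, le_div_iff₀ h2] at h1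
  rw [kB]; linarith

lemma kB_anti (hn : 2 < n) (hq : 0 ≤ q) : AntitoneOn (fun r => kB n r q) (Ioi 0) := by
  have hd : ∀ r : ℝ, 0 < r → HasDerivAt (fun r => kB n r q)
      (r ^ (1 - n) * ((2 - n) * kb n (q / r ^ 2) + 2 * ((q / r ^ 2) * kh n (q / r ^ 2)))) r := by
    intro r hr
    have h1 : HasDerivAt (fun r : ℝ => q / r ^ 2) (-2 * q / r ^ 3) r := by
      have := ((hasDerivAt_const r q).div (hasDerivAt_pow 2 r) (by positivity))
      refine this.congr_deriv ?_
      simp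
      field_simp
    have h2 := (Real.hasDerivAt_rpow_const (x := r) (p := 2 - n) (Or.inl hr.ne')).mul
      ((kb_hasDerivAt n (q / r ^ 2)).comp r h1)
    refine h2.congr_deriv ?_
    simp only [Function.comp]
    rw [show 2 - n - 1 = 1 - n by ring, show (2 : ℝ) - n = (1 - n) + 1 by ring,
      Real.rpow_add_one hr.ne']
    field_simp
  apply antitoneOn_of_deriv_nonpos (convex_Ioi 0)
  · exact fun r hr => (hd r hr).continuousAt.continuousWithinAt
  · exact fun r hr => (hd r (interior_subset hr)).differentiableAt.differentiableWithinAt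
  · intro r hr
    rw [interior_Ioi] at hr
    have hr : 0 < r := hr
    rw [(hd r hr).deriv]
    have h3 := kh_le_kb hn (q / r ^ 2)
    have h4 : 0 < r ^ (1 - n) := Real.rpow_pos_of_pos hr _
    apply mul_nonpos_of_nonneg_of_nonpos h4.le
    linarith

/-- A smooth radial profile `b` with first two derivatives `b1`, `b2`, vanishing for large
arguments. -/
structure Prof (b b1 b2 : ℝ → ℝ) : Prop where
  d1 : ∀ q, -1 < q → HasDerivAt b (b1 q) q
  d2 : ∀ q, -1 < q → HasDerivAt b1 (b2 q) q
  smooth : ∀ q, -1 < q → ContDiffAt ℝ ∞ b q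
  supp : ∃ Q, 0 < Q ∧ ∀ q, Q < q → b q = 0 ∧ b1 q = 0 ∧ b2 q = 0

/-- Laplacian of `z ↦ b (‖z‖²)` in terms of `q = ‖z‖²`. -/
def radL (n : ℝ) (b1 b2 : ℝ → ℝ) (q : ℝ) : ℝ := 4 * q * b2 q + 2 * n * b1 q

def kB1 (n r q : ℝ) : ℝ := -(r ^ (-n) * kh n (q / r ^ 2))
def kB2 (n r q : ℝ) : ℝ := -(r ^ (-n - 2) * deriv (kh n) (q / r ^ 2))

lemma kB_hasDerivAt (hr : 0 < r) (q : ℝ) : HasDerivAt (kB n r) (kB1 n r q) q := by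
  have h := ((kb_hasDerivAt n (q / r ^ 2)).comp q ((hasDerivAt_id q).div_const (r ^ 2))).const_mul
    (r ^ (2 - n))
  refine h.congr_deriv ?_
  rw [kB1, show (2 : ℝ) - n = -n + 2 by ring, Real.rpow_add hr, Real.rpow_two]
  field_simp

lemma kB1_hasDerivAt (hr : 0 < r) (q : ℝ) : HasDerivAt (kB1 n r) (kB2 n r q) q := by
  have h := (((kh_hasDerivAt n (q / r ^ 2)).comp q
    ((hasDerivAt_id q).div_const (r ^ 2))).const_mul (r ^ (-n))).neg
  refine h.congr_deriv ?_
  rw [kB2, show -n = (-n - 2) + 2 by ring, Real.rpow_add hr, Real.rpow_two]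
  field_simp
  ring_nf

lemma kB_contDiff : ContDiff ℝ ∞ (kB n r) := by
  unfold kB
  exact contDiff_const.mul ((kb_contDiff n).comp (by fun_prop))

lemma kB_prof (hr : 0 < r) (hrs : r < s) :
    Prof (fun q => kB n r q - kB n s q) (fun q => kB1 n r q - kB1 n s q)
      (fun q => kB2 n r q - kB2 n s q) where
  d1 q _ := (kB_hasDerivAt hr q).sub (kB_hasDerivAt (hr.trans hrs) q)
  d2 q _ := (kB1_hasDerivAt hr q).sub (kB1_hasDerivAt (hr.trans hrs) q)
  smooth q _ := (kB_contDiff.sub kB_contDiff).contDiffAt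
  supp := by
    have hs := hr.trans hrs
    have h0 : ∀ q, s ^ 2 < q → kB n r q - kB n s q = 0 := by
      intro q hq
      rw [kB_eq_of_ge hr (by nlinarith), kB_eq_of_ge hs hq.le, sub_self]
    have h1 : ∀ q, s ^ 2 < q → kB1 n r q - kB1 n s q = 0 := by
      intro q hq
      have a := ((kB_hasDerivAt (n := n) hr q).sub (kB_hasDerivAt (n := n) hs q)).deriv
      have b : (kB n r - kB n s) =ᶠ[𝓝 q] fun _ => 0 := by
        filter_upwards [Ioi_mem_nhds hq] with y hy using h0 y hy
      rw [← a, b.deriv_eq]; simp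
    refine ⟨s ^ 2, by positivity, fun q hq => ⟨h0 q hq, h1 q hq, ?_⟩⟩
    have a := ((kB1_hasDerivAt (n := n) hr q).sub (kB1_hasDerivAt (n := n) hs q)).deriv
    have b : (kB1 n r - kB1 n s) =ᶠ[𝓝 q] fun _ => 0 := by
      filter_upwards [Ioi_mem_nhds hq] with y hy using h1 y hy
    rw [← a, b.deriv_eq]; simp

lemma kB_radL (hr : 0 < r) (hs : 0 < s) :
    radL n (fun q => kB1 n r q - kB1 n s q) (fun q => kB2 n r q - kB2 n s q) q =
      -(r ^ (-n) * kth n (q / r ^ 2)) + s ^ (-n) * kth n (q / s ^ 2) := by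
  have h1 : ∀ r : ℝ, 0 < r → r ^ (-n - 2) = r ^ (-n) / r ^ 2 := by
    intro r hr
    rw [Real.rpow_sub hr, Real.rpow_two]
  simp only [radL, kB1, kB2, kth, h1 r hr, h1 s hs]
  field_simp
  ring

lemma finrank_Eu (N : ℕ) : Module.finrank ℝ (Eu N) = N := by simp

lemma nontrivial_Eu (hN : 3 ≤ N) : Nontrivial (Eu N) := by
  apply Module.nontrivial_of_finrank_pos (R := ℝ)
  rw [finrank_Eu]; omega

lemma kth_norm_continuous (r : ℝ) : Continuous fun z : Eu N => kth N (‖z‖ ^ 2 / r ^ 2) := by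
  have := kth_continuous (N : ℝ)
  fun_prop

lemma kth_norm_zero (hr : 0 < r) {z : Eu N} (h : r ≤ ‖z‖) : kth N (‖z‖ ^ 2 / r ^ 2) = 0 :=
  kth_eq_zero ((one_le_div (by positivity)).2 (by gcongr))

lemma hasCompactSupport_of_norm (h : ∀ z, r ≤ ‖z‖ → f z = 0) :
    HasCompactSupport f := by
  apply HasCompactSupport.of_support_subset_isCompact (isCompact_closedBall (0 : Eu N) r)
  intro z hz
  rw [mem_closedBall_zero_iff]
  by_contra! hc
  exact hz (h z hc.le)

lemma kth_norm_compact (hr : 0 < r) :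
    HasCompactSupport fun z : Eu N => kth N (‖z‖ ^ 2 / r ^ 2) :=
  hasCompactSupport_of_norm fun _ h => kth_norm_zero hr h

/-- Normalising constant of the averaging kernel. -/
def cK (N : ℕ) : ℝ := ∫ z : Eu N, kth N (‖z‖ ^ 2)

lemma three_le_cast (hN : 3 ≤ N) : (2 : ℝ) < N := by
  have : (3 : ℝ) ≤ N := by exact_mod_cast hN
  linarith

lemma cK_pos (hN : 3 ≤ N) : 0 < cK N := by
  have hn := three_le_cast hN
  have hc : Continuous fun z : Eu N => kth N (‖z‖ ^ 2) := by
    simpa using kth_norm_continuous (N := N) 1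
  have hs : HasCompactSupport fun z : Eu N => kth N (‖z‖ ^ 2) := by
    simpa using kth_norm_compact (N := N) one_pos
  refine hc.integral_pos_of_hasCompactSupport_nonneg_nonzero hs (fun z => kth_nonneg' hn _)
    (x := 0) ?_
  rw [kth_of_lt (by simp)]
  have : (N : ℝ) / 2 - 1 > 0 := by linarith
  positivity

/-- The averaging kernel at scale `r`. -/
def thK (r : ℝ) (z : Eu N) : ℝ := (cK N)⁻¹ * (r ^ (-N : ℝ) * kth N (‖z‖ ^ 2 / r ^ 2))

lemma thK_continuous (r : ℝ) : Continuous (thK (N := N) r) := by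
  have := kth_norm_continuous (N := N) r
  unfold thK; fun_prop

lemma thK_nonneg (hN : 3 ≤ N) (hr : 0 < r) (z : Eu N) : 0 ≤ thK r z := by
  have := kth_nonneg' (three_le_cast hN) (‖z‖ ^ 2 / r ^ 2)
  have := cK_pos hN
  unfold thK; positivity

lemma thK_neg (r : ℝ) (z : Eu N) : thK r (-z) = thK r z := by simp [thK]

lemma thK_zero (hr : 0 < r) {z : Eu N} (h : r ≤ ‖z‖) : thK r z = 0 := by
  simp [thK, kth_norm_zero hr h]

lemma thK_compact (hr : 0 < r) : HasCompactSupport (thK (N := N) r) :=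
  hasCompactSupport_of_norm fun _ h => thK_zero hr h

lemma thK_integrable (hr : 0 < r) : Integrable (thK (N := N) r) :=
  (thK_continuous r).integrable_of_hasCompactSupport (thK_compact hr)

lemma exists_thK_le (hN : 3 ≤ N) : ∃ C, 0 < C ∧ ∀ r : ℝ, 0 < r → ∀ z : Eu N,
    thK r z ≤ C * r ^ (-N : ℝ) := by
  obtain ⟨C, hC, h⟩ := exists_kth_bound N
  have h1 := cK_pos hN
  refine ⟨(cK N)⁻¹ * C, by positivity, fun r hr z => ?_⟩
  have h2 := (le_abs_self _).trans (h (‖z‖ ^ 2 / r ^ 2) (by positivity))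
  unfold thK
  calc _ ≤ (cK N)⁻¹ * (r ^ (-N : ℝ) * C) := by gcongr
    _ = _ := by ring

lemma exists_le_thK (hN : 3 ≤ N) : ∃ c, 0 < c ∧ ∀ r : ℝ, 0 < r → ∀ z : Eu N, ‖z‖ < r / 2 →
    c * r ^ (-N : ℝ) ≤ thK r z := by
  have h1 := cK_pos hN
  have hn := three_le_cast hN
  have hn2 : (N : ℝ) / 2 - 1 > 0 := by linarith
  refine ⟨(cK N)⁻¹ * (2 * N * (N / 2 - 1)), by positivity, fun r hr z hz => ?_⟩
  unfold thK
  rw [kth_of_lt]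
  · exact le_of_eq (by ring)
  · rw [div_lt_iff₀ (by positivity)]
    nlinarith [norm_nonneg z]

lemma integral_thK_mul (r : ℝ) (hr : 0 < r) (g : Eu N → ℝ) :
    ∫ z, thK r z * g z = ∫ z, thK 1 z * g (r • z) := by
  have h := Measure.integral_comp_smul (volume : Measure (Eu N)) (fun z => thK r z * g z) r
  rw [finrank_Eu] at h
  have h2 : ∀ z : Eu N, thK r (r • z) = r ^ (-N : ℝ) * thK 1 z := by
    intro z
    unfold thK
    rw [norm_smul, Real.norm_eq_abs, abs_of_pos hr, mul_pow,
      mul_div_cancel_left₀ _ (by positivity)]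
    simp; ring
  simp only [h2, mul_assoc] at h
  rw [integral_const_mul, abs_of_pos (by positivity), smul_eq_mul, ← Real.rpow_natCast,
    ← Real.rpow_neg hr.le] at h
  exact (mul_left_cancel₀ (Real.rpow_pos_of_pos hr _).ne' h).symm

lemma integral_thK (hN : 3 ≤ N) (hr : 0 < r) : ∫ z : Eu N, thK r z = 1 := by
  have h := integral_thK_mul (N := N) r hr (fun _ => 1)
  simp only [mul_one] at h
  rw [h]
  simp only [thK, Real.one_rpow, one_mul, one_pow, div_one]
  rw [integral_const_mul]
  exact inv_mul_cancel₀ (cK_pos hN).ne'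

lemma exists_second_moment (hN : 3 ≤ N) : ∃ c, 0 < c ∧ ∀ r : ℝ, 0 < r → ∀ x : Eu N,
    ∫ z, thK r z * ‖x + z‖ ^ 2 = ‖x‖ ^ 2 + c * r ^ 2 := by
  refine ⟨∫ z : Eu N, thK 1 z * ‖z‖ ^ 2, ?_, fun r hr x => ?_⟩
  · obtain ⟨c, hc, h⟩ := exists_le_thK hN
    have hcont : Continuous fun z : Eu N => thK 1 z * ‖z‖ ^ 2 := by
      have := thK_continuous (N := N) 1
      fun_prop
    have := nontrivial_Eu hN
    obtain ⟨e, he⟩ := exists_norm_eq (Eu N) (show (0 : ℝ) ≤ 1 / 4 by norm_num)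
    refine hcont.integral_pos_of_hasCompactSupport_nonneg_nonzero
      ((thK_compact one_pos).mul_right)
      (fun z => mul_nonneg (thK_nonneg hN one_pos z) (by positivity)) (x := e) ?_
    have h1 := h 1 one_pos e (by rw [he]; norm_num)
    rw [Real.one_rpow, mul_one] at h1
    rw [he]
    have : 0 < thK 1 e := by linarith
    positivity
  · have hI : ∀ g : Eu N → ℝ, Continuous g → Integrable fun z => thK r z * g z := fun g hg =>
      ((thK_continuous r).mul hg).integrable_of_hasCompactSupport ((thK_compact hr).mul_right)
    have e1 : ∀ z : Eu N, thK r z * ‖x + z‖ ^ 2 =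
        thK r z * ‖x‖ ^ 2 + 2 * (thK r z * inner ℝ x z) + thK r z * ‖z‖ ^ 2 := by
      intro z; rw [norm_add_sq_real]; ring
    have hodd : ∫ z : Eu N, thK r z * inner ℝ x z = 0 := by
      have h := integral_neg_eq_self (fun z : Eu N => thK r z * inner ℝ x z) volume
      simp only [thK_neg, inner_neg_right, mul_neg] at h
      rw [integral_neg] at h
      linarith
    simp_rw [e1]
    have i1 := hI (fun _ => ‖x‖ ^ 2) (by fun_prop)
    have i2 := (hI (fun z => inner ℝ x z) (by fun_prop)).const_mul 2
    have i3 := hI (fun z => ‖z‖ ^ 2) (by fun_prop)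
    have i12 : Integrable fun z => thK r z * ‖x‖ ^ 2 + 2 * (thK r z * inner ℝ x z) := i1.add i2
    rw [integral_add i12 i3, integral_add i1 i2, integral_const_mul, hodd, integral_mul_const, integral_thK hN hr,
      integral_thK_mul r hr]
    have : ∀ z : Eu N, thK 1 z * ‖r • z‖ ^ 2 = (thK 1 z * ‖z‖ ^ 2) * r ^ 2 := by
      intro z; rw [norm_smul, mul_pow, Real.norm_eq_abs, sq_abs]; ring
    simp_rw [this]
    rw [integral_mul_const]; ring

/-- Newtonian potential over a ball controlled by the mass growth on concentric balls. -/
lemma newton_le_of_mass (hN : 3 ≤ N) {g : Eu N → ℝ≥0∞} (hg : Measurable g) {A : ℝ}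
    (hr : 0 < r) (hA : 0 ≤ A) (hγ : γ < 2)
    (h : ∀ s, 0 < s → s ≤ r → ∫⁻ y in ball x s, g y ≤ ofReal (A * s ^ ((N : ℝ) - γ))) :
    ∫⁻ y in ball x r, g y * ofReal (‖y - x‖ ^ (2 - N : ℝ)) ≤
      ofReal (A * (1 + (N - 2) / (2 - γ)) * r ^ (2 - γ)) := by
  have hn := three_le_cast hN
  have layer : ∀ d : ℝ, 0 < d → d < r → ofReal (d ^ (2 - N : ℝ)) ≤
      ofReal (r ^ (2 - N : ℝ)) +
        ∫⁻ s in Ioo 0 r, (if d < s then ofReal ((N - 2) * s ^ (1 - N : ℝ)) else 0) := by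
    intro d hd hdr
    have h1 : ∫⁻ s in Ioo 0 r, (if d < s then ofReal ((N - 2) * s ^ (1 - N : ℝ)) else 0)
        ≥ ∫⁻ s in Ioc d r, ofReal ((N - 2) * s ^ (1 - N : ℝ)) := by
      rw [← setLIntegral_congr Ioo_ae_eq_Ioc, ge_iff_le, ← lintegral_indicator measurableSet_Ioo,
        ← lintegral_indicator measurableSet_Ioo]
      apply lintegral_mono
      intro s
      by_cases hs : s ∈ Ioo d r
      · have hs' : s ∈ Ioo 0 r := ⟨hd.trans hs.1, hs.2⟩
        simp [hs, hs', hs.1]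
      · simp [hs]
    have hcont : ContinuousOn (fun s : ℝ => (N - 2) * s ^ (1 - N : ℝ)) (Icc d r) := by
      intro s hs
      exact (continuousAt_const.mul (Real.continuousAt_rpow_const _ _
        (Or.inl (hd.trans_le hs.1).ne'))).continuousWithinAt
    have hint : IntervalIntegrable (fun s : ℝ => (N - 2) * s ^ (1 - N : ℝ)) volume d r := by
      apply ContinuousOn.intervalIntegrable; rwa [uIcc_of_le hdr.le]
    have h2 : ∫⁻ s in Ioc d r, ofReal ((N - 2) * s ^ (1 - N : ℝ)) =
        ofReal (d ^ (2 - N : ℝ) - r ^ (2 - N : ℝ)) := by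
      rw [← ofReal_integral_eq_lintegral_ofReal
        ((intervalIntegrable_iff_integrableOn_Ioc_of_le hdr.le).1 hint),
        ← intervalIntegral.integral_of_le hdr.le]
      · congr 1
        rw [intervalIntegral.integral_eq_sub_of_hasDerivAt
          (f := fun s : ℝ => -s ^ (2 - N : ℝ)) _ hint]
        · ring
        · intro s hs
          rw [uIcc_of_le hdr.le] at hs
          refine (Real.hasDerivAt_rpow_const (x := s) (p := 2 - (N : ℝ))
            (Or.inl (hd.trans_le hs.1).ne')).neg.congr_deriv ?_
          rw [show 2 - (N : ℝ) - 1 = 1 - N by ring]; ring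
      · filter_upwards [ae_restrict_mem measurableSet_Ioc] with s hs
        have := Real.rpow_nonneg (hd.le.trans hs.1.le) (1 - N : ℝ)
        have : (0 : ℝ) ≤ N - 2 := by linarith
        simp only [Pi.zero_apply]; positivity
    rw [h2] at h1
    have h3 : r ^ (2 - N : ℝ) ≤ d ^ (2 - N : ℝ) :=
      Real.rpow_le_rpow_of_nonpos hd hdr.le (by linarith)
    calc ofReal (d ^ (2 - N : ℝ)) = ofReal (r ^ (2 - N : ℝ)) +
          ofReal (d ^ (2 - N : ℝ) - r ^ (2 - N : ℝ)) := by
            rw [← ENNReal.ofReal_add (by positivity) (by linarith)]; congr 1; ring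
      _ ≤ _ := by gcongr
  have hm : Measurable fun p : Eu N × ℝ =>
      g p.1 * (if ‖p.1 - x‖ < p.2 then ofReal ((N - 2) * p.2 ^ (1 - N : ℝ)) else 0) := by
    refine (hg.comp measurable_fst).mul (Measurable.ite ?_ (by fun_prop) measurable_const)
    exact measurableSet_lt (by fun_prop) (by fun_prop)
  have hae : ∀ᵐ y ∂(volume : Measure (Eu N)), y ≠ x := by
    have := nontrivial_Eu hN
    simp [ae_iff]
  calc ∫⁻ y in ball x r, g y * ofReal (‖y - x‖ ^ (2 - N : ℝ))
      ≤ ∫⁻ y in ball x r, (g y * ofReal (r ^ (2 - N : ℝ)) + ∫⁻ s in Ioo 0 r,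
          g y * (if ‖y - x‖ < s then ofReal ((N - 2) * s ^ (1 - N : ℝ)) else 0)) := by
        apply lintegral_mono_ae
        filter_upwards [ae_restrict_mem measurableSet_ball, ae_restrict_of_ae hae] with y hy hne
        rw [lintegral_const_mul]
        · rw [← mul_add]
          gcongr
          refine layer _ (norm_pos_iff.2 (sub_ne_zero.2 hne)) ?_
          rwa [mem_ball_iff_norm] at hy
        · refine Measurable.ite (measurableSet_lt (by fun_prop) (by fun_prop)) (by fun_prop)
            measurable_const
    _ = (∫⁻ y in ball x r, g y * ofReal (r ^ (2 - N : ℝ))) +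
          ∫⁻ s in Ioo 0 r, ∫⁻ y in ball x r,
            g y * (if ‖y - x‖ < s then ofReal ((N - 2) * s ^ (1 - N : ℝ)) else 0) := by
        rw [lintegral_add_left (by fun_prop)]
        congr 1
        rw [lintegral_lintegral_swap]
        exact hm.aemeasurable
    _ ≤ ofReal (A * r ^ (2 - γ)) +
          ∫⁻ s in Ioc 0 r, ofReal (A * (N - 2) * s ^ (1 - γ)) := by
        refine add_le_add ?_ ?_
        · rw [lintegral_mul_const _ hg]
          calc _ ≤ ofReal (A * r ^ ((N : ℝ) - γ)) * ofReal (r ^ (2 - N : ℝ)) := by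
                gcongr; exact h r hr le_rfl
            _ = _ := by
                rw [← ENNReal.ofReal_mul (by positivity), mul_assoc, ← Real.rpow_add hr]
                congr 3; ring
        · rw [← setLIntegral_congr Ioo_ae_eq_Ioc]
          apply lintegral_mono_ae
          filter_upwards [ae_restrict_mem measurableSet_Ioo] with s hs
          have e : ∀ y, g y * (if ‖y - x‖ < s then
              ofReal ((N - 2) * s ^ (1 - N : ℝ)) else 0) =
              (ball x s).indicator (fun y => g y * ofReal ((N - 2) * s ^ (1 - N : ℝ))) y
              := by
            intro y
            by_cases hy : ‖y - x‖ < s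
            · rw [if_pos hy, indicator_of_mem (mem_ball_iff_norm.2 hy)]
            · rw [if_neg hy, indicator_of_notMem (fun h => hy (mem_ball_iff_norm.1 h)), mul_zero]
          simp_rw [e]
          have h5 : (0 : ℝ) ≤ N - 2 := by linarith
          have h6 := hs.1
          calc _ ≤ ∫⁻ y, (ball x s).indicator
                (fun y => g y * ofReal ((N - 2) * s ^ (1 - N : ℝ))) y :=
                setLIntegral_le_lintegral _ _
            _ = (∫⁻ y in ball x s, g y) * ofReal ((N - 2) * s ^ (1 - N : ℝ)) := by
                rw [lintegral_indicator measurableSet_ball, lintegral_mul_const _ hg]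
            _ ≤ ofReal (A * s ^ ((N : ℝ) - γ)) *
                ofReal ((N - 2) * s ^ (1 - N : ℝ)) := by
                gcongr; exact h s hs.1 hs.2.le
            _ = _ := by
                rw [← ENNReal.ofReal_mul (by positivity),
                  show (1 : ℝ) - γ = (N - γ) + (1 - N) by ring, Real.rpow_add hs.1]
                congr 1; ring
    _ = _ := by
        have hint : IntervalIntegrable (fun s : ℝ => A * (N - 2) * s ^ (1 - γ)) volume 0 r :=
          (intervalIntegral.intervalIntegrable_rpow' (by linarith)).const_mul _
        rw [← ofReal_integral_eq_lintegral_ofReal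
          ((intervalIntegrable_iff_integrableOn_Ioc_of_le hr.le).1 hint),
          ← intervalIntegral.integral_of_le hr.le, intervalIntegral.integral_const_mul,
          integral_rpow (Or.inl (by linarith)), ← ENNReal.ofReal_add]
        · congr 1
          rw [show 1 - γ + 1 = 2 - γ by ring, Real.zero_rpow (by linarith)]
          have : 2 - γ ≠ 0 := by linarith
          field_simp
          ring
        · positivity
        · rw [show 1 - γ + 1 = 2 - γ by ring, Real.zero_rpow (by linarith)]
          have : 0 < 2 - γ := by linarith
          have h5 : (0 : ℝ) ≤ N - 2 := by linarith
          have := Real.rpow_nonneg hr.le (2 - γ)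
          rw [sub_zero]
          positivity
        · filter_upwards [ae_restrict_mem measurableSet_Ioc] with s hs
          have := Real.rpow_nonneg hs.1.le (1 - γ)
          have : (0 : ℝ) ≤ N - 2 := by linarith
          simp only [Pi.zero_apply]; positivity

lemma exists_lintegral_rpow_ball_zero (hN : 3 ≤ N) (hγ : γ < N) : ∃ C, 0 ≤ C ∧
    ∀ s : ℝ, 0 < s → ∫⁻ y in ball (0 : Eu N) s, ofReal (‖y‖ ^ (-γ)) =
      ofReal (C * s ^ ((N : ℝ) - γ)) := by
  have hint : ∀ s : ℝ, IntegrableOn (fun y : Eu N => ‖y‖ ^ (-γ)) (ball 0 s) := by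
    intro s
    have := locallyIntegrable_of_norm_le_rpow (μ := (volume : Measure (Eu N)))
      (f := fun y : Eu N => ‖y‖ ^ (-γ)) (C := 1) (α := γ) (by rw [finrank_Eu]; omega)
      (by rw [finrank_Eu]; exact hγ) (by
        refine Eventually.of_forall fun x => ?_
        rw [Real.norm_eq_abs, abs_of_nonneg (by positivity), one_mul])
      (by fun_prop : Measurable fun y : Eu N => ‖y‖ ^ (-γ)).aestronglyMeasurable
    exact (this.integrableOn_isCompact (isCompact_closedBall 0 s)).mono_set ball_subset_closedBall
  refine ⟨∫ y in ball (0 : Eu N) 1, ‖y‖ ^ (-γ), by positivity, fun s hs => ?_⟩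
  rw [← ofReal_integral_eq_lintegral_ofReal (hint s)
    (Eventually.of_forall fun x => by simp only [Pi.zero_apply]; positivity)]
  congr 1
  have h := Measure.setIntegral_comp_smul_of_pos (volume : Measure (Eu N))
    (fun y => ‖y‖ ^ (-γ)) (ball 0 1) hs
  rw [smul_unitBall_of_pos hs, finrank_Eu, smul_eq_mul] at h
  have h2 : ∀ y : Eu N, ‖s • y‖ ^ (-γ) = s ^ (-γ) * ‖y‖ ^ (-γ) := by
    intro y
    rw [norm_smul, Real.norm_eq_abs, abs_of_pos hs, Real.mul_rpow hs.le (norm_nonneg _)]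
  simp only [h2] at h
  rw [integral_const_mul] at h
  have h3 : s ^ ((N : ℝ) - γ) = s ^ N * s ^ (-γ) := by
    rw [← Real.rpow_natCast, ← Real.rpow_add hs]; ring_nf
  have h4 : (0 : ℝ) < s ^ N := by positivity
  rw [h3]
  field_simp at h
  linarith

lemma exists_lintegral_rpow_ball (hN : 3 ≤ N) (h0 : 0 ≤ γ) (hγ : γ < 2) : ∃ C, 0 ≤ C ∧
    ∀ (x : Eu N) (s : ℝ), 0 < s → ∫⁻ y in ball x s, ofReal (‖y‖ ^ (-γ)) ≤
      ofReal (C * s ^ ((N : ℝ) - γ)) := by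
  have hn := three_le_cast hN
  obtain ⟨C, hC, h⟩ := exists_lintegral_rpow_ball_zero hN (γ := γ) (by linarith)
  obtain ⟨C', hC', h'⟩ := exists_lintegral_rpow_ball_zero hN (γ := 0) (by linarith)
  refine ⟨C + C', by positivity, fun x s hs => ?_⟩
  have hvol : volume (ball x s) = ofReal (C' * s ^ (N : ℝ)) := by
    have := h' s hs
    simp only [neg_zero, Real.rpow_zero, ENNReal.ofReal_one, sub_zero, lintegral_one,
      Measure.restrict_apply_univ] at this
    rw [← this, Measure.addHaar_ball_center]
  have hpt : ∀ y : Eu N, ofReal (‖y‖ ^ (-γ)) ≤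
      (ball (0 : Eu N) s).indicator (fun y => ofReal (‖y‖ ^ (-γ))) y +
        ofReal (s ^ (-γ)) := by
    intro y
    by_cases hy : ‖y‖ < s
    · simp [hy]
    · refine le_add_left (ENNReal.ofReal_le_ofReal ?_)
      exact Real.rpow_le_rpow_of_nonpos hs (not_lt.1 hy) (by linarith)
  calc _ ≤ ∫⁻ y in ball x s, ((ball (0 : Eu N) s).indicator
          (fun y => ofReal (‖y‖ ^ (-γ))) y + ofReal (s ^ (-γ))) :=
        lintegral_mono hpt
    _ = (∫⁻ y in ball x s, (ball (0 : Eu N) s).indicator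
          (fun y => ofReal (‖y‖ ^ (-γ))) y) +
          ofReal (s ^ (-γ)) * volume (ball x s) := by
        rw [lintegral_add_right _ measurable_const, setLIntegral_const]
    _ ≤ ofReal (C * s ^ ((N : ℝ) - γ)) + ofReal (C' * s ^ ((N : ℝ) - γ)) := by
        refine add_le_add ?_ ?_
        · rw [← h s hs]
          refine (setLIntegral_le_lintegral _ _).trans_eq ?_
          rw [lintegral_indicator measurableSet_ball]
        · rw [hvol, ← ENNReal.ofReal_mul (by positivity)]
          apply ENNReal.ofReal_le_ofReal
          rw [sub_eq_add_neg, Real.rpow_add hs]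
          exact le_of_eq (by ring)
    _ = _ := by
        rw [← ENNReal.ofReal_add (by positivity) (by positivity)]
        ring_nf

lemma exists_newton_rpow (hN : 3 ≤ N) (h0 : 0 ≤ γ) (hγ : γ < 2) : ∃ C, 0 < C ∧
    ∀ (x : Eu N) (r : ℝ), 0 < r →
    ∫⁻ y in ball x r, ofReal (‖y‖ ^ (-γ)) * ofReal (‖y - x‖ ^ (2 - N : ℝ)) ≤
      ofReal (C * r ^ (2 - γ)) := by
  have hn := three_le_cast hN
  obtain ⟨C, hC, h⟩ := exists_lintegral_rpow_ball hN h0 hγ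
  have h1 : (0 : ℝ) < N - 2 := by linarith
  have h2 : 0 < 2 - γ := by linarith
  refine ⟨C * (1 + (N - 2) / (2 - γ)) + 1, by positivity, fun x r hr => ?_⟩
  refine (newton_le_of_mass hN (by fun_prop) hr hC hγ fun s hs _ => h x s hs).trans ?_
  apply ENNReal.ofReal_le_ofReal
  have := Real.rpow_pos_of_pos hr (2 - γ)
  nlinarith

lemma exists_newton_rpow' (hN : 3 ≤ N) (h0 : 0 ≤ γ) (hγ : γ < 2) : ∃ C, 0 < C ∧
    ∀ (x : Eu N) (r : ℝ), 0 < r → x ≠ 0 →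
    ∫⁻ y in ball x r, ofReal (‖y‖ ^ (-γ)) * ofReal (‖y - x‖ ^ (2 - N : ℝ)) ≤
      ofReal (C * r ^ 2 * ‖x‖ ^ (-γ)) := by
  obtain ⟨C, hC, h⟩ := exists_newton_rpow hN h0 hγ
  obtain ⟨C', hC', h'⟩ := exists_newton_rpow hN (γ := 0) le_rfl two_pos
  refine ⟨(C + C') * 2 ^ γ, by positivity, fun x r hr hx => ?_⟩
  have hx0 : 0 < ‖x‖ := norm_pos_iff.2 hx
  have hhalf : (‖x‖ / 2) ^ (-γ) = 2 ^ γ * ‖x‖ ^ (-γ) := by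
    rw [Real.div_rpow hx0.le two_pos.le, Real.rpow_neg two_pos.le]; field_simp
  have hp : 0 < ‖x‖ ^ (-γ) := Real.rpow_pos_of_pos hx0 _
  have hp2 : (0 : ℝ) < 2 ^ γ := Real.rpow_pos_of_pos two_pos _
  rcases lt_or_ge (‖x‖ / 2) r with hc | hc
  · refine (h x r hr).trans (ENNReal.ofReal_le_ofReal ?_)
    have h3 : r ^ (-γ) ≤ 2 ^ γ * ‖x‖ ^ (-γ) := by
      rw [← hhalf]
      exact Real.rpow_le_rpow_of_nonpos (by positivity) hc.le (by linarith)
    rw [sub_eq_add_neg, Real.rpow_add hr, Real.rpow_two]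
    calc C * (r ^ 2 * r ^ (-γ)) ≤ C * (r ^ 2 * (2 ^ γ * ‖x‖ ^ (-γ))) := by gcongr
      _ ≤ (C + C') * (r ^ 2 * (2 ^ γ * ‖x‖ ^ (-γ))) := by gcongr; linarith
      _ = _ := by ring
  · have h4 := h' x r hr
    simp only [neg_zero, Real.rpow_zero, ENNReal.ofReal_one, one_mul, sub_zero] at h4
    calc _ ≤ ∫⁻ y in ball x r, ofReal (2 ^ γ * ‖x‖ ^ (-γ)) *
            ofReal (‖y - x‖ ^ (2 - N : ℝ)) := by
          apply lintegral_mono_ae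
          filter_upwards [ae_restrict_mem measurableSet_ball] with y hy
          gcongr
          rw [← hhalf]
          apply Real.rpow_le_rpow_of_nonpos (by positivity) _ (by linarith)
          rw [mem_ball_iff_norm] at hy
          have := norm_sub_norm_le x y
          rw [norm_sub_rev] at this
          linarith
      _ ≤ ofReal (2 ^ γ * ‖x‖ ^ (-γ)) * ofReal (C' * r ^ 2) := by
          rw [lintegral_const_mul _ (by fun_prop)]
          gcongr
          exact_mod_cast h4
      _ ≤ _ := by
          rw [← ENNReal.ofReal_mul (by positivity)]
          apply ENNReal.ofReal_le_ofReal
          calc _ = C' * (r ^ 2 * (2 ^ γ * ‖x‖ ^ (-γ))) := by ring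
            _ ≤ (C + C') * (r ^ 2 * (2 ^ γ * ‖x‖ ^ (-γ))) := by gcongr; linarith
            _ = _ := by ring

lemma Prof.contDiff_norm {b b1 b2 : ℝ → ℝ} (h : Prof b b1 b2) (x0 : Eu N) :
    ContDiff ℝ ∞ fun x : Eu N => b (‖x - x0‖ ^ 2) := by
  rw [contDiff_iff_contDiffAt]
  intro x
  have h1 : ContDiffAt ℝ ∞ (fun x : Eu N => ‖x - x0‖ ^ 2) x :=
    ((contDiff_id.sub contDiff_const).norm_sq ℝ).contDiffAt
  have h2 : (-1 : ℝ) < ‖x - x0‖ ^ 2 := lt_of_lt_of_le (by norm_num) (sq_nonneg _)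
  exact (h.smooth _ h2).comp x h1

lemma Prof.zero_of_norm {b b1 b2 : ℝ → ℝ} (h : Prof b b1 b2) : ∃ R, 0 < R ∧ ∀ q, R ^ 2 < q →
    b q = 0 ∧ b1 q = 0 ∧ b2 q = 0 := by
  obtain ⟨Q, hQ, hz⟩ := h.supp
  exact ⟨√Q, Real.sqrt_pos.2 hQ, fun q hq => hz q (by rwa [Real.sq_sqrt hQ.le] at hq)⟩

lemma hasFDerivAt_norm_sub_sq (x0 x : Eu N) :
    HasFDerivAt (fun x : Eu N => ‖x - x0‖ ^ 2) (2 • innerSL ℝ (x - x0)) x := by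
  have h := ((hasFDerivAt_id x).sub_const x0).norm_sq
  refine h.congr_fderiv ?_
  ext v; simp

lemma Prof.hasFDerivAt {b b1 b2 : ℝ → ℝ} (h : Prof b b1 b2) (x0 x : Eu N) :
    HasFDerivAt (fun x : Eu N => b (‖x - x0‖ ^ 2))
      ((b1 (‖x - x0‖ ^ 2)) • (2 • innerSL ℝ (x - x0))) x :=
  (h.d1 _ (lt_of_lt_of_le (by norm_num) (sq_nonneg _))).comp_hasFDerivAt x (hasFDerivAt_norm_sub_sq x0 x)

lemma Prof.hasFDerivAt1 {b b1 b2 : ℝ → ℝ} (h : Prof b b1 b2) (x0 x : Eu N) :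
    HasFDerivAt (fun x : Eu N => b1 (‖x - x0‖ ^ 2))
      ((b2 (‖x - x0‖ ^ 2)) • (2 • innerSL ℝ (x - x0))) x :=
  (h.d2 _ (lt_of_lt_of_le (by norm_num) (sq_nonneg _))).comp_hasFDerivAt x (hasFDerivAt_norm_sub_sq x0 x)

lemma lapX_test {b b1 b2 : ℝ → ℝ} (h : Prof b b1 b2) (hκ : ContDiff ℝ ∞ κ) (x0 : Eu N)
    (p : Eu N × ℝ) :
    lapX (fun q : Eu N × ℝ => b (‖q.1 - x0‖ ^ 2) * κ q.2) p =
      κ p.2 * radL N b1 b2 (‖p.1 - x0‖ ^ 2) := by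
  have hκd : ∀ t, HasDerivAt κ (deriv κ t) t := fun t => (hκ.differentiable (by simp) t).hasDerivAt
  have hfst : ∀ (g : Eu N → ℝ) (g' : Eu N →L[ℝ] ℝ) (q : Eu N × ℝ), HasFDerivAt g g' q.1 →
      HasFDerivAt (fun q : Eu N × ℝ => g q.1 * κ q.2)
        (g q.1 • ((deriv κ q.2) • ContinuousLinearMap.snd ℝ (Eu N) ℝ) +
          κ q.2 • (g'.comp (ContinuousLinearMap.fst ℝ (Eu N) ℝ))) q := by
    intro g g' q hg
    exact (hg.comp q hasFDerivAt_fst).mul ((hκd q.2).comp_hasFDerivAt q hasFDerivAt_snd)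
  unfold lapX
  have e1 : ∀ i : Fin N, (fun q : Eu N × ℝ => fderiv ℝ
      (fun q : Eu N × ℝ => b (‖q.1 - x0‖ ^ 2) * κ q.2) q (EuclideanSpace.single i 1, 0)) =
      fun q => (b1 (‖q.1 - x0‖ ^ 2) * (2 * (q.1 i - x0 i))) * κ q.2 := by
    intro i; ext q
    rw [(hfst _ _ q (h.hasFDerivAt x0 q.1)).fderiv]
    simp [EuclideanSpace.inner_single_right]
    ring
  have e2 : ∀ i : Fin N, fderiv ℝ (fun q : Eu N × ℝ => fderiv ℝ
      (fun q : Eu N × ℝ => b (‖q.1 - x0‖ ^ 2) * κ q.2) q (EuclideanSpace.single i 1, 0)) p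
        (EuclideanSpace.single i 1, 0) =
      κ p.2 * (4 * b2 (‖p.1 - x0‖ ^ 2) * (p.1 i - x0 i) ^ 2 + 2 * b1 (‖p.1 - x0‖ ^ 2)) := by
    intro i
    rw [e1 i]
    have h3 : HasFDerivAt (fun x : Eu N => 2 * (x i - x0 i))
        ((2 : ℝ) • (EuclideanSpace.proj i : Eu N →L[ℝ] ℝ)) p.1 := by
      have := (((EuclideanSpace.proj i : Eu N →L[ℝ] ℝ).hasFDerivAt
        (x := p.1)).sub_const (x0 i)).const_mul (2 : ℝ)
      simpa using this
    rw [(hfst (fun x => b1 (‖x - x0‖ ^ 2) * (2 * (x i - x0 i))) _ p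
      ((h.hasFDerivAt1 x0 p.1).mul h3)).fderiv]
    simp [EuclideanSpace.inner_single_right]
    ring
  simp_rw [e2]
  rw [← Finset.mul_sum, Finset.sum_add_distrib, ← Finset.mul_sum, radL]
  have e3 : ‖p.1 - x0‖ ^ 2 = ∑ i, (p.1 i - x0 i) ^ 2 := by
    rw [EuclideanSpace.norm_sq_eq]; simp
  rw [← e3]
  simp
  ring_nf
  simp

lemma ptder_test {b b1 b2 : ℝ → ℝ} (h : Prof b b1 b2) (hκ : ContDiff ℝ ∞ κ) (x0 : Eu N)
    (p : Eu N × ℝ) :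
    ptder (fun q : Eu N × ℝ => b (‖q.1 - x0‖ ^ 2) * κ q.2) p =
      deriv κ p.2 * b (‖p.1 - x0‖ ^ 2) := by
  have hκd : HasDerivAt κ (deriv κ p.2) p.2 := (hκ.differentiable (by simp) _).hasDerivAt
  have h2 := ((h.hasFDerivAt x0 p.1).comp p hasFDerivAt_fst).mul
    (hκd.comp_hasFDerivAt p hasFDerivAt_snd)
  unfold ptder
  have e : (fun q : Eu N × ℝ => b (‖q.1 - x0‖ ^ 2) * κ q.2) =
      ((fun x : Eu N => b (‖x - x0‖ ^ 2)) ∘ Prod.fst) * (κ ∘ Prod.snd) := rfl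
  rw [e, h2.fderiv]
  simp
  ring

/-- Pointwise version of the weight condition. -/
structure Wt (N : ℕ) (γ Cl Cu : ℝ) (ρ : Eu N → ℝ) : Prop where
  meas : Measurable ρ
  g0 : 0 ≤ γ
  g2 : γ < 2
  l0 : 0 < Cl
  low : ∀ x, Cl * (1 + ‖x‖) ^ (-γ) ≤ ρ x
  up : ∀ x, x ≠ 0 → ρ x ≤ Cu * ‖x‖ ^ (-γ)

/-- A regularised representative of a non-negative very weak solution. -/
structure Sol (ρ : Eu N → ℝ) (m T : ℝ) (u : Eu N → ℝ → ℝ) : Prop where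
  meas : Measurable fun p : Eu N × ℝ => u p.1 p.2
  nonneg : ∀ x t, 0 ≤ u x t
  int1 : ∀ R a b, 0 < a → b < T →
    IntegrableOn (fun p : Eu N × ℝ => ρ p.1 * u p.1 p.2) (closedBall 0 R ×ˢ Icc a b)
  intm : ∀ R a b, 0 < a → b < T →
    IntegrableOn (fun p : Eu N × ℝ => u p.1 p.2 ^ m) (closedBall 0 R ×ˢ Icc a b)
  slice : ∀ x a b, 0 < a → b < T → IntegrableOn (fun t => u x t ^ m) (Icc a b)
  weak : ∀ (x0 : Eu N) (b b1 b2 κ : ℝ → ℝ), Prof b b1 b2 → ContDiff ℝ ∞ κ →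
    HasCompactSupport κ → tsupport κ ⊆ Ioo 0 T →
    ∫ p : Eu N × ℝ, (ρ p.1 * u p.1 p.2 * (deriv κ p.2 * b (‖p.1 - x0‖ ^ 2)) +
      u p.1 p.2 ^ m * (κ p.2 * radL N b1 b2 (‖p.1 - x0‖ ^ 2))) = 0

lemma exists_wt (h : WeightCond N γ Cl Cu ρ) :
    ∃ ρ', Wt N γ Cl Cu ρ' ∧ ρ' =ᵐ[volume] ρ := by
  obtain ⟨hm, h0, h2, hl, hlu, hae⟩ := h
  refine ⟨fun x => max (Cl * (1 + ‖x‖) ^ (-γ)) (min (ρ x) (Cu * ‖x‖ ^ (-γ))), ?_, ?_⟩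
  · refine ⟨by fun_prop, h0, h2, hl, fun x => le_max_left _ _, fun x hx => ?_⟩
    refine max_le ?_ (min_le_right _ _)
    have hx0 : 0 < ‖x‖ := norm_pos_iff.2 hx
    have : (1 + ‖x‖) ^ (-γ) ≤ ‖x‖ ^ (-γ) :=
      Real.rpow_le_rpow_of_nonpos hx0 (by linarith) (by linarith)
    have h3 : 0 ≤ (1 + ‖x‖) ^ (-γ) := by positivity
    exact mul_le_mul hlu.le this h3 (hl.le.trans hlu.le)
  · filter_upwards [hae] with x hx
    rw [min_eq_left hx.2, max_eq_right hx.1]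

lemma ae_slice_integrable {f : Eu N × ℝ → ℝ}
    (h : ∀ R a b, 0 < a → b < T → IntegrableOn f (closedBall 0 R ×ˢ Icc a b)) :
    ∀ᵐ x ∂(volume : Measure (Eu N)), ∀ a b, 0 < a → b < T →
      IntegrableOn (fun t => f (x, t)) (Icc a b) := by
  have h1 : ∀ k : ℕ, ∀ᵐ x ∂(volume : Measure (Eu N)), x ∈ closedBall (0 : Eu N) k →
      IntegrableOn (fun t => f (x, t)) (Icc (1 / (k + 1 : ℝ)) (T - 1 / (k + 1))) := by
    intro k
    have h2 := h k (1 / (k + 1 : ℝ)) (T - 1 / (k + 1)) (by positivity)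
      (by have : 0 < 1 / (k + 1 : ℝ) := by positivity
          linarith)
    rw [IntegrableOn, Measure.volume_eq_prod, ← Measure.prod_restrict] at h2
    have h3 := h2.prod_right_ae
    rwa [ae_restrict_iff' measurableSet_closedBall] at h3
  filter_upwards [ae_all_iff.2 h1] with x hx a b ha hb
  obtain ⟨k1, hk1⟩ := exists_nat_ge ‖x‖
  obtain ⟨k2, hk2⟩ := exists_nat_one_div_lt ha
  obtain ⟨k3, hk3⟩ := exists_nat_one_div_lt (sub_pos.2 hb)
  set k := max k1 (max k2 k3)
  have e1 : k1 ≤ k := le_max_left _ _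
  have e2 : k2 ≤ k := (le_max_left _ _).trans (le_max_right _ _)
  have e3 : k3 ≤ k := (le_max_right _ _).trans (le_max_right _ _)
  refine (hx k ?_).mono_set (Icc_subset_Icc ?_ ?_)
  · rw [mem_closedBall_zero_iff]
    exact hk1.trans (by exact_mod_cast e1)
  · exact (Nat.one_div_le_one_div e2).trans hk2.le
  · have := Nat.one_div_le_one_div (α := ℝ) e3
    linarith

set_option maxHeartbeats 400000 in
lemma VWS.exists_sol {ρ' : Eu N → ℝ} (hm : 1 < m)
    (hρ : ρ' =ᵐ[volume] ρ) (hu : VWS ρ m univ 0 T u)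
    (hupos : ∀ᵐ p ∂(volume.restrict ((univ : Set (Eu N)) ×ˢ Ioo 0 T) : Measure (Eu N × ℝ)),
      0 ≤ u p.1 p.2) :
    ∃ u', Sol ρ' m T u' ∧
      ∀ᵐ p ∂(volume.restrict ((univ : Set (Eu N)) ×ˢ Ioo 0 T) : Measure (Eu N × ℝ)),
        u' p.1 p.2 = u p.1 p.2 := by
  set S : Set (Eu N × ℝ) := univ ×ˢ Ioo 0 T with hS
  have hSm : MeasurableSet S := MeasurableSet.univ.prod measurableSet_Ioo
  have hρ2 : ∀ᵐ p : Eu N × ℝ ∂volume, ρ' p.1 = ρ p.1 := by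
    rw [Measure.volume_eq_prod]
    exact Measure.quasiMeasurePreserving_fst.ae hρ
  set w : Eu N × ℝ → ℝ := fun p => max (hu.aemeas.mk _ p) 0 with hwdef
  have hwm : Measurable w := hu.aemeas.measurable_mk.max measurable_const
  have hwu : ∀ᵐ p ∂(volume.restrict S), w p = u p.1 p.2 := by
    filter_upwards [hu.aemeas.ae_eq_mk, hupos] with p hp hp0
    rw [hwdef]; simp only [← hp, max_eq_left hp0]
  have hsub : ∀ R a b, 0 < a → b < T → closedBall (0 : Eu N) R ×ˢ Icc a b ⊆ S :=
    fun R a b ha hb p hp => ⟨mem_univ _, ha.trans_le hp.2.1, hp.2.2.trans_lt hb⟩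
  have hwm_int : ∀ R a b, 0 < a → b < T →
      IntegrableOn (fun p => w p ^ m) (closedBall (0 : Eu N) R ×ˢ Icc a b) := by
    intro R a b ha hb
    have h1 := (hu.locint _ ((isCompact_closedBall (0 : Eu N) R).prod isCompact_Icc)
      (hsub R a b ha hb)).2
    refine h1.congr ?_
    filter_upwards [ae_restrict_of_ae_restrict_of_subset (hsub R a b ha hb) hwu] with p hp
    rw [← hp, abs_of_nonneg (le_max_right _ _)]
  set G : Set (Eu N) := {x | ∀ a b, 0 < a → b < T →
      IntegrableOn (fun t => w (x, t) ^ m) (Icc a b)} with hG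
  have hslice : ∀ᵐ x ∂(volume : Measure (Eu N)), x ∈ G := ae_slice_integrable hwm_int
  obtain ⟨Z, hZsub, hZm, hZ0⟩ : ∃ Z : Set (Eu N), Gᶜ ⊆ Z ∧ MeasurableSet Z ∧
      (volume : Measure (Eu N)) Z = 0 := exists_measurable_superset_of_null hslice
  classical
  set u' : Eu N → ℝ → ℝ := fun x t => if x ∈ Z then 0 else w (x, t) with hu'
  have hZae : ∀ᵐ p : Eu N × ℝ ∂volume, p.1 ∉ Z := by
    rw [Measure.volume_eq_prod]
    exact Measure.quasiMeasurePreserving_fst.ae (measure_eq_zero_iff_ae_notMem.1 hZ0)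
  have huw : ∀ᵐ p : Eu N × ℝ ∂volume, u' p.1 p.2 = w p := by
    filter_upwards [hZae] with p hp
    simp [hu', hp]
  have hfin : ∀ᵐ p ∂(volume.restrict S), u' p.1 p.2 = u p.1 p.2 := by
    filter_upwards [hwu, ae_restrict_of_ae huw] with p h1 h2
    rw [h2, h1]
  have hm0 : m ≠ 0 := by linarith
  have hspow : ∀ a : ℝ, 0 ≤ a → spow a m = a ^ m := by
    intro a ha
    rcases ha.eq_or_lt with rfl | ha
    · simp [spow, hm0]
    · rw [spow, abs_of_pos ha, Real.rpow_sub_one ha.ne']; field_simp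
  have hnn : ∀ x t, 0 ≤ u' x t := by
    intro x t
    simp only [hu', hwdef]
    split_ifs
    exacts [le_rfl, le_max_right _ _]
  refine ⟨u', ⟨?_, hnn, ?_, ?_, ?_, ?_⟩, hfin⟩
  · exact Measurable.ite (measurable_fst hZm) measurable_const hwm
  · intro R a b ha hb
    have h1 := (hu.locint _ ((isCompact_closedBall (0 : Eu N) R).prod isCompact_Icc)
      (hsub R a b ha hb)).1
    refine h1.congr ?_
    filter_upwards [ae_restrict_of_ae_restrict_of_subset (hsub R a b ha hb) hfin,
      ae_restrict_of_ae hρ2] with p hp hp2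
    rw [← hp, abs_of_nonneg (hnn _ _), hp2, mul_comm]
  · intro R a b ha hb
    refine (hwm_int R a b ha hb).congr ?_
    filter_upwards [ae_restrict_of_ae huw] with p hp
    rw [hp]
  · intro x a b ha hb
    by_cases hx : x ∈ Z
    · simp [hu', hx, hm0]
    · simp only [hu', hx, if_false]
      by_contra hc
      exact hx (hZsub (fun hall => hc (hall a b ha hb)))
  · intro x0 b b1 b2 κ hb hκ hκc hκs
    set ψ : Eu N × ℝ → ℝ := fun q => b (‖q.1 - x0‖ ^ 2) * κ q.2 with hψ
    obtain ⟨R, hR, hz⟩ := hb.zero_of_norm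
    have hsupp : tsupport ψ ⊆ closedBall x0 R ×ˢ tsupport κ := by
      apply closure_minimal _ (isClosed_closedBall.prod (isClosed_tsupport κ))
      intro p hp
      have hp' : b (‖p.1 - x0‖ ^ 2) * κ p.2 ≠ 0 := hp
      refine ⟨?_, subset_tsupport _ (right_ne_zero_of_mul hp')⟩
      rw [mem_closedBall_iff_norm]
      by_contra! hc
      exact left_ne_zero_of_mul hp' (hz _ (by gcongr)).1
    have h1 := hu.weak ψ (((hb.contDiff_norm x0).comp contDiff_fst).mul (hκ.comp contDiff_snd))
      (HasCompactSupport.intro' ((isCompact_closedBall x0 R).prod hκc)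
        (isClosed_closedBall.prod (isClosed_tsupport κ)) fun x hx =>
          image_eq_zero_of_notMem_tsupport fun h => hx (hsupp h))
      (fun p hp => ⟨mem_univ _, hκs (hsupp hp).2⟩)
    rw [← h1]
    rw [← setIntegral_eq_integral_of_forall_compl_eq_zero (s := S)]
    · apply integral_congr_ae
      filter_upwards [hfin, ae_restrict_of_ae hρ2] with p hp hp2
      rw [lapX_test hb hκ, ptder_test hb hκ, hp2, ← hp, hspow _ (hnn _ _)]
      ring
    · intro p hp
      have hp2 : p.2 ∉ tsupport κ := fun h => hp ⟨mem_univ _, hκs h⟩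
      rw [image_eq_zero_of_notMem_tsupport hp2,
        image_eq_zero_of_notMem_tsupport (fun h => hp2 (tsupport_deriv_subset h))]
      simp

/-- Integrability on all balls. -/
def LI (f : Eu N → ℝ) : Prop := ∀ R : ℝ, IntegrableOn f (closedBall 0 R)

lemma LI.add (hf : LI f) (hg : LI g) : LI fun x => f x + g x :=
  fun R => (hf R).add (hg R)

lemma LI.sub (hf : LI f) (hg : LI g) : LI fun x => f x - g x :=
  fun R => (hf R).sub (hg R)

lemma LI.const_mul (hf : LI f) (c : ℝ) : LI fun x => c * f x :=
  fun R => (hf R).const_mul c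

lemma LI.of_continuous (hf : Continuous f) : LI f :=
  fun R => hf.continuousOn.integrableOn_compact (isCompact_closedBall 0 R)

lemma LI.locallyIntegrable (h : LI f) : LocallyIntegrable f := by
  intro x
  refine ⟨closedBall 0 (‖x‖ + 1), ?_, h _⟩
  have : ball x 1 ⊆ closedBall 0 (‖x‖ + 1) := by
    intro y hy
    rw [mem_closedBall_zero_iff]
    have := norm_le_norm_add_norm_sub' y x
    rw [mem_ball_iff_norm] at hy
    linarith
  exact mem_of_superset (ball_mem_nhds x one_pos) this

lemma exists_closedBall_of_compact (hc : HasCompactSupport g) :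
    ∃ R, 0 < R ∧ ∀ x ∉ closedBall (0 : Eu N) R, g x = 0 := by
  obtain ⟨R, hR⟩ := hc.isCompact.isBounded.subset_closedBall (0 : Eu N)
  refine ⟨max R 1, by positivity, fun x hx => image_eq_zero_of_notMem_tsupport fun h => hx ?_⟩
  exact closedBall_subset_closedBall (le_max_left _ _) (hR h)

lemma exists_bound_of_compact (hg : Continuous g) (hc : HasCompactSupport g) :
    ∃ C, 0 ≤ C ∧ ∀ x, |g x| ≤ C := by
  obtain ⟨C, hC⟩ := hg.bounded_above_of_compact_support hc
  exact ⟨C, (norm_nonneg _).trans (hC 0), hC⟩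

lemma LI.integrable_mul (h : LI f) (hg : Continuous g)
    (hc : HasCompactSupport g) : Integrable fun x => f x * g x := by
  obtain ⟨R, -, hR⟩ := exists_closedBall_of_compact hc
  obtain ⟨C, -, hC⟩ := exists_bound_of_compact hg hc
  refine IntegrableOn.integrable_of_forall_notMem_eq_zero (s := closedBall 0 R) ?_ ?_
  · exact (h R).mul_bdd hg.aestronglyMeasurable (Eventually.of_forall hC)
  · intro x hx; simp [hR x hx]

section profile
variable {b b1 b2 : ℝ → ℝ}

lemma Prof.continuousOn2 (h : Prof b b1 b2) : ContinuousOn b2 (Ioi (-1)) := by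
  have h0 : ContDiffOn ℝ ∞ b (Ioi (-1)) := fun q hq => (h.smooth q hq).contDiffWithinAt
  have h1 : ContDiffOn ℝ ∞ b1 (Ioi (-1)) :=
    (h0.deriv_of_isOpen isOpen_Ioi (m := ∞) (by simp)).congr fun q hq => (h.d1 q hq).deriv.symm
  have h2 : ContDiffOn ℝ ∞ b2 (Ioi (-1)) :=
    (h1.deriv_of_isOpen isOpen_Ioi (m := ∞) (by simp)).congr fun q hq => (h.d2 q hq).deriv.symm
  exact h2.continuousOn

lemma Prof.continuousOn1 (h : Prof b b1 b2) : ContinuousOn b1 (Ioi (-1)) :=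
  fun q hq => (h.d2 q hq).continuousAt.continuousWithinAt

lemma Prof.cont_b (h : Prof b b1 b2) (x0 : Eu N) : Continuous fun x : Eu N => b (‖x - x0‖ ^ 2) :=
  (h.contDiff_norm x0).continuous

lemma Prof.cont_L (h : Prof b b1 b2) (n : ℝ) (x0 : Eu N) : Continuous fun x : Eu N => radL n b1 b2 (‖x - x0‖ ^ 2) := by
  have hm : ∀ x : Eu N, ‖x - x0‖ ^ 2 ∈ Ioi (-1 : ℝ) :=
    fun x => lt_of_lt_of_le (by norm_num : (-1 : ℝ) < 0) (sq_nonneg _)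
  have hq : Continuous fun x : Eu N => ‖x - x0‖ ^ 2 := by fun_prop
  have h1 := h.continuousOn1.comp_continuous hq hm
  have h2 := h.continuousOn2.comp_continuous hq hm
  exact ((continuous_const.mul hq).mul h2).add (continuous_const.mul h1)

lemma Prof.compact_aux (h : Prof b b1 b2) {g : ℝ → ℝ} (hg : ∀ q, b q = 0 ∧ b1 q = 0 ∧ b2 q = 0 → g q = 0)
    (x0 : Eu N) : HasCompactSupport fun x : Eu N => g (‖x - x0‖ ^ 2) := by
  obtain ⟨R, hR, hz⟩ := h.zero_of_norm
  refine HasCompactSupport.intro (isCompact_closedBall x0 R) fun x hx => ?_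
  rw [mem_closedBall_iff_norm] at hx
  push Not at hx
  exact hg _ (hz _ (by gcongr))

lemma Prof.compact_b (h : Prof b b1 b2) (x0 : Eu N) : HasCompactSupport fun x : Eu N => b (‖x - x0‖ ^ 2) :=
  h.compact_aux (g := b) (fun _ hq => hq.1) x0

lemma Prof.compact_L (h : Prof b b1 b2) (n : ℝ) (x0 : Eu N) :
    HasCompactSupport fun x : Eu N => radL n b1 b2 (‖x - x0‖ ^ 2) :=
  h.compact_aux (g := radL n b1 b2) (fun q hq => by simp [radL, hq]) x0

end profile

lemma exists_Icc_of_compact {K : Set ℝ} (hK : IsCompact K) (hs : K ⊆ Ioo 0 T) :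
    ∃ a b, 0 < a ∧ b < T ∧ K ⊆ Icc a b := by
  rcases K.eq_empty_or_nonempty with rfl | hne
  · exact ⟨1, T - 1, one_pos, by linarith, by simp⟩
  · exact ⟨sInf K, sSup K, (hs (hK.sInf_mem hne)).1, (hs (hK.sSup_mem hne)).2,
      fun x hx => ⟨csInf_le hK.bddBelow hx, le_csSup hK.bddAbove hx⟩⟩

lemma exists_Icc_of_smooth (hκc : HasCompactSupport κ)
    (hs : tsupport κ ⊆ Ioo 0 T) :
    ∃ a b, 0 < a ∧ b < T ∧ (∀ t ∉ Icc a b, κ t = 0) ∧ ∀ t ∉ Icc a b, deriv κ t = 0 := by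
  obtain ⟨a, b, ha, hb, hab⟩ := exists_Icc_of_compact hκc.isCompact hs
  refine ⟨a, b, ha, hb, fun t ht => image_eq_zero_of_notMem_tsupport fun h => ht (hab h),
    fun t ht => image_eq_zero_of_notMem_tsupport fun h => ht (hab (tsupport_deriv_subset h))⟩

/-- Integrability of a space-time product of a function integrable on cylinders with
continuous compactly supported factors. -/
lemma integrable_prod_mul {G : Eu N × ℝ → ℝ}
    (hG : ∀ R a b, 0 < a → b < T → IntegrableOn G (closedBall 0 R ×ˢ Icc a b))
    {k : ℝ → ℝ} (hg : Continuous g) (hgc : HasCompactSupport g)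
    (hk : Measurable k) (hkC : ∀ t, |k t| ≤ C) (ha : 0 < a) (hb : b < T)
    (hk0 : ∀ t ∉ Icc a b, k t = 0) :
    Integrable fun p : Eu N × ℝ => G p * (k p.2 * g p.1) := by
  obtain ⟨R, -, hR⟩ := exists_closedBall_of_compact hgc
  obtain ⟨D, hD0, hD⟩ := exists_bound_of_compact hg hgc
  refine IntegrableOn.integrable_of_forall_notMem_eq_zero (s := closedBall 0 R ×ˢ Icc a b) ?_ ?_
  · refine (hG R a b ha hb).mul_bdd (c := C * D) ?_ (Eventually.of_forall fun p => ?_)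
    · exact ((hk.comp measurable_snd).mul
        (hg.measurable.comp measurable_fst)).aestronglyMeasurable
    · rw [Real.norm_eq_abs, abs_mul]
      exact mul_le_mul (hkC _) (hD _) (abs_nonneg _) ((abs_nonneg _).trans (hkC p.2))
  · intro p hp
    by_cases h1 : p.1 ∈ closedBall (0 : Eu N) R
    · have h2 : p.2 ∉ Icc a b := fun h2 => hp ⟨h1, h2⟩
      simp [hk0 _ h2]
    · simp [hR _ h1]

/-- Time integrals of functions integrable on cylinders are locally integrable. -/
lemma LI.time_integral {G : Eu N × ℝ → ℝ}
    (hG : ∀ R a b, 0 < a → b < T → IntegrableOn G (closedBall 0 R ×ˢ Icc a b))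
    {k : ℝ → ℝ} (hk : Measurable k) (hkC : ∀ t, |k t| ≤ C) (ha : 0 < a) (hb : b < T)
    (hk0 : ∀ t ∉ Icc a b, k t = 0) : LI fun x => ∫ t, k t * G (x, t) := by
  intro R
  have h1 : IntegrableOn (fun p : Eu N × ℝ => k p.2 * G p) (closedBall 0 R ×ˢ univ) := by
    have h2 : IntegrableOn (fun p : Eu N × ℝ => k p.2 * G p) (closedBall 0 R ×ˢ Icc a b) :=
      (hG R a b ha hb).bdd_mul (c := C) (hk.comp measurable_snd).aestronglyMeasurable
        (Eventually.of_forall fun p => hkC _)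
    refine IntegrableOn.of_forall_sdiff_eq_zero h2
      (measurableSet_closedBall.prod MeasurableSet.univ) fun p hp => ?_
    have : p.2 ∉ Icc a b := fun h => hp.2 ⟨hp.1.1, h⟩
    simp [hk0 _ this]
  rw [IntegrableOn, Measure.volume_eq_prod, ← Measure.prod_restrict, Measure.restrict_univ] at h1
  exact h1.integral_prod_left

/-- The equation tested against a product: as an integral in time, and as one in space. -/
lemma Sol.weak_prod (h : Sol ρ m T u) {b b1 b2 : ℝ → ℝ} (hb : Prof b b1 b2) (x0 : Eu N)
    (hκ : ContDiff ℝ ∞ κ) (hκc : HasCompactSupport κ) (hκs : tsupport κ ⊆ Ioo 0 T) :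
    (∫ t, (deriv κ t * (∫ x, ρ x * u x t * b (‖x - x0‖ ^ 2)) +
      κ t * ∫ x, u x t ^ m * radL N b1 b2 (‖x - x0‖ ^ 2)) = 0) ∧
    (∫ x, (∫ t, κ t * u x t ^ m) * radL N b1 b2 (‖x - x0‖ ^ 2)) +
      ∫ x, (∫ t, deriv κ t * (ρ x * u x t)) * b (‖x - x0‖ ^ 2) = 0 := by
  obtain ⟨a, c, ha, hc, hk0, hk1⟩ := exists_Icc_of_smooth hκc hκs
  obtain ⟨C, hC⟩ := hκ.continuous.bounded_above_of_compact_support hκc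
  obtain ⟨D, hD⟩ := (hκ.continuous_deriv (by simp)).bounded_above_of_compact_support hκc.deriv
  have i1 := integrable_prod_mul h.int1 (hb.cont_b x0) (hb.compact_b x0)
    (hκ.continuous_deriv (by simp)).measurable hD ha hc hk1
  have i2 := integrable_prod_mul h.intm (hb.cont_L N x0) (hb.compact_L N x0)
    hκ.continuous.measurable hC ha hc hk0
  have h0 := h.weak x0 b b1 b2 κ hb hκ hκc hκs
  rw [Measure.volume_eq_prod] at h0 i1 i2
  constructor
  · rw [← (integral_prod_symm _ (i1.add i2)).symm.trans h0]
    apply integral_congr_ae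
    filter_upwards [i1.prod_left_ae, i2.prod_left_ae] with t ht1 ht2
    simp only [Pi.add_apply]
    rw [integral_add ht1 ht2, ← integral_const_mul, ← integral_const_mul]
    congr 1 <;> (congr 1; ext x; ring)
  · rw [integral_add i1 i2, integral_prod _ i1, integral_prod _ i2] at h0
    rw [← h0, add_comm]
    congr 1 <;>
    · congr 1; ext x
      rw [← integral_mul_const]
      congr 1; ext t
      ring

/-- A smooth cutoff in time, equal to `1` up to `T1` and vanishing from `T2 < T` on. -/
structure Cut (χ : ℝ → ℝ) (T T1 T2 : ℝ) : Prop where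
  smooth : ContDiff ℝ ∞ χ
  pos : 0 < T1
  lt12 : T1 < T2
  lt2 : T2 < T
  one : ∀ t, t ≤ T1 → χ t = 1
  zero : ∀ t, T2 ≤ t → χ t = 0
  nonneg : ∀ t, 0 ≤ χ t
  le_one : ∀ t, χ t ≤ 1

lemma Cut.deriv_zero (h : Cut χ T T1 T2) (ht : t ∉ Icc T1 T2) :
    deriv χ t = 0 := by
  rcases lt_or_lt_of_notMem_Icc ht with ht | ht
  · have : χ =ᶠ[𝓝 t] fun _ => 1 := by
      filter_upwards [Iio_mem_nhds ht] with s hs using h.one s (le_of_lt hs)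
    rw [this.deriv_eq]; simp
  · have : χ =ᶠ[𝓝 t] fun _ => 0 := by
      filter_upwards [Ioi_mem_nhds ht] with s hs using h.zero s (le_of_lt hs)
    rw [this.deriv_eq]; simp

lemma Cut.exists_deriv_bound (h : Cut χ T T1 T2) :
    ∃ C, 0 ≤ C ∧ ∀ t, |deriv χ t| ≤ C := by
  have hc : HasCompactSupport (deriv χ) :=
    HasCompactSupport.intro isCompact_Icc fun t ht => h.deriv_zero ht
  obtain ⟨C, hC⟩ := (h.smooth.continuous_deriv (by simp)).bounded_above_of_compact_support hc
  exact ⟨C, (norm_nonneg _).trans (hC 0), hC⟩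

lemma Cut.abs_le_one (h : Cut χ T T1 T2) (t : ℝ) : |χ t| ≤ 1 := by
  rw [abs_of_nonneg (h.nonneg t)]; exact h.le_one t

lemma integral_add3 {α : Type*} [MeasurableSpace α] {μ : Measure α} {f g h : α → ℝ}
    (hf : Integrable f μ) (hg : Integrable g μ) (hh : Integrable h μ) :
    ∫ x, f x + g x + h x ∂μ = ∫ x, f x ∂μ + ∫ x, g x ∂μ + ∫ x, h x ∂μ := by
  exact (integral_add (hf.add hg) hh).trans (by rw [integral_add' hf hg])

lemma ae_duhamel {h g : ℝ → ℝ}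
    (hh : ∀ a b, 0 < a → b < T → IntegrableOn h (Icc a b))
    (hg : ∀ a b, 0 < a → b < T → IntegrableOn g (Icc a b))
    (hw : ∀ κ : ℝ → ℝ, ContDiff ℝ ∞ κ → HasCompactSupport κ → tsupport κ ⊆ Ioo 0 T →
      ∫ t, (deriv κ t * h t + κ t * g t) = 0) (hχ : Cut χ T T1 T2) :
    ∀ᵐ t, t ∈ Ioo 0 T1 → h t + (∫ s, deriv χ s * h s) + ∫ s in Ioc t T2, χ s * g s = 0 := by
  have hχg : ∀ a, 0 < a → IntegrableOn (fun s => χ s * g s) (Icc a T2) := fun a ha =>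
    (hg a T2 ha hχ.lt2).bdd_mul (c := 1) hχ.smooth.continuous.aestronglyMeasurable
      (Eventually.of_forall hχ.abs_le_one)
  obtain ⟨C, hC0, hC⟩ := hχ.exists_deriv_bound
  have hχh : Integrable fun s => deriv χ s * h s := by
    refine IntegrableOn.integrable_of_forall_notMem_eq_zero (s := Icc T1 T2) ?_ ?_
    · exact (hh _ _ hχ.pos hχ.lt2).bdd_mul (c := C)
        (hχ.smooth.continuous_deriv (by simp)).aestronglyMeasurable (Eventually.of_forall hC)
    · intro s hs; simp [hχ.deriv_zero hs]
  set c1 := ∫ s, deriv χ s * h s with hc1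
  set J : ℝ → ℝ := fun t => ∫ s in Ioc t T2, χ s * g s with hJ
  have hJc : ContinuousOn J (Ioo 0 T1) := by
    intro t ht
    have ht0 : 0 < t / 2 := half_pos ht.1
    have h1 : ContinuousOn (fun x => ∫ s in x..T2, χ s * g s) (uIcc (t / 2) T2) := by
      apply intervalIntegral.continuousOn_primitive_interval_left
      rw [uIcc_of_le (by linarith [ht.2, hχ.lt12, ht.1])]
      exact hχg _ ht0
    have h2 : uIcc (t / 2) T2 ∈ 𝓝 t := by
      rw [uIcc_of_le (by linarith [ht.2, hχ.lt12, ht.1])]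
      exact Icc_mem_nhds (by linarith [ht.1]) (ht.2.trans hχ.lt12)
    have h3 := h1.continuousAt h2
    refine (h3.congr ?_).continuousWithinAt
    filter_upwards [Iio_mem_nhds (ht.2.trans hχ.lt12)] with s hs
    rw [intervalIntegral.integral_of_le (le_of_lt hs)]
  have hloc : LocallyIntegrableOn (fun t => h t + c1 + J t) (Ioo 0 T1) := by
    rw [locallyIntegrableOn_iff isOpen_Ioo.isLocallyClosed]
    intro k hk hkc
    obtain ⟨a, b, ha, hb, hab⟩ := exists_Icc_of_compact hkc hk
    have h1 : IntegrableOn h k :=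
      (hh a b ha (hb.trans (hχ.lt12.trans hχ.lt2))).mono_set hab
    have h2 : IntegrableOn J k := (hJc.mono hk).integrableOn_compact hkc
    have h3 : IntegrableOn (fun _ : ℝ => c1) k := by
      exact continuousOn_const.integrableOn_compact hkc
    exact (h1.add h3).add h2
  refine isOpen_Ioo.ae_eq_zero_of_integral_contDiff_smul_eq_zero hloc ?_
  intro θ hθ hθc hθs
  obtain ⟨a, b, ha, hb, hab⟩ := exists_Icc_of_compact hθc.isCompact hθs
  have hθ0 : ∀ t ∉ Icc a b, θ t = 0 := fun t ht =>
    image_eq_zero_of_notMem_tsupport fun h => ht (hab h)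
  have hθi : Integrable θ := hθ.continuous.integrable_of_hasCompactSupport hθc
  set K : ℝ → ℝ := fun s => ∫ t in Iic s, θ t with hK
  set c0 := ∫ t, θ t with hc0
  have hKd : ∀ s, HasDerivAt K (θ s) s := by
    intro s
    have e : K = fun s => (∫ t in (0 : ℝ)..s, θ t) + ∫ t in Iic 0, θ t := by
      ext s
      rw [← intervalIntegral.integral_Iic_sub_Iic hθi.integrableOn hθi.integrableOn]; ring
    rw [e]
    exact (intervalIntegral.integral_hasDerivAt_right (hθ.continuous.intervalIntegrable _ _)
      (hθ.continuous.stronglyMeasurableAtFilter _ _) hθ.continuous.continuousAt).add_const _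
  have hKs : ContDiff ℝ ∞ K := by
    rw [contDiff_infty_iff_deriv]
    refine ⟨fun s => (hKd s).differentiableAt, ?_⟩
    have : deriv K = θ := funext fun s => (hKd s).deriv
    rw [this]; exact hθ
  have hK0 : ∀ s, s < a → K s = 0 := by
    intro s hs
    apply setIntegral_eq_zero_of_forall_eq_zero
    intro t ht
    exact hθ0 t fun h => absurd (h.1.trans (mem_Iic.1 ht)) (not_le.2 hs)
  have hK1 : ∀ s, b ≤ s → K s = c0 := by
    intro s hs
    rw [hK, hc0]
    apply setIntegral_eq_integral_of_forall_compl_eq_zero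
    intro t ht
    exact hθ0 t fun h => ht (h.2.trans hs)
  have hbT2 : b < T2 := hb.trans hχ.lt12
  have hκ0 : ∀ s ∉ Icc a T2, χ s * K s = 0 := by
    intro s hs
    rcases lt_or_lt_of_notMem_Icc hs with hs | hs
    · simp [hK0 s hs]
    · simp [hχ.zero s hs.le]
  have hκts : tsupport (fun s => χ s * K s) ⊆ Icc a T2 :=
    closure_minimal (fun s hs => by by_contra hc; exact hs (hκ0 s hc)) isClosed_Icc
  have hκcs : HasCompactSupport fun s => χ s * K s :=
    HasCompactSupport.intro isCompact_Icc hκ0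
  have h0 := hw (fun s => χ s * K s) (hχ.smooth.mul hKs) hκcs
    (hκts.trans fun s hs => ⟨ha.trans_le hs.1, hs.2.trans_lt hχ.lt2⟩)
  have hder : ∀ s, deriv (fun s => χ s * K s) s = c0 * deriv χ s + θ s := by
    intro s
    have := ((hχ.smooth.differentiable (by simp) s).hasDerivAt.mul (hKd s)).deriv
    refine this.trans ?_
    have e1 : deriv χ s * K s = c0 * deriv χ s := by
      rcases lt_or_ge s T1 with hs | hs
      · rw [hχ.deriv_zero fun h => absurd h.1 (not_le.2 hs)]; simp
      · rw [hK1 s (hb.le.trans hs)]; ring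
    have e2 : χ s * θ s = θ s := by
      rcases le_or_gt s T1 with hs | hs
      · rw [hχ.one s hs, one_mul]
      · rw [hθ0 s fun h => absurd (h.2.trans_lt hb) (not_lt.2 hs.le), mul_zero]
    rw [e1, e2]
  obtain ⟨M, hM⟩ := hθ.continuous.bounded_above_of_compact_support hθc
  have hTh : Integrable fun t => θ t * h t := by
    refine IntegrableOn.integrable_of_forall_notMem_eq_zero (s := Icc a b) ?_ ?_
    · exact (hh a b ha (hbT2.trans hχ.lt2)).bdd_mul (c := M)
        hθ.continuous.aestronglyMeasurable (Eventually.of_forall hM)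
    · intro s hs; simp [hθ0 s hs]
  have hG : Integrable (indicator (Icc a T2) fun s => χ s * g s) :=
    (integrable_indicator_iff measurableSet_Icc).2 (hχg a ha)
  have hF : Integrable (fun p : ℝ × ℝ => {p : ℝ × ℝ | p.1 < p.2}.indicator
      (fun p => θ p.1 * (Icc a T2).indicator (fun s => χ s * g s) p.2) p)
      ((volume : Measure ℝ).prod volume) :=
    (hθi.mul_prod hG).indicator (measurableSet_lt measurable_fst measurable_snd)
  have e1 : ∀ t, t ∈ Icc a b → ∫ s, {p : ℝ × ℝ | p.1 < p.2}.indicator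
      (fun p => θ p.1 * (Icc a T2).indicator (fun s => χ s * g s) p.2) (t, s) = θ t * J t := by
    intro t ht
    rw [hJ]; simp only
    rw [← integral_const_mul, ← integral_indicator measurableSet_Ioc]
    congr 1; ext s
    by_cases h1 : t < s
    · by_cases h2 : s ≤ T2
      · have h3 : s ∈ Icc a T2 := ⟨ht.1.trans h1.le, h2⟩
        have h4 : s ∈ Ioc t T2 := ⟨h1, h2⟩
        simp [indicator, h1, h3, h4]
      · simp [indicator, h1, h2]
    · simp [indicator, h1]
  have e2 : ∀ s, ∫ t, {p : ℝ × ℝ | p.1 < p.2}.indicator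
      (fun p => θ p.1 * (Icc a T2).indicator (fun s => χ s * g s) p.2) (t, s) =
      χ s * K s * g s := by
    intro s
    by_cases h1 : s ∈ Icc a T2
    · have : ∀ t, {p : ℝ × ℝ | p.1 < p.2}.indicator
        (fun p => θ p.1 * (Icc a T2).indicator (fun s => χ s * g s) p.2) (t, s) =
          (Iio s).indicator θ t * (χ s * g s) := by
        intro t
        by_cases h2 : t < s
        · simp only [indicator, mem_ofPred_eq, h2, h1, if_true, mem_Iio]
        · simp [indicator, h2]
      simp_rw [this]
      rw [integral_mul_const, integral_indicator measurableSet_Iio, hK]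
      simp only
      rw [integral_Iic_eq_integral_Iio]; ring
    · have : ∀ t, {p : ℝ × ℝ | p.1 < p.2}.indicator
        (fun p => θ p.1 * (Icc a T2).indicator (fun s => χ s * g s) p.2) (t, s) = 0 := by
        intro t
        simp only [indicator, h1, if_false]; simp
      simp_rw [this, hκ0 s h1]; simp
  have hswap := integral_integral_swap (f := fun t s => {p : ℝ × ℝ | p.1 < p.2}.indicator
      (fun p => θ p.1 * (Icc a T2).indicator (fun s => χ s * g s) p.2) (t, s)) hF
  have e3 : ∫ t, θ t * J t = ∫ s, χ s * K s * g s := by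
    simp_rw [e2] at hswap
    rw [← hswap]
    congr 1; ext t
    by_cases ht : t ∈ Icc a b
    · rw [e1 t ht]
    · simp [indicator, hθ0 t ht]
  have hTJ : Integrable fun t => θ t * J t := by
    refine hF.integral_prod_left.congr (Eventually.of_forall fun t => ?_)
    by_cases ht : t ∈ Icc a b
    · exact e1 t ht
    · simp [indicator, hθ0 t ht]
  have hKg : Integrable fun s => χ s * K s * g s := by
    have := hF.integral_prod_right
    simp_rw [e2] at this; exact this
  simp_rw [hder] at h0
  have e4 : ∀ s, (c0 * deriv χ s + θ s) * h s + χ s * K s * g s =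
      (c0 * (deriv χ s * h s) + θ s * h s) + χ s * K s * g s := fun s => by ring
  simp_rw [e4] at h0
  have i1 : Integrable fun s => c0 * (deriv χ s * h s) := hχh.const_mul c0
  have h5 := (integral_add3 i1 hTh hKg).symm.trans h0
  rw [integral_const_mul, ← e3] at h5
  have i2 : Integrable fun t => θ t * c1 := hθi.mul_const c1
  have h6 := integral_add3 hTh i2 hTJ
  rw [integral_mul_const] at h6
  calc ∫ t, θ t • (h t + c1 + J t) = ∫ t, (θ t * h t + θ t * c1) + θ t * J t := by
        congr 1; ext t; simp only [smul_eq_mul]; ring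
    _ = 0 := by rw [h6]; linarith

/-- Time average of `u` over the cutoff region. -/
def Om (χ : ℝ → ℝ) (u : Eu N → ℝ → ℝ) (x : Eu N) : ℝ := -∫ s, deriv χ s * u x s

/-- Potential of the solution, integrated from time `t` on. -/
def Pt (χ : ℝ → ℝ) (T2 m : ℝ) (u : Eu N → ℝ → ℝ) (x : Eu N) (t : ℝ) : ℝ :=
  ∫ s in Ioc t T2, χ s * u x s ^ m

lemma ae_LI_slice {f : Eu N × ℝ → ℝ}
    (h : ∀ R a b, 0 < a → b < T → IntegrableOn f (closedBall 0 R ×ˢ Icc a b)) :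
    ∀ᵐ t : ℝ, t ∈ Ioo 0 T → LI fun x => f (x, t) := by
  have h1 : ∀ k : ℕ, ∀ᵐ t : ℝ, t ∈ Icc (1 / (k + 1 : ℝ)) (T - 1 / (k + 1)) →
      IntegrableOn (fun x => f (x, t)) (closedBall (0 : Eu N) k) := by
    intro k
    have h2 := h k (1 / (k + 1 : ℝ)) (T - 1 / (k + 1)) (by positivity)
      (by have : 0 < 1 / (k + 1 : ℝ) := by positivity
          linarith)
    rw [IntegrableOn, Measure.volume_eq_prod, ← Measure.prod_restrict] at h2
    have h3 := h2.prod_left_ae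
    rwa [ae_restrict_iff' measurableSet_Icc] at h3
  filter_upwards [ae_all_iff.2 h1] with t ht htT R
  obtain ⟨k1, hk1⟩ := exists_nat_ge R
  obtain ⟨k2, hk2⟩ := exists_nat_one_div_lt htT.1
  obtain ⟨k3, hk3⟩ := exists_nat_one_div_lt (sub_pos.2 htT.2)
  set k := max k1 (max k2 k3)
  have e1 : k1 ≤ k := le_max_left _ _
  have e2 : k2 ≤ k := (le_max_left _ _).trans (le_max_right _ _)
  have e3 : k3 ≤ k := (le_max_right _ _).trans (le_max_right _ _)
  refine (ht k ⟨?_, ?_⟩).mono_set (closedBall_subset_closedBall ?_)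
  · exact (Nat.one_div_le_one_div e2).trans hk2.le
  · have := Nat.one_div_le_one_div (α := ℝ) e3
    linarith
  · exact hk1.trans (by exact_mod_cast e1)

lemma Om_mul (x : Eu N) : ρ x * Om χ u x = -∫ s, deriv χ s * (ρ x * u x s) := by
  rw [Om, mul_neg, ← integral_const_mul]
  congr 2; ext s; ring

lemma Sol.LI_Om (h : Sol ρ m T u) (hχ : Cut χ T T1 T2) : LI fun x => ρ x * Om χ u x := by
  obtain ⟨C, hC0, hC⟩ := hχ.exists_deriv_bound
  have := (LI.time_integral h.int1 (hχ.smooth.continuous_deriv (by simp)).measurable hC hχ.pos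
    hχ.lt2 (fun t ht => hχ.deriv_zero ht)).const_mul (-1)
  simpa only [Om_mul, neg_mul, one_mul] using this

lemma Pt_eq (t : ℝ) (x : Eu N) :
    Pt χ T2 m u x t = ∫ s, (Ioc t T2).indicator χ s * u x s ^ m := by
  rw [Pt, ← integral_indicator measurableSet_Ioc]
  congr 1; ext s
  by_cases hs : s ∈ Ioc t T2 <;> simp [hs]

lemma Cut.abs_indicator_le (hχ : Cut χ T T1 T2) (t s : ℝ) : |(Ioc t T2).indicator χ s| ≤ 1 := by
  by_cases hs : s ∈ Ioc t T2
  · simpa [hs] using hχ.abs_le_one s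
  · simp [hs]

lemma Cut.indicator_zero (hs : s ∉ Icc t T2) : (Ioc t T2).indicator χ s = 0 :=
  indicator_of_notMem (fun h => hs (Ioc_subset_Icc_self h)) _

lemma Sol.LI_Pt (h : Sol ρ m T u) (hχ : Cut χ T T1 T2) (ht : 0 < t) :
    LI fun x => Pt χ T2 m u x t := by
  have := LI.time_integral h.intm (k := (Ioc t T2).indicator χ)
    (hχ.smooth.continuous.measurable.indicator measurableSet_Ioc) (C := 1)
    (hχ.abs_indicator_le t) ht hχ.lt2 (fun s hs => Cut.indicator_zero hs)
  simpa only [Pt_eq] using this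

lemma Sol.Pt_pot (h : Sol ρ m T u) (hχ : Cut χ T T1 T2) {b b1 b2 : ℝ → ℝ} (hb : Prof b b1 b2)
    (x0 : Eu N) : ∀ᵐ t, t ∈ Ioo 0 T1 →
      (∫ x, ρ x * (u x t - Om χ u x) * b (‖x - x0‖ ^ 2)) +
        ∫ x, Pt χ T2 m u x t * radL N b1 b2 (‖x - x0‖ ^ 2) = 0 := by
  obtain ⟨C, hC0, hC⟩ := hχ.exists_deriv_bound
  have key : ∀ (G : Eu N × ℝ → ℝ), (∀ R a b, 0 < a → b < T →
      IntegrableOn G (closedBall 0 R ×ˢ Icc a b)) → ∀ g : Eu N → ℝ, Continuous g →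
      HasCompactSupport g → ∀ a b, 0 < a → b < T →
      IntegrableOn (fun t => ∫ x, G (x, t) * g x) (Icc a b) := by
    intro G hG g hg hgc a b ha hb
    have h1 := integrable_prod_mul hG hg hgc (k := (Icc a b).indicator fun _ => 1)
      (measurable_const.indicator measurableSet_Icc) (C := 1) (a := a) (b := b)
      (fun t => by by_cases ht : t ∈ Icc a b <;> simp [ht]) ha hb
      (fun t ht => indicator_of_notMem ht _)
    rw [Measure.volume_eq_prod] at h1
    rw [← integrable_indicator_iff measurableSet_Icc]
    refine h1.integral_prod_right.congr (Eventually.of_forall fun t => ?_)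
    by_cases ht : t ∈ Icc a b <;> simp [ht]
  have hd := ae_duhamel (h := fun t => ∫ x, ρ x * u x t * b (‖x - x0‖ ^ 2))
    (g := fun t => ∫ x, u x t ^ m * radL N b1 b2 (‖x - x0‖ ^ 2))
    (key _ h.int1 _ (hb.cont_b x0) (hb.compact_b x0))
    (key _ h.intm _ (hb.cont_L N x0) (hb.compact_L N x0))
    (fun κ hκ hκc hκs => (h.weak_prod hb x0 hκ hκc hκs).1) hχ
  have hLI := ae_LI_slice h.int1
  filter_upwards [hd, hLI] with t ht htL htT
  have ht1 := ht htT
  have i0 := (htL ⟨htT.1, htT.2.trans (hχ.lt12.trans hχ.lt2)⟩).integrable_mul (hb.cont_b x0)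
    (hb.compact_b x0)
  have i1 := (h.LI_Om hχ).integrable_mul (hb.cont_b x0) (hb.compact_b x0)
  have e1 : ∫ s, deriv χ s * ∫ x, ρ x * u x s * b (‖x - x0‖ ^ 2) =
      -∫ x, ρ x * Om χ u x * b (‖x - x0‖ ^ 2) := by
    have j := integrable_prod_mul h.int1 (hb.cont_b x0) (hb.compact_b x0)
      (hχ.smooth.continuous_deriv (by simp)).measurable hC hχ.pos hχ.lt2
      (fun t ht => hχ.deriv_zero ht)
    rw [Measure.volume_eq_prod] at j
    have := integral_integral_swap (f := fun (x : Eu N) s =>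
      ρ x * u x s * (deriv χ s * b (‖x - x0‖ ^ 2))) j
    calc _ = ∫ s, ∫ x, ρ x * u x s * (deriv χ s * b (‖x - x0‖ ^ 2)) := by
          congr 1; ext s; rw [← integral_const_mul]; congr 1; ext x; ring
      _ = _ := by
          rw [← this, ← integral_neg]
          congr 1; ext x
          rw [Om_mul, neg_mul, neg_neg, ← integral_mul_const]
          congr 1; ext s; ring
  have e2 : ∫ s in Ioc t T2, χ s * ∫ x, u x s ^ m * radL N b1 b2 (‖x - x0‖ ^ 2) =
      ∫ x, Pt χ T2 m u x t * radL N b1 b2 (‖x - x0‖ ^ 2) := by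
    have j := integrable_prod_mul h.intm (hb.cont_L N x0) (hb.compact_L N x0)
      (k := (Ioc t T2).indicator χ)
      (hχ.smooth.continuous.measurable.indicator measurableSet_Ioc) (C := 1)
      (hχ.abs_indicator_le t) htT.1 hχ.lt2 (fun s hs => Cut.indicator_zero hs)
    rw [Measure.volume_eq_prod] at j
    have := integral_integral_swap (f := fun (x : Eu N) s =>
      u x s ^ m * ((Ioc t T2).indicator χ s * radL N b1 b2 (‖x - x0‖ ^ 2))) j
    calc _ = ∫ s, ∫ x, u x s ^ m * ((Ioc t T2).indicator χ s *
          radL N b1 b2 (‖x - x0‖ ^ 2)) := by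
          rw [← integral_indicator measurableSet_Ioc]
          congr 1; ext s
          by_cases hs : s ∈ Ioc t T2
          · simp only [hs, indicator_of_mem]
            rw [← integral_const_mul]; congr 1; ext x; ring
          · simp [hs]
      _ = _ := by
          rw [← this]
          congr 1; ext x
          rw [Pt_eq, ← integral_mul_const]
          congr 1; ext s; ring
  rw [e1, e2] at ht1
  have e3 : ∫ x, ρ x * (u x t - Om χ u x) * b (‖x - x0‖ ^ 2) =
      (∫ x, ρ x * u x t * b (‖x - x0‖ ^ 2)) - ∫ x, ρ x * Om χ u x * b (‖x - x0‖ ^ 2) := by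
    rw [← integral_sub i0 i1]
    congr 1; ext x; ring
  rw [e3]; linarith

lemma kB_nonneg (hn : 2 < n) (hr : 0 < r) (hq : 0 ≤ q) : 0 ≤ kB n r q := by
  rw [kB]
  refine mul_nonneg (Real.rpow_nonneg hr.le _) ?_
  set y := q / r ^ 2
  have hy : 0 ≤ y := by positivity
  rcases le_or_gt 1 y with h | h
  · rw [kb_eq_of_ge h]; positivity
  · rw [kb]
    have : 0 ≤ ∫ s in y..1, kh n s := by
      apply intervalIntegral.integral_nonneg h.le
      intro s hs
      have hs0 : 0 ≤ s := hy.trans hs.1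
      have h1 := kcut_nonneg s
      have h2 := kcut_le_one s
      have h3 : 0 ≤ s ^ (-(n / 2)) := Real.rpow_nonneg hs0 _
      exact mul_nonneg (by linarith) (add_nonneg (mul_nonneg h1 h3) (by linarith))
    linarith

lemma ofReal_integral_le {α : Type*} [MeasurableSpace α] {μ : Measure α} {f : α → ℝ}
    (hf : Integrable f μ) : ofReal (∫ x, f x ∂μ) ≤ ∫⁻ x, ofReal (f x) ∂μ := by
  have h1 : ∫ x, f x ∂μ ≤ ∫ x, max (f x) 0 ∂μ :=
    integral_mono hf hf.pos_part fun x => le_max_left _ _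
  refine (ENNReal.ofReal_le_ofReal h1).trans ?_
  rw [ofReal_integral_eq_lintegral_ofReal hf.pos_part (Eventually.of_forall fun x => le_max_right _ _)]
  refine lintegral_mono fun x => ?_
  rcases le_total (f x) 0 with h | h
  · simp [max_eq_right h]
  · simp [max_eq_left h]

/-- `-ΔQ = f` tested with truncated Newton kernels centred at `x`. -/
def PotAt (r : ℝ) (Q f : Eu N → ℝ) (x : Eu N) : Prop :=
  ∀ k : ℕ, 1 / (k + 1 : ℝ) < r →
    cK N * ((∫ y, Q y * thK (1 / (k + 1 : ℝ)) (y - x)) - ∫ y, Q y * thK r (y - x)) =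
      ∫ y, f y * (kB N (1 / (k + 1 : ℝ)) (‖y - x‖ ^ 2) - kB N r (‖y - x‖ ^ 2))

lemma thK_shift_continuous (r : ℝ) (x : Eu N) : Continuous fun y : Eu N => thK r (y - x) :=
  (thK_continuous r).comp (by fun_prop)

lemma thK_shift_compact (hr : 0 < r) (x : Eu N) :
    HasCompactSupport fun y : Eu N => thK r (y - x) := by
  refine HasCompactSupport.intro (isCompact_closedBall x r) fun y hy => thK_zero hr ?_
  rw [mem_closedBall_iff_norm] at hy
  exact (not_le.1 hy).le

lemma LI.integrable_thK (hQ : LI Q) (hr : 0 < r) (x : Eu N) :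
    Integrable fun y => Q y * thK r (y - x) :=
  hQ.integrable_mul (thK_shift_continuous r x) (thK_shift_compact hr x)

lemma integral_radL_kB (hN : 3 ≤ N) (hQ : LI Q) (hs : 0 < s) (hsr : s < r)
    (x : Eu N) :
    ∫ y, Q y * radL N (fun q => kB1 N s q - kB1 N r q) (fun q => kB2 N s q - kB2 N r q)
      (‖y - x‖ ^ 2) =
    -(cK N * ((∫ y, Q y * thK s (y - x)) - ∫ y, Q y * thK r (y - x))) := by
  have hc := (cK_pos hN).ne'
  rw [← integral_sub (hQ.integrable_thK hs x) (hQ.integrable_thK (hs.trans hsr) x),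
    ← integral_const_mul, ← integral_neg]
  congr 1; ext y
  rw [kB_radL hs (hs.trans hsr), thK, thK]
  field_simp
  ring

lemma PotAt.of_prof (hN : 3 ≤ N) (hQ : LI Q)
    (h : ∀ k : ℕ, 1 / (k + 1 : ℝ) < r →
      (∫ y, Q y * radL N (fun q => kB1 N (1 / (k + 1 : ℝ)) q - kB1 N r q)
        (fun q => kB2 N (1 / (k + 1 : ℝ)) q - kB2 N r q) (‖y - x‖ ^ 2)) +
      ∫ y, f y * (kB N (1 / (k + 1 : ℝ)) (‖y - x‖ ^ 2) - kB N r (‖y - x‖ ^ 2)) = 0) :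
    PotAt r Q f x := by
  intro k hk
  have h1 := h k hk
  rw [integral_radL_kB hN hQ (by positivity) hk] at h1
  linarith

lemma kB_sub_continuous (hs : 0 < s) (hsr : s < r) (x : Eu N) :
    Continuous fun y : Eu N => kB N s (‖y - x‖ ^ 2) - kB N r (‖y - x‖ ^ 2) :=
  (kB_prof hs hsr).cont_b x

lemma kB_sub_compact (hs : 0 < s) (hsr : s < r) (x : Eu N) :
    HasCompactSupport fun y : Eu N => kB N s (‖y - x‖ ^ 2) - kB N r (‖y - x‖ ^ 2) :=
  (kB_prof hs hsr).compact_b x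

lemma PotAt.add {Q' f' : Eu N → ℝ} (hr : 0 < r) (h : PotAt r Q f x)
    (h' : PotAt r Q' f' x) (hQ : LI Q) (hf : LI f) (hQ' : LI Q') (hf' : LI f') :
    PotAt r (fun y => Q y + Q' y) (fun y => f y + f' y) x := by
  intro k hk
  have hk0 : 0 < 1 / (k + 1 : ℝ) := by positivity
  have h1 := h k hk
  have h2 := h' k hk
  simp only [add_mul]
  rw [integral_add (hQ.integrable_thK hk0 x) (hQ'.integrable_thK hk0 x),
    integral_add (hQ.integrable_thK hr x) (hQ'.integrable_thK hr x),
    integral_add (hf.integrable_mul (kB_sub_continuous hk0 hk x) (kB_sub_compact hk0 hk x))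
      (hf'.integrable_mul (kB_sub_continuous hk0 hk x) (kB_sub_compact hk0 hk x)), ← h1, ← h2]
  ring

lemma PotAt.const_mul (h : PotAt r Q f x) (c : ℝ) :
    PotAt r (fun y => c * Q y) (fun y => c * f y) x := by
  intro k hk
  have h1 := h k hk
  simp only [mul_assoc]
  rw [integral_const_mul, integral_const_mul, integral_const_mul, ← h1]
  ring

lemma PotAt.sub {Q' f' : Eu N → ℝ} (hr : 0 < r) (h : PotAt r Q f x)
    (h' : PotAt r Q' f' x) (hQ : LI Q) (hf : LI f) (hQ' : LI Q') (hf' : LI f') :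
    PotAt r (fun y => Q y - Q' y) (fun y => f y - f' y) x := by
  have := h.add hr (h'.const_mul (-1)) hQ hf (hQ'.const_mul _) (hf'.const_mul _)
  simpa only [neg_mul, one_mul, ← sub_eq_add_neg] using this

lemma ae_tendsto_thK (hN : 3 ≤ N) (hQ : LI Q) :
    ∀ᵐ x, Tendsto (fun k : ℕ => ∫ y, Q y * thK (1 / (k + 1 : ℝ)) (y - x)) atTop (𝓝 (Q x)) := by
  obtain ⟨C, hC, hCk⟩ := exists_thK_le hN
  have := nontrivial_Eu hN
  filter_upwards [IsUnifLocDoublingMeasure.ae_tendsto_average_norm_sub (volume : Measure (Eu N))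
    hQ.locallyIntegrable 1] with x hx
  have hδ : Tendsto (fun k : ℕ => 1 / (k + 1 : ℝ)) atTop (𝓝[>] 0) := by
    rw [tendsto_nhdsWithin_iff]
    exact ⟨tendsto_one_div_add_atTop_nhds_zero_nat, Eventually.of_forall fun k => by
      simp only [mem_Ioi]; positivity⟩
  have h1 := hx (fun _ : ℕ => x) (fun k : ℕ => 1 / (k + 1 : ℝ)) hδ
    (Eventually.of_forall fun k => mem_closedBall_self (by positivity))
  have h2 := h1.const_mul (C * (volume (ball (0 : Eu N) 1)).toReal)
  rw [mul_zero] at h2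
  rw [tendsto_iff_norm_sub_tendsto_zero]
  refine squeeze_zero (fun _ => norm_nonneg _) (fun k => ?_) h2
  set s : ℝ := 1 / (k + 1 : ℝ) with hs
  have hs0 : 0 < s := by positivity
  have e1 : Q x = ∫ y, Q x * thK s (y - x) := by
    rw [integral_const_mul, integral_sub_right_eq_self (fun y : Eu N => thK s y),
      integral_thK hN hs0, mul_one]
  have hcst : LI fun _ : Eu N => Q x := LI.of_continuous continuous_const
  have hd : LI fun y => Q y - Q x := hQ.sub hcst
  have e0 : (∫ y, Q y * thK s (y - x)) - Q x =
      ∫ y, (Q y * thK s (y - x) - Q x * thK s (y - x)) := by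
    rw [integral_sub (hQ.integrable_thK hs0 x) (hcst.integrable_thK hs0 x), ← e1]
  rw [e0]
  refine (norm_integral_le_integral_norm _).trans ?_
  have hloc : IntegrableOn (fun y => ‖Q y - Q x‖) (closedBall x s) :=
    (hd.locallyIntegrable.integrableOn_isCompact (isCompact_closedBall x s)).norm
  have e2 : ∫ y, ‖Q y * thK s (y - x) - Q x * thK s (y - x)‖ ≤
      C * s ^ (-N : ℝ) * ∫ y in closedBall x s, ‖Q y - Q x‖ := by
    rw [← integral_const_mul, ← integral_indicator measurableSet_closedBall]
    refine integral_mono_of_nonneg (Eventually.of_forall fun _ => norm_nonneg _)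
      ((integrable_indicator_iff measurableSet_closedBall).2 (hloc.const_mul _))
      (Eventually.of_forall fun y => ?_)
    simp only
    rw [← sub_mul, norm_mul]
    by_cases hy : y ∈ closedBall x s
    · rw [indicator_of_mem hy, Real.norm_of_nonneg (thK_nonneg hN hs0 _), mul_comm]
      exact mul_le_mul_of_nonneg_right (hCk s hs0 _) (norm_nonneg _)
    · rw [indicator_of_notMem hy, thK_zero hs0, norm_zero, mul_zero]
      rw [mem_closedBall_iff_norm] at hy
      exact (not_le.1 hy).le
  refine e2.trans (le_of_eq ?_)
  rw [setAverage_eq, smul_eq_mul, measureReal_def, Measure.addHaar_closedBall _ _ hs0.le,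
    ENNReal.toReal_mul, finrank_Eu, ENNReal.toReal_ofReal (by positivity),
    Real.rpow_neg hs0.le, Real.rpow_natCast]
  have hv : (volume (ball (0 : Eu N) 1)).toReal ≠ 0 :=
    (ENNReal.toReal_pos (measure_ball_pos _ _ one_pos).ne' measure_ball_lt_top.ne).ne'
  field_simp

lemma submean (hN : 3 ≤ N) {n : Eu N → ℝ} (hQ : LI Q) (hf : LI f)
    (hfn : ∀ᵐ y, f y ≤ n y) :
    ∀ᵐ x, ∀ r > 0, PotAt r Q f x → ofReal (cK N * (Q x - ∫ y, Q y * thK r (y - x))) ≤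
      ∫⁻ y in ball x r, ofReal (n y) * ofReal (‖y - x‖ ^ (2 - N : ℝ)) := by
  filter_upwards [ae_tendsto_thK hN hQ] with x hx r hr hp
  have hn2 := three_le_cast hN
  have h1 : Tendsto (fun k : ℕ => ofReal (cK N * ((∫ y, Q y * thK (1 / (k + 1 : ℝ)) (y - x))
      - ∫ y, Q y * thK r (y - x)))) atTop
      (𝓝 (ofReal (cK N * (Q x - ∫ y, Q y * thK r (y - x))))) :=
    ENNReal.tendsto_ofReal ((hx.sub_const _).const_mul _)
  refine le_of_tendsto h1 ?_
  have hev : ∀ᶠ k : ℕ in atTop, 1 / (k + 1 : ℝ) < r :=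
    tendsto_one_div_add_atTop_nhds_zero_nat.eventually_lt_const hr
  filter_upwards [hev] with k hk
  have hk0 : 0 < 1 / (k + 1 : ℝ) := by positivity
  rw [hp k hk]
  refine (ofReal_integral_le (hf.integrable_mul (kB_sub_continuous hk0 hk x)
    (kB_sub_compact hk0 hk x))).trans ?_
  rw [← lintegral_indicator measurableSet_ball]
  refine lintegral_mono_ae ?_
  have hne : ∀ᵐ y : Eu N, y ≠ x := by
    have := nontrivial_Eu hN
    exact Measure.ae_ne volume x
  filter_upwards [hfn, hne] with y hy hyx
  have hpos : 0 < ‖y - x‖ := norm_pos_iff.2 (sub_ne_zero.2 hyx)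
  by_cases hyr : y ∈ ball x r
  · rw [indicator_of_mem hyr, ← ENNReal.ofReal_mul' (by positivity)]
    have b0 : 0 ≤ kB N (1 / (k + 1 : ℝ)) (‖y - x‖ ^ 2) - kB N r (‖y - x‖ ^ 2) :=
      sub_nonneg.2 (kB_anti hn2 (by positivity) hk0 hr hk.le)
    have b1 : kB N (1 / (k + 1 : ℝ)) (‖y - x‖ ^ 2) - kB N r (‖y - x‖ ^ 2) ≤
        ‖y - x‖ ^ (2 - N : ℝ) := by
      have := kB_le hn2 hk0 (show 0 < ‖y - x‖ ^ 2 by positivity)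
      have e : (‖y - x‖ ^ 2) ^ (1 - (N : ℝ) / 2) = ‖y - x‖ ^ (2 - N : ℝ) := by
        rw [← Real.rpow_natCast, ← Real.rpow_mul hpos.le]
        congr 1
        push_cast
        ring
      rw [e] at this
      have h3 := kB_nonneg (q := ‖y - x‖ ^ 2) hn2 hr (by positivity)
      linarith
    rcases le_or_gt (f y) 0 with h0 | h0
    · rw [ENNReal.ofReal_of_nonpos (mul_nonpos_of_nonpos_of_nonneg h0 b0)]
      exact zero_le
    · exact ENNReal.ofReal_le_ofReal (mul_le_mul hy b1 b0 (h0.le.trans hy))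
  · rw [indicator_of_notMem hyr]
    rw [mem_ball_iff_norm, not_lt] at hyr
    have hq : r ^ 2 ≤ ‖y - x‖ ^ 2 := by gcongr
    rw [kB_eq_of_ge hr hq, kB_eq_of_ge hk0 (le_trans (by gcongr) hq), sub_self, mul_zero]
    simp

lemma LI.continuous_shift (hQ : LI Q) (hg : Continuous g)
    (hc : HasCompactSupport g) : Continuous fun x => ∫ y, Q y * g (y - x) := by
  have hc' : HasCompactSupport fun z : Eu N => g (-z) := hc.comp_homeomorph (Homeomorph.neg _)
  have h := hc'.continuous_convolution_right (ContinuousLinearMap.mul ℝ ℝ) (μ := volume)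
    hQ.locallyIntegrable (hg.comp continuous_neg)
  refine h.congr fun x => ?_
  simp only [convolution_def, ContinuousLinearMap.mul_apply', neg_sub]

lemma Sol.LI_F (h : Sol ρ m T u) (hκ : ContDiff ℝ ∞ κ) (hκc : HasCompactSupport κ)
    (hκs : tsupport κ ⊆ Ioo 0 T) : LI fun x => ∫ t, κ t * u x t ^ m := by
  obtain ⟨a, c, ha, hc, hk0, hk1⟩ := exists_Icc_of_smooth hκc hκs
  obtain ⟨C, hC⟩ := hκ.continuous.bounded_above_of_compact_support hκc
  exact LI.time_integral h.intm hκ.continuous.measurable hC ha hc hk0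

lemma Sol.LI_F1 (h : Sol ρ m T u) (hκ : ContDiff ℝ ∞ κ) (hκc : HasCompactSupport κ)
    (hκs : tsupport κ ⊆ Ioo 0 T) : LI fun x => ∫ t, deriv κ t * (ρ x * u x t) := by
  obtain ⟨a, c, ha, hc, hk0, hk1⟩ := exists_Icc_of_smooth hκc hκs
  obtain ⟨C, hC⟩ := (hκ.continuous_deriv (by simp)).bounded_above_of_compact_support hκc.deriv
  exact LI.time_integral h.int1 (hκ.continuous_deriv (by simp)).measurable hC ha hc hk1

lemma Sol.potAt (hN : 3 ≤ N) (h : Sol ρ m T u) (hκ : ContDiff ℝ ∞ κ)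
    (hκc : HasCompactSupport κ) (hκs : tsupport κ ⊆ Ioo 0 T) (r : ℝ) (x : Eu N) :
    PotAt r (fun y => ∫ t, κ t * u y t ^ m) (fun y => ∫ t, deriv κ t * (ρ y * u y t)) x :=
  PotAt.of_prof hN (h.LI_F hκ hκc hκs) fun k hk =>
    (h.weak_prod (kB_prof (n := (N : ℝ)) (show 0 < 1 / (k + 1 : ℝ) by positivity) hk) x hκ hκc hκs).2

lemma Sol.ae_LI (h : Sol ρ m T u) (hχ : Cut χ T T1 T2) :
    ∀ᵐ t, t ∈ Ioo 0 T → LI fun y => ρ y * (u y t - Om χ u y) := by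
  filter_upwards [ae_LI_slice h.int1] with t ht htT
  have := (ht htT).sub (h.LI_Om hχ)
  simpa only [mul_sub] using this

lemma Sol.Pt_potAt (hN : 3 ≤ N) (h : Sol ρ m T u) (hχ : Cut χ T T1 T2) (r : ℝ) :
    ∀ᵐ t, t ∈ Ioo 0 T1 → ∀ x, PotAt r (fun y => Pt χ T2 m u y t)
      (fun y => ρ y * (u y t - Om χ u y)) x := by
  have h1 : ∀ᵐ t, ∀ k : ℕ, 1 / (k + 1 : ℝ) < r → ∀ i : ℕ, t ∈ Ioo 0 T1 →
      (∫ x, ρ x * (u x t - Om χ u x) * (kB N (1 / (k + 1 : ℝ)) (‖x - TopologicalSpace.denseSeq (Eu N) i‖ ^ 2) -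
        kB N r (‖x - TopologicalSpace.denseSeq (Eu N) i‖ ^ 2))) +
        ∫ x, Pt χ T2 m u x t * radL N (fun q => kB1 N (1 / (k + 1 : ℝ)) q - kB1 N r q)
        (fun q => kB2 N (1 / (k + 1 : ℝ)) q - kB2 N r q) (‖x - TopologicalSpace.denseSeq (Eu N) i‖ ^ 2) = 0 := by
    rw [ae_all_iff]; intro k
    by_cases hk : 1 / (k + 1 : ℝ) < r
    · simp only [hk, true_imp_iff]
      rw [ae_all_iff]; intro i
      exact h.Pt_pot hχ (kB_prof (n := (N : ℝ)) (show 0 < 1 / (k + 1 : ℝ) by positivity) hk) _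
    · exact Eventually.of_forall fun t hk' => absurd hk' hk
  filter_upwards [h1, h.ae_LI hχ] with t ht hli ht1 x
  have hT : t ∈ Ioo 0 T := ⟨ht1.1, ht1.2.trans (hχ.lt12.trans hχ.lt2)⟩
  have hf := hli hT
  have hP := h.LI_Pt hχ ht1.1
  refine PotAt.of_prof hN hP fun k hk => ?_
  have hp := kB_prof (n := (N : ℝ)) (show 0 < 1 / (k + 1 : ℝ) by positivity) hk
  have e1 : (fun x0 => (∫ x, ρ x * (u x t - Om χ u x) * (kB N (1 / (k + 1 : ℝ)) (‖x - x0‖ ^ 2) -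
        kB N r (‖x - x0‖ ^ 2))) +
        ∫ x, Pt χ T2 m u x t * radL N (fun q => kB1 N (1 / (k + 1 : ℝ)) q - kB1 N r q)
        (fun q => kB2 N (1 / (k + 1 : ℝ)) q - kB2 N r q) (‖x - x0‖ ^ 2)) = fun _ => 0 := by
    refine Continuous.ext_on (TopologicalSpace.denseRange_denseSeq (Eu N)) ?_ continuous_const ?_
    · have c1 := hp.cont_b (0 : Eu N)
      have c2 := hp.compact_b (0 : Eu N)
      have c3 := hp.cont_L N (0 : Eu N)
      have c4 := hp.compact_L N (0 : Eu N)
      simp only [sub_zero] at c1 c2 c3 c4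
      exact (hf.continuous_shift c1 c2).add (hP.continuous_shift c3 c4)
    · rintro _ ⟨i, rfl⟩
      exact ht k hk i ht1
  have := congrFun e1 x
  rw [add_comm]
  exact this
/-- Running maximum of a sequence, started at `0`. -/
def rmax (d : ℕ → ℝ) : ℕ → ℝ
  | 0 => 0
  | j + 1 => max (rmax d j) (d (j + 1))

lemma rmax_succ (d : ℕ → ℝ) (j : ℕ) : rmax d (j + 1) = max (rmax d j) (d (j + 1)) := rfl

lemma rmax_nonneg (d : ℕ → ℝ) : ∀ j, 0 ≤ rmax d j
  | 0 => le_rfl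
  | j + 1 => (rmax_nonneg d j).trans (le_max_left _ _)

lemma rmax_le {d : ℕ → ℝ} (hC : 0 ≤ C) (h : ∀ j, d j ≤ C) : ∀ j, rmax d j ≤ C
  | 0 => hC
  | j + 1 => max_le (rmax_le hC h j) (h _)

lemma le_rmax {d : ℕ → ℝ} (h0 : d 0 ≤ 0) : ∀ j, d j ≤ rmax d j
  | 0 => h0
  | _ + 1 => le_max_right _ _

lemma rmax_zero : ∀ j, rmax (fun _ => 0) j = 0
  | 0 => rfl
  | j + 1 => by rw [rmax_succ, rmax_zero j, max_self]

lemma rmax_step_nonneg (d : ℕ → ℝ) (j : ℕ) : 0 ≤ rmax d (j + 1) - rmax d j :=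
  sub_nonneg.2 (le_max_left _ _)

lemma rmax_step {d : ℕ → ℝ} (h0 : d 0 ≤ 0) (j : ℕ) {e : ℝ} (he : 0 ≤ e)
    (h : max (d (j + 1)) 0 - max (d j) 0 ≤ e) : rmax d (j + 1) - rmax d j ≤ e := by
  have h1 : max (d j) 0 ≤ rmax d j := max_le (le_rmax h0 j) (rmax_nonneg d j)
  rw [rmax_succ]
  rcases le_total (rmax d j) (d (j + 1)) with h2 | h2
  · rw [max_eq_right h2]
    have := le_max_left (d (j + 1)) 0
    linarith
  · rw [max_eq_left h2]; linarith

lemma rmax_sum_le {d : ℕ → ℝ} (hC : 0 ≤ C) (hK : 0 ≤ K) (h : ∀ j, d j ≤ C) {A : ℕ → ℝ}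
    (hA : ∀ j, A j ≤ K) (n : ℕ) :
    ∑ j ∈ Finset.range n, (rmax d (j + 1) - rmax d j) * A (j + 1) ≤ C * K := by
  calc _ ≤ ∑ j ∈ Finset.range n, (rmax d (j + 1) - rmax d j) * K := by
        gcongr with j _
        · exact rmax_step_nonneg d j
        · exact hA _
    _ = (rmax d n - rmax d 0) * K := by rw [← Finset.sum_mul, Finset.sum_range_sub]
    _ ≤ C * K := by
        have := rmax_le hC h n
        have h0 : rmax d 0 = 0 := rfl
        gcongr
        linarith

lemma rmax_grid {D A z : ℝ → ℝ} (hab : a < b) (hA : ContinuousOn A (Icc a b))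
    (hz : IntegrableOn z (Icc a b)) (hz0 : ∀ t, 0 ≤ z t) (hD0 : D a ≤ 0)
    (hD : ∀ s t, s ∈ Icc a b → t ∈ Icc a b → s ≤ t →
      max (D t) 0 - max (D s) 0 ≤ ∫ τ in Ioc s t, z τ) (hA0 : ∀ t, 0 ≤ A t) {ε : ℝ} (hε : 0 < ε) :
    ∀ᶠ n : ℕ in atTop, ∑ j ∈ Finset.range (n + 1),
      (rmax (fun j => D (a + j * ((b - a) / (n + 1)))) (j + 1) -
        rmax (fun j => D (a + j * ((b - a) / (n + 1)))) j) *
        A (a + (j + 1 : ℕ) * ((b - a) / (n + 1))) ≤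
      (∫ t in Ioc a b, z t * A t) + ε * ∫ t in Ioc a b, z t := by
  have huc := isCompact_Icc.uniformContinuousOn_of_continuous hA
  rw [Metric.uniformContinuousOn_iff] at huc
  obtain ⟨δ, hδ, huc⟩ := huc ε hε
  have hlim : Tendsto (fun n : ℕ => (b - a) * (1 / (n + 1 : ℝ))) atTop (𝓝 ((b - a) * 0)) :=
    tendsto_one_div_add_atTop_nhds_zero_nat.const_mul _
  rw [mul_zero] at hlim
  filter_upwards [hlim.eventually_lt_const hδ] with n hn
  set h : ℝ := (b - a) / (n + 1) with hh
  have hh0 : 0 < h := div_pos (by linarith) (by positivity)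
  have hhδ : h < δ := by rwa [hh, div_eq_mul_one_div]
  have hn1 : (n + 1 : ℝ) * h = b - a := by rw [hh]; field_simp
  set τ : ℕ → ℝ := fun j => a + j * h with hτ
  have hmono : Monotone τ := fun i j hij => by
    simp only [hτ]
    have : (i : ℝ) ≤ j := by exact_mod_cast hij
    gcongr
  have hτ0 : τ 0 = a := by simp [hτ]
  have hτn : τ (n + 1) = b := by simp only [hτ]; push_cast; linarith
  have hmem : ∀ j ≤ n + 1, τ j ∈ Icc a b := fun j hj =>
    ⟨hτ0 ▸ hmono (Nat.zero_le j), hτn ▸ hmono hj⟩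
  have hsucc : ∀ j, τ (j + 1) - τ j = h := fun j => by simp only [hτ]; push_cast; ring
  have hsub : ∀ j < n + 1, Ioc (τ j) (τ (j + 1)) ⊆ Icc a b := fun j hj t ht =>
    ⟨(hmem j hj.le).1.trans ht.1.le, ht.2.trans (hmem (j + 1) hj).2⟩
  have hzA : IntegrableOn (fun t => z t * A t) (Icc a b) := by
    obtain ⟨C, hC⟩ := isCompact_Icc.exists_bound_of_continuousOn hA
    exact hz.mul_bdd (c := C) (hA.aestronglyMeasurable measurableSet_Icc)
      ((ae_restrict_iff' measurableSet_Icc).2 (Eventually.of_forall hC))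
  have hf : IntegrableOn (fun t => z t * A t + ε * z t) (Icc a b) := hzA.add (hz.const_mul ε)
  have step : ∀ j ∈ Finset.range (n + 1), (rmax (fun j => D (τ j)) (j + 1) -
      rmax (fun j => D (τ j)) j) * A (τ (j + 1)) ≤
      ∫ t in Ioc (τ j) (τ (j + 1)), (z t * A t + ε * z t) := by
    intro j hj
    rw [Finset.mem_range] at hj
    have h1 : rmax (fun j => D (τ j)) (j + 1) - rmax (fun j => D (τ j)) j ≤
        ∫ t in Ioc (τ j) (τ (j + 1)), z t :=
      rmax_step (d := fun j => D (τ j)) (by simpa only [hτ0] using hD0) j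
        (setIntegral_nonneg measurableSet_Ioc fun t _ => hz0 t)
        (hD _ _ (hmem j hj.le) (hmem _ hj) (hmono (Nat.le_succ j)))
    refine (mul_le_mul_of_nonneg_right h1 (hA0 _)).trans ?_
    rw [← integral_mul_const]
    refine setIntegral_mono_on ((hz.mono_set (hsub j hj)).mul_const _) (hf.mono_set (hsub j hj))
      measurableSet_Ioc fun t ht => ?_
    have h2 := huc t (hsub j hj ht) (τ (j + 1)) (hmem _ hj) (by
      rw [Real.dist_eq, abs_lt]
      have := hsucc j
      constructor <;> linarith [ht.1, ht.2])
    rw [Real.dist_eq, abs_lt] at h2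
    have := hz0 t
    nlinarith [h2.1]
  refine (Finset.sum_le_sum step).trans (le_of_eq ?_)
  have hsum : ∀ k ≤ n + 1, ∑ j ∈ Finset.range k, ∫ t in Ioc (τ j) (τ (j + 1)),
      (z t * A t + ε * z t) = ∫ t in Ioc a (τ k), (z t * A t + ε * z t) := by
    intro k
    induction k with
    | zero => intro _; simp [hτ0]
    | succ k ih =>
      intro hk
      rw [Finset.sum_range_succ, ih (by omega), ← Ioc_union_Ioc_eq_Ioc (hmem k (by omega)).1
        (hmono (Nat.le_succ k)), setIntegral_union (Ioc_disjoint_Ioc_of_le le_rfl) measurableSet_Ioc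
        (hf.mono_set fun t ht => ⟨ht.1.le, ht.2.trans (hmem k (by omega)).2⟩)
        (hf.mono_set (hsub k (by omega)))]
  rw [hsum _ le_rfl, hτn]
  refine (integral_add (hzA.mono_set Ioc_subset_Icc_self)
    ((hz.mono_set Ioc_subset_Icc_self).const_mul ε)).trans ?_
  rw [integral_const_mul]

lemma integrable_form (hN : 3 ≤ N) (hr : 0 < r) (hf : Integrable f)
    (hg : Integrable g) : Integrable (fun p : Eu N × Eu N => f p.1 * g p.2 * thK r (p.2 - p.1))
      ((volume : Measure (Eu N)).prod volume) := by
  obtain ⟨C, -, hC⟩ := exists_thK_le hN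
  refine (hf.mul_prod hg).mul_bdd (c := C * r ^ (-N : ℝ)) ?_ (Eventually.of_forall fun p => ?_)
  · exact ((thK_continuous r).comp (by fun_prop)).aestronglyMeasurable
  · rw [Real.norm_of_nonneg (thK_nonneg hN hr _)]
    exact hC r hr _

lemma form_eq (hN : 3 ≤ N) (hr : 0 < r) (hf : Integrable f)
    (hg : Integrable g) :
    ∫ p : Eu N × Eu N, f p.1 * g p.2 * thK r (p.2 - p.1) ∂((volume : Measure (Eu N)).prod volume) =
      ∫ x, f x * ∫ y, g y * thK r (y - x) := by
  rw [integral_prod _ (integrable_form hN hr hf hg)]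
  congr 1; ext x
  rw [← integral_const_mul]
  congr 1; ext y; ring

lemma form_symm (hN : 3 ≤ N) (hr : 0 < r) (hf : Integrable f)
    (hg : Integrable g) :
    ∫ x, f x * (∫ y, g y * thK r (y - x)) = ∫ x, g x * (∫ y, f y * thK r (y - x)) := by
  rw [← form_eq hN hr hf hg, ← form_eq hN hr hg hf,
    ← integral_prod_swap (fun p : Eu N × Eu N => f p.1 * g p.2 * thK r (p.2 - p.1))]
  congr 1; ext p
  simp only [Prod.fst_swap, Prod.snd_swap]
  rw [← thK_neg, neg_sub]
  ring

/-- Coercivity of the energy of the averaging kernel on balls. -/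
lemma exists_coercive (hN : 3 ≤ N) (R : ℝ) (hR : 0 < R) : ∃ c, 0 < c ∧ ∀ r : ℝ, 0 < r → r ≤ 1 →
    ∀ (f : Eu N → ℝ) (C : ℝ), Measurable f → (∀ x, 0 ≤ f x) → (∀ x, f x ≤ C) →
      (∀ x ∉ ball (0 : Eu N) R, f x = 0) →
      c * r ^ 2 * ∫ x, f x ^ 2 ≤ (∫ x, f x ^ 2) - ∫ x, f x * ∫ y, f y * thK r (y - x) := by
  obtain ⟨c, hc, hmom⟩ := exists_second_moment hN
  set C0 := (R + 2) ^ 2 with hC0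
  refine ⟨c / C0, by positivity, fun r hr hr1 f C hfm hf0 hfC hfB => ?_⟩
  set φ : Eu N → ℝ := fun x => C0 - ‖x‖ ^ 2 with hφ
  have hφc : Continuous φ := by fun_prop
  have hφpos : ∀ x, ‖x‖ < R + 1 → 2 ≤ φ x := by
    intro x hx
    simp only [hφ, hC0]
    nlinarith [norm_nonneg x]
  have hφle : ∀ x, φ x ≤ C0 := fun x => by simp only [hφ]; nlinarith [norm_nonneg x]
  have hJφ : ∀ x, ∫ y, φ y * thK r (y - x) = φ x - c * r ^ 2 := by
    intro x
    have e1 := integral_sub_right_eq_self (μ := (volume : Measure (Eu N)))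
      (fun z => φ (x + z) * thK r z) x
    have e2 : ∀ y, φ (x + (y - x)) * thK r (y - x) = φ y * thK r (y - x) := fun y => by
      rw [add_sub_cancel]
    simp only [e2] at e1
    rw [e1]
    have i1 : Integrable fun z : Eu N => C0 * thK r z := (thK_integrable hr).const_mul _
    have i2 : Integrable fun z : Eu N => thK r z * ‖x + z‖ ^ 2 :=
      ((thK_continuous r).mul (by fun_prop : Continuous fun z : Eu N => ‖x + z‖ ^ 2)
        ).integrable_of_hasCompactSupport (thK_compact hr).mul_right
    have e3 : ∀ z : Eu N, φ (x + z) * thK r z = C0 * thK r z - thK r z * ‖x + z‖ ^ 2 := fun z => by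
      simp only [hφ]; ring
    simp only [e3]
    rw [integral_sub i1 i2, integral_const_mul, integral_thK hN hr, hmom r hr x]
    simp only [hφ]; ring
  have hbi : ∀ g : Eu N → ℝ, Measurable g → (∃ K, ∀ x, |g x| ≤ K) →
      (∀ x ∉ ball (0 : Eu N) R, g x = 0) → Integrable g := by
    rintro g hg ⟨K, hK⟩ hgB
    refine IntegrableOn.integrable_of_forall_notMem_eq_zero (s := ball 0 R) ?_ hgB
    exact Measure.integrableOn_of_bounded (M := K) measure_ball_lt_top.ne hg.aestronglyMeasurable
      (Eventually.of_forall hK)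
  have hRx : ∀ x ∈ ball (0 : Eu N) R, ‖x‖ < R + 1 := fun x hx => by
    rw [mem_ball_zero_iff] at hx; linarith
  set w : Eu N → ℝ := fun x => f x ^ 2 / φ x with hw
  set ψ : Eu N → ℝ := (ball (0 : Eu N) R).indicator φ with hψ
  have hf : Integrable f := hbi f hfm ⟨C, fun x => by rw [abs_of_nonneg (hf0 x)]; exact hfC x⟩ hfB
  have hwB : ∀ x ∉ ball (0 : Eu N) R, w x = 0 := fun x hx => by simp [hw, hfB x hx]
  have hw0 : ∀ x, 0 ≤ w x := by
    intro x
    by_cases hx : x ∈ ball (0 : Eu N) R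
    · have := hφpos x (hRx x hx); simp only [hw]; positivity
    · rw [hwB x hx]
  have hwi : Integrable w := by
    refine hbi w ((hfm.pow_const 2).div hφc.measurable) ⟨C ^ 2, fun x => ?_⟩ hwB
    rw [abs_of_nonneg (hw0 x)]
    by_cases hx : x ∈ ball (0 : Eu N) R
    · have h2 := hφpos x (hRx x hx)
      simp only [hw]
      rw [div_le_iff₀ (by linarith)]
      have := hf0 x
      have := hfC x
      nlinarith [pow_le_pow_left₀ (hf0 x) (hfC x) 2, sq_nonneg C]
    · rw [hwB x hx]; positivity
  have hψi : Integrable ψ := by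
    refine hbi ψ (hφc.measurable.indicator measurableSet_ball) ⟨C0, fun x => ?_⟩
      fun x hx => indicator_of_notMem hx _
    by_cases hx : x ∈ ball (0 : Eu N) R
    · rw [hψ, indicator_of_mem hx, abs_of_nonneg (by linarith [hφpos x (hRx x hx)])]
      exact hφle x
    · rw [hψ, indicator_of_notMem hx, abs_zero]; positivity
  have key : ∫ x, f x * (∫ y, f y * thK r (y - x)) ≤ ∫ x, w x * ∫ y, ψ y * thK r (y - x) := by
    have e1 := form_symm hN hr hwi hψi
    have e2 : ∫ x, w x * (∫ y, ψ y * thK r (y - x)) =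
        (1 / 2) * (∫ x, w x * (∫ y, ψ y * thK r (y - x))) +
        (1 / 2) * ∫ x, ψ x * (∫ y, w y * thK r (y - x)) := by rw [← e1]; ring
    rw [e2, ← form_eq hN hr hf hf, ← form_eq hN hr hwi hψi, ← form_eq hN hr hψi hwi,
      ← integral_const_mul, ← integral_const_mul]
    rw [← integral_add ((integrable_form hN hr hwi hψi).const_mul _)
      ((integrable_form hN hr hψi hwi).const_mul _)]
    refine integral_mono (integrable_form hN hr hf hf) (((integrable_form hN hr hwi hψi).const_mul _).add
      ((integrable_form hN hr hψi hwi).const_mul _)) fun p => ?_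
    simp only
    have ht := thK_nonneg hN hr (p.2 - p.1)
    by_cases h1 : p.1 ∈ ball (0 : Eu N) R
    · by_cases h2 : p.2 ∈ ball (0 : Eu N) R
      · have p1 := hφpos _ (hRx _ h1)
        have p2 := hφpos _ (hRx _ h2)
        simp only [hψ, indicator_of_mem h1, indicator_of_mem h2, hw]
        have : f p.1 * f p.2 ≤ 1 / 2 * (f p.1 ^ 2 / φ p.1 * φ p.2) +
            1 / 2 * (φ p.1 * (f p.2 ^ 2 / φ p.2)) := by
          have e : 1 / 2 * (f p.1 ^ 2 / φ p.1 * φ p.2) + 1 / 2 * (φ p.1 * (f p.2 ^ 2 / φ p.2)) -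
              f p.1 * f p.2 = (f p.1 * φ p.2 - f p.2 * φ p.1) ^ 2 / (2 * φ p.1 * φ p.2) := by
            field_simp; ring
          have : 0 ≤ (f p.1 * φ p.2 - f p.2 * φ p.1) ^ 2 / (2 * φ p.1 * φ p.2) := by positivity
          linarith
        nlinarith [mul_le_mul_of_nonneg_right this ht]
      · rw [hfB _ h2, hwB _ h2]
        simp [hψ, indicator_of_notMem h2]
    · rw [hfB _ h1, hwB _ h1]
      simp [hψ, indicator_of_notMem h1]
  have hff : Integrable fun x => f x ^ 2 := by
    refine hbi _ (hfm.pow_const 2) ⟨C ^ 2, fun x => ?_⟩ fun x hx => by simp [hfB x hx]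
    rw [abs_of_nonneg (sq_nonneg _)]
    exact pow_le_pow_left₀ (hf0 x) (hfC x) 2
  have key2 : ∫ x, w x * (∫ y, ψ y * thK r (y - x)) ≤ ∫ x, (1 - c / C0 * r ^ 2) * f x ^ 2 := by
    refine integral_mono ?_ (hff.const_mul _) fun x => ?_
    · have := (integrable_form hN hr hwi hψi).integral_prod_left
      refine this.congr (Eventually.of_forall fun x => ?_)
      simp only
      rw [← integral_const_mul]
      congr 1; ext y; ring
    · simp only
      by_cases hx : x ∈ ball (0 : Eu N) R
      · have p1 := hφpos _ (hRx _ hx)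
        have hle : ∫ y, ψ y * thK r (y - x) ≤ φ x - c * r ^ 2 := by
          rw [← hJφ x]
          have hψl : LI ψ := fun R => hψi.integrableOn
          refine integral_mono (hψl.integrable_thK hr x)
            ((LI.of_continuous hφc).integrable_thK hr x) fun y => ?_
          simp only
          by_cases hy : y ∈ ball (0 : Eu N) R
          · rw [hψ, indicator_of_mem hy]
          · rw [hψ, indicator_of_notMem hy, zero_mul]
            rcases lt_or_ge ‖y - x‖ r with hyx | hyx
            · refine mul_nonneg ?_ (thK_nonneg hN hr _)
              have h3 : ‖y‖ < R + 1 := by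
                rw [mem_ball_zero_iff] at hx
                have := norm_le_norm_add_norm_sub' y x
                linarith
              linarith [hφpos y h3]
            · rw [thK_zero hr hyx, mul_zero]
        calc _ ≤ w x * (φ x - c * r ^ 2) := mul_le_mul_of_nonneg_left hle (hw0 x)
          _ = f x ^ 2 - c * r ^ 2 * f x ^ 2 * (φ x)⁻¹ := by simp only [hw]; field_simp
          _ ≤ f x ^ 2 - c * r ^ 2 * f x ^ 2 * C0⁻¹ := by
            have := hφle x
            gcongr
          _ = _ := by ring
      · rw [hwB x hx, hfB x hx]; simp
  rw [integral_const_mul] at key2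
  linarith

/-- Deviation from the average. -/
def AK (r : ℝ) (f : Eu N → ℝ) (x : Eu N) : ℝ := f x - ∫ y, f y * thK r (y - x)

lemma measurable_rmax {d : ℕ → Eu N → ℝ} (hd : ∀ j, Measurable (d j)) (j : ℕ) :
    Measurable fun x => rmax (fun j => d j x) j := by
  induction j with
  | zero => exact measurable_const
  | succ j ih => exact ih.max (hd _)

lemma LI.AK (hr : 0 < r) (hl : LI f) : LI (AK r f) :=
  hl.sub (LI.of_continuous (hl.continuous_shift (thK_continuous r) (thK_compact hr)))

lemma integrable_of_ball (hg : Measurable g) (hK : ∀ x, |g x| ≤ K)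
    (hgB : ∀ x ∉ ball (0 : Eu N) R, g x = 0) : Integrable g := by
  refine IntegrableOn.integrable_of_forall_notMem_eq_zero (s := ball 0 R) ?_ hgB
  exact Measure.integrableOn_of_bounded (M := K) measure_ball_lt_top.ne hg.aestronglyMeasurable
    (Eventually.of_forall hK)

lemma energy_step (hN : 3 ≤ N) (hr : 0 < r) {f' : Eu N → ℝ} (hfm : Measurable f)
    (hfm' : Measurable f') (hf0 : ∀ x, 0 ≤ f x) (hff : ∀ x, f x ≤ f' x) (hf'C : ∀ x, f' x ≤ C)
    (hfB : ∀ x ∉ ball (0 : Eu N) R, f' x = 0) :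
    (∫ x, f' x ^ 2) - (∫ x, f' x * ∫ y, f' y * thK r (y - x)) =
      (∫ x, f x ^ 2) - (∫ x, f x * ∫ y, f y * thK r (y - x)) +
      2 * (∫ x, (f' x - f x) * AK r f' x) -
      ((∫ x, (f' x - f x) ^ 2) -
        ∫ x, (f' x - f x) * ∫ y, (f' y - f y) * thK r (y - x)) := by
  have hfB0 : ∀ x ∉ ball (0 : Eu N) R, f x = 0 := fun x hx =>
    le_antisymm ((hff x).trans (hfB x hx).le) (hf0 x)
  have hC : ∀ x, |f' x| ≤ C := fun x => by
    rw [abs_of_nonneg ((hf0 x).trans (hff x))]; exact hf'C x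
  have hC2 : ∀ x, |f x| ≤ C := fun x => by
    rw [abs_of_nonneg (hf0 x)]; exact (hff x).trans (hf'C x)
  have i1 : Integrable f := integrable_of_ball hfm hC2 hfB0
  have i2 : Integrable f' := integrable_of_ball hfm' hC hfB
  have l1 : LI f := fun R => i1.integrableOn
  have l2 : LI f' := fun R => i2.integrableOn
  have prod : ∀ {g h : Eu N → ℝ}, Integrable g → Integrable h →
      Integrable fun x => g x * ∫ y, h y * thK r (y - x) := by
    intro g h hg hh
    have := (integrable_form hN hr hg hh).integral_prod_left
    refine this.congr (Eventually.of_forall fun x => ?_)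
    simp only
    rw [← integral_const_mul]
    congr 1; ext y; ring
  have q1 : Integrable fun x => f x * f x := i1.mul_bdd (c := C) hfm.aestronglyMeasurable
    (Eventually.of_forall hC2)
  have q2 : Integrable fun x => f' x * f' x := i2.mul_bdd (c := C) hfm'.aestronglyMeasurable
    (Eventually.of_forall hC)
  have q3 : Integrable fun x => f x * f' x := i1.mul_bdd (c := C) hfm'.aestronglyMeasurable
    (Eventually.of_forall hC)
  have sq1 : ∫ x, (f' x - f x) ^ 2 = (∫ x, f' x * f' x) - 2 * (∫ x, f x * f' x) + ∫ x, f x * f x := by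
    rw [← integral_const_mul, ← integral_sub q2 (q3.const_mul 2)]
    refine Eq.trans ?_ (integral_add (q2.sub (q3.const_mul 2)) q1)
    congr 1; ext x; ring
  have hJ : ∀ x, ∫ y, (f' y - f y) * thK r (y - x) =
      (∫ y, f' y * thK r (y - x)) - ∫ y, f y * thK r (y - x) := by
    intro x
    simp only [sub_mul]
    exact integral_sub (l2.integrable_thK hr x) (l1.integrable_thK hr x)
  have sq2 : ∫ x, (f' x - f x) * (∫ y, (f' y - f y) * thK r (y - x)) =
      (∫ x, f' x * ∫ y, f' y * thK r (y - x)) - (∫ x, f x * ∫ y, f' y * thK r (y - x)) -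
      ((∫ x, f' x * ∫ y, f y * thK r (y - x)) - ∫ x, f x * ∫ y, f y * thK r (y - x)) := by
    rw [← integral_sub (prod i2 i2) (prod i1 i2), ← integral_sub (prod i2 i1) (prod i1 i1)]
    refine Eq.trans ?_ (integral_sub ((prod i2 i2).sub (prod i1 i2)) ((prod i2 i1).sub (prod i1 i1)))
    congr 1; ext x
    rw [hJ]
    ring
  have sq3 : ∫ x, (f' x - f x) * AK r f' x = (∫ x, f' x * f' x) - (∫ x, f x * f' x) -
      ((∫ x, f' x * ∫ y, f' y * thK r (y - x)) - ∫ x, f x * ∫ y, f' y * thK r (y - x)) := by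
    rw [← integral_sub q2 q3, ← integral_sub (prod i2 i2) (prod i1 i2)]
    refine Eq.trans ?_ (integral_sub (q2.sub q3) ((prod i2 i2).sub (prod i1 i2)))
    congr 1; ext x
    rw [AK]
    ring
  rw [sq1, sq2, sq3, form_symm hN hr i2 i1]
  simp only [pow_two]
  ring

lemma energy_grid (hN : 3 ≤ N) {c : ℝ} (hr : 0 < r) (hr1 : r ≤ 1) (hC : 0 ≤ C)
    (hcoer : ∀ (f : Eu N → ℝ) (C : ℝ), Measurable f → (∀ x, 0 ≤ f x) → (∀ x, f x ≤ C) →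
      (∀ x ∉ ball (0 : Eu N) R, f x = 0) →
      c * r ^ 2 * ∫ x, f x ^ 2 ≤ (∫ x, f x ^ 2) - ∫ x, f x * ∫ y, f y * thK r (y - x))
    (hc : 0 < c) {d : ℕ → Eu N → ℝ} (hdm : ∀ j, Measurable (d j)) (hdl : ∀ j, LI (d j))
    {B : Set (Eu N)} (hB : MeasurableSet B) (hBR : B ⊆ ball 0 R)
    (hdC : ∀ j, ∀ x ∈ B, d j x ≤ C)
    (hout : ∀ j, ∀ᵐ y : Eu N, ‖y‖ < R + 1 → y ∉ B → d j y ≤ 0) (n : ℕ) :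
    Integrable (fun x => ∑ j ∈ Finset.range n, (rmax (fun j => B.indicator (d j) x) (j + 1) -
        rmax (fun j => B.indicator (d j) x) j) * max (AK r (d (j + 1)) x) 0) ∧
    c * r ^ 2 * ∫ x, rmax (fun j => B.indicator (d j) x) n ^ 2 ≤
      2 * ∫ x, ∑ j ∈ Finset.range n, (rmax (fun j => B.indicator (d j) x) (j + 1) -
        rmax (fun j => B.indicator (d j) x) j) * max (AK r (d (j + 1)) x) 0 := by
  set M : ℕ → Eu N → ℝ := fun j x => rmax (fun j => B.indicator (d j) x) j with hM
  have hMm : ∀ j, Measurable (M j) := measurable_rmax fun j => (hdm j).indicator hB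
  have hM0 : ∀ j x, 0 ≤ M j x := fun j x => rmax_nonneg _ j
  have hMC : ∀ j x, M j x ≤ C := fun j x => rmax_le hC (fun j => by
    by_cases hx : x ∈ B
    · simpa [hx] using hdC j x hx
    · simpa [hx] using hC) j
  have hMBz : ∀ j, ∀ x ∉ B, M j x = 0 := fun j x hx => by
    simp only [hM, indicator_of_notMem hx]; exact rmax_zero j
  have hMB : ∀ j, ∀ x ∉ ball (0 : Eu N) R, M j x = 0 := fun j x hx => hMBz j x fun h => hx (hBR h)
  have hMs : ∀ j x, M j x ≤ M (j + 1) x := fun j x => le_max_left _ _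
  have hMi : ∀ j, Integrable (M j) := fun j => integrable_of_ball (hMm j)
    (fun x => by rw [abs_of_nonneg (hM0 j x)]; exact hMC j x) (hMB j)
  have hMl : ∀ j, LI (M j) := fun j R => (hMi j).integrableOn
  have hδi : ∀ j, Integrable fun x => (M (j + 1) x - M j x) * max (AK r (d (j + 1)) x) 0 := by
    intro j
    refine IntegrableOn.integrable_of_forall_notMem_eq_zero (s := closedBall 0 R) ?_ fun x hx => ?_
    · refine ((hdl (j + 1)).AK hr R).pos_part.bdd_mul (c := C)
        ((hMm _).sub (hMm _)).aestronglyMeasurable (Eventually.of_forall fun x => ?_)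
      rw [Real.norm_of_nonneg (sub_nonneg.2 (hMs j x))]
      linarith [hMC (j + 1) x, hM0 j x]
    · have hx' : x ∉ ball (0 : Eu N) R := fun h => hx (ball_subset_closedBall h)
      rw [hMB _ x hx', hMB _ x hx']; simp
  have hAKM : ∀ j, Integrable fun x => (M (j + 1) x - M j x) * AK r (M (j + 1)) x := by
    intro j
    refine IntegrableOn.integrable_of_forall_notMem_eq_zero (s := closedBall 0 R) ?_ fun x hx => ?_
    · refine ((hMl (j + 1)).AK hr R).bdd_mul (c := C)
        ((hMm _).sub (hMm _)).aestronglyMeasurable (Eventually.of_forall fun x => ?_)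
      rw [Real.norm_of_nonneg (sub_nonneg.2 (hMs j x))]
      linarith [hMC (j + 1) x, hM0 j x]
    · have hx' : x ∉ ball (0 : Eu N) R := fun h => hx (ball_subset_closedBall h)
      rw [hMB _ x hx', hMB _ x hx']; simp
  have hstep : ∀ j, ∫ x, (M (j + 1) x - M j x) * AK r (M (j + 1)) x ≤
      ∫ x, (M (j + 1) x - M j x) * max (AK r (d (j + 1)) x) 0 := by
    intro j
    refine integral_mono (hAKM j) (hδi j) fun x => ?_
    simp only
    rcases (hMs j x).eq_or_lt with he | hlt
    · rw [he]; simp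
    · have hxB : x ∈ B := by
        by_contra hx
        rw [hMBz _ x hx, hMBz _ x hx] at hlt
        exact lt_irrefl _ hlt
      have hMd : M (j + 1) x = d (j + 1) x := by
        have e : M (j + 1) x = max (M j x) (B.indicator (d (j + 1)) x) := rfl
        rw [indicator_of_mem hxB] at e
        rcases le_total (M j x) (d (j + 1) x) with h | h
        · rw [e, max_eq_right h]
        · rw [e, max_eq_left h] at hlt; exact absurd hlt (lt_irrefl _)
      refine mul_le_mul_of_nonneg_left (le_trans ?_ (le_max_left _ _)) (sub_nonneg.2 hlt.le)
      rw [AK, AK, hMd]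
      refine sub_le_sub_left (integral_mono_ae ((hdl _).integrable_thK hr x)
        ((hMl _).integrable_thK hr x) ?_) _
      filter_upwards [hout (j + 1)] with y hy
      rcases lt_or_ge ‖y - x‖ r with hyx | hyx
      · refine mul_le_mul_of_nonneg_right ?_ (thK_nonneg hN hr _)
        by_cases hyB : y ∈ B
        · have : B.indicator (d (j + 1)) y ≤ M (j + 1) y := le_max_right _ _
          rwa [indicator_of_mem hyB] at this
        · refine (hy ?_ hyB).trans (hM0 _ y)
          have h1 := hBR hxB
          rw [mem_ball_zero_iff] at h1
          have := norm_le_norm_add_norm_sub' y x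
          linarith
      · rw [thK_zero hr hyx, mul_zero, mul_zero]
  have hind : ∀ n, (∫ x, M n x ^ 2) - (∫ x, M n x * ∫ y, M n y * thK r (y - x)) ≤
      2 * ∑ j ∈ Finset.range n, ∫ x, (M (j + 1) x - M j x) * max (AK r (d (j + 1)) x) 0 := by
    intro n
    induction n with
    | zero =>
      have : M 0 = fun _ => 0 := rfl
      simp [this]
    | succ n ih =>
      rw [energy_step hN hr (hMm n) (hMm (n + 1)) (hM0 n) (hMs n) (hMC (n + 1)) (hMB (n + 1)),
        Finset.sum_range_succ]
      have h1 := hcoer (fun x => M (n + 1) x - M n x) C ((hMm _).sub (hMm _))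
        (fun x => sub_nonneg.2 (hMs n x)) (fun x => by linarith [hMC (n + 1) x, hM0 n x])
        (fun x hx => by rw [hMB _ x hx, hMB _ x hx, sub_zero])
      have h2 : 0 ≤ c * r ^ 2 * ∫ x, (M (n + 1) x - M n x) ^ 2 :=
        mul_nonneg (by positivity) (integral_nonneg fun x => sq_nonneg _)
      linarith [hstep n]
  refine ⟨integrable_finsetSum _ fun j _ => hδi j, ?_⟩
  rw [integral_finsetSum _ fun j _ => hδi j]
  exact (hcoer (M n) C (hMm n) (hM0 n) (hMC n) (hMB n)).trans (hind n)

lemma le_of_ae_Ioo {g : ℝ → ℝ} (hab : a < b) (hg : Continuous g)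
    (h : ∀ᵐ t : ℝ, t ∈ Ioo a b → g t ≤ K) : ∀ t ∈ Icc a b, g t ≤ K := by
  have ho : IsOpen (Ioo a b ∩ {t | K < g t}) := isOpen_Ioo.inter (isOpen_lt continuous_const hg)
  have hz : volume (Ioo a b ∩ {t | K < g t}) = 0 := by
    refine measure_mono_null ?_ h
    rintro t ⟨ht, hK⟩ hh
    exact absurd (hh ht) (not_le.2 hK)
  have he := ho.eq_empty_of_measure_zero hz
  have hsub : Ioo a b ⊆ {t | g t ≤ K} := by
    intro t ht
    by_contra hh
    have : t ∈ Ioo a b ∩ {t | K < g t} := ⟨ht, by simpa using hh⟩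
    rw [he] at this
    exact this
  have := closure_minimal hsub (isClosed_le hg continuous_const)
  rw [closure_Ioo hab.ne] at this
  exact this

lemma grid_vanish {D z : ℝ → ℝ} {A : ℕ → ℝ → ℝ} {W : ℝ} (hab : a < b)
    (hA : ∀ k, Continuous (A k)) (hA0 : ∀ k t, 0 ≤ A k t)
    (hAW : ∀ (k : ℕ), ∀ t ∈ Icc a b, (k + 1 : ℝ) ^ 2 * A k t ≤ W)
    (hz : IntegrableOn z (Icc a b)) (hz0 : ∀ t, 0 ≤ z t) (hD0 : D a ≤ 0)
    (hD : ∀ s t, s ∈ Icc a b → t ∈ Icc a b → s ≤ t →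
      max (D t) 0 - max (D s) 0 ≤ ∫ τ in Ioc s t, z τ)
    (hlim : ∀ᵐ t : ℝ, t ∈ Ioo a b → 0 < z t →
      Tendsto (fun k : ℕ => (k + 1 : ℝ) ^ 2 * A k t) atTop (𝓝 0)) :
    Tendsto (fun k : ℕ => limsup (fun n : ℕ => ofReal ((k + 1 : ℝ) ^ 2 *
      ∑ j ∈ Finset.range (n + 1),
      (rmax (fun j => D (a + j * ((b - a) / (n + 1)))) (j + 1) -
        rmax (fun j => D (a + j * ((b - a) / (n + 1)))) j) *
        A k (a + (j + 1 : ℕ) * ((b - a) / (n + 1))))) atTop) atTop (𝓝 0) := by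
  have hz' : IntegrableOn z (Ioc a b) := hz.mono_set Ioc_subset_Icc_self
  have hIk : Tendsto (fun k : ℕ => ∫ t in Ioc a b, z t * ((k + 1 : ℝ) ^ 2 * A k t)) atTop
      (𝓝 (∫ t in Ioc a b, (0 : ℝ))) := by
    refine tendsto_integral_of_dominated_convergence (fun t => z t * W) (fun k => ?_)
      (hz'.mul_const W) (fun k => ?_) ?_
    · exact hz'.aestronglyMeasurable.mul (by have := (hA k).measurable; fun_prop : Measurable fun t => (k + 1 : ℝ) ^ 2 * A k t).aestronglyMeasurable
    · refine (ae_restrict_iff' measurableSet_Ioc).2 (Eventually.of_forall fun t ht => ?_)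
      have h1 := hA0 k t
      rw [Real.norm_of_nonneg (mul_nonneg (hz0 t) (by positivity))]
      exact mul_le_mul_of_nonneg_left (hAW k t (Ioc_subset_Icc_self ht)) (hz0 t)
    · rw [← restrict_Ioo_eq_restrict_Ioc]
      refine (ae_restrict_iff' measurableSet_Ioo).2 ?_
      filter_upwards [hlim] with t ht hti
      rcases (hz0 t).eq_or_lt with h | h
      · simp [← h]
      · simpa using (ht hti h).const_mul (z t)
  have hub : Tendsto (fun k : ℕ => ofReal
      ((∫ t in Ioc a b, z t * ((k + 1 : ℝ) ^ 2 * A k t)) +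
        1 / (k + 1 : ℝ) * ∫ t in Ioc a b, z t)) atTop (𝓝 0) := by
    have h2 := (tendsto_one_div_add_atTop_nhds_zero_nat (𝕜 := ℝ)).mul_const (∫ t in Ioc a b, z t)
    have h3 := ENNReal.tendsto_ofReal (hIk.add h2)
    simpa using h3
  refine tendsto_of_tendsto_of_tendsto_of_le_of_le tendsto_const_nhds hub (fun k => zero_le)
    fun k => ?_
  have hk : (0 : ℝ) < (k : ℝ) + 1 := by positivity
  refine limsup_le_of_le (by isBoundedDefault) ?_
  filter_upwards [rmax_grid hab (hA k).continuousOn hz hz0 hD0 hD (hA0 k)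
    (ε := 1 / (k + 1 : ℝ) ^ 3) (by positivity)] with n hn
  refine ENNReal.ofReal_le_ofReal ?_
  refine (mul_le_mul_of_nonneg_left hn (by positivity)).trans (le_of_eq ?_)
  have : (∫ t in Ioc a b, z t * ((k + 1 : ℝ) ^ 2 * A k t)) =
      (k + 1 : ℝ) ^ 2 * ∫ t in Ioc a b, z t * A k t := by
    rw [← integral_const_mul]
    congr 1; ext t; ring
  rw [this]
  field_simp

/-- Newtonian potentials over small balls of a function vanishing at a Lebesgue point. -/
lemma ae_tendsto_newton (hN : 3 ≤ N) (hfm : Measurable f) (hf : LI f) :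
    ∀ᵐ x, f x ≤ 0 → Tendsto (fun k : ℕ => ofReal ((k + 1 : ℝ) ^ 2) *
      ∫⁻ y in ball x (1 / (k + 1 : ℝ)), ofReal (f y) *
        ofReal (‖y - x‖ ^ (2 - N : ℝ))) atTop (𝓝 0) := by
  have hn := three_le_cast hN
  have : Nontrivial (Eu N) := nontrivial_Eu hN
  have hfp : LI fun y => max (f y) 0 := fun R => (hf R).pos_part
  filter_upwards [IsUnifLocDoublingMeasure.ae_tendsto_average_norm_sub (volume : Measure (Eu N))
    hfp.locallyIntegrable 1] with x hx hfx
  have h1 := hx (fun _ : ℝ => x) (fun s : ℝ => s) (l := 𝓝[>] 0) tendsto_id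
    (eventually_mem_nhdsWithin.mono fun s hs => mem_closedBall_self (by simpa using (le_of_lt hs)))
  set V : ℝ := (volume (ball (0 : Eu N) 1)).toReal with hV
  have hVpos : 0 < V := ENNReal.toReal_pos (measure_ball_pos _ _ one_pos).ne' measure_ball_lt_top.ne
  set K : ℝ := V * (1 + (N - 2) / (2 - 0)) with hK
  have hKpos : 0 < K := by
    have : 0 < (N - 2 : ℝ) := by linarith
    positivity
  rw [ENNReal.tendsto_nhds_zero]
  intro ε hε
  rcases eq_or_ne ε ⊤ with rfl | hεt
  · exact Eventually.of_forall fun _ => le_top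
  have hε' : 0 < ε.toReal := ENNReal.toReal_pos hε.ne' hεt
  have hev := h1.eventually_lt_const (show 0 < ε.toReal / K by positivity)
  rw [eventually_nhdsWithin_iff, Metric.eventually_nhds_iff] at hev
  obtain ⟨δ, hδ, hev⟩ := hev
  have hk : ∀ᶠ k : ℕ in atTop, 1 / (k + 1 : ℝ) < δ :=
    tendsto_one_div_add_atTop_nhds_zero_nat.eventually_lt_const hδ
  filter_upwards [hk] with k hk
  have hk0 : 0 < 1 / (k + 1 : ℝ) := by positivity
  have hmass : ∀ s, 0 < s → s ≤ 1 / (k + 1 : ℝ) → ∫⁻ y in ball x s, ofReal (f y) ≤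
      ofReal (ε.toReal / K * V * s ^ ((N : ℝ) - 0)) := by
    intro s hs hsk
    have h2 := hev (y := s) (by rw [Real.dist_eq, sub_zero, abs_of_pos hs]; linarith) hs
    have hfi := hfp.locallyIntegrable.integrableOn_isCompact (isCompact_closedBall x s)
    rw [setAverage_eq, smul_eq_mul, measureReal_def, Measure.addHaar_closedBall _ _ hs.le,
      finrank_Eu, ENNReal.toReal_mul, ENNReal.toReal_ofReal (by positivity), ← hV,
      max_eq_right hfx] at h2
    calc ∫⁻ y in ball x s, ofReal (f y)
        ≤ ∫⁻ y in closedBall x s, ofReal (f y) := lintegral_mono_set ball_subset_closedBall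
      _ ≤ ∫⁻ y in closedBall x s, ofReal (max (f y) 0) := lintegral_mono fun y =>
          ENNReal.ofReal_le_ofReal (le_max_left _ _)
      _ = ofReal (∫ y in closedBall x s, max (f y) 0) :=
          (ofReal_integral_eq_lintegral_ofReal hfi
            (Eventually.of_forall fun y => le_max_right _ _)).symm
      _ ≤ _ := by
          refine ENNReal.ofReal_le_ofReal ?_
          have e : ∫ y in closedBall x s, ‖max (f y) 0 - 0‖ = ∫ y in closedBall x s, max (f y) 0 := by
            congr 1; ext y; rw [sub_zero, Real.norm_of_nonneg (le_max_right _ _)]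
          rw [e, inv_mul_lt_iff₀ (by positivity)] at h2
          rw [sub_zero, Real.rpow_natCast]
          linarith [h2]
  have h3 := newton_le_of_mass hN hfm.ennreal_ofReal hk0 (by positivity) two_pos hmass
  refine (mul_le_mul_right h3 _).trans ?_
  rw [← ENNReal.ofReal_mul (by positivity), ENNReal.ofReal_le_iff_le_toReal hεt]
  refine le_of_eq ?_
  have : (1 / (k + 1 : ℝ)) ^ ((2 : ℝ) - 0) = 1 / (k + 1 : ℝ) ^ 2 := by
    rw [sub_zero, Real.rpow_two, one_div_pow]
  rw [this, mul_assoc (ε.toReal / K), ← hK]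
  field_simp

lemma LI.of_bound (hg : LI g) (hf : Measurable f) (h : ∀ᵐ x, |f x| ≤ g x) :
    LI f := fun R => (hg R).mono' hf.aestronglyMeasurable (ae_restrict_of_ae h)

/-- The positive part of the sub-mean-value defect. -/
def AP (k : ℕ) (D : Eu N → ℝ → ℝ) (x : Eu N) (t : ℝ) : ℝ :=
  max (AK (1 / (k + 1 : ℝ)) (fun y => D y t) x) 0

lemma measurable_AP (k : ℕ) {D : Eu N → ℝ → ℝ} (hD : Measurable fun p : Eu N × ℝ => D p.1 p.2) :
    Measurable fun p : Eu N × ℝ => AP k D p.1 p.2 := by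
  unfold AP AK
  refine (hD.sub ?_).max measurable_const
  have h : StronglyMeasurable fun q : (Eu N × ℝ) × Eu N =>
      D q.2 q.1.2 * thK (1 / (k + 1 : ℝ)) (q.2 - q.1.1) := by
    have h1 : Measurable fun q : (Eu N × ℝ) × Eu N => D q.2 q.1.2 :=
      hD.comp (measurable_snd.prodMk (measurable_snd.comp measurable_fst))
    have h2 : Continuous fun q : (Eu N × ℝ) × Eu N => thK (1 / (k + 1 : ℝ)) (q.2 - q.1.1) :=
      (thK_continuous _).comp (by fun_prop)
    exact (h1.mul h2.measurable).stronglyMeasurable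
  exact h.integral_prod_right'.measurable

lemma ae_AP_bounds (hN : 3 ≤ N) (h0 : 0 ≤ γ) (h2 : γ < 2) : ∃ C0, 0 < C0 ∧
    ∀ {R a b Bc : ℝ}, 0 ≤ Bc → ∀ {D f : Eu N → ℝ → ℝ},
    (Measurable fun p : Eu N × ℝ => D p.1 p.2) → (Measurable fun p : Eu N × ℝ => f p.1 p.2) →
    (∀ t, LI fun y => D y t) →
    (∀ᵐ t : ℝ, t ∈ Ioo a b → LI fun y => f y t) →
    (∀ᵐ t : ℝ, t ∈ Ioo a b → ∀ᵐ y : Eu N, ‖y‖ < R + 2 → f y t ≤ Bc * ‖y‖ ^ (-γ)) →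
    (∀ k : ℕ, ∀ᵐ t : ℝ, t ∈ Ioo a b → ∀ x,
      PotAt (1 / (k + 1 : ℝ)) (fun y => D y t) (fun y => f y t) x) →
    ∀ᵐ x : Eu N, ∀ᵐ t : ℝ, t ∈ Ioo a b → ‖x‖ < R →
      (∀ k : ℕ, (k + 1 : ℝ) ^ 2 * AP k D x t ≤ Bc * C0 * ‖x‖ ^ (-γ)) ∧
      (f x t ≤ 0 → Tendsto (fun k : ℕ => (k + 1 : ℝ) ^ 2 * AP k D x t) atTop (𝓝 0)) := by
  obtain ⟨C, hC, hnew⟩ := exists_newton_rpow' hN h0 h2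
  have hcK := cK_pos hN
  refine ⟨C / cK N, by positivity, fun {R a b Bc} hBc {D f} hDm hfm hDl hfl hfB hpot => ?_⟩
  have hAPm : ∀ k : ℕ, Measurable fun p : Eu N × ℝ => (k + 1 : ℝ) ^ 2 * AP k D p.1 p.2 :=
    fun k => (measurable_AP k hDm).const_mul _
  rw [Measure.ae_ae_comm]
  · filter_upwards [hfl, hfB, ae_all_iff.2 hpot] with t hfl hfB hpot
    by_cases ht : t ∈ Ioo a b
    swap
    · exact Eventually.of_forall fun x h => absurd h ht
    have hfmt : Measurable fun y => f y t := hfm.comp (measurable_id.prodMk measurable_const)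
    have hne : ∀ᵐ x : Eu N, x ≠ 0 := by
      have := nontrivial_Eu hN
      exact Measure.ae_ne volume 0
    filter_upwards [submean hN (hDl t) (hfl ht) (Eventually.of_forall fun _ => le_rfl),
      ae_tendsto_newton hN hfmt (hfl ht), hne] with x hsub hnw hx0 _ hxR
    have hkey : ∀ k : ℕ, ofReal ((k + 1 : ℝ) ^ 2 * AP k D x t) ≤
        ofReal ((cK N)⁻¹) * (ofReal ((k + 1 : ℝ) ^ 2) *
        ∫⁻ y in ball x (1 / (k + 1 : ℝ)), ofReal (f y t) *
        ofReal (‖y - x‖ ^ (2 - N : ℝ))) := by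
      intro k
      have h1 := hsub (1 / (k + 1 : ℝ)) (by positivity) (hpot k ht x)
      calc _ = ofReal ((cK N)⁻¹) * (ofReal ((k + 1 : ℝ) ^ 2) *
            ofReal (cK N * AK (1 / (k + 1 : ℝ)) (fun y => D y t) x)) := by
            rw [ENNReal.ofReal_mul (by positivity), ENNReal.ofReal_mul hcK.le, mul_left_comm, ← mul_assoc (ofReal (cK N)⁻¹),
              ← ENNReal.ofReal_mul (p := (cK N)⁻¹) (by positivity), inv_mul_cancel₀ hcK.ne', ENNReal.ofReal_one,
              one_mul]
            congr 1
            unfold AP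
            rw [ENNReal.ofReal_max]; simp
        _ ≤ _ := by
            unfold AK
            gcongr
    refine ⟨fun k => ?_, fun hf0 => ?_⟩
    · have hk0 : 0 < 1 / (k + 1 : ℝ) := by positivity
      have hk1 : 1 / (k + 1 : ℝ) ≤ 1 := by
        rw [div_le_one (by positivity)]; linarith [(Nat.cast_nonneg k : (0 : ℝ) ≤ k)]
      have h1 : ∫⁻ y in ball x (1 / (k + 1 : ℝ)), ofReal (f y t) *
        ofReal (‖y - x‖ ^ (2 - N : ℝ)) ≤
          ofReal Bc * ofReal (C * (1 / (k + 1 : ℝ)) ^ 2 * ‖x‖ ^ (-γ)) := by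
        refine le_trans ?_ (mul_le_mul_right (hnew x _ hk0 hx0) _)
        rw [← lintegral_const_mul' _ _ ENNReal.ofReal_ne_top]
        refine setLIntegral_mono_ae' measurableSet_ball ?_
        filter_upwards [hfB ht] with y hy hyb
        rw [← mul_assoc, ← ENNReal.ofReal_mul hBc]
        gcongr
        refine hy ?_
        rw [mem_ball_iff_norm] at hyb
        have := norm_le_norm_add_norm_sub' y x
        linarith
      have h3 := (hkey k).trans (mul_le_mul_right (mul_le_mul_right h1 _) _)
      rw [← ENNReal.ofReal_mul hBc, ← ENNReal.ofReal_mul (by positivity),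
        ← ENNReal.ofReal_mul (by positivity), ENNReal.ofReal_le_ofReal_iff (by positivity)] at h3
      refine h3.trans (le_of_eq ?_)
      field_simp
    · have h4 := ENNReal.Tendsto.const_mul (a := ofReal ((cK N)⁻¹)) (hnw hf0)
        (Or.inr ENNReal.ofReal_ne_top)
      rw [mul_zero] at h4
      have h5 := tendsto_of_tendsto_of_tendsto_of_le_of_le tendsto_const_nhds h4
        (fun _ => zero_le) hkey
      have h6 := (ENNReal.tendsto_toReal ENNReal.zero_ne_top).comp h5
      refine h6.congr fun k => ?_
      have : 0 ≤ AP k D x t := le_max_right _ _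
      simp only [Function.comp]
      rw [ENNReal.toReal_ofReal (by positivity)]
  · have m1 : MeasurableSet {p : Eu N × ℝ | p.2 ∈ Ioo a b} := measurable_snd measurableSet_Ioo
    have m2 : MeasurableSet {p : Eu N × ℝ | ‖p.1‖ < R} :=
      measurableSet_lt (by fun_prop) measurable_const
    have m3 : MeasurableSet {p : Eu N × ℝ | ∀ k : ℕ,
        (k + 1 : ℝ) ^ 2 * AP k D p.1 p.2 ≤ Bc * (C / cK N) * ‖p.1‖ ^ (-γ)} := by
      rw [ofPred_forall]
      exact MeasurableSet.iInter fun k => measurableSet_le (hAPm k) (by fun_prop)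
    have m4 : MeasurableSet {p : Eu N × ℝ | f p.1 p.2 ≤ 0} := measurableSet_le hfm measurable_const
    have m5 : MeasurableSet {p : Eu N × ℝ |
        Tendsto (fun k : ℕ => (k + 1 : ℝ) ^ 2 * AP k D p.1 p.2) atTop (𝓝 0)} :=
      measurableSet_tendsto (𝓝 0) hAPm
    exact m1.imp (m2.imp (m3.inter (m4.imp m5)))

lemma continuous_AP (k : ℕ) {D : Eu N → ℝ → ℝ}
    (hD : Measurable fun p : Eu N × ℝ => D p.1 p.2) (hΨ : LI Ψ)
    (hreg : ∀ᵐ x, Continuous (D x) ∧ ∀ t, |D x t| ≤ Ψ x) (hx : Continuous (D x)) :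
    Continuous (AP k D x) := by
  have hk0 : 0 < 1 / (k + 1 : ℝ) := by positivity
  have h : Continuous fun t => ∫ y, D y t * thK (1 / (k + 1 : ℝ)) (y - x) := by
    refine continuous_of_dominated (bound := fun y => ‖Ψ y * thK (1 / (k + 1 : ℝ)) (y - x)‖)
      (fun t => ?_) (fun t => ?_) ?_ ?_
    · have h1 : Measurable fun y => D y t := hD.comp (measurable_id.prodMk measurable_const)
      exact (h1.mul (thK_shift_continuous _ x).measurable).aestronglyMeasurable
    · filter_upwards [hreg] with y hy
      rw [norm_mul, norm_mul]
      gcongr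
      exact (hy.2 t).trans (le_abs_self _)
    · exact (hΨ.integrable_mul (thK_shift_continuous _ x) (thK_shift_compact hk0 x)).norm
    · filter_upwards [hreg] with y hy
      exact hy.1.mul continuous_const
  exact (hx.sub h).max continuous_const

set_option maxHeartbeats 1000000 in
lemma comparison_core (hN : 3 ≤ N) (h0 : 0 ≤ γ) (h2 : γ < 2) (hR : 0 < R)
    (hab : a < b) (hC1 : 0 ≤ C1) (hBc : 0 ≤ Bc) {D f z : Eu N → ℝ → ℝ}
    (hΨ : LI Ψ) (hDm : Measurable fun p : Eu N × ℝ => D p.1 p.2)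
    (hfm : Measurable fun p : Eu N × ℝ => f p.1 p.2)
    (hreg : ∀ᵐ x, Continuous (D x) ∧ ∀ t, |D x t| ≤ Ψ x)
    (hball : ∀ᵐ x : Eu N, ‖x‖ < R → D x a ≤ 0 ∧ (∀ t, D x t ≤ C1) ∧
      IntegrableOn (z x) (Icc a b) ∧ (∀ t, 0 ≤ z x t) ∧
      ∀ s t, s ∈ Icc a b → t ∈ Icc a b → s ≤ t →
        max (D x t) 0 - max (D x s) 0 ≤ ∫ τ in Ioc s t, z x τ)
    (hout : ∀ᵐ x : Eu N, R ≤ ‖x‖ → ‖x‖ < R + 1 → ∀ t, D x t ≤ 0)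
    (hfl : ∀ᵐ t : ℝ, t ∈ Ioo a b → LI fun y => f y t)
    (hfB : ∀ᵐ t : ℝ, t ∈ Ioo a b → ∀ᵐ y : Eu N, ‖y‖ < R + 2 → f y t ≤ Bc * ‖y‖ ^ (-γ))
    (hpot : ∀ k : ℕ, ∀ᵐ t : ℝ, t ∈ Ioo a b → ∀ x,
      PotAt (1 / (k + 1 : ℝ)) (fun y => D y t) (fun y => f y t) x)
    (hzf : ∀ᵐ x : Eu N, ‖x‖ < R → ∀ᵐ t : ℝ, t ∈ Ioo a b → 0 < z x t → f x t ≤ 0) :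
    ∀ᵐ x : Eu N, ‖x‖ < R → D x b ≤ 0 := by
  have hn := three_le_cast hN
  obtain ⟨C0, hC0, hAPb⟩ := ae_AP_bounds hN h0 h2
  obtain ⟨c, hc, hcoer⟩ := exists_coercive hN R hR
  have hDmt : ∀ t, Measurable fun y => D y t := fun t =>
    hDm.comp (measurable_id.prodMk measurable_const)
  have hDl : ∀ t, LI fun y => D y t := fun t =>
    hΨ.of_bound (hDmt t) (hreg.mono fun x hx => hx.2 t)
  have hAPb' := hAPb (R := R) hBc hDm hfm hDl hfl hfB hpot
  -- the good set
  have hgood : ∀ᵐ x : Eu N, ‖x‖ < R → (D x a ≤ 0 ∧ ∀ t, D x t ≤ C1) ∧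
      (∀ (k : ℕ), ∀ t ∈ Icc a b, (k + 1 : ℝ) ^ 2 * AP k D x t ≤ Bc * C0 * ‖x‖ ^ (-γ)) ∧
      Tendsto (fun k : ℕ => limsup (fun n : ℕ => ofReal ((k + 1 : ℝ) ^ 2 *
      ∑ j ∈ Finset.range (n + 1),
      (rmax (fun j => D x (a + j * ((b - a) / (n + 1)))) (j + 1) -
        rmax (fun j => D x (a + j * ((b - a) / (n + 1)))) j) *
        AP k D x (a + (j + 1 : ℕ) * ((b - a) / (n + 1))))) atTop) atTop (𝓝 0) := by
    filter_upwards [hreg, hball, hAPb', hzf] with x hreg' hball hAP hzf hx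
    obtain ⟨b1, b2, b3, b4, b5⟩ := hball hx
    have hcont : ∀ k, Continuous (AP k D x) := fun k => continuous_AP k hDm hΨ hreg hreg'.1
    have hW : ∀ (k : ℕ), ∀ t ∈ Icc a b,
        (k + 1 : ℝ) ^ 2 * AP k D x t ≤ Bc * C0 * ‖x‖ ^ (-γ) := by
      intro k
      refine le_of_ae_Ioo hab (continuous_const.mul (hcont k)) ?_
      filter_upwards [hAP] with t ht hti
      exact (ht hti hx).1 k
    refine ⟨⟨b1, b2⟩, hW, grid_vanish hab hcont (fun k t => le_max_right _ _) hW b3 b4 b1 b5 ?_⟩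
    filter_upwards [hAP, hzf hx] with t ht hz hti hzt
    exact (ht hti hx).2 (hz hti hzt)
  obtain ⟨Z, hZ, hZm, hZ0⟩ := exists_measurable_superset_of_null hgood
  set B : Set (Eu N) := ball 0 R \ Z with hB
  have hBm : MeasurableSet B := measurableSet_ball.diff hZm
  have hBR : B ⊆ ball 0 R := sdiff_subset
  have hBg := fun x (hx : x ∈ B) =>
    (show _ → _ from not_not.1 (mt (@hZ x) hx.2)) (by simpa using hx.1)
  have hgrid : ∀ (n j : ℕ), j ≤ n + 1 → a + j * ((b - a) / (n + 1 : ℝ)) ∈ Icc a b := by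
    intro n j hj
    have hj' : (j : ℝ) ≤ n + 1 := by exact_mod_cast hj
    have hba : 0 < b - a := by linarith
    refine ⟨by have : 0 ≤ (j : ℝ) * ((b - a) / (n + 1 : ℝ)) := by positivity
               linarith, ?_⟩
    have : (j : ℝ) * ((b - a) / (n + 1 : ℝ)) ≤ (n + 1) * ((b - a) / (n + 1 : ℝ)) := by gcongr
    rw [mul_div_cancel₀ _ (by positivity)] at this
    linarith
  set G : ℕ → ℕ → Eu N → ℝ := fun k n x => ∑ j ∈ Finset.range (n + 1),
      (rmax (fun j => B.indicator (fun x => D x (a + j * ((b - a) / (n + 1 : ℝ)))) x) (j + 1) -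
        rmax (fun j => B.indicator (fun x => D x (a + j * ((b - a) / (n + 1 : ℝ)))) x) j) *
        AP k D x (a + (j + 1 : ℕ) * ((b - a) / (n + 1 : ℝ))) with hG
  have hGin : ∀ k n, ∀ x ∈ B, G k n x = ∑ j ∈ Finset.range (n + 1),
      (rmax (fun j => D x (a + j * ((b - a) / (n + 1)))) (j + 1) -
        rmax (fun j => D x (a + j * ((b - a) / (n + 1)))) j) *
        AP k D x (a + (j + 1 : ℕ) * ((b - a) / (n + 1))) := by
    intro k n x hx
    simp only [hG, indicator_of_mem hx]
  have hGout : ∀ k n, ∀ x ∉ B, G k n x = 0 := by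
    intro k n x hx
    have : ∀ j, rmax (fun _ => 0) j = 0 := fun j =>
      le_antisymm (rmax_le le_rfl (fun _ => le_rfl) j) (rmax_nonneg _ j)
    simp only [hG, indicator_of_notMem hx, this]
    simp
  have hGm : ∀ k n, Measurable (G k n) := by
    intro k n
    refine Finset.measurable_sum _ fun j _ => Measurable.mul (Measurable.sub ?_ ?_) ?_
    · exact measurable_rmax (fun j => (hDmt _).indicator hBm) _
    · exact measurable_rmax (fun j => (hDmt _).indicator hBm) _
    · exact (measurable_AP k hDm).comp (measurable_id.prodMk measurable_const)
  have hGnn : ∀ k n x, 0 ≤ G k n x := fun k n x => Finset.sum_nonneg fun j _ =>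
    mul_nonneg (rmax_step_nonneg _ _) (le_max_right _ _)
  set g : Eu N → ℝ≥0∞ := B.indicator fun x => ofReal (C1 * (Bc * C0 * ‖x‖ ^ (-γ))) with hg
  have hgm : Measurable g := Measurable.indicator (by fun_prop) hBm
  have hgfin : ∫⁻ x, g x ≠ ⊤ := by
    obtain ⟨C, hC, hCs⟩ := exists_lintegral_rpow_ball_zero hN (γ := γ) (by linarith)
    have : ∫⁻ x, g x ≤ ofReal (C1 * (Bc * C0)) * ofReal (C * R ^ ((N : ℝ) - γ)) := by
      rw [← hCs R hR, ← lintegral_const_mul' _ _ ENNReal.ofReal_ne_top, hg,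
        lintegral_indicator hBm]
      refine (lintegral_mono_set hBR).trans (lintegral_mono fun x => le_of_eq ?_)
      rw [← ENNReal.ofReal_mul (by positivity), mul_assoc C1]
    exact (this.trans_lt (ENNReal.mul_lt_top ENNReal.ofReal_lt_top ENNReal.ofReal_lt_top)).ne
  have hGg : ∀ (k n : ℕ) (x : Eu N), ofReal ((k + 1 : ℝ) ^ 2 * G k n x) ≤ g x := by
    intro k n x
    by_cases hx : x ∈ B
    · obtain ⟨⟨g1, g2⟩, g3, -⟩ := hBg x hx
      rw [hg, indicator_of_mem hx, hGin k n x hx]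
      refine ENNReal.ofReal_le_ofReal ?_
      rw [Finset.mul_sum]
      have hW0 : 0 ≤ Bc * C0 * ‖x‖ ^ (-γ) := by positivity
      have := rmax_sum_le (d := fun j => D x (a + j * ((b - a) / (n + 1)))) (C := C1) hC1 hW0
        (fun j => g2 _) (A := fun j => if j ≤ n + 1 then
          (k + 1 : ℝ) ^ 2 * AP k D x (a + j * ((b - a) / (n + 1))) else 0)
        (fun j => by
          split_ifs with hj
          · exact g3 k _ (hgrid n j hj)
          · exact hW0) (n + 1)
      refine le_trans (le_of_eq ?_) this
      refine Finset.sum_congr rfl fun j hj => ?_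
      rw [Finset.mem_range] at hj
      rw [if_pos (by omega)]
      ring
    · rw [hGout k n x hx]; simp
  -- the energy inequality
  set I : ℝ≥0∞ := ∫⁻ x, ofReal ((B.indicator (fun x => max (D x b) 0) x) ^ 2) with hI
  have hen : ∀ k n : ℕ, ofReal c * I ≤
      2 * ∫⁻ x, ofReal ((k + 1 : ℝ) ^ 2 * G k n x) := by
    intro k n
    have hk0 : 0 < 1 / (k + 1 : ℝ) := by positivity
    have hk1 : 1 / (k + 1 : ℝ) ≤ 1 := by
      rw [div_le_one (by positivity)]; linarith [(Nat.cast_nonneg k : (0 : ℝ) ≤ k)]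
    have hZnull : ∀ᵐ y : Eu N, y ∉ Z := measure_eq_zero_iff_ae_notMem.1 hZ0
    obtain ⟨e1, e2⟩ := energy_grid hN hk0 hk1 hC1 (hcoer _ hk0 hk1) hc
      (d := fun j x => D x (a + j * ((b - a) / (n + 1 : ℝ)))) (fun j => hDmt _) (fun j => hDl _)
      hBm hBR (fun j x hx => (hBg x hx).1.2 _) (fun j => by
        filter_upwards [hout, hZnull] with y hy hyZ hyR hyB
        have : R ≤ ‖y‖ := by
          by_contra hh
          exact hyB ⟨by simpa using hh, hyZ⟩
        exact hy this hyR _) (n + 1)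
    have e1' : Integrable (G k n) := e1
    have e3 : c * (∫ x, (B.indicator (fun x => max (D x b) 0) x) ^ 2) ≤
        2 * ∫ x, (k + 1 : ℝ) ^ 2 * G k n x := by
      rw [integral_const_mul]
      have hmono : ∫ x, (B.indicator (fun x => max (D x b) 0) x) ^ 2 ≤
          ∫ x, rmax (fun j => B.indicator
            (fun x => D x (a + j * ((b - a) / (n + 1 : ℝ)))) x) (n + 1) ^ 2 := by
        refine integral_mono_of_nonneg (Eventually.of_forall fun x => sq_nonneg _) ?_
          (Eventually.of_forall fun x => ?_)
        · have hr1 : ∀ x, rmax (fun j => B.indicator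
            (fun x => D x (a + j * ((b - a) / (n + 1 : ℝ)))) x) (n + 1) ≤ C1 := fun x =>
            rmax_le hC1 (fun j => by
              by_cases hx : x ∈ B
              · rw [indicator_of_mem hx]; exact (hBg x hx).1.2 _
              · rw [indicator_of_notMem hx]; exact hC1) _
          refine integrable_of_ball (R := R) (K := C1 ^ 2) ?_ ?_ ?_
          · exact (measurable_rmax (fun j => (hDmt _).indicator hBm) _).pow_const _
          · intro x
            rw [abs_of_nonneg (sq_nonneg _)]
            have := rmax_nonneg (fun j => B.indicator
              (fun x => D x (a + j * ((b - a) / (n + 1 : ℝ)))) x) (n + 1)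
            have := hr1 x
            gcongr
          · intro x hx
            have hxB : x ∉ B := fun h => hx (hBR h)
            have : ∀ j, rmax (fun _ => 0) j = 0 := fun j =>
              le_antisymm (rmax_le le_rfl (fun _ => le_rfl) j) (rmax_nonneg _ j)
            simp only [indicator_of_notMem hxB, this]
            simp
        · simp only
          have hb : a + ((n + 1 : ℕ) : ℝ) * ((b - a) / (n + 1 : ℝ)) = b := by
            push_cast; field_simp; ring
          by_cases hx : x ∈ B
          · simp only [indicator_of_mem hx]
            refine pow_le_pow_left₀ (le_max_right _ _) (max_le ?_ (rmax_nonneg _ _)) 2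
            have := le_max_right (rmax (fun j : ℕ => D x (a + j * ((b - a) / (n + 1 : ℝ)))) n)
              (D x (a + ((n + 1 : ℕ) : ℝ) * ((b - a) / (n + 1 : ℝ))))
            rw [hb] at this
            rw [rmax_succ, hb]
            exact le_max_right _ _
          · simp only [indicator_of_notMem hx]
            rw [zero_pow two_ne_zero]
            exact sq_nonneg _
      have e2' : c * (1 / (k + 1 : ℝ)) ^ 2 * ∫ x, rmax (fun j => B.indicator
            (fun x => D x (a + j * ((b - a) / (n + 1 : ℝ)))) x) (n + 1) ^ 2 ≤
            2 * ∫ x, G k n x := e2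
      have hk : (0 : ℝ) < (k : ℝ) + 1 := by positivity
      have e4 := mul_le_mul_of_nonneg_left e2' (sq_nonneg (k + 1 : ℝ))
      have e5 := mul_le_mul_of_nonneg_left hmono hc.le
      have e6 : ∀ J : ℝ, c * J = (k + 1 : ℝ) ^ 2 * (c * (1 / (k + 1 : ℝ)) ^ 2 * J) := by
        intro J; field_simp
      exact e5.trans ((e6 _).le.trans (e4.trans (le_of_eq (by ring))))
    have hsq : Integrable fun x => (B.indicator (fun x => max (D x b) 0) x) ^ 2 := by
      refine integrable_of_ball (R := R) (K := C1 ^ 2) ?_ ?_ ?_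
      · exact (Measurable.indicator ((hDmt b).max measurable_const) hBm).pow_const _
      · intro x
        rw [abs_of_nonneg (sq_nonneg _)]
        by_cases hx : x ∈ B
        · rw [indicator_of_mem hx]
          exact pow_le_pow_left₀ (le_max_right _ _) (max_le ((hBg x hx).1.2 _) hC1) 2
        · rw [indicator_of_notMem hx, zero_pow two_ne_zero]; positivity
      · intro x hx
        rw [indicator_of_notMem fun h => hx (hBR h)]; simp
    rw [hI, ← ofReal_integral_eq_lintegral_ofReal hsq (Eventually.of_forall fun x => sq_nonneg _),
      ← ofReal_integral_eq_lintegral_ofReal (e1'.const_mul _) (Eventually.of_forall fun x =>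
        mul_nonneg (by positivity) (hGnn k n x)), ← ENNReal.ofReal_mul hc.le]
    refine (ENNReal.ofReal_le_ofReal e3).trans ?_
    rw [ENNReal.ofReal_mul (by norm_num)]
    simp
  set L : ℕ → Eu N → ℝ≥0∞ := fun k x =>
    limsup (fun n => ofReal ((k + 1 : ℝ) ^ 2 * G k n x)) atTop with hL
  have hLm : ∀ k, Measurable (L k) := fun k =>
    Measurable.limsup fun n => ((hGm k n).const_mul _).ennreal_ofReal
  have hIL : ∀ k : ℕ, ofReal c * I ≤ 2 * ∫⁻ x, L k x := by
    intro k
    have h1 : limsup (fun n => ∫⁻ x, ofReal ((k + 1 : ℝ) ^ 2 * G k n x)) atTop ≤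
        ∫⁻ x, L k x :=
      limsup_lintegral_le g (fun n => ((hGm k n).const_mul _).ennreal_ofReal)
        (fun n => Eventually.of_forall (hGg k n)) hgfin
    have h2 : ofReal c * I / 2 ≤
        limsup (fun n => ∫⁻ x, ofReal ((k + 1 : ℝ) ^ 2 * G k n x)) atTop := by
      refine le_limsup_of_frequently_le (Eventually.frequently (Eventually.of_forall fun n => ?_))
        (by isBoundedDefault)
      refine ENNReal.div_le_of_le_mul ?_
      rw [mul_comm _ (2 : ℝ≥0∞)]
      exact hen k n
    have h3 := h2.trans h1
    rw [ENNReal.div_le_iff_le_mul (by simp) (by simp)] at h3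
    rwa [mul_comm _ (2 : ℝ≥0∞)] at h3
  have hLlim : Tendsto (fun k => ∫⁻ x, L k x) atTop (𝓝 (∫⁻ _ : Eu N, 0)) := by
    refine tendsto_lintegral_of_dominated_convergence g hLm (fun k => Eventually.of_forall fun x =>
      limsup_le_of_le (by isBoundedDefault) (Eventually.of_forall fun n => hGg k n x)) hgfin
      (Eventually.of_forall fun x => ?_)
    by_cases hx : x ∈ B
    · obtain ⟨-, -, g4⟩ := hBg x hx
      simp only [hL, hGin _ _ x hx]
      exact g4
    · simp only [hL, hGout _ _ x hx]
      simp
  have hI0 : I = 0 := by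
    have h1 := ENNReal.Tendsto.const_mul (a := 2) hLlim (Or.inr (by simp))
    rw [lintegral_zero, mul_zero] at h1
    have h2 := ge_of_tendsto' h1 hIL
    have h3 : ofReal c * I = 0 := le_antisymm h2 zero_le
    rcases mul_eq_zero.1 h3 with h | h
    · exact absurd h (ENNReal.ofReal_pos.2 hc).ne'
    · exact h
  rw [hI, lintegral_eq_zero_iff
    ((Measurable.indicator ((hDmt b).max measurable_const) hBm).pow_const _).ennreal_ofReal] at hI0
  have hZnull : ∀ᵐ y : Eu N, y ∉ Z := measure_eq_zero_iff_ae_notMem.1 hZ0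
  filter_upwards [hI0, hZnull] with x hx hxZ hxR
  have hxB : x ∈ B := ⟨by simpa using hxR, hxZ⟩
  simp only [indicator_of_mem hxB, Pi.zero_apply, ENNReal.ofReal_eq_zero] at hx
  have : max (D x b) 0 = 0 := pow_eq_zero_iff two_ne_zero |>.1 (le_antisymm hx (sq_nonneg _))
  exact (le_max_left _ _).trans this.le

/-- Comparison principle on a ball for potentials evolving monotonically in time. -/
lemma comparison (hN : 3 ≤ N) (h0 : 0 ≤ γ) (h2 : γ < 2) (hR : 0 < R)
    (hab : a < b) (hC1 : 0 ≤ C1) (hBc : 0 ≤ Bc) {D f z : Eu N → ℝ → ℝ}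
    (hΨ : LI Ψ) (hDm : Measurable fun p : Eu N × ℝ => D p.1 p.2)
    (hfm : Measurable fun p : Eu N × ℝ => f p.1 p.2)
    (hreg : ∀ᵐ x, ContinuousOn (D x) (Icc a b) ∧ ∀ t ∈ Icc a b, |D x t| ≤ Ψ x)
    (hball : ∀ᵐ x : Eu N, ‖x‖ < R → D x a ≤ 0 ∧ (∀ t ∈ Icc a b, D x t ≤ C1) ∧
      IntegrableOn (z x) (Icc a b) ∧ (∀ t, 0 ≤ z x t) ∧
      ∀ s t, s ∈ Icc a b → t ∈ Icc a b → s ≤ t →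
        max (D x t) 0 - max (D x s) 0 ≤ ∫ τ in Ioc s t, z x τ)
    (hout : ∀ᵐ x : Eu N, R ≤ ‖x‖ → ‖x‖ < R + 1 → ∀ t ∈ Icc a b, D x t ≤ 0)
    (hfl : ∀ᵐ t : ℝ, t ∈ Ioo a b → LI fun y => f y t)
    (hfB : ∀ᵐ t : ℝ, t ∈ Ioo a b → ∀ᵐ y : Eu N, ‖y‖ < R + 2 → f y t ≤ Bc * ‖y‖ ^ (-γ))
    (hpot : ∀ k : ℕ, ∀ᵐ t : ℝ, t ∈ Ioo a b → ∀ x,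
      PotAt (1 / (k + 1 : ℝ)) (fun y => D y t) (fun y => f y t) x)
    (hzf : ∀ᵐ x : Eu N, ‖x‖ < R → ∀ᵐ t : ℝ, t ∈ Ioo a b → 0 < z x t → f x t ≤ 0) :
    ∀ᵐ x : Eu N, ‖x‖ < R → D x b ≤ 0 := by
  set p : ℝ → ℝ := fun t => max a (min b t) with hp
  have hpc : Continuous p := by fun_prop
  have hpI : ∀ t, p t ∈ Icc a b := fun t => ⟨le_max_left _ _, max_le hab.le (min_le_left _ _)⟩
  have hpe : ∀ t ∈ Icc a b, p t = t := fun t ht => by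
    simp only [hp]; rw [min_eq_right ht.2, max_eq_right ht.1]
  have key := comparison_core hN (γ := γ) (D := fun x t => D x (p t)) (f := f) (z := z) (Ψ := Ψ)
    h0 h2 hR hab hC1 hBc hΨ (hDm.comp (measurable_fst.prodMk (hpc.measurable.comp measurable_snd)))
    hfm ?_ ?_ ?_ hfl hfB ?_ hzf
  · filter_upwards [key] with x hx hxR
    simpa only [hpe b (right_mem_Icc.2 hab.le)] using hx hxR
  · filter_upwards [hreg] with x hx
    exact ⟨hx.1.comp_continuous hpc hpI, fun t => hx.2 _ (hpI t)⟩
  · filter_upwards [hball] with x hx hxR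
    obtain ⟨b1, b2, b3, b4, b5⟩ := hx hxR
    refine ⟨by rwa [hpe a (left_mem_Icc.2 hab.le)], fun t => b2 _ (hpI t), b3, b4,
      fun s t hs ht hst => ?_⟩
    rw [hpe s hs, hpe t ht]
    exact b5 s t hs ht hst
  · filter_upwards [hout] with x hx h1 h2 t
    exact hx h1 h2 _ (hpI t)
  · intro k
    filter_upwards [hpot k] with t ht hti x
    rw [hpe t (Ioo_subset_Icc_self hti)]
    exact ht hti x

/-- A smooth convex regularization of the positive part. -/
def cvx (s : ℝ) : ℝ := s * expNegInvGlue s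
def cvx1 (s : ℝ) : ℝ := (1 + s⁻¹) * expNegInvGlue s
def cvx2 (s : ℝ) : ℝ := s⁻¹ ^ 3 * expNegInvGlue s

lemma cvx1_hasDerivAt (s : ℝ) : HasDerivAt cvx1 (cvx2 s) s := by
  have h := expNegInvGlue.hasDerivAt_polynomial_eval_inv_mul (1 + Polynomial.X) s
  have h1 : (fun x : ℝ => (1 + Polynomial.X : Polynomial ℝ).eval x⁻¹ * expNegInvGlue x) = cvx1 := by
    ext x; simp [cvx1]
  rw [h1] at h
  refine h.congr_deriv ?_
  simp [cvx2]
  ring_nf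
  simp

lemma cvx_hasDerivAt (s : ℝ) : HasDerivAt cvx (cvx1 s) s := by
  have h := expNegInvGlue.hasDerivAt_polynomial_eval_inv_mul 1 s
  have h1 : (fun x : ℝ => (1 : Polynomial ℝ).eval x⁻¹ * expNegInvGlue x) = expNegInvGlue := by
    ext x; simp
  rw [h1] at h
  refine ((hasDerivAt_id s).mul h).congr_deriv ?_
  rcases eq_or_ne s 0 with rfl | hs
  · simp [cvx1, expNegInvGlue]
  · simp [cvx1]
    field_simp

lemma cvx_contDiff : ContDiff ℝ ∞ cvx := contDiff_id.mul expNegInvGlue.contDiff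

lemma glue_of_pos (hs : 0 < s) : expNegInvGlue s = Real.exp (-s⁻¹) := by
  simp [expNegInvGlue, hs.not_ge]

lemma cvx1_nonneg (s : ℝ) : 0 ≤ cvx1 s := by
  rcases le_or_gt s 0 with hs | hs
  · simp [cvx1, expNegInvGlue.zero_of_nonpos hs]
  · have := expNegInvGlue.nonneg s
    unfold cvx1; positivity

lemma cvx2_nonneg (s : ℝ) : 0 ≤ cvx2 s := by
  rcases le_or_gt s 0 with hs | hs
  · simp [cvx2, expNegInvGlue.zero_of_nonpos hs]
  · have := expNegInvGlue.nonneg s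
    unfold cvx2; positivity

lemma cvx_nonneg (s : ℝ) : 0 ≤ cvx s := by
  rcases le_or_gt s 0 with hs | hs
  · simp [cvx, expNegInvGlue.zero_of_nonpos hs]
  · have := expNegInvGlue.nonneg s
    unfold cvx; positivity

lemma cvx1_le_one (s : ℝ) : cvx1 s ≤ 1 := by
  rcases le_or_gt s 0 with hs | hs
  · simp [cvx1, expNegInvGlue.zero_of_nonpos hs]
  · rw [cvx1, glue_of_pos hs, Real.exp_neg, ← div_eq_mul_inv, div_le_one (Real.exp_pos _)]
    linarith [Real.add_one_le_exp s⁻¹]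

lemma cvx_le (s : ℝ) : cvx s ≤ (s + 1) * cvx1 s := by
  rcases le_or_gt s 0 with h | h
  · simp [cvx, cvx1, expNegInvGlue.zero_of_nonpos h]
  · have h1 := expNegInvGlue.nonneg s
    have h2 : 0 < s⁻¹ := by positivity
    unfold cvx cvx1
    nlinarith [mul_nonneg h1 h2.le, mul_nonneg h1 h.le, mul_nonneg (mul_nonneg h1 h2.le) h.le]

lemma exp_le_cvx1 (hs : 1 ≤ s) : Real.exp (-1) ≤ cvx1 s := by
  have h : 0 < s := by linarith
  rw [cvx1, glue_of_pos h]
  have h1 : Real.exp (-1) ≤ Real.exp (-s⁻¹) := by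
    apply Real.exp_le_exp.2
    linarith [inv_le_one_of_one_le₀ hs]
  have h2 : 0 < s⁻¹ := by positivity
  nlinarith [Real.exp_pos (-s⁻¹)]

lemma exists_growth_prof {al L : ℝ} (hn : 2 < n) (hl : 0 < lam) (hal : al = n - 2 + lam / 2)
    (hL : 0 < L) : ∃ b b1 b2 : ℝ → ℝ, Prof b b1 b2 ∧ ∀ q, 0 ≤ q → ∃ e, 0 ≤ e ∧ e ≤ 1 ∧
      0 ≤ b q ∧ b q ≤ L ^ al * (1 + q) ^ (-(al / 2)) * e ∧
      (1 + 4 * n / lam ≤ q → al * (lam / 4) * (L ^ al * (1 + q) ^ (-(al / 2)) * e) / (1 + q) ≤ radL n b1 b2 q) ∧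
      -(al * n * L ^ al) ≤ radL n b1 b2 q ∧
      (2 ≤ L ^ al * (1 + q) ^ (-(al / 2)) → Real.exp (-1) ≤ e) ∧
      (L ^ 2 ≤ q → b q = 0 ∧ e = 0 ∧ radL n b1 b2 q = 0) := by
  have hal0 : 0 < al := by rw [hal]; linarith
  have hLa : 0 < L ^ al := by positivity
  set w : ℝ → ℝ := fun q => L ^ al * (1 + q) ^ (-(al / 2)) with hw
  set w1 : ℝ → ℝ := fun q => -(al / 2) * L ^ al * (1 + q) ^ (-(al / 2) - 1) with hw1
  set w2 : ℝ → ℝ := fun q => (al / 2) * (al / 2 + 1) * L ^ al * (1 + q) ^ (-(al / 2) - 2) with hw2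
  have dw : ∀ q, -1 < q → HasDerivAt w (w1 q) q := fun q hq => by
    have := ((((hasDerivAt_id q).const_add 1).rpow_const (p := -(al / 2))
      (Or.inl (by simp; linarith))).const_mul (L ^ al))
    refine this.congr_deriv ?_
    simp [hw1]; ring
  have dw1 : ∀ q, -1 < q → HasDerivAt w1 (w2 q) q := fun q hq => by
    have := ((((hasDerivAt_id q).const_add 1).rpow_const (p := -(al / 2) - 1)
      (Or.inl (by simp; linarith))).const_mul (-(al / 2) * L ^ al))
    refine this.congr_deriv ?_
    simp [hw2]
    rw [show -(al / 2) - 1 - 1 = -(al / 2) - 2 by ring]; ring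
  have hz : ∀ q, L ^ 2 ≤ q → w q - 1 ≤ 0 := fun q hq => by
    have hq0 : 0 < q := lt_of_lt_of_le (by positivity) hq
    have h1 : L ^ al ≤ (1 + q) ^ (al / 2) := by
      calc L ^ al = (L ^ 2) ^ (al / 2) := by
            rw [← Real.rpow_natCast, ← Real.rpow_mul hL.le]; congr 1; push_cast; ring
        _ ≤ _ := Real.rpow_le_rpow (by positivity) (by linarith) (by positivity)
    simp only [hw]
    rw [Real.rpow_neg (by linarith), ← div_eq_mul_inv, sub_nonpos, div_le_one (by positivity)]
    exact h1
  have z0 : ∀ s, s ≤ 0 → cvx s = 0 ∧ cvx1 s = 0 ∧ cvx2 s = 0 := fun s hs => by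
    simp [cvx, cvx1, cvx2, expNegInvGlue.zero_of_nonpos hs]
  refine ⟨fun q => cvx (w q - 1), fun q => cvx1 (w q - 1) * w1 q,
    fun q => cvx2 (w q - 1) * w1 q ^ 2 + cvx1 (w q - 1) * w2 q, ⟨?_, ?_, ?_, ?_⟩, ?_⟩
  · intro q hq
    exact (cvx_hasDerivAt (w q - 1)).comp q ((dw q hq).sub_const 1)
  · intro q hq
    have := ((cvx1_hasDerivAt (w q - 1)).comp q ((dw q hq).sub_const 1)).mul (dw1 q hq)
    refine this.congr_deriv ?_
    simp; ring
  · intro q hq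
    refine cvx_contDiff.contDiffAt.comp q ?_
    refine ContDiffAt.sub (contDiffAt_const.mul ?_) contDiffAt_const
    exact (contDiffAt_const.add contDiffAt_id).rpow_const_of_ne (by simp; linarith)
  · refine ⟨L ^ 2, by positivity, fun q hq => ?_⟩
    obtain ⟨h0, h1, h2⟩ := z0 _ (hz q hq.le)
    simp [h0, h1, h2]
  · intro q hq
    have hwp : 0 < w q := by simp only [hw]; positivity
    have e1 : w1 q = -(al / 2) * w q / (1 + q) := by
      simp only [hw, hw1]; rw [Real.rpow_sub_one (by linarith)]; ring
    have e2 : w2 q = (al / 2) * (al / 2 + 1) * w q / (1 + q) ^ 2 := by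
      simp only [hw, hw2]
      rw [Real.rpow_sub (by linarith)]; norm_num; ring
    have hwL : w q ≤ L ^ al := by
      simp only [hw]
      refine mul_le_of_le_one_right hLa.le (Real.rpow_le_one_of_one_le_of_nonpos (by linarith) (by linarith))
    have hR : cvx1 (w q - 1) * (al * w q * (lam / 2 * q - n) / (1 + q) ^ 2) ≤
        radL n (fun q => cvx1 (w q - 1) * w1 q)
          (fun q => cvx2 (w q - 1) * w1 q ^ 2 + cvx1 (w q - 1) * w2 q) q := by
      have hd : cvx1 (w q - 1) * (al * w q * (lam / 2 * q - n) / (1 + q) ^ 2) =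
          cvx1 (w q - 1) * (4 * q * w2 q + 2 * n * w1 q) := by
        rw [e1, e2]
        have : (1 + q) ≠ 0 := by linarith
        have hlam : lam = 2 * (al + 2 - n) := by rw [hal]; ring
        rw [hlam]
        field_simp
        ring
      rw [hd, radL]
      have := mul_nonneg (mul_nonneg (by linarith : (0:ℝ) ≤ 4 * q) (cvx2_nonneg (w q - 1))) (sq_nonneg (w1 q))
      linarith
    have c0 := cvx1_nonneg (w q - 1)
    have c1 := cvx1_le_one (w q - 1)
    refine ⟨cvx1 (w q - 1), c0, c1, cvx_nonneg _, ?_, ?_, ?_, ?_, ?_⟩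
    · have := cvx_le (w q - 1)
      simpa using this
    · intro h
      refine le_trans ?_ hR
      have h2 : lam / 4 * (1 + q) ≤ lam / 2 * q - n := by
        have : n = lam / 4 * (4 * n / lam) := by field_simp
        nlinarith
      have h3 : al * (lam / 4) * (w q * cvx1 (w q - 1)) / (1 + q) =
          cvx1 (w q - 1) * (al * w q * (lam / 4 * (1 + q)) / (1 + q) ^ 2) := by
        have : (1 + q) ≠ 0 := by linarith
        field_simp
      change al * (lam / 4) * (w q * cvx1 (w q - 1)) / (1 + q) ≤ _
      rw [h3]
      gcongr
    · refine le_trans ?_ hR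
      have h2 : -(al * n * L ^ al) ≤ al * w q * (lam / 2 * q - n) / (1 + q) ^ 2 := by
        rw [le_div_iff₀ (by positivity)]
        have h4 : (1:ℝ) ≤ (1 + q) ^ 2 := by nlinarith
        have h5 : al * n * w q ≤ al * n * L ^ al := by gcongr
        have h6 : 0 ≤ al * w q * (lam / 2 * q) := by positivity
        have h7 : 0 ≤ al * n * L ^ al := by positivity
        nlinarith
      have h7 : 0 ≤ al * n * L ^ al := by positivity
      nlinarith [mul_le_mul_of_nonneg_left h2 c0]
    · intro h
      exact exp_le_cvx1 (by change 2 ≤ w q at h; linarith)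
    · intro h
      obtain ⟨h0, h1, h2⟩ := z0 _ (hz q h)
      simp [h0, h1, h2, radL]

lemma young_split {k U W : ℝ} (hm : 1 < m) (hk : 0 ≤ k) (hU : 0 ≤ U) (hW : 0 < W) :
    k ^ (1 / m) * U ≤ W + W ^ (1 - m) * (k * U ^ m) := by
  have hm0 : m ≠ 0 := by linarith
  set X := k ^ (1 / m) * U with hX
  have hX0 : 0 ≤ X := by positivity
  have e : k * U ^ m = X ^ m := by
    rw [hX, Real.mul_rpow (by positivity) hU, ← Real.rpow_mul hk, one_div_mul_cancel hm0, Real.rpow_one]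
  rw [e]
  rcases le_total X W with h | h
  · have : 0 ≤ W ^ (1 - m) * X ^ m := by positivity
    linarith
  · have hXp : 0 < X := hW.trans_le h
    have h1 : X ^ (1 - m) ≤ W ^ (1 - m) := Real.rpow_le_rpow_of_nonpos hW h (by linarith)
    have h2 : X ^ (1 - m) * X ^ m = X := by
      rw [← Real.rpow_add hXp]; simp
    have h3 : X ^ (1 - m) * X ^ m ≤ W ^ (1 - m) * X ^ m := by gcongr
    linarith

lemma Sol.integrable_time (h : Sol ρ m T u) {k : ℝ → ℝ} (hk : Measurable k)
    (hkC : ∀ t, |k t| ≤ C) (ha : 0 < a) (hb : b < T) (hk0 : ∀ t ∉ Icc a b, k t = 0) (x : Eu N) :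
    Integrable fun t => k t * u x t ^ m := by
  refine IntegrableOn.integrable_of_forall_notMem_eq_zero (s := Icc a b) ?_ fun t ht => by simp [hk0 t ht]
  exact (h.slice x a b ha hb).bdd_mul (c := C) hk.aestronglyMeasurable (Eventually.of_forall hkC)

lemma Sol.time_young (h : Sol ρ m T u) (hm : 1 < m) (hT : 0 < T) {κ1 : ℝ → ℝ} (hκm : Measurable κ)
    (hC0 : 0 ≤ C0) (hκ0 : ∀ t, 0 ≤ κ t) (hκ1 : ∀ t, κ t ≤ C) (ha : 0 < a) (hb : b < T)
    (hk0 : ∀ t ∉ Icc a b, κ t = 0) (h0 : ∀ t, 0 ≤ κ1 t) (h1 : ∀ t, κ1 t ≤ C0 * κ t ^ (1 / m)) (x : Eu N)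
    {W : ℝ} (hW : 0 < W) :
    ∫ t, κ1 t * u x t ≤ C0 * (T * W + W ^ (1 - m) * ∫ t, κ t * u x t ^ m) := by
  have i1 := h.integrable_time hκm (C := C) (fun t => by rw [abs_of_nonneg (hκ0 t)]; exact hκ1 t) ha hb hk0 x
  have i2 : Integrable ((Ioo 0 T).indicator fun _ : ℝ => W) :=
    (integrable_indicator_iff measurableSet_Ioo).2 (integrableOn_const (by simp))
  have e : C0 * (T * W + W ^ (1 - m) * ∫ t, κ t * u x t ^ m) =
      ∫ t, C0 * ((Ioo 0 T).indicator (fun _ : ℝ => W) t + W ^ (1 - m) * (κ t * u x t ^ m)) := by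
    rw [integral_const_mul, integral_add i2 (i1.const_mul _), integral_const_mul,
      integral_indicator measurableSet_Ioo, setIntegral_const]
    simp [hT.le]
  rw [e]
  refine integral_mono_of_nonneg (Eventually.of_forall fun t => mul_nonneg (h0 t) (h.nonneg x t))
    ((i2.add (i1.const_mul _)).const_mul C0) (Eventually.of_forall fun t => ?_)
  have hu := h.nonneg x t
  by_cases ht : t ∈ Icc a b
  · have ht' : t ∈ Ioo 0 T := ⟨ha.trans_le ht.1, ht.2.trans_lt hb⟩
    simp only [indicator_of_mem ht']
    calc κ1 t * u x t ≤ (C0 * κ t ^ (1 / m)) * u x t := by gcongr; exact h1 t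
      _ = C0 * (κ t ^ (1 / m) * u x t) := by ring
      _ ≤ _ := by gcongr; exact young_split hm (hκ0 t) hu hW
  · have hk : κ1 t ≤ 0 := by
      have := h1 t
      rwa [hk0 t ht, Real.zero_rpow (by positivity), mul_zero] at this
    have : κ1 t = 0 := le_antisymm hk (h0 t)
    simp only [this, zero_mul]
    have : 0 ≤ (Ioo 0 T).indicator (fun _ : ℝ => W) t := indicator_nonneg (fun _ _ => hW.le) _
    have h5 : 0 ≤ W ^ (1 - m) * (κ t * u x t ^ m) := by have := hκ0 t; positivity
    positivity

lemma Sol.F_nonneg (h : Sol ρ m T u) (hκ0 : ∀ t, 0 ≤ κ t) (x : Eu N) :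
    0 ≤ ∫ t, κ t * u x t ^ m :=
  integral_nonneg fun t => mul_nonneg (hκ0 t) (Real.rpow_nonneg (h.nonneg x t) _)

lemma exists_rpow_ball (hN : 3 ≤ N) {p : ℝ} (hp : 0 < p + N) :
    ∃ C, 0 < C ∧ ∀ r0 L, 1 ≤ r0 → 0 < L → IntegrableOn (fun x : Eu N => (1 + ‖x‖ ^ 2) ^ (p / 2)) (ball 0 L \ closedBall 0 r0) ∧
      ∫ x in ball (0 : Eu N) L \ closedBall 0 r0, (1 + ‖x‖ ^ 2) ^ (p / 2) ≤ C * L ^ (p + N) := by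
  obtain ⟨C, hC, h⟩ := exists_lintegral_rpow_ball_zero hN (γ := -p) (by linarith)
  refine ⟨2 ^ |p / 2| * C + 1, by positivity, fun r0 L h1 hL0 => ?_⟩
  have hc : Continuous fun x : Eu N => (1 + ‖x‖ ^ 2) ^ (p / 2) :=
    (by fun_prop : Continuous fun x : Eu N => 1 + ‖x‖ ^ 2).rpow_const fun x => Or.inl (by positivity)
  have hi : IntegrableOn (fun x : Eu N => (1 + ‖x‖ ^ 2) ^ (p / 2)) (ball 0 L \ closedBall 0 r0) :=
    (hc.continuousOn.integrableOn_compact (isCompact_closedBall 0 L)).mono_set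
      (sdiff_subset.trans ball_subset_closedBall)
  refine ⟨hi, ?_⟩
  have hms : MeasurableSet (ball (0 : Eu N) L \ closedBall 0 r0) := measurableSet_ball.diff measurableSet_closedBall
  have hX : 0 ≤ C * L ^ (p + N) := by positivity
  suffices ∫ x in ball (0 : Eu N) L \ closedBall 0 r0, (1 + ‖x‖ ^ 2) ^ (p / 2) ≤ 2 ^ |p / 2| * (C * L ^ (p + N)) by
    have : 0 < L ^ (p + N) := by positivity
    nlinarith
  rw [integral_eq_lintegral_of_nonneg_ae (Eventually.of_forall fun x => by positivity) hi.aestronglyMeasurable]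
  refine ENNReal.toReal_le_of_le_ofReal (by positivity) ?_
  calc ∫⁻ x in ball (0 : Eu N) L \ closedBall 0 r0, ofReal ((1 + ‖x‖ ^ 2) ^ (p / 2))
      ≤ ∫⁻ x in ball (0 : Eu N) L \ closedBall 0 r0, ofReal (2 ^ |p / 2|) * ofReal (‖x‖ ^ (-(-p))) := by
        refine setLIntegral_mono' hms fun x hx => ?_
        rw [← ENNReal.ofReal_mul (by positivity)]
        apply ENNReal.ofReal_le_ofReal
        have hx1 : 1 ≤ ‖x‖ := by
          have : r0 < ‖x‖ := by simpa using hx.2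
          linarith
        have hx0 : 0 < ‖x‖ := by linarith
        have e : ‖x‖ ^ (-(-p)) = (‖x‖ ^ 2) ^ (p / 2) := by
          rw [← Real.rpow_natCast, ← Real.rpow_mul hx0.le]; congr 1; push_cast; ring
        rw [e]
        have h2 : (1:ℝ) ≤ ‖x‖ ^ 2 := by nlinarith
        rcases le_total 0 p with hp | hp
        · rw [abs_of_nonneg (by linarith), ← Real.mul_rpow (by norm_num) (by positivity)]
          exact Real.rpow_le_rpow (by positivity) (by linarith) (by linarith)
        · have : (1 + ‖x‖ ^ 2) ^ (p / 2) ≤ (‖x‖ ^ 2) ^ (p / 2) :=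
            Real.rpow_le_rpow_of_nonpos (by positivity) (by linarith) (by linarith)
          have h3 : (1:ℝ) ≤ 2 ^ |p / 2| := Real.one_le_rpow (by norm_num) (abs_nonneg _)
          have h4 : 0 ≤ (‖x‖ ^ 2) ^ (p / 2) := by positivity
          nlinarith
    _ = ofReal (2 ^ |p / 2|) * ∫⁻ x in ball (0 : Eu N) L \ closedBall 0 r0, ofReal (‖x‖ ^ (-(-p))) :=
        lintegral_const_mul _ (by fun_prop)
    _ ≤ ofReal (2 ^ |p / 2|) * ∫⁻ x in ball (0 : Eu N) L, ofReal (‖x‖ ^ (-(-p))) :=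
        mul_le_mul_right (lintegral_mono_set sdiff_subset) _
    _ = _ := by rw [h L hL0, ← ENNReal.ofReal_mul (by positivity), sub_neg_eq_add, add_comm p]

/-- The critical growth exponent of `u ^ m`. -/
def gexp (γ m : ℝ) : ℝ := (2 - γ) * m / (m - 1)

lemma gexp_pos (hγ : γ < 2) (hm : 1 < m) : 0 < gexp γ m :=
  div_pos (mul_pos (by linarith) (by linarith)) (by linarith)

lemma gexp_div (hm : 1 < m) : gexp γ m / m = gexp γ m - (2 - γ) := by
  unfold gexp
  have : m - 1 ≠ 0 := by linarith
  field_simp; ring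

lemma gexp_div' (hm : 1 < m) : gexp γ m / m * (1 - m) = -(2 - γ) := by
  unfold gexp
  have : m - 1 ≠ 0 := by linarith
  field_simp; ring

lemma Wt.nonneg (hW : Wt N γ Cl Cu ρ) (x : Eu N) : 0 ≤ ρ x :=
  le_trans (by have := hW.l0; positivity) (hW.low x)

lemma Wt.up_far (hW : Wt N γ Cl Cu ρ) (hx : 1 ≤ ‖x‖) :
    ρ x ≤ 2 * |Cu| * (1 + ‖x‖ ^ 2) ^ (-γ / 2) := by
  have hx0 : 0 < ‖x‖ := by linarith
  have h1 := hW.up x (norm_pos_iff.1 hx0)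
  have hg := hW.g0
  have hg2 := hW.g2
  have h2 : ‖x‖ ^ (-γ) ≤ 2 * (1 + ‖x‖ ^ 2) ^ (-γ / 2) := by
    have e : ‖x‖ ^ (-γ) = (‖x‖ ^ 2) ^ (-γ / 2) := by
      rw [← Real.rpow_natCast, ← Real.rpow_mul hx0.le]; congr 1; push_cast; ring
    rw [e]
    have h3 : (2 * ‖x‖ ^ 2) ^ (-γ / 2) ≤ (1 + ‖x‖ ^ 2) ^ (-γ / 2) :=
      Real.rpow_le_rpow_of_nonpos (by positivity) (by nlinarith) (by linarith)
    rw [Real.mul_rpow (by norm_num) (by positivity)] at h3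
    have h4 : (2:ℝ)⁻¹ ≤ 2 ^ (-γ / 2) := by
      rw [← Real.rpow_neg_one]
      exact Real.rpow_le_rpow_of_exponent_le (by norm_num) (by linarith)
    have h5 : 0 ≤ (‖x‖ ^ 2) ^ (-γ / 2) := by positivity
    nlinarith
  have h3 : Cu * ‖x‖ ^ (-γ) ≤ |Cu| * ‖x‖ ^ (-γ) := by gcongr; exact le_abs_self _
  have h4 : |Cu| * ‖x‖ ^ (-γ) ≤ |Cu| * (2 * (1 + ‖x‖ ^ 2) ^ (-γ / 2)) := by gcongr
  linarith

lemma neg_integral_le (f g : ℝ → ℝ) (hf : ∀ t, 0 ≤ f t) :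
    -∫ t, g t * f t ≤ ∫ t, max (-g t) 0 * f t := by
  by_cases hi : Integrable fun t => g t * f t
  · rw [← integral_neg]
    have e : (fun t => max (-g t) 0 * f t) = fun t => max (-(g t * f t)) 0 := by
      ext t
      rw [← neg_mul, max_mul_of_nonneg _ _ (hf t), zero_mul]
    rw [e]
    exact integral_mono hi.neg hi.neg.pos_part fun t => le_max_left _ _
  · rw [integral_undef hi, neg_zero]
    exact integral_nonneg fun t => mul_nonneg (le_max_right _ _) (hf t)

/-- A far-field bound on the negative part of the source. -/
lemma exists_source_bound (hm : 1 < m) (hT : 0 < T) (hW : Wt N γ Cl Cu ρ) {c5 : ℝ} (hC0 : 0 ≤ C0)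
    (hc5 : 0 < c5) : ∃ K, 0 ≤ K ∧ ∀ u, Sol ρ m T u → ∀ κ κ1 : ℝ → ℝ, Measurable κ → ∀ a b, 0 < a → b < T →
      (∀ t, 0 ≤ κ t) → (∀ t, κ t ≤ 1) → (∀ t ∉ Icc a b, κ t = 0) → (∀ t, 0 ≤ κ1 t) →
      (∀ t, κ1 t ≤ C0 * κ t ^ (1 / m)) → ∀ x : Eu N, 1 ≤ ‖x‖ →
      ∫ t, κ1 t * (ρ x * u x t) ≤ K * (1 + ‖x‖ ^ 2) ^ (gexp γ m / 2 - 1) +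
        c5 * (∫ t, κ t * u x t ^ m) / (1 + ‖x‖ ^ 2) := by
  have hm1 : m - 1 ≠ 0 := by linarith
  set K0 := C0 * (2 * |Cu|) with hK0
  have hK00 : 0 ≤ K0 := by positivity
  set Lam := ((K0 + 1) / c5) ^ (1 / (m - 1)) with hLam
  have hLam0 : 0 < Lam := by positivity
  have hLp : K0 * Lam ^ (1 - m) ≤ c5 := by
    rw [hLam, ← Real.rpow_mul (by positivity), show 1 / (m - 1) * (1 - m) = -1 by field_simp; ring,
      Real.rpow_neg_one, inv_div, ← mul_div_assoc, div_le_iff₀ (by positivity)]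
    nlinarith
  refine ⟨K0 * T * Lam, by positivity, fun u h κ κ1 hκm a b ha hb hκ0 hκ1 hk0 h0 h1 x hx => ?_⟩
  set q := ‖x‖ ^ 2 with hq
  have hq0 : 0 < 1 + q := by positivity
  have hF := h.F_nonneg hκ0 x
  set F := ∫ t, κ t * u x t ^ m with hFd
  have hy := h.time_young hm hT hκm hC0 hκ0 hκ1 ha hb hk0 h0 h1 x
    (W := Lam * (1 + q) ^ (gexp γ m / (2 * m))) (by positivity)
  have e1 : ∫ t, κ1 t * (ρ x * u x t) = ρ x * ∫ t, κ1 t * u x t := by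
    rw [← integral_const_mul]; congr 1; ext t; ring
  rw [e1]
  have hρ := hW.up_far hx
  have hρ0 := hW.nonneg x
  have e2 : (Lam * (1 + q) ^ (gexp γ m / (2 * m))) ^ (1 - m) = Lam ^ (1 - m) * (1 + q) ^ (-(2 - γ) / 2) := by
    rw [Real.mul_rpow hLam0.le (by positivity), ← Real.rpow_mul hq0.le]
    congr 2
    rw [← gexp_div' (γ := γ) hm]; ring
  rw [e2] at hy
  have e3 : (1 + q) ^ (-γ / 2) * (1 + q) ^ (gexp γ m / (2 * m)) = (1 + q) ^ (gexp γ m / 2 - 1) := by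
    rw [← Real.rpow_add hq0]
    congr 1
    have := gexp_div (γ := γ) hm
    have e : gexp γ m / (2 * m) = gexp γ m / m / 2 := by ring
    rw [e, this]; ring
  have e4 : (1 + q) ^ (-γ / 2) * (1 + q) ^ (-(2 - γ) / 2) = (1 + q)⁻¹ := by
    rw [← Real.rpow_add hq0, ← Real.rpow_neg_one]
    congr 1
    ring
  calc ρ x * ∫ t, κ1 t * u x t
      ≤ (2 * |Cu| * (1 + q) ^ (-γ / 2)) * (C0 * (T * (Lam * (1 + q) ^ (gexp γ m / (2 * m))) +
        Lam ^ (1 - m) * (1 + q) ^ (-(2 - γ) / 2) * F)) :=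
        mul_le_mul hρ hy (integral_nonneg fun t => mul_nonneg (h0 t) (h.nonneg x t)) (by positivity)
    _ = K0 * T * Lam * ((1 + q) ^ (-γ / 2) * (1 + q) ^ (gexp γ m / (2 * m))) +
        K0 * Lam ^ (1 - m) * (((1 + q) ^ (-γ / 2) * (1 + q) ^ (-(2 - γ) / 2)) * F) := by
        rw [hK0]; ring
    _ ≤ _ := by
        rw [e3, e4]
        have : K0 * Lam ^ (1 - m) * ((1 + q)⁻¹ * F) ≤ c5 * ((1 + q)⁻¹ * F) := by gcongr
        have e5 : c5 * F / (1 + q) = c5 * ((1 + q)⁻¹ * F) := by rw [div_eq_mul_inv (c5 * F)]; ring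
        rw [e5]
        linarith

set_option maxHeartbeats 1000000 in
/-- Growth of the time-integrated pressure over large balls. -/
theorem growth (hN : 3 ≤ N) (hm : 1 < m) (hT : 0 < T) (hW : Wt N γ Cl Cu ρ) (hC0 : 0 ≤ C0) :
    ∃ C r0, 0 < C ∧ 1 ≤ r0 ∧ ∀ u, Sol ρ m T u → ∀ κ : ℝ → ℝ, ContDiff ℝ ∞ κ → HasCompactSupport κ →
      tsupport κ ⊆ Ioo 0 T → (∀ t, 0 ≤ κ t) → (∀ t, κ t ≤ 1) → (∀ t, -deriv κ t ≤ C0 * κ t ^ (1 / m)) →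
      ∀ R, 1 ≤ R → ∫ x in closedBall (0 : Eu N) R, (∫ t, κ t * u x t ^ m) ≤
        C * (1 + (∫ x in closedBall (0 : Eu N) r0, ∫ t, κ t * u x t ^ m) +
          ∫ x in closedBall (0 : Eu N) r0, ∫ t, max (-deriv κ t) 0 * (ρ x * u x t)) * R ^ (N + gexp γ m) := by
  have hn : (2:ℝ) < N := three_le_cast hN
  set n : ℝ := (N : ℝ) with hnd
  set lam := gexp γ m with hlam
  have hl : 0 < lam := gexp_pos hW.g2 hm
  set al := n - 2 + lam / 2 with hal
  have hal0 : 0 < al := by rw [hal]; linarith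
  set c5 := al * lam / 8 with hc5
  have hc50 : 0 < c5 := by positivity
  obtain ⟨K, hK0, hK⟩ := exists_source_bound hm hT hW hC0 hc50
  set r0 := √(1 + 4 * n / lam) with hr0
  have hr0' : r0 ^ 2 = 1 + 4 * n / lam := Real.sq_sqrt (by positivity)
  have hr01 : 1 ≤ r0 := by rw [hr0, Real.one_le_sqrt]; have : 0 ≤ 4 * n / lam := by positivity
                           linarith
  obtain ⟨C', hC', hvol⟩ := exists_rpow_ball hN (p := lam - 2 - al) (by rw [hal]; linarith)
  set c := √2 * 2 ^ (1 / al) with hc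
  have hc1 : 1 < c := by
    have h1 : 1 < √2 := by rw [Real.lt_sqrt] <;> norm_num
    have h2 : (1:ℝ) ≤ 2 ^ (1 / al) := Real.one_le_rpow (by norm_num) (by positivity)
    rw [hc]; nlinarith
  set c6 := c5 * Real.exp (-1) with hc6
  have hc60 : 0 < c6 := by positivity
  refine ⟨1 + c ^ (n - 2 + lam) / c6 * (K * C' + al * n + 1), r0, by positivity, hr01,
    fun u h κ hκ hκc hκs hκ0 hκ1 hκd R hR => ?_⟩
  obtain ⟨a, b', ha, hb', hk0, hk1⟩ := exists_Icc_of_smooth hκc hκs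
  set F : Eu N → ℝ := fun x => ∫ t, κ t * u x t ^ m with hF
  set k : Eu N → ℝ := fun x => ∫ t, max (-deriv κ t) 0 * (ρ x * u x t) with hk
  set G : Eu N → ℝ := fun x => ∫ t, deriv κ t * (ρ x * u x t) with hG
  have hF0 : ∀ x, 0 ≤ F x := h.F_nonneg hκ0
  have hρ0 := hW.nonneg
  have hk00 : ∀ x, 0 ≤ k x := fun x => integral_nonneg fun t =>
    mul_nonneg (le_max_right _ _) (mul_nonneg (hρ0 x) (h.nonneg x t))
  have hGk : ∀ x, -k x ≤ G x := fun x => by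
    have := neg_integral_le (fun t => ρ x * u x t) (deriv κ) fun t => mul_nonneg (hρ0 x) (h.nonneg x t)
    simp only [hG, hk]; linarith
  have hdc : Continuous (deriv κ) := hκ.continuous_deriv (by simp)
  have hFLI : LI F := h.LI_F hκ hκc hκs
  have hGLI : LI G := h.LI_F1 hκ hκc hκs
  have hkLI : LI k := by
    obtain ⟨C, hC⟩ := hdc.bounded_above_of_compact_support hκc.deriv
    refine LI.time_integral h.int1 (k := fun t => max (-deriv κ t) 0) (C := C) (by fun_prop) (fun t => ?_) ha hb' ?_
    · rw [abs_of_nonneg (le_max_right _ _)]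
      exact max_le ((neg_le_abs _).trans (hC t)) ((norm_nonneg _).trans (hC t))
    · intro t ht; simp [hk1 t ht]
  set L := c * R with hL
  have hR0 : 0 < R := by linarith
  have hL0 : 0 < L := by positivity
  have hRL : R < L := by rw [hL]; nlinarith
  have hL1 : 1 ≤ L := by linarith
  have hLal : L ^ al = 2 * (2 * R ^ 2) ^ (al / 2) := by
    have e1 : L ^ al = (L ^ 2) ^ (al / 2) := by
      rw [← Real.rpow_natCast, ← Real.rpow_mul hL0.le]; congr 1; push_cast; ring
    have e2 : L ^ 2 = 2 ^ (2 / al) * (2 * R ^ 2) := by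
      rw [hL, hc, mul_pow, mul_pow, Real.sq_sqrt (by norm_num), ← Real.rpow_natCast (2 ^ (1 / al)),
        ← Real.rpow_mul (by norm_num)]
      rw [show 1 / al * ((2 : ℕ) : ℝ) = 2 / al by push_cast; ring]; ring
    rw [e1, e2, Real.mul_rpow (by positivity) (by positivity), ← Real.rpow_mul (by norm_num),
      show 2 / al * (al / 2) = 1 by field_simp, Real.rpow_one]
  have hLa : 0 < L ^ al := by positivity
  obtain ⟨b, b1, b2, hb, hbq⟩ := exists_growth_prof hn hl hal hL0
  have hpot := (h.weak_prod hb 0 hκ hκc hκs).2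
  obtain ⟨hvi, hv⟩ := hvol r0 L hr01 hL0
  set V : Eu N → ℝ := fun x => (1 + ‖x‖ ^ 2) ^ ((lam - 2 - al) / 2) with hV
  have hcB : ∀ r, MeasurableSet (closedBall (0 : Eu N) r) := fun r => measurableSet_closedBall
  have hpt : ∀ x, (closedBall (0 : Eu N) R \ closedBall 0 r0).indicator (fun x => c6 / R ^ 2 * F x) x
      - (ball (0 : Eu N) L \ closedBall 0 r0).indicator (fun x => K * L ^ al * V x) x
      - (closedBall (0 : Eu N) r0).indicator (fun x => L ^ al * (al * n * F x + k x)) x ≤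
      F x * radL n b1 b2 (‖x - 0‖ ^ 2) + G x * b (‖x - 0‖ ^ 2) := by
    intro x
    obtain ⟨e, he0, he1, hb0, hbe, hrad, hrad', hwe, hz⟩ := hbq (‖x‖ ^ 2) (by positivity)
    rw [sub_zero]
    have hq1 : (1:ℝ) ≤ 1 + ‖x‖ ^ 2 := by nlinarith [sq_nonneg ‖x‖]
    have hGx := hGk x
    have hFx := hF0 x
    have hkx := hk00 x
    have hwL : L ^ al * (1 + ‖x‖ ^ 2) ^ (-(al / 2)) ≤ L ^ al :=
      mul_le_of_le_one_right hLa.le (Real.rpow_le_one_of_one_le_of_nonpos hq1 (by linarith))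
    have hGb : -(k x * b (‖x‖ ^ 2)) ≤ G x * b (‖x‖ ^ 2) := by
      have := mul_le_mul_of_nonneg_right hGx hb0
      linarith
    have hw0 : 0 < L ^ al * (1 + ‖x‖ ^ 2) ^ (-(al / 2)) := by positivity
    by_cases hx : ‖x‖ ≤ r0
    · have m1 : x ∈ closedBall (0 : Eu N) r0 := by simpa using hx
      rw [indicator_of_notMem (fun h => h.2 m1), indicator_of_notMem (fun h => h.2 m1), indicator_of_mem m1]
      have h1 : k x * b (‖x‖ ^ 2) ≤ k x * L ^ al := by
        exact mul_le_mul_of_nonneg_left (hbe.trans ((mul_le_of_le_one_right hw0.le he1).trans hwL)) hkx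
      have h2 : F x * -(al * n * L ^ al) ≤ F x * radL n b1 b2 (‖x‖ ^ 2) := by gcongr
      linarith
    · have m1 : x ∉ closedBall (0 : Eu N) r0 := by simpa using hx
      push Not at hx
      rw [indicator_of_notMem m1, sub_zero]
      by_cases hxL : ‖x‖ < L
      · have m2 : x ∈ ball (0 : Eu N) L \ closedBall 0 r0 := ⟨by simpa using hxL, m1⟩
        rw [indicator_of_mem m2]
        have hr := hrad (by rw [← hr0']; gcongr)
        have hkb := hK u h κ (fun t => max (-deriv κ t) 0) hκ.continuous.measurable a b' ha hb' hκ0 hκ1 hk0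
          (fun t => le_max_right _ _) (fun t => max_le (hκd t) (by have := hκ0 t; positivity)) x (by linarith)
        change k x ≤ K * (1 + ‖x‖ ^ 2) ^ (lam / 2 - 1) + c5 * F x / (1 + ‖x‖ ^ 2) at hkb
        have hV : (1 + ‖x‖ ^ 2) ^ (lam / 2 - 1) * (1 + ‖x‖ ^ 2) ^ (-(al / 2)) = V x := by
          rw [← Real.rpow_add (by linarith)]; simp only [hV]; congr 1; ring
        set w := L ^ al * (1 + ‖x‖ ^ 2) ^ (-(al / 2)) with hw
        have hwV : (1 + ‖x‖ ^ 2) ^ (lam / 2 - 1) * w = L ^ al * V x := by rw [← hV, hw]; ring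
        have hVx : 0 ≤ L ^ al * V x := by rw [← hwV]; positivity
        have h1 : k x * b (‖x‖ ^ 2) ≤ (K * (1 + ‖x‖ ^ 2) ^ (lam / 2 - 1) + c5 * F x / (1 + ‖x‖ ^ 2)) * (w * e) := by
          gcongr
        have h2 : F x * (al * (lam / 4) * (w * e) / (1 + ‖x‖ ^ 2)) ≤ F x * radL n b1 b2 (‖x‖ ^ 2) := by gcongr
        have h3 : F x * (al * (lam / 4) * (w * e) / (1 + ‖x‖ ^ 2)) = 2 * (c5 * F x * (w * e) / (1 + ‖x‖ ^ 2)) := by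
          rw [hc5]; ring
        have h4 : (K * (1 + ‖x‖ ^ 2) ^ (lam / 2 - 1) + c5 * F x / (1 + ‖x‖ ^ 2)) * (w * e) =
            K * (L ^ al * V x) * e + c5 * F x * (w * e) / (1 + ‖x‖ ^ 2) := by rw [← hwV]; ring
        have h5 : K * (L ^ al * V x) * e ≤ K * L ^ al * V x := by
          have : 0 ≤ K * (L ^ al * V x) := by positivity
          exact (mul_le_of_le_one_right this he1).trans_eq (by ring)
        have h6 : (closedBall (0 : Eu N) R \ closedBall 0 r0).indicator (fun x => c6 / R ^ 2 * F x) x ≤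
            c5 * F x * (w * e) / (1 + ‖x‖ ^ 2) := by
          by_cases hxR : ‖x‖ ≤ R
          · have m3 : x ∈ closedBall (0 : Eu N) R \ closedBall 0 r0 := ⟨by simpa using hxR, m1⟩
            rw [indicator_of_mem m3]
            have hqR : 1 + ‖x‖ ^ 2 ≤ 2 * R ^ 2 := by
              have h11 : ‖x‖ ^ 2 ≤ R ^ 2 := by gcongr
              have h12 : (1:ℝ) ≤ R ^ 2 := one_le_pow₀ hR
              linarith
            have hw2 : 2 ≤ w := by
              have : (2 * R ^ 2) ^ (-(al / 2)) ≤ (1 + ‖x‖ ^ 2) ^ (-(al / 2)) :=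
                Real.rpow_le_rpow_of_nonpos (by linarith) hqR (by linarith)
              have h7 : (2 * R ^ 2) ^ (al / 2) * (2 * R ^ 2) ^ (-(al / 2)) = 1 := by
                rw [← Real.rpow_add (by positivity)]; simp
              have h8 : 0 < (2 * R ^ 2) ^ (al / 2) := by positivity
              have h9 := mul_le_mul_of_nonneg_left this h8.le
              rw [hw, hLal, mul_assoc]
              linarith
            have hee := hwe hw2
            rw [le_div_iff₀ (by linarith), hc6]
            calc c5 * Real.exp (-1) / R ^ 2 * F x * (1 + ‖x‖ ^ 2) ≤ c5 * Real.exp (-1) / R ^ 2 * F x * (2 * R ^ 2) := by gcongr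
              _ = c5 * F x * (2 * Real.exp (-1)) := by field_simp
              _ ≤ _ := by gcongr
          · rw [indicator_of_notMem (fun h => hxR (by simpa using h.1))]
            positivity
        linarith
      · push Not at hxL
        obtain ⟨z1, z2, z3⟩ := hz (by gcongr)
        rw [z1, z3, indicator_of_notMem (fun h => by have : ‖x‖ ≤ R := by simpa using h.1
                                                     linarith),
          indicator_of_notMem (fun h => by have : ‖x‖ < L := by simpa using h.1
                                           linarith)]
        simp
  have i1 : Integrable ((closedBall (0 : Eu N) R \ closedBall 0 r0).indicator (fun x => c6 / R ^ 2 * F x)) :=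
    (integrable_indicator_iff ((hcB _).diff (hcB _))).2 (Integrable.const_mul ((hFLI R).mono_set sdiff_subset) _)
  have i2 : Integrable ((ball (0 : Eu N) L \ closedBall 0 r0).indicator (fun x => K * L ^ al * V x)) :=
    (integrable_indicator_iff (measurableSet_ball.diff (hcB _))).2 (Integrable.const_mul hvi _)
  have i3 : Integrable ((closedBall (0 : Eu N) r0).indicator (fun x => L ^ al * (al * n * F x + k x))) :=
    (integrable_indicator_iff (hcB _)).2 (Integrable.const_mul (((hFLI r0).const_mul _).add (hkLI r0)) _)
  have j1 := hFLI.integrable_mul (hb.cont_L n 0) (hb.compact_L n 0)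
  have j2 := hGLI.integrable_mul (hb.cont_b 0) (hb.compact_b 0)
  have hint := integral_mono ((i1.sub i2).sub i3) (j1.add j2) hpt
  have hint0 : ∫ x, ((fun x => F x * radL n b1 b2 (‖x - 0‖ ^ 2)) + fun x => G x * b (‖x - 0‖ ^ 2)) x = 0 :=
    (integral_add j1 j2).trans hpot
  rw [hint0] at hint
  have hint1 := (integral_sub (i1.sub i2) i3).symm.trans_le hint
  rw [integral_sub' i1 i2, integral_indicator ((hcB _).diff (hcB _)), integral_indicator (measurableSet_ball.diff (hcB _)),
    integral_indicator (hcB _), integral_const_mul, integral_const_mul, integral_const_mul,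
    integral_add ((hFLI r0).const_mul _) (hkLI r0), integral_const_mul] at hint1
  have hsplit : ∫ x in closedBall (0 : Eu N) R, F x ≤ (∫ x in closedBall (0 : Eu N) r0, F x) +
      ∫ x in closedBall (0 : Eu N) R \ closedBall 0 r0, F x := by
    rw [← setIntegral_union disjoint_sdiff_right ((hcB _).diff (hcB _)) (hFLI r0) ((hFLI R).mono_set sdiff_subset)]
    refine setIntegral_mono_set ((hFLI r0).union ((hFLI R).mono_set sdiff_subset)) (Eventually.of_forall hF0) ?_
    refine LE.le.eventuallyLE ?_
    rw [union_sdiff_self]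
    exact subset_union_right
  set I1 := ∫ x in closedBall (0 : Eu N) R \ closedBall 0 r0, F x with hI1
  set A := ∫ x in closedBall (0 : Eu N) r0, F x with hA
  set A2 := ∫ x in closedBall (0 : Eu N) r0, k x with hA2
  have hA0 : 0 ≤ A := setIntegral_nonneg (hcB _) fun x _ => hF0 x
  have hA20 : 0 ≤ A2 := setIntegral_nonneg (hcB _) fun x _ => hk00 x
  generalize (∫ x in ball (0 : Eu N) L \ closedBall 0 r0, V x) = IV at hint1 hv
  have ep : lam - 2 - al + (N : ℝ) = lam / 2 := by rw [hal]; ring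
  rw [ep] at hv
  set Y := L ^ (n - 2 + lam) with hY
  have hYe : L ^ al * L ^ (lam / 2) = Y := by rw [hY, ← Real.rpow_add hL0]; congr 1; rw [hal]; ring
  have hYa : L ^ al ≤ Y := Real.rpow_le_rpow_of_exponent_le hL1 (by rw [hal]; linarith)
  have hY0 : 0 < Y := by positivity
  have hb1 : c6 / R ^ 2 * I1 ≤ Y * (K * C' + al * n + 1) * (1 + A + A2) := by
    have q1 : K * L ^ al * IV ≤ K * C' * Y := by
      calc K * L ^ al * IV ≤ K * L ^ al * (C' * L ^ (lam / 2)) := by gcongr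
        _ = K * C' * (L ^ al * L ^ (lam / 2)) := by ring
        _ = _ := by rw [hYe]
    have q2 : L ^ al * (al * n * A + A2) ≤ Y * (al * n * A + A2) := by gcongr
    have q3 : 0 ≤ Y * (K * C' + al * n + 1) * 1 := by positivity
    have q4 : 0 ≤ Y * (K * C' + 1) * A := by positivity
    have q5 : 0 ≤ Y * (K * C' + al * n) * A2 := by positivity
    have q6 : 0 ≤ Y * (al * n + 1) := by positivity
    have e : Y * (K * C' + al * n + 1) * (1 + A + A2) = K * C' * Y + Y * (al * n + 1) + (Y * (al * n * A + A2)) +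
      Y * (K * C' + 1) * A + Y * (K * C' + al * n) * A2 := by ring
    rw [e]; linarith
  have hYR : Y * R ^ 2 = c ^ (n - 2 + lam) * R ^ (n + lam) := by
    rw [hY, hL, Real.mul_rpow (by positivity) hR0.le, mul_assoc]
    congr 1
    rw [← Real.rpow_natCast R 2, ← Real.rpow_add hR0]; congr 1; push_cast; ring
  have hI1b : I1 ≤ c ^ (n - 2 + lam) / c6 * (K * C' + al * n + 1) * (1 + A + A2) * R ^ (n + lam) := by
    have e : I1 = R ^ 2 / c6 * (c6 / R ^ 2 * I1) := by field_simp
    rw [e]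
    calc R ^ 2 / c6 * (c6 / R ^ 2 * I1) ≤ R ^ 2 / c6 * (Y * (K * C' + al * n + 1) * (1 + A + A2)) := by gcongr
      _ = (Y * R ^ 2) / c6 * (K * C' + al * n + 1) * (1 + A + A2) := by ring
      _ = _ := by rw [hYR]; ring
  have hRp : 1 ≤ R ^ (n + lam) := Real.one_le_rpow hR (by linarith)
  have : A ≤ (1 + A + A2) * R ^ (n + lam) := by nlinarith
  exact (hsplit.trans (add_le_add this hI1b)).trans_eq (by ring)

lemma one_add_norm_comparable {ε : ℝ} (hε : ε ≤ 1 / 2) {y : Eu N} (h : ‖y - x‖ < ε * (1 + ‖x‖)) :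
    1 + ‖y‖ ≤ 2 * (1 + ‖x‖) ∧ 1 + ‖x‖ ≤ 2 * (1 + ‖y‖) := by
  have h1 : ‖y‖ ≤ ‖x‖ + ‖y - x‖ := by simpa using norm_add_le x (y - x)
  have h2 : ‖x‖ ≤ ‖y‖ + ‖y - x‖ := by
    have := norm_sub_le y (y - x); simpa using this
  have h3 : ε * (1 + ‖x‖) ≤ 1 / 2 * (1 + ‖x‖) := by gcongr
  constructor <;> nlinarith [norm_nonneg x, norm_nonneg y]

lemma rpow_comparable (p : ℝ) (ha : 0 < a) (hb : 0 < b) (h1 : a ≤ 2 * b) (h2 : b ≤ 2 * a) :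
    a ^ p ≤ 2 ^ |p| * b ^ p := by
  rcases le_total 0 p with hp | hp
  · rw [abs_of_nonneg hp, ← Real.mul_rpow (by norm_num) hb.le]
    exact Real.rpow_le_rpow ha.le h1 hp
  · have : a ^ p ≤ (b / 2) ^ p := Real.rpow_le_rpow_of_nonpos (by positivity) (by linarith) hp
    rw [Real.div_rpow hb.le (by norm_num)] at this
    rw [abs_of_nonpos hp, Real.rpow_neg (by norm_num)]
    rwa [div_eq_inv_mul] at this

lemma newton_weight_le (hN : 3 ≤ N) (h0 : 0 ≤ γ) (h2 : γ < 2) (p : ℝ) : ∃ C, 0 < C ∧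
    ∀ ε, 0 < ε → ε ≤ 1 / 2 → ∀ x : Eu N, ∫⁻ y in ball x (ε * (1 + ‖x‖)),
      ofReal (‖y‖ ^ (-γ) * (1 + ‖y‖) ^ p) * ofReal (‖y - x‖ ^ (2 - N : ℝ)) ≤
        ofReal (C * ε ^ (2 - γ) * (1 + ‖x‖) ^ (p + (2 - γ))) := by
  obtain ⟨C, hC, h⟩ := exists_newton_rpow hN h0 h2
  refine ⟨2 ^ |p| * C, by positivity, fun ε hε hε2 x => ?_⟩
  have hx : 0 < 1 + ‖x‖ := by positivity
  calc ∫⁻ y in ball x (ε * (1 + ‖x‖)),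
      ofReal (‖y‖ ^ (-γ) * (1 + ‖y‖) ^ p) * ofReal (‖y - x‖ ^ (2 - N : ℝ))
      ≤ ∫⁻ y in ball x (ε * (1 + ‖x‖)), ofReal (2 ^ |p| * (1 + ‖x‖) ^ p) *
        (ofReal (‖y‖ ^ (-γ)) * ofReal (‖y - x‖ ^ (2 - N : ℝ))) := by
        refine setLIntegral_mono' measurableSet_ball fun y hy => ?_
        rw [← mul_assoc, ← ENNReal.ofReal_mul (p := 2 ^ |p| * (1 + ‖x‖) ^ p) (by positivity)]
        refine mul_le_mul_left (ENNReal.ofReal_le_ofReal ?_) _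
        obtain ⟨h1, h2⟩ := one_add_norm_comparable hε2 (by simpa [dist_eq_norm] using hy)
        rw [mul_comm]
        gcongr
        exact rpow_comparable p (by positivity) hx h1 h2
    _ = ofReal (2 ^ |p| * (1 + ‖x‖) ^ p) * ∫⁻ y in ball x (ε * (1 + ‖x‖)),
        (ofReal (‖y‖ ^ (-γ)) * ofReal (‖y - x‖ ^ (2 - N : ℝ))) :=
        lintegral_const_mul _ (by fun_prop)
    _ ≤ ofReal (2 ^ |p| * (1 + ‖x‖) ^ p) * ofReal (C * (ε * (1 + ‖x‖)) ^ (2 - γ)) :=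
        mul_le_mul_right (h x _ (by positivity)) _
    _ = _ := by
        rw [← ENNReal.ofReal_mul (by positivity), Real.mul_rpow hε.le hx.le, Real.rpow_add hx]
        congr 1; ring

lemma newton_weight_dual (hN : 3 ≤ N) (h0 : 0 ≤ γ) (h2 : γ < 2) (M : ℝ) : ∃ C, 0 < C ∧
    ∀ ε, 0 < ε → ε ≤ 1 / 4 → ∀ g : Eu N → ℝ≥0∞, Measurable g →
      ∫⁻ x, ofReal (‖x‖ ^ (-γ) * (1 + ‖x‖) ^ (-M)) * ∫⁻ y in ball x (ε * (1 + ‖x‖)),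
        g y * ofReal (‖y - x‖ ^ (2 - N : ℝ)) ≤
      ofReal (C * ε ^ (2 - γ)) * ∫⁻ y, g y * ofReal ((1 + ‖y‖) ^ (2 - γ - M)) := by
  obtain ⟨C, hC, h⟩ := newton_weight_le hN h0 h2 (-M)
  refine ⟨C * 2 ^ (2 - γ), by positivity, fun ε hε hε2 g hg => ?_⟩
  set S : Set (Eu N × Eu N) := {p | ‖p.2 - p.1‖ < ε * (1 + ‖p.1‖)} with hS
  have hSm : MeasurableSet S := measurableSet_lt (by fun_prop) (by fun_prop)
  set k : Eu N × Eu N → ℝ≥0∞ := S.indicator fun p =>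
    ofReal (‖p.1‖ ^ (-γ) * (1 + ‖p.1‖) ^ (-M)) * (g p.2 * ofReal (‖p.2 - p.1‖ ^ (2 - N : ℝ))) with hk
  have hkm : Measurable k := by
    refine Measurable.indicator ?_ hSm
    have := hg.comp (measurable_snd : Measurable (Prod.snd : Eu N × Eu N → Eu N))
    simp only [Function.comp_def] at this
    fun_prop
  have e1 : ∀ x : Eu N, ofReal (‖x‖ ^ (-γ) * (1 + ‖x‖) ^ (-M)) * ∫⁻ y in ball x (ε * (1 + ‖x‖)),
        g y * ofReal (‖y - x‖ ^ (2 - N : ℝ)) = ∫⁻ y, k (x, y) := fun x => by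
    rw [← lintegral_const_mul _ (by fun_prop), ← lintegral_indicator measurableSet_ball]
    refine lintegral_congr fun y => ?_
    by_cases hy : ‖y - x‖ < ε * (1 + ‖x‖)
    · have m1 : y ∈ ball x (ε * (1 + ‖x‖)) := by simpa [dist_eq_norm] using hy
      have m2 : (x, y) ∈ S := hy
      rw [indicator_of_mem m1, hk, indicator_of_mem m2]
    · have m1 : y ∉ ball x (ε * (1 + ‖x‖)) := by simpa [dist_eq_norm] using hy
      have m2 : (x, y) ∉ S := hy
      rw [indicator_of_notMem m1, hk, indicator_of_notMem m2]
  calc _ = ∫⁻ x, ∫⁻ y, k (x, y) := lintegral_congr e1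
    _ = ∫⁻ y, ∫⁻ x, k (x, y) := lintegral_lintegral_swap (f := fun x y => k (x, y)) hkm.aemeasurable
    _ ≤ ∫⁻ y, ofReal (C * 2 ^ (2 - γ) * ε ^ (2 - γ)) * (g y * ofReal ((1 + ‖y‖) ^ (2 - γ - M))) := by
        refine lintegral_mono fun y => ?_
        have hb := h (2 * ε) (by positivity) (by linarith) y
        calc ∫⁻ x, k (x, y) ≤ ∫⁻ x, (ball y (2 * ε * (1 + ‖y‖))).indicator (fun x => g y *
              (ofReal (‖x‖ ^ (-γ) * (1 + ‖x‖) ^ (-M)) * ofReal (‖x - y‖ ^ (2 - N : ℝ)))) x := by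
              refine lintegral_mono fun x => ?_
              by_cases hy : ‖y - x‖ < ε * (1 + ‖x‖)
              · have m1 : x ∈ ball y (2 * ε * (1 + ‖y‖)) := by
                  have := (one_add_norm_comparable (by linarith) hy).2
                  rw [mem_ball, dist_eq_norm, norm_sub_rev]
                  nlinarith
                have m2 : (x, y) ∈ S := hy
                simp only [hk]
                rw [indicator_of_mem m1, indicator_of_mem m2, norm_sub_rev y x]
                exact (by ring : _ = _).le
              · have m2 : (x, y) ∉ S := hy
                simp only [hk]
                rw [indicator_of_notMem m2]
                exact zero_le
          _ = g y * ∫⁻ x in ball y (2 * ε * (1 + ‖y‖)), ofReal (‖x‖ ^ (-γ) * (1 + ‖x‖) ^ (-M)) *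
              ofReal (‖x - y‖ ^ (2 - N : ℝ)) := by
              rw [lintegral_indicator measurableSet_ball, lintegral_const_mul _ (by fun_prop)]
          _ ≤ g y * ofReal (C * (2 * ε) ^ (2 - γ) * (1 + ‖y‖) ^ (-M + (2 - γ))) := mul_le_mul_right hb _
          _ = _ := by
              rw [Real.mul_rpow (by norm_num) hε.le, show C * (2 ^ (2 - γ) * ε ^ (2 - γ)) * (1 + ‖y‖) ^ (-M + (2 - γ)) =
                (C * 2 ^ (2 - γ) * ε ^ (2 - γ)) * (1 + ‖y‖) ^ (2 - γ - M) by
                  rw [show -M + (2 - γ) = 2 - γ - M by ring]; ring, ENNReal.ofReal_mul (by positivity)]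
              ring
    _ = _ := lintegral_const_mul _ (by fun_prop)

/-- Absorption: a function dominated by a power plus a small local Newtonian potential of itself
is dominated by the power. -/
lemma exists_absorb (hN : 3 ≤ N) (h0 : 0 ≤ γ) (h2 : γ < 2) (p M : ℝ) {c : ℝ} (hc : 0 ≤ c) :
    ∃ ε, 0 < ε ∧ ε ≤ 1 / 4 ∧ ∀ (F : Eu N → ℝ≥0∞) (M0 : ℝ), Measurable F → 0 ≤ M0 →
      ∫⁻ x, ofReal (‖x‖ ^ (-γ) * (1 + ‖x‖) ^ (-M)) * F x ≠ (⊤ : ℝ≥0∞) →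
      (∀ᵐ x, F x ≤ ofReal (M0 * (1 + ‖x‖) ^ p) + ∫⁻ y in ball x (ε * (1 + ‖x‖)),
        ofReal (c * (‖y‖ ^ (-γ) * (1 + ‖y‖) ^ (γ - 2))) * F y * ofReal (‖y - x‖ ^ (2 - N : ℝ))) →
      ∀ᵐ x, F x ≤ ofReal (2 * M0 * (1 + ‖x‖) ^ p) := by
  obtain ⟨C1, hC1, h1⟩ := newton_weight_le hN h0 h2 (γ - 2 + p)
  obtain ⟨C2, hC2, h2'⟩ := newton_weight_dual hN h0 h2 M
  obtain ⟨ε, hε, hε4, he1, he2⟩ : ∃ ε, 0 < ε ∧ ε ≤ 1 / 4 ∧ c * (C1 * ε ^ (2 - γ)) ≤ 1 / 2 ∧ c * (C2 * ε ^ (2 - γ)) ≤ 1 / 2 := by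
    have hlim : Tendsto (fun ε : ℝ => ε ^ (2 - γ)) (𝓝[>] 0) (𝓝 0) := by
      have := (Real.continuousAt_rpow_const 0 (2 - γ) (Or.inr (by linarith))).tendsto
      rw [Real.zero_rpow (by linarith)] at this
      exact this.mono_left nhdsWithin_le_nhds
    have l1 := (hlim.const_mul (c * C1)).eventually (ge_mem_nhds (show c * C1 * 0 < 1 / 2 by norm_num))
    have l2 := (hlim.const_mul (c * C2)).eventually (ge_mem_nhds (show c * C2 * 0 < 1 / 2 by norm_num))
    have l3 : ∀ᶠ ε : ℝ in 𝓝[>] 0, ε ∈ Ioc (0:ℝ) (1 / 4) := Ioc_mem_nhdsGT (by norm_num)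
    obtain ⟨ε, a1, a2, a3⟩ := (l1.and (l2.and l3)).exists
    exact ⟨ε, a3.1, a3.2, by linarith, by linarith⟩
  refine ⟨ε, hε, hε4, fun F M0 hF hM0 hfin hle => ?_⟩
  set h : Eu N → ℝ≥0∞ := fun x => F x - ofReal (2 * M0 * (1 + ‖x‖) ^ p) with hh
  have hm : Measurable h := by fun_prop
  set j : Eu N → ℝ≥0∞ := fun y => ofReal (c * (‖y‖ ^ (-γ) * (1 + ‖y‖) ^ (γ - 2))) with hj
  have hjm : Measurable j := by fun_prop
  set T : (Eu N → ℝ≥0∞) → Eu N → ℝ≥0∞ := fun f x => ∫⁻ y in ball x (ε * (1 + ‖x‖)),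
        j y * f y * ofReal (‖y - x‖ ^ (2 - N : ℝ)) with hT
  have hTw : ∀ x, T (fun y => ofReal (2 * M0 * (1 + ‖y‖) ^ p)) x ≤ ofReal (M0 * (1 + ‖x‖) ^ p) := fun x => by
    calc _ = ∫⁻ y in ball x (ε * (1 + ‖x‖)), ofReal (2 * M0 * c) *
          (ofReal (‖y‖ ^ (-γ) * (1 + ‖y‖) ^ (γ - 2 + p)) * ofReal (‖y - x‖ ^ (2 - N : ℝ))) := by
          refine lintegral_congr fun y => ?_
          rw [← mul_assoc]
          congr 1
          rw [hj, ← ENNReal.ofReal_mul (by positivity), ← ENNReal.ofReal_mul (by positivity),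
            Real.rpow_add (by positivity)]
          congr 1; ring
      _ = ofReal (2 * M0 * c) * _ := lintegral_const_mul _ (by fun_prop)
      _ ≤ ofReal (2 * M0 * c) * ofReal (C1 * ε ^ (2 - γ) * (1 + ‖x‖) ^ (γ - 2 + p + (2 - γ))) :=
          mul_le_mul_right (h1 ε hε (by linarith) x) _
      _ ≤ _ := by
          rw [← ENNReal.ofReal_mul (by positivity), show γ - 2 + p + (2 - γ) = p by ring]
          apply ENNReal.ofReal_le_ofReal
          have : 0 ≤ M0 * (1 + ‖x‖) ^ p := by positivity
          nlinarith
  have key : ∀ᵐ x, h x ≤ T h x := by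
    filter_upwards [hle] with x hx
    have e1 : T F x ≤ T h x + T (fun y => ofReal (2 * M0 * (1 + ‖y‖) ^ p)) x := by
      simp only [hT]
      rw [← lintegral_add_left (by fun_prop)]
      refine lintegral_mono fun y => ?_
      have : F y ≤ h y + ofReal (2 * M0 * (1 + ‖y‖) ^ p) := le_tsub_add
      calc j y * F y * ofReal (‖y - x‖ ^ (2 - N : ℝ)) ≤
          j y * (h y + ofReal (2 * M0 * (1 + ‖y‖) ^ p)) * ofReal (‖y - x‖ ^ (2 - N : ℝ)) := by gcongr
        _ = _ := by ring
    have e2 : ofReal (2 * M0 * (1 + ‖x‖) ^ p) = ofReal (M0 * (1 + ‖x‖) ^ p) + ofReal (M0 * (1 + ‖x‖) ^ p) := by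
      rw [← ENNReal.ofReal_add (by positivity) (by positivity)]; congr 1; ring
    simp only [hh]
    rw [tsub_le_iff_left, e2, add_assoc]
    refine hx.trans (add_le_add le_rfl ?_)
    exact (e1.trans (add_le_add le_rfl (hTw x))).trans_eq (add_comm _ _)
  set ν : Eu N → ℝ≥0∞ := fun x => ofReal (‖x‖ ^ (-γ) * (1 + ‖x‖) ^ (-M)) with hν
  have hνm : Measurable ν := by fun_prop
  have hT2 : ∫⁻ x, ν x * T h x ≤ ofReal (1 / 2) * ∫⁻ x, ν x * h x := by
    refine (h2' ε hε hε4 (fun y => j y * h y) (by fun_prop)).trans ?_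
    calc _ = ofReal (C2 * ε ^ (2 - γ)) * ∫⁻ y, ofReal c * (ν y * h y) := by
          congr 1
          refine lintegral_congr fun y => ?_
          have : j y * ofReal ((1 + ‖y‖) ^ (2 - γ - M)) = ofReal c * ν y := by
            rw [hj, hν, ← ENNReal.ofReal_mul (by positivity), ← ENNReal.ofReal_mul (by positivity)]
            congr 1
            rw [show -M = (γ - 2) + (2 - γ - M) by ring, Real.rpow_add (by positivity)]
            ring
          rw [mul_right_comm, this, mul_assoc]
      _ = ofReal (c * (C2 * ε ^ (2 - γ))) * ∫⁻ y, ν y * h y := by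
          rw [lintegral_const_mul _ (by fun_prop), ← mul_assoc, ← ENNReal.ofReal_mul (by positivity)]
          congr 2; ring
      _ ≤ _ := mul_le_mul_left (ENNReal.ofReal_le_ofReal he2) _
  have hfin2 : ∫⁻ x, ν x * h x ≠ (⊤ : ℝ≥0∞) :=
    ne_top_of_le_ne_top hfin (lintegral_mono fun x => mul_le_mul_right tsub_le_self _)
  have hle2 : ∫⁻ x, ν x * h x ≤ ofReal (1 / 2) * ∫⁻ x, ν x * h x :=
    (lintegral_mono_ae (by filter_upwards [key] with x hx; exact mul_le_mul_right hx _)).trans hT2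
  have hz : ∫⁻ x, ν x * h x = 0 := by
    lift (∫⁻ x, ν x * h x) to NNReal using hfin2 with I
    rw [ofReal, ← ENNReal.coe_mul, ENNReal.coe_le_coe, ← NNReal.coe_le_coe] at hle2
    push_cast at hle2
    rw [Real.coe_toNNReal _ (by norm_num)] at hle2
    have : (I : ℝ) = 0 := le_antisymm (by linarith) I.2
    simpa using this
  rw [lintegral_eq_zero_iff (by fun_prop)] at hz
  have hne : ∀ᵐ x : Eu N, x ≠ 0 := by
    have := nontrivial_Eu hN
    exact Measure.ae_ne volume 0
  filter_upwards [hz, hne] with x hx hx0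
  have hν0 : ν x ≠ 0 := by
    have : 0 < ‖x‖ := norm_pos_iff.2 hx0
    simp only [hν, ne_eq, ENNReal.ofReal_eq_zero, not_le]
    positivity
  simp only [Pi.zero_apply, mul_eq_zero, hν0, false_or] at hx
  exact tsub_eq_zero_iff_le.1 hx

lemma exists_mean_le (hN : 3 ≤ N) : ∃ C, 0 < C ∧ ∀ (F : Eu N → ℝ) (A p : ℝ), LI F → (∀ x, 0 ≤ F x) →
    (∀ R, 1 ≤ R → ∫ x in closedBall (0 : Eu N) R, F x ≤ A * R ^ ((N : ℝ) + p)) → ∀ ε, 0 < ε → ε ≤ 1 → ∀ x,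
      ∫ y, F y * thK (ε * (1 + ‖x‖)) (y - x) ≤ C * A * ε ^ (-N : ℝ) * 2 ^ ((N : ℝ) + p) * (1 + ‖x‖) ^ p := by
  obtain ⟨C, hC, h⟩ := exists_thK_le hN
  refine ⟨C, hC, fun F A p hF h0 hA ε hε hε1 x => ?_⟩
  have hx : 0 < 1 + ‖x‖ := by positivity
  have hr : 0 < ε * (1 + ‖x‖) := by positivity
  have hR := hA (2 * (1 + ‖x‖)) (by linarith [norm_nonneg x])
  have i1 : Integrable ((closedBall (0 : Eu N) (2 * (1 + ‖x‖))).indicator F) :=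
    (integrable_indicator_iff measurableSet_closedBall).2 (hF _)
  calc ∫ y, F y * thK (ε * (1 + ‖x‖)) (y - x)
      ≤ ∫ y, (C * (ε * (1 + ‖x‖)) ^ (-N : ℝ)) * (closedBall (0 : Eu N) (2 * (1 + ‖x‖))).indicator F y := by
        refine integral_mono (hF.integrable_thK hr x) (i1.const_mul _) fun y => ?_
        by_cases hy : y ∈ closedBall (0 : Eu N) (2 * (1 + ‖x‖))
        · simp only [indicator_of_mem hy]
          rw [mul_comm]
          exact mul_le_mul_of_nonneg_right (h _ hr _) (h0 y)
        · simp only [indicator_of_notMem hy, mul_zero]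
          rw [thK_zero hr, mul_zero]
          rw [mem_closedBall_zero_iff, not_le] at hy
          have : ‖y‖ ≤ ‖x‖ + ‖y - x‖ := by simpa using norm_add_le x (y - x)
          nlinarith [norm_nonneg x]
    _ = (C * (ε * (1 + ‖x‖)) ^ (-N : ℝ)) * ∫ y in closedBall (0 : Eu N) (2 * (1 + ‖x‖)), F y := by
        rw [integral_const_mul, integral_indicator measurableSet_closedBall]
    _ ≤ (C * (ε * (1 + ‖x‖)) ^ (-N : ℝ)) * (A * (2 * (1 + ‖x‖)) ^ ((N : ℝ) + p)) := by
        exact mul_le_mul_of_nonneg_left hR (by positivity)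
    _ = _ := by
        have : (1 + ‖x‖) ^ p = (1 + ‖x‖) ^ (-N : ℝ) * (1 + ‖x‖) ^ ((N : ℝ) + p) := by
          rw [← Real.rpow_add hx]; congr 1; ring
        rw [Real.mul_rpow hε.le hx.le, Real.mul_rpow (by norm_num) hx.le, this]
        ring

lemma lintegral_growth_ne_top {F : Eu N → ℝ} {A : ℝ} (hq : 0 ≤ q) (hF : LI F) (h0 : ∀ x, 0 ≤ F x)
    (hA : ∀ R, 1 ≤ R → ∫ x in closedBall (0 : Eu N) R, F x ≤ A * R ^ q) :
    ∫⁻ x, ofReal ((1 + ‖x‖) ^ (-(q + 2))) * ofReal (F x) ≠ (⊤ : ℝ≥0∞) := by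
  have hA0 : 0 ≤ A := by
    have := (setIntegral_nonneg (μ := volume) measurableSet_closedBall fun x _ => h0 x).trans (hA 1 le_rfl)
    simpa using this
  set S : ℕ → Set (Eu N) := fun n => {x | (n : ℝ) ≤ ‖x‖ ∧ ‖x‖ < n + 1} with hS
  have hSm : ∀ n, MeasurableSet (S n) := fun n =>
    (measurableSet_le measurable_const measurable_norm).inter (measurableSet_lt measurable_norm measurable_const)
  have hU : (⋃ n, S n) = univ := by
    refine eq_univ_of_forall fun x => mem_iUnion.2 ⟨⌊‖x‖⌋₊, ?_⟩
    exact ⟨Nat.floor_le (norm_nonneg x), Nat.lt_floor_add_one _⟩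
  have hn : ∀ n : ℕ, ∫⁻ x in S n, ofReal ((1 + ‖x‖) ^ (-(q + 2))) * ofReal (F x) ≤
      ofReal (A * (1 / ((n + 1 : ℕ) : ℝ) ^ 2)) := fun n => by
    have hn0 : (0 : ℝ) < n + 1 := by positivity
    calc _ ≤ ∫⁻ x in S n, ofReal ((n + 1 : ℝ) ^ (-(q + 2))) * ofReal (F x) := by
          refine setLIntegral_mono' (hSm n) fun x hx => mul_le_mul_left (ENNReal.ofReal_le_ofReal ?_) _
          exact Real.rpow_le_rpow_of_nonpos hn0 (by linarith [hx.1]) (by linarith)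
      _ = ofReal ((n + 1 : ℝ) ^ (-(q + 2))) * ∫⁻ x in S n, ofReal (F x) :=
          lintegral_const_mul' _ _ ENNReal.ofReal_ne_top
      _ ≤ ofReal ((n + 1 : ℝ) ^ (-(q + 2))) * ∫⁻ x in closedBall 0 (n + 1 : ℝ), ofReal (F x) := by
          refine mul_le_mul_right (lintegral_mono_set fun x hx => ?_) _
          rw [mem_closedBall_zero_iff]; exact hx.2.le
      _ = ofReal ((n + 1 : ℝ) ^ (-(q + 2))) * ofReal (∫ x in closedBall 0 (n + 1 : ℝ), F x) := by
          rw [ofReal_integral_eq_lintegral_ofReal (hF _) (Eventually.of_forall h0)]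
      _ ≤ ofReal ((n + 1 : ℝ) ^ (-(q + 2))) * ofReal (A * (n + 1 : ℝ) ^ q) :=
          mul_le_mul_right (ENNReal.ofReal_le_ofReal (hA _ (by linarith [n.cast_nonneg (α := ℝ)]))) _
      _ = _ := by
          rw [← ENNReal.ofReal_mul (by positivity)]
          congr 1
          have : (n + 1 : ℝ) ^ (-(q + 2)) * (n + 1 : ℝ) ^ q = ((n + 1 : ℝ) ^ 2)⁻¹ := by
            rw [← Real.rpow_add hn0, show -(q + 2) + q = -(2 : ℕ) by push_cast; ring, Real.rpow_neg hn0.le,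
              Real.rpow_natCast]
          push_cast
          rw [one_div, ← this]; ring
  rw [← setLIntegral_univ, ← hU]
  refine ne_top_of_le_ne_top ?_ ((lintegral_iUnion_le _ _).trans (ENNReal.tsum_le_tsum hn))
  have hs : Summable fun n : ℕ => A * (1 / ((n + 1 : ℕ) : ℝ) ^ 2) :=
    ((summable_nat_add_iff 1).2 (Real.summable_one_div_nat_pow.2 one_lt_two)).mul_left A
  rw [← ENNReal.ofReal_tsum_of_nonneg (fun n => by positivity) hs]
  exact ENNReal.ofReal_ne_top

lemma exists_pow_cut {φ : ℝ → ℝ} (hφ : ContDiff ℝ ∞ φ) (h0 : ∀ t, 0 ≤ φ t) (h1 : ∀ t, φ t ≤ 1) {L : ℝ}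
    (hm : 1 < m) (hL : ∀ t, |deriv φ t| ≤ L) :
    ∃ j : ℕ, 1 ≤ j ∧ ∃ C, 0 ≤ C ∧ ∀ t, |deriv (fun t => φ t ^ j) t| ≤ C * (φ t ^ j) ^ (1 / m) := by
  obtain ⟨j, hj⟩ := exists_nat_ge (m / (m - 1) + 1)
  have hm1 : 0 < m - 1 := by linarith
  have hq : 0 < m / (m - 1) := by positivity
  have hL0 : 0 ≤ L := (abs_nonneg _).trans (hL 0)
  have hj1 : 1 ≤ j := by
    have : (1 : ℝ) ≤ j := by linarith
    exact_mod_cast this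
  refine ⟨j, hj1, j * L, by positivity, fun t => ?_⟩
  have hd : deriv (fun t => φ t ^ j) t = j * φ t ^ (j - 1) * deriv φ t := by
    exact (((hφ.differentiable (by simp)) t).hasDerivAt.pow j).deriv
  have hp : φ t ^ (j - 1) ≤ (φ t ^ j) ^ (1 / m) := by
    rw [← Real.rpow_natCast, ← Real.rpow_natCast, ← Real.rpow_mul (h0 t)]
    refine Real.rpow_le_rpow_of_exponent_ge' (h0 t) (h1 t) (by positivity) ?_
    push_cast [hj1]
    have : m / (m - 1) ≤ j := by linarith
    rw [div_le_iff₀ hm1] at this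
    rw [mul_one_div, div_le_iff₀ (by linarith)]
    linarith
  rw [hd, abs_mul, abs_mul, Nat.abs_cast, abs_of_nonneg (pow_nonneg (h0 t) _)]
  calc (j : ℝ) * φ t ^ (j - 1) * |deriv φ t| ≤ j * (φ t ^ j) ^ (1 / m) * L :=
        mul_le_mul (mul_le_mul_of_nonneg_left hp (Nat.cast_nonneg j)) (hL t) (abs_nonneg _)
          (mul_nonneg (Nat.cast_nonneg j) (Real.rpow_nonneg (pow_nonneg (h0 t) _) _))
    _ = _ := by ring

/-- A smooth admissible time weight. -/
structure TW (κ : ℝ → ℝ) (T m : ℝ) : Prop where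
  smooth : ContDiff ℝ ∞ κ
  compact : HasCompactSupport κ
  supp : tsupport κ ⊆ Ioo 0 T
  nonneg : ∀ t, 0 ≤ κ t
  le_one : ∀ t, κ t ≤ 1
  der : ∃ C0, 0 ≤ C0 ∧ ∀ t, |deriv κ t| ≤ C0 * κ t ^ (1 / m)

lemma Sol.measurable_F (h : Sol ρ m T u) (hκ : Measurable κ) :
    Measurable fun x => ∫ t, κ t * u x t ^ m := by
  have h1 : Measurable fun p : Eu N × ℝ => κ p.2 * u p.1 p.2 ^ m :=
    (hκ.comp measurable_snd).mul (h.meas.pow_const m)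
  exact (h1.stronglyMeasurable.integral_prod_right').measurable

lemma Sol.measurable_F1 (h : Sol ρ m T u) (hW : Wt N γ Cl Cu ρ) (hκ : Measurable κ) :
    Measurable fun x => ∫ t, κ t * (ρ x * u x t) := by
  have h1 : Measurable fun p : Eu N × ℝ => κ p.2 * (ρ p.1 * u p.1 p.2) :=
    (hκ.comp measurable_snd).mul ((hW.meas.comp measurable_fst).mul h.meas)
  exact (h1.stronglyMeasurable.integral_prod_right').measurable

lemma Sol.F_growth (hN : 3 ≤ N) (hm : 1 < m) (hT : 0 < T) (hW : Wt N γ Cl Cu ρ) (h : Sol ρ m T u)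
    (hκ : TW κ T m) : ∃ A, 0 ≤ A ∧ ∀ R, 1 ≤ R →
      ∫ x in closedBall (0 : Eu N) R, (∫ t, κ t * u x t ^ m) ≤ A * R ^ (N + gexp γ m) := by
  obtain ⟨C0, hC0, hd⟩ := hκ.der
  obtain ⟨C, r0, hC, hr0, hg⟩ := growth hN hm hT hW hC0
  have := hg u h κ hκ.smooth hκ.compact hκ.supp hκ.nonneg hκ.le_one
    fun t => (neg_le_abs _).trans (hd t)
  refine ⟨_, ?_, this⟩
  refine mul_nonneg hC.le (add_nonneg (add_nonneg zero_le_one ?_) ?_)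
  · exact setIntegral_nonneg measurableSet_closedBall fun x _ => h.F_nonneg hκ.nonneg x
  · exact setIntegral_nonneg measurableSet_closedBall fun x _ => integral_nonneg fun t =>
      mul_nonneg (le_max_right _ _) (mul_nonneg (hW.nonneg x) (h.nonneg x t))

/-- Time averages with an admissible weight are controlled by the pressure. -/
lemma Sol.avg_le (hm : 1 < m) (hT : 0 < T) (h : Sol ρ m T u) (hκ : TW κ T m)
    (hC0 : 0 ≤ C0) {κ1 : ℝ → ℝ} (h0 : ∀ t, 0 ≤ κ1 t) (h1 : ∀ t, κ1 t ≤ C0 * κ t ^ (1 / m)) (x : Eu N) :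
    ∫ t, κ1 t * u x t ≤ C0 * (T * (1 + ‖x‖) ^ (gexp γ m / m) +
      (1 + ‖x‖) ^ (γ - 2) * ∫ t, κ t * u x t ^ m) := by
  obtain ⟨a, b, ha, hb, hk0, -⟩ := exists_Icc_of_smooth hκ.compact hκ.supp
  have := h.time_young hm hT hκ.smooth.continuous.measurable hC0 hκ.nonneg hκ.le_one ha hb hk0 h0 h1 x
    (W := (1 + ‖x‖) ^ (gexp γ m / m)) (by positivity)
  rwa [← Real.rpow_mul (by positivity), gexp_div' hm, neg_sub] at this

set_option maxHeartbeats 1000000 in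
theorem Sol.pointwise (hN : 3 ≤ N) (hm : 1 < m) (hT : 0 < T) (hW : Wt N γ Cl Cu ρ) (h : Sol ρ m T u)
    (hκ : TW κ T m) : ∃ C, 0 ≤ C ∧
      ∀ᵐ x, ∫ t, κ t * u x t ^ m ≤ C * (1 + ‖x‖) ^ gexp γ m := by
  obtain ⟨A, hA0, hA⟩ := h.F_growth hN hm hT hW hκ
  obtain ⟨C0, hC0, hd⟩ := hκ.der
  obtain ⟨Cm, hCm, hmean⟩ := exists_mean_le hN
  have hn : (2:ℝ) < N := three_le_cast hN
  have hne := nontrivial_Eu hN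
  have hcK := cK_pos hN
  set lam := gexp γ m with hlam
  have hl : 0 < lam := gexp_pos hW.g2 hm
  set F : Eu N → ℝ := fun x => ∫ t, κ t * u x t ^ m with hF
  have hF0 : ∀ x, 0 ≤ F x := h.F_nonneg hκ.nonneg
  have hFm : Measurable F := h.measurable_F hκ.smooth.continuous.measurable
  have hFL : LI F := h.LI_F hκ.smooth hκ.compact hκ.supp
  set c' := |Cu| * C0 * (T + 1) with hc'
  have hc'0 : 0 ≤ c' := by positivity
  set nn : Eu N → ℝ := fun y => c' * (‖y‖ ^ (-γ) * (1 + ‖y‖) ^ (lam / m) + ‖y‖ ^ (-γ) * (1 + ‖y‖) ^ (γ - 2) * F y) with hnn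
  set f : Eu N → ℝ := fun y => ∫ t, deriv κ t * (ρ y * u y t) with hf
  have hfL : LI f := h.LI_F1 hκ.smooth hκ.compact hκ.supp
  set k : Eu N → ℝ := fun y => ∫ t, |deriv κ t| * (ρ y * u y t) with hk
  have hdm : Measurable (deriv κ) := (hκ.smooth.continuous_deriv (by simp)).measurable
  have hkL : LI k := by
    obtain ⟨a, c, ha, hc, hk0, hk1⟩ := exists_Icc_of_smooth hκ.compact hκ.supp
    obtain ⟨C, hC⟩ := (hκ.smooth.continuous_deriv (by simp)).bounded_above_of_compact_support hκ.compact.deriv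
    exact LI.time_integral h.int1 (k := fun t => |deriv κ t|) hdm.abs (fun t => by rw [abs_abs]; exact hC t) ha hc
      fun t ht => by rw [hk1 t ht, abs_zero]
  have hkm : Measurable k := h.measurable_F1 hW hdm.abs
  have hfk : ∀ y, f y ≤ k y := fun y => by
    refine (le_abs_self _).trans ?_
    have := norm_integral_le_integral_norm (μ := volume) fun t => deriv κ t * (ρ y * u y t)
    simp only [Real.norm_eq_abs, abs_mul, abs_of_nonneg (hW.nonneg y), abs_of_nonneg (h.nonneg y _)] at this
    exact this
  have hkn : ∀ y, y ≠ 0 → k y ≤ nn y := fun y hy => by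
    have h1 := h.avg_le (γ := γ) hm hT hκ hC0 (κ1 := fun t => |deriv κ t|) (fun t => abs_nonneg _) hd y
    have e : k y = ρ y * ∫ t, |deriv κ t| * u y t := by
      rw [hk, ← integral_const_mul]
      refine integral_congr_ae (Eventually.of_forall fun t => ?_)
      ring
    have hρ : ρ y ≤ |Cu| * ‖y‖ ^ (-γ) := (hW.up y hy).trans (by gcongr; exact le_abs_self _)
    rw [e]
    have i0 : 0 ≤ ∫ t, |deriv κ t| * u y t := integral_nonneg fun t => mul_nonneg (abs_nonneg _) (h.nonneg y t)
    have p1 : 0 ≤ (1 + ‖y‖) ^ (lam / m) := by positivity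
    have p2 : 0 ≤ (1 + ‖y‖) ^ (γ - 2) * F y := mul_nonneg (by positivity) (hF0 y)
    calc ρ y * ∫ t, |deriv κ t| * u y t ≤ (|Cu| * ‖y‖ ^ (-γ)) * (C0 * (T * (1 + ‖y‖) ^ (lam / m) + (1 + ‖y‖) ^ (γ - 2) * F y)) :=
          mul_le_mul hρ h1 i0 (by positivity)
      _ ≤ (|Cu| * ‖y‖ ^ (-γ)) * (C0 * ((T + 1) * ((1 + ‖y‖) ^ (lam / m) + (1 + ‖y‖) ^ (γ - 2) * F y))) := by
          refine mul_le_mul_of_nonneg_left (mul_le_mul_of_nonneg_left ?_ hC0) (by positivity)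
          nlinarith
      _ = nn y := by rw [hnn, hc']; ring
  have hy0 : ∀ᵐ y : Eu N, y ≠ 0 := Measure.ae_ne volume 0
  obtain ⟨ε, hε, hε4, habs⟩ := exists_absorb hN hW.g0 hW.g2 lam ((N : ℝ) + lam + 2) (c := (cK N)⁻¹ * c') (by positivity)
  obtain ⟨C1, hC1, hnw⟩ := newton_weight_le hN hW.g0 hW.g2 (lam / m)
  obtain ⟨C2, hC2, hnd⟩ := newton_weight_dual hN hW.g0 hW.g2 ((N : ℝ) + lam + 2)
  set M1 := Cm * A * ε ^ (-N : ℝ) * 2 ^ ((N : ℝ) + lam) with hM1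
  have hM10 : 0 ≤ M1 := by positivity
  set M2 := (cK N)⁻¹ * c' * (C1 * ε ^ (2 - γ)) with hM2
  have hM20 : 0 ≤ M2 := by positivity
  have hmn : ∀ x, ∫ y, F y * thK (ε * (1 + ‖x‖)) (y - x) ≤ M1 * (1 + ‖x‖) ^ lam := fun x =>
    hmean F A lam hFL hF0 hA ε hε (by linarith) x
  -- the common consequence of the sub-mean-value inequality
  have hsub : ∀ g : Eu N → ℝ, (∀ᵐ y, f y ≤ g y) → ∀ᵐ x, ofReal (F x) ≤ ofReal (M1 * (1 + ‖x‖) ^ lam) +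
      ofReal (cK N)⁻¹ * ∫⁻ y in ball x (ε * (1 + ‖x‖)), ofReal (g y) * ofReal (‖y - x‖ ^ (2 - N : ℝ)) := by
    intro g hg
    filter_upwards [submean hN hFL hfL hg] with x hx
    have h1 := hx (ε * (1 + ‖x‖)) (by positivity) (h.potAt hN hκ.smooth hκ.compact hκ.supp _ x)
    calc ofReal (F x) ≤ ofReal (M1 * (1 + ‖x‖) ^ lam + (cK N)⁻¹ * (cK N * (F x - ∫ y, F y * thK (ε * (1 + ‖x‖)) (y - x)))) := by
          apply ENNReal.ofReal_le_ofReal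
          rw [inv_mul_cancel_left₀ hcK.ne']
          linarith [hmn x]
      _ ≤ _ := ENNReal.ofReal_add_le
      _ ≤ _ := by
          refine add_le_add le_rfl ?_
          rw [ENNReal.ofReal_mul (by positivity)]
          exact mul_le_mul_right h1 _
  have hle : ∀ᵐ x, ofReal (F x) ≤ ofReal ((M1 + M2) * (1 + ‖x‖) ^ lam) + ∫⁻ y in ball x (ε * (1 + ‖x‖)),
        ofReal ((cK N)⁻¹ * c' * (‖y‖ ^ (-γ) * (1 + ‖y‖) ^ (γ - 2))) * ofReal (F y) * ofReal (‖y - x‖ ^ (2 - N : ℝ)) := by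
    have hfn : ∀ᵐ y, f y ≤ nn y := by
      filter_upwards [hy0] with y hy using (hfk y).trans (hkn y hy)
    filter_upwards [hsub nn hfn] with x hx
    refine hx.trans ?_
    have e1 : ofReal (cK N)⁻¹ * ∫⁻ y in ball x (ε * (1 + ‖x‖)), ofReal (nn y) * ofReal (‖y - x‖ ^ (2 - N : ℝ)) =
        ofReal ((cK N)⁻¹ * c') * (∫⁻ y in ball x (ε * (1 + ‖x‖)), ofReal (‖y‖ ^ (-γ) * (1 + ‖y‖) ^ (lam / m)) * ofReal (‖y - x‖ ^ (2 - N : ℝ))) + ∫⁻ y in ball x (ε * (1 + ‖x‖)),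
        ofReal ((cK N)⁻¹ * c' * (‖y‖ ^ (-γ) * (1 + ‖y‖) ^ (γ - 2))) * ofReal (F y) * ofReal (‖y - x‖ ^ (2 - N : ℝ)) := by
      rw [← lintegral_const_mul _ (by fun_prop), ← lintegral_const_mul _ (by fun_prop), ← lintegral_add_left (by fun_prop)]
      refine lintegral_congr fun y => ?_
      have q1 := hF0 y
      rw [hnn, ← ENNReal.ofReal_mul (by positivity), ← ENNReal.ofReal_mul (by positivity),
        ← ENNReal.ofReal_mul (by positivity), ← ENNReal.ofReal_mul (by positivity), ← ENNReal.ofReal_mul (by positivity),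
        ← ENNReal.ofReal_mul (by positivity), ← ENNReal.ofReal_add (by positivity) (by positivity)]
      congr 1; ring
    rw [e1, ← add_assoc]
    refine add_le_add ?_ le_rfl
    have h2 := mul_le_mul_right (hnw ε hε (by linarith) x) (ofReal ((cK N)⁻¹ * c'))
    refine (add_le_add le_rfl h2).trans ?_
    rw [← ENNReal.ofReal_mul (by positivity), ← ENNReal.ofReal_add (by positivity) (by positivity)]
    apply ENNReal.ofReal_le_ofReal
    have e : lam / m + (2 - γ) = lam := by rw [hlam, gexp_div hm]; ring
    rw [e, hM2]
    exact le_of_eq (by ring)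
  have hfin : ∫⁻ x, ofReal (‖x‖ ^ (-γ) * (1 + ‖x‖) ^ (-((N : ℝ) + lam + 2))) * ofReal (F x) ≠ (⊤ : ℝ≥0∞) := by
    rw [← lintegral_add_compl _ (measurableSet_ball (x := (0 : Eu N)) (ε := 1)), ENNReal.add_ne_top]
    constructor
    · set g : Eu N → ℝ≥0∞ := (closedBall (0 : Eu N) 3).indicator fun y => ofReal (k y) with hg
      have hgm : Measurable g := (by fun_prop : Measurable fun y => ofReal (k y)).indicator measurableSet_closedBall
      obtain ⟨C3, hC3, h3⟩ := exists_lintegral_rpow_ball_zero hN (γ := γ) (by linarith [hW.g2])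
      have hb : ∀ᵐ x, x ∈ ball (0 : Eu N) 1 → ofReal (‖x‖ ^ (-γ) * (1 + ‖x‖) ^ (-((N : ℝ) + lam + 2))) * ofReal (F x) ≤
          ofReal (M1 * 2 ^ lam) * ofReal (‖x‖ ^ (-γ)) + ofReal (cK N)⁻¹ * (ofReal (‖x‖ ^ (-γ) * (1 + ‖x‖) ^ (-((N : ℝ) + lam + 2))) *
          ∫⁻ y in ball x (ε * (1 + ‖x‖)), g y * ofReal (‖y - x‖ ^ (2 - N : ℝ))) := by
        filter_upwards [hsub k (Eventually.of_forall hfk)] with x hx hx1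
        rw [mem_ball_zero_iff] at hx1
        have e : ∫⁻ y in ball x (ε * (1 + ‖x‖)), ofReal (k y) * ofReal (‖y - x‖ ^ (2 - N : ℝ)) =
            ∫⁻ y in ball x (ε * (1 + ‖x‖)), g y * ofReal (‖y - x‖ ^ (2 - N : ℝ)) := by
          refine setLIntegral_congr_fun measurableSet_ball fun y hy => ?_
          have : y ∈ closedBall (0 : Eu N) 3 := by
            rw [mem_ball, dist_eq_norm] at hy
            rw [mem_closedBall_zero_iff]
            have : ‖y‖ ≤ ‖x‖ + ‖y - x‖ := by simpa using norm_add_le x (y - x)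
            nlinarith [norm_nonneg x]
          simp only [hg, indicator_of_mem this]
        rw [e] at hx
        refine (mul_le_mul_right hx _).trans ?_
        rw [mul_add]
        refine add_le_add ?_ (by rw [mul_left_comm])
        rw [← ENNReal.ofReal_mul (by positivity), ← ENNReal.ofReal_mul (by positivity)]
        apply ENNReal.ofReal_le_ofReal
        have q1 : (1 + ‖x‖) ^ (-((N : ℝ) + lam + 2)) ≤ 1 :=
          Real.rpow_le_one_of_one_le_of_nonpos (by linarith [norm_nonneg x]) (by linarith)
        have q2 : (1 + ‖x‖) ^ lam ≤ 2 ^ lam := Real.rpow_le_rpow (by positivity) (by linarith) hl.le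
        calc _ ≤ (‖x‖ ^ (-γ) * 1) * (M1 * 2 ^ lam) := by gcongr
          _ = _ := by ring
      refine ne_top_of_le_ne_top ?_ (setLIntegral_mono_ae' measurableSet_ball hb)
      rw [lintegral_add_left (by fun_prop), ENNReal.add_ne_top]
      constructor
      · rw [lintegral_const_mul _ (by fun_prop), h3 1 one_pos]
        exact ENNReal.mul_ne_top ENNReal.ofReal_ne_top ENNReal.ofReal_ne_top
      · rw [lintegral_const_mul' _ _ ENNReal.ofReal_ne_top]
        refine ENNReal.mul_ne_top ENNReal.ofReal_ne_top ?_
        refine ne_top_of_le_ne_top ?_ ((setLIntegral_le_lintegral _ _).trans (hnd ε hε hε4 g hgm))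
        refine ENNReal.mul_ne_top ENNReal.ofReal_ne_top ?_
        have hle1 : ∀ y, g y * ofReal ((1 + ‖y‖) ^ (2 - γ - ((N : ℝ) + lam + 2))) ≤ g y := fun y => by
          conv_rhs => rw [← mul_one (g y)]
          refine mul_le_mul_right ?_ _
          rw [ENNReal.ofReal_le_one]
          exact Real.rpow_le_one_of_one_le_of_nonpos (by linarith [norm_nonneg y]) (by linarith [hW.g0])
        refine ne_top_of_le_ne_top ?_ (lintegral_mono hle1)
        rw [hg, lintegral_indicator measurableSet_closedBall]
        exact (Integrable.lintegral_lt_top (hkL 3)).ne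
    · refine ne_top_of_le_ne_top (lintegral_growth_ne_top (q := (N : ℝ) + lam) (by positivity) hFL hF0 hA) ?_
      refine (setLIntegral_mono' measurableSet_ball.compl fun x hx => ?_).trans (setLIntegral_le_lintegral _ _)
      refine mul_le_mul_left (ENNReal.ofReal_le_ofReal ?_) _
      have : 1 ≤ ‖x‖ := by simpa using hx
      have q1 : ‖x‖ ^ (-γ) ≤ 1 := Real.rpow_le_one_of_one_le_of_nonpos this (by linarith [hW.g0])
      have q2 : 0 ≤ (1 + ‖x‖) ^ (-((N : ℝ) + lam + 2)) := by positivity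
      exact mul_le_of_le_one_left q2 q1
  have := habs (fun x => ofReal (F x)) (M1 + M2) (by fun_prop) (by positivity) hfin hle
  refine ⟨2 * (M1 + M2), by positivity, ?_⟩
  filter_upwards [this] with x hx
  exact (ENNReal.ofReal_le_ofReal_iff (by positivity)).1 hx

/-- Pointwise bound of admissible time averages of the solution. -/
lemma Sol.avg_bound (hN : 3 ≤ N) (hm : 1 < m) (hT : 0 < T) (hW : Wt N γ Cl Cu ρ) (h : Sol ρ m T u)
    (hκ : TW κ T m) : ∃ C, 0 ≤ C ∧ ∀ᵐ x, ∀ C0, 0 ≤ C0 → ∀ κ1 : ℝ → ℝ, (∀ t, 0 ≤ κ1 t) →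
      (∀ t, κ1 t ≤ C0 * κ t ^ (1 / m)) → ∫ t, κ1 t * u x t ≤ C0 * C * (1 + ‖x‖) ^ (gexp γ m / m) := by
  obtain ⟨C, hC, hF⟩ := h.pointwise hN hm hT hW hκ
  refine ⟨T + C, by positivity, ?_⟩
  filter_upwards [hF] with x hx C0 hC0 κ1 h0 h1
  refine (h.avg_le (γ := γ) hm hT hκ hC0 h0 h1 x).trans ?_
  have hx0 : 0 < 1 + ‖x‖ := by positivity
  have e : (1 + ‖x‖) ^ (γ - 2) * (1 + ‖x‖) ^ gexp γ m = (1 + ‖x‖) ^ (gexp γ m / m) := by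
    rw [← Real.rpow_add hx0, gexp_div hm]; congr 1; ring
  rw [mul_assoc]
  refine mul_le_mul_of_nonneg_left ?_ hC0
  calc _ ≤ T * (1 + ‖x‖) ^ (gexp γ m / m) + (1 + ‖x‖) ^ (γ - 2) * (C * (1 + ‖x‖) ^ gexp γ m) := by gcongr
    _ = (T + C) * (1 + ‖x‖) ^ (gexp γ m / m) := by rw [← e]; ring

/-- A twice continuously differentiable radial profile. -/
structure Rad (g g1 g2 : ℝ → ℝ) : Prop where
  d1 : ∀ q, -1 < q → HasDerivAt g (g1 q) q
  d2 : ∀ q, -1 < q → HasDerivAt g1 (g2 q) q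
  c2 : ContinuousOn g2 (Ioi (-1))

lemma Prof.rad {b b1 b2 : ℝ → ℝ} (h : Prof b b1 b2) : Rad b b1 b2 := ⟨h.d1, h.d2, h.continuousOn2⟩

/-- The second partial derivative of a radial function. -/
def rad2 (b1 b2 : ℝ → ℝ) (x0 : Eu N) (i : Fin N) (x : Eu N) : ℝ :=
  4 * b2 (‖x - x0‖ ^ 2) * (x i - x0 i) ^ 2 + 2 * b1 (‖x - x0‖ ^ 2)

lemma sum_rad2 (b1 b2 : ℝ → ℝ) (x0 x : Eu N) :
    ∑ i, rad2 b1 b2 x0 i x = radL N b1 b2 (‖x - x0‖ ^ 2) := by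
  have e3 : ‖x - x0‖ ^ 2 = ∑ i, (x i - x0 i) ^ 2 := by
    rw [EuclideanSpace.norm_sq_eq]; simp
  simp only [rad2]
  rw [Finset.sum_add_distrib, ← Finset.mul_sum, radL, ← e3]
  simp
  ring

section rad
variable {g g1 g2 : ℝ → ℝ}

lemma Rad.cont0 (h : Rad g g1 g2) (x0 : Eu N) : Continuous fun x : Eu N => g (‖x - x0‖ ^ 2) :=
  ContinuousOn.comp_continuous (s := Ioi (-1)) (fun q hq => (h.d1 q hq).continuousAt.continuousWithinAt) (by fun_prop)
    fun x => lt_of_lt_of_le (by norm_num : (-1 : ℝ) < 0) (sq_nonneg _)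

lemma Rad.cont1 (h : Rad g g1 g2) (x0 : Eu N) : Continuous fun x : Eu N => g1 (‖x - x0‖ ^ 2) :=
  ContinuousOn.comp_continuous (s := Ioi (-1)) (fun q hq => (h.d2 q hq).continuousAt.continuousWithinAt) (by fun_prop)
    fun x => lt_of_lt_of_le (by norm_num : (-1 : ℝ) < 0) (sq_nonneg _)

lemma Rad.cont2 (h : Rad g g1 g2) (x0 : Eu N) : Continuous fun x : Eu N => g2 (‖x - x0‖ ^ 2) :=
  h.c2.comp_continuous (by fun_prop) fun x => lt_of_lt_of_le (by norm_num : (-1 : ℝ) < 0) (sq_nonneg _)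

lemma Rad.contL (h : Rad g g1 g2) (n : ℝ) (x0 : Eu N) : Continuous fun x : Eu N => radL n g1 g2 (‖x - x0‖ ^ 2) := by
  have h1 := h.cont1 x0
  have h2 := h.cont2 x0
  exact ((by fun_prop : Continuous fun x : Eu N => 4 * ‖x - x0‖ ^ 2).mul h2).add (continuous_const.mul h1)

lemma Rad.cont_rad2 (h : Rad g g1 g2) (x0 : Eu N) (i : Fin N) : Continuous (rad2 g1 g2 x0 i) := by
  have h1 := h.cont1 x0
  have h2 := h.cont2 x0
  exact ((continuous_const.mul h2).mul (by fun_prop)).add (continuous_const.mul h1)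

lemma hasDerivAt_line_sq (x0 x : Eu N) (i : Fin N) :
    HasDerivAt (fun t : ℝ => ‖x + t • EuclideanSpace.single i (1 : ℝ) - x0‖ ^ 2) (2 * (x i - x0 i)) 0 := by
  have h1 : HasDerivAt (fun t : ℝ => x + t • EuclideanSpace.single i (1 : ℝ)) (EuclideanSpace.single i (1 : ℝ)) 0 := by
    simpa using ((hasDerivAt_id (0 : ℝ)).smul_const (EuclideanSpace.single i (1 : ℝ))).const_add x
  have h2 := (hasFDerivAt_norm_sub_sq x0 (x + (0 : ℝ) • EuclideanSpace.single i (1 : ℝ))).comp_hasDerivAt (0 : ℝ) h1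
  refine h2.congr_deriv ?_
  simp [EuclideanSpace.inner_single_right]

lemma Rad.line1 (h : Rad g g1 g2) (x0 x : Eu N) (i : Fin N) :
    HasLineDerivAt ℝ (fun x : Eu N => g (‖x - x0‖ ^ 2)) (g1 (‖x - x0‖ ^ 2) * (2 * (x i - x0 i))) x
      (EuclideanSpace.single i 1) := by
  have h1 := (h.d1 (‖x + (0 : ℝ) • EuclideanSpace.single i (1 : ℝ) - x0‖ ^ 2)
    (lt_of_lt_of_le (by norm_num) (sq_nonneg _))).comp (0 : ℝ) (hasDerivAt_line_sq x0 x i)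
  rw [zero_smul, add_zero] at h1
  exact h1

lemma Rad.line2 (h : Rad g g1 g2) (x0 x : Eu N) (i : Fin N) :
    HasLineDerivAt ℝ (fun x : Eu N => g1 (‖x - x0‖ ^ 2) * (2 * (x i - x0 i))) (rad2 g1 g2 x0 i x) x
      (EuclideanSpace.single i 1) := by
  have h1 := (h.d2 (‖x + (0 : ℝ) • EuclideanSpace.single i (1 : ℝ) - x0‖ ^ 2)
    (lt_of_lt_of_le (by norm_num) (sq_nonneg _))).comp (0 : ℝ) (hasDerivAt_line_sq x0 x i)
  have h2 : HasDerivAt (fun t : ℝ => 2 * ((x + t • EuclideanSpace.single i (1 : ℝ)) i - x0 i)) 2 0 := by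
    have : HasDerivAt (fun t : ℝ => 2 * ((x i + t) - x0 i)) (2 * 1) 0 :=
      (((hasDerivAt_id (0 : ℝ)).const_add (x i)).sub_const (x0 i)).const_mul 2
    simpa using this
  refine (h1.mul h2).congr_deriv ?_
  simp [rad2]
  ring

end rad

lemma radial_ibp {g g1 g2 b b1 b2 : ℝ → ℝ} (hg : Rad g g1 g2) (hb : Prof b b1 b2) (y0 x0 : Eu N) :
    ∫ y : Eu N, g (‖y - y0‖ ^ 2) * radL N b1 b2 (‖y - x0‖ ^ 2) = ∫ y : Eu N, radL N g1 g2 (‖y - y0‖ ^ 2) * b (‖y - x0‖ ^ 2) := by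
  have hr := hb.rad
  have c0 : HasCompactSupport fun x : Eu N => b (‖x - x0‖ ^ 2) := hb.compact_b x0
  have c1 : ∀ i, HasCompactSupport fun x : Eu N => b1 (‖x - x0‖ ^ 2) * (2 * (x i - x0 i)) := fun i =>
    (hb.compact_aux (g := b1) (fun _ hq => hq.2.1) x0).mul_right
  have c2 : ∀ i, HasCompactSupport (rad2 b1 b2 x0 i) := fun i => by
    have h1 := hb.compact_aux (g := b1) (fun _ hq => hq.2.1) x0
    have h2 := hb.compact_aux (g := b2) (fun _ hq => hq.2.2) x0
    exact ((h2.mul_left (f := fun _ => (4 : ℝ))).mul_right).add (h1.mul_left (f := fun _ => (2 : ℝ)))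
  have k1 : ∀ i : Fin N, Continuous fun x : Eu N => b1 (‖x - x0‖ ^ 2) * (2 * (x i - x0 i)) := fun i =>
    (hr.cont1 x0).mul (by fun_prop)
  have l1 : ∀ i : Fin N, Continuous fun x : Eu N => g1 (‖x - y0‖ ^ 2) * (2 * (x i - y0 i)) := fun i =>
    (hg.cont1 y0).mul (by fun_prop)
  have I : ∀ (f φ : Eu N → ℝ), Continuous f → Continuous φ → HasCompactSupport φ →
      Integrable fun x => f x * φ x := fun f φ hf hφ hc => (hf.mul hφ).integrable_of_hasCompactSupport hc.mul_left
  have key : ∀ i : Fin N, ∫ y : Eu N, g (‖y - y0‖ ^ 2) * rad2 b1 b2 x0 i y = ∫ y : Eu N, rad2 g1 g2 y0 i y * b (‖y - x0‖ ^ 2) := by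
    intro i
    have e1 := integral_bilinear_hasLineDerivAt_right_eq_neg_left_of_integrable (μ := (volume : Measure (Eu N)))
      (B := ContinuousLinearMap.mul ℝ ℝ) (f := fun y : Eu N => g (‖y - y0‖ ^ 2))
      (f' := fun x => g1 (‖x - y0‖ ^ 2) * (2 * (x i - y0 i))) (g := fun x => b1 (‖x - x0‖ ^ 2) * (2 * (x i - x0 i)))
      (g' := rad2 b1 b2 x0 i) (v := EuclideanSpace.single i 1)
      (I _ _ (l1 i) (k1 i) (c1 i)) (I _ _ (hg.cont0 y0) (hr.cont_rad2 x0 i) (c2 i))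
      (I _ _ (hg.cont0 y0) (k1 i) (c1 i)) (fun x _ => hg.line1 y0 x i) (fun x _ => hr.line2 x0 x i)
    have e2 := integral_bilinear_hasLineDerivAt_right_eq_neg_left_of_integrable (μ := (volume : Measure (Eu N)))
      (B := ContinuousLinearMap.mul ℝ ℝ) (f := fun x => g1 (‖x - y0‖ ^ 2) * (2 * (x i - y0 i)))
      (f' := rad2 g1 g2 y0 i) (g := fun y : Eu N => b (‖y - x0‖ ^ 2))
      (g' := fun x => b1 (‖x - x0‖ ^ 2) * (2 * (x i - x0 i))) (v := EuclideanSpace.single i 1)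
      (I _ _ (hg.cont_rad2 y0 i) (hr.cont0 x0) c0) (I _ _ (l1 i) (k1 i) (c1 i))
      (I _ _ (l1 i) (hr.cont0 x0) c0) (fun x _ => hg.line2 y0 x i) (fun x _ => hr.line1 x0 x i)
    simp only [ContinuousLinearMap.mul_apply'] at e1 e2
    rw [e1, e2, neg_neg]
  calc _ = ∫ y : Eu N, ∑ i, g (‖y - y0‖ ^ 2) * rad2 b1 b2 x0 i y := by
        refine integral_congr_ae (Eventually.of_forall fun y => ?_)
        simp only
        rw [← Finset.mul_sum, sum_rad2]
    _ = ∑ i, ∫ y : Eu N, g (‖y - y0‖ ^ 2) * rad2 b1 b2 x0 i y :=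
        integral_finsetSum _ fun i _ => I _ _ (hg.cont0 y0) (hr.cont_rad2 x0 i) (c2 i)
    _ = ∑ i, ∫ y : Eu N, rad2 g1 g2 y0 i y * b (‖y - x0‖ ^ 2) := Finset.sum_congr rfl fun i _ => key i
    _ = ∫ y : Eu N, ∑ i, rad2 g1 g2 y0 i y * b (‖y - x0‖ ^ 2) :=
        (integral_finsetSum _ fun i _ => I _ _ (hg.cont_rad2 y0 i) (hr.cont0 x0) c0).symm
    _ = _ := by
        refine integral_congr_ae (Eventually.of_forall fun y => ?_)
        simp only
        rw [← Finset.sum_mul, sum_rad2]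

lemma Rad.potAt (hN : 3 ≤ N) {g g1 g2 : ℝ → ℝ} (hg : Rad g g1 g2) (r : ℝ) (x : Eu N) :
    PotAt r (fun y : Eu N => g (‖y‖ ^ 2)) (fun y => -radL N g1 g2 (‖y‖ ^ 2)) x := by
  have hc : Continuous fun y : Eu N => g (‖y‖ ^ 2) := by simpa using hg.cont0 (0 : Eu N)
  refine PotAt.of_prof hN (LI.of_continuous hc) fun k hk => ?_
  have := radial_ibp hg (kB_prof (n := (N : ℝ)) (show 0 < 1 / (k + 1 : ℝ) by positivity) hk) (0 : Eu N) x
  simp only [sub_zero] at this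
  rw [this]
  simp only [neg_mul]
  rw [integral_neg, add_neg_cancel]

/-- The part of an increment rate that feeds the positive part. -/
def posRate (D ζ : ℝ → ℝ) (t : ℝ) : ℝ := if 0 < D t then max (ζ t) 0 else 0

lemma posRate_nonneg (D ζ : ℝ → ℝ) (t : ℝ) : 0 ≤ posRate D ζ t := by
  unfold posRate; split_ifs <;> simp

lemma posRate_pos {D ζ : ℝ → ℝ} (h : 0 < posRate D ζ t) : 0 < D t ∧ 0 < ζ t := by
  unfold posRate at h
  split_ifs at h with h1
  · exact ⟨h1, by simpa using h⟩
  · exact absurd h (lt_irrefl _)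

lemma posRate_integrableOn {D ζ : ℝ → ℝ} {S : Set ℝ} (hD : Measurable D) (hζ : IntegrableOn ζ S) :
    IntegrableOn (posRate D ζ) S := by
  have h1 : posRate D ζ = {t | 0 < D t}.indicator fun t => max (ζ t) 0 := by
    ext t; simp [posRate, indicator]
  rw [h1]
  exact (Integrable.pos_part hζ).indicator (measurableSet_lt measurable_const hD)

lemma posRate_incr {D ζ : ℝ → ℝ} (hD : Measurable D) (hc : ContinuousOn D (Icc a b))
    (hζ : IntegrableOn ζ (Icc a b))
    (hinc : ∀ s t, s ∈ Icc a b → t ∈ Icc a b → s ≤ t → D t - D s = ∫ τ in Ioc s t, ζ τ)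
    (hs : s ∈ Icc a b) (ht : t ∈ Icc a b) (hst : s ≤ t) :
    max (D t) 0 - max (D s) 0 ≤ ∫ τ in Ioc s t, posRate D ζ τ := by
  have hz := posRate_integrableOn hD hζ
  have hz0 : ∀ s t, 0 ≤ ∫ τ in Ioc s t, posRate D ζ τ := fun s t =>
    integral_nonneg fun τ => posRate_nonneg D ζ τ
  have hsub : ∀ σ, s ≤ σ → Ioc σ t ⊆ Icc a b := fun σ hσ x hx =>
    ⟨hs.1.trans (hσ.trans hx.1.le), hx.2.trans ht.2⟩
  have hle : ∀ σ, s ≤ σ → σ ≤ t → (∀ r ∈ Ioc σ t, 0 < D r) → D t - D σ ≤ ∫ τ in Ioc s t, posRate D ζ τ := by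
    intro σ h1 h2 hp
    rw [hinc σ t ⟨hs.1.trans h1, h2.trans ht.2⟩ ht h2]
    calc ∫ τ in Ioc σ t, ζ τ ≤ ∫ τ in Ioc σ t, posRate D ζ τ := by
          refine setIntegral_mono_on (hζ.mono_set (hsub σ h1)) (hz.mono_set (hsub σ h1)) measurableSet_Ioc fun r hr => ?_
          simp [posRate, hp r hr]
      _ ≤ _ := setIntegral_mono_set (hz.mono_set (hsub s le_rfl))
          (Eventually.of_forall fun τ => posRate_nonneg D ζ τ) (Ioc_subset_Ioc_left h1).eventuallyLE
  rcases le_or_gt (D t) 0 with h0 | h0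
  · rw [max_eq_right h0]
    linarith [hz0 s t, le_max_right (D s) 0]
  rw [max_eq_left h0.le]
  set Z := {r | r ∈ Icc s t ∧ D r ≤ 0} with hZ
  rcases Z.eq_empty_or_nonempty with he | hne
  · have hp : ∀ r ∈ Icc s t, 0 < D r := fun r hr => by
      by_contra hcon
      have : r ∈ Z := ⟨hr, not_lt.1 hcon⟩
      rw [he] at this; exact this
    have := hle s le_rfl hst fun r hr => hp r (Ioc_subset_Icc_self hr)
    linarith [le_max_left (D s) 0]
  · have hcst : ContinuousOn D (Icc s t) := hc.mono (Icc_subset_Icc hs.1 ht.2)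
    have hcl : IsClosed Z := by
      have := hcst.preimage_isClosed_of_isClosed isClosed_Icc (isClosed_Iic (a := (0 : ℝ)))
      convert this using 1
      ext r; simp [hZ]
    have hbd : BddAbove Z := ⟨t, fun r hr => hr.1.2⟩
    have hm := hcl.csSup_mem hne hbd
    have := hle (sSup Z) hm.1.1 hm.1.2 fun r hr => by
      by_contra hcon
      exact absurd (le_csSup hbd (show r ∈ Z from ⟨⟨hm.1.1.trans hr.1.le, hr.2⟩, not_lt.1 hcon⟩)) (not_le.2 hr.1)
    linarith [le_max_right (D s) 0, hm.2]

lemma Sol.measurable_kernel (h : Sol ρ m T u) {k : ℝ → ℝ → ℝ} (hk : Measurable fun q : ℝ × ℝ => k q.1 q.2) :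
    Measurable fun p : Eu N × ℝ => ∫ s, k p.2 s * u p.1 s ^ m := by
  have h1 : Measurable fun q : (Eu N × ℝ) × ℝ => k q.1.2 q.2 * u q.1.1 q.2 ^ m :=
    (hk.comp ((measurable_snd.comp measurable_fst).prodMk measurable_snd)).mul
      ((h.meas.comp ((measurable_fst.comp measurable_fst).prodMk measurable_snd)).pow_const m)
  exact (h1.stronglyMeasurable.integral_prod_right').measurable

lemma Sol.measurable_Pt (h : Sol ρ m T u) (hχ : Cut χ T T1 T2) :
    Measurable fun p : Eu N × ℝ => Pt χ T2 m u p.1 p.2 := by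
  have hk : Measurable fun q : ℝ × ℝ => (Ioc q.1 T2).indicator χ q.2 := by
    have : (fun q : ℝ × ℝ => (Ioc q.1 T2).indicator χ q.2) = {q : ℝ × ℝ | q.1 < q.2 ∧ q.2 ≤ T2}.indicator fun q => χ q.2 := by
      ext q; simp [indicator]
    rw [this]
    exact (hχ.smooth.continuous.measurable.comp measurable_snd).indicator
      ((measurableSet_lt measurable_fst measurable_snd).inter (measurableSet_le measurable_snd measurable_const))
  simpa only [Pt_eq] using h.measurable_kernel (k := fun t s => (Ioc t T2).indicator χ s) hk

lemma Sol.measurable_Om (h : Sol ρ m T u) (hχ : Cut χ T T1 T2) : Measurable (Om χ u) := by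
  have h1 : Measurable fun p : Eu N × ℝ => deriv χ p.2 * u p.1 p.2 :=
    ((hχ.smooth.continuous_deriv (by simp)).measurable.comp measurable_snd).mul h.meas
  exact (h1.stronglyMeasurable.integral_prod_right').measurable.neg

lemma Sol.Pt_nonneg (h : Sol ρ m T u) (hχ : Cut χ T T1 T2) (x : Eu N) (t : ℝ) : 0 ≤ Pt χ T2 m u x t :=
  integral_nonneg fun s => mul_nonneg (hχ.nonneg s) (Real.rpow_nonneg (h.nonneg x s) _)

lemma Cut.integrableOn (hχ : Cut χ T T1 T2) {w : ℝ → ℝ} {S : Set ℝ} (hw : IntegrableOn w S) :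
    IntegrableOn (fun s => χ s * w s) S :=
  hw.bdd_mul (c := 1) hχ.smooth.continuous.aestronglyMeasurable (Eventually.of_forall hχ.abs_le_one)

/-- Time regularity of the pressure, given integrability near the initial time. -/
lemma Pt_incr (hχ : Cut χ T T1 T2) (hi : IntegrableOn (fun s => u x s ^ m) (Ioc a T2))
    (hs : a ≤ s) (hst : s ≤ t) (ht : t ≤ T1) :
    Pt χ T2 m u x s - Pt χ T2 m u x t = ∫ τ in Ioc s t, u x τ ^ m := by
  have hT := hχ.lt12
  have hi' := hχ.integrableOn hi
  have hu : Ioc s T2 = Ioc s t ∪ Ioc t T2 := (Ioc_union_Ioc_eq_Ioc hst (by linarith)).symm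
  have e : ∫ τ in Ioc s t, u x τ ^ m = ∫ τ in Ioc s t, χ τ * u x τ ^ m :=
    setIntegral_congr_fun measurableSet_Ioc fun τ hτ => by simp [hχ.one τ (hτ.2.trans ht)]
  unfold Pt
  rw [e, hu, setIntegral_union (Ioc_disjoint_Ioc_of_le le_rfl) measurableSet_Ioc
    (hi'.mono_set (Ioc_subset_Ioc hs (by linarith))) (hi'.mono_set (Ioc_subset_Ioc_left (by linarith)))]
  ring

lemma Pt_continuousOn (hχ : Cut χ T T1 T2) (hi : IntegrableOn (fun s => u x s ^ m) (Ioc a T2)) :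
    ContinuousOn (fun t => Pt χ T2 m u x t) (Icc a T1) := by
  have hT := hχ.lt12
  have h1 : ContinuousOn (fun t => ∫ τ in Ioc a t, u x τ ^ m) (Icc a T1) :=
    intervalIntegral.continuousOn_primitive
      ((integrableOn_Icc_iff_integrableOn_Ioc).2 (hi.mono_set (Ioc_subset_Ioc_right hT.le)))
  refine (continuousOn_const (c := Pt χ T2 m u x a) |>.sub h1).congr fun t ht => ?_
  have := Pt_incr (m := m) hχ hi le_rfl ht.1 ht.2
  change Pt χ T2 m u x t = Pt χ T2 m u x a - ∫ τ in Ioc a t, u x τ ^ m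
  linarith

lemma Pt_anti (h : Sol ρ m T u) (hχ : Cut χ T T1 T2) (hi : IntegrableOn (fun s => u x s ^ m) (Ioc a T2))
    (ht : a ≤ t) : Pt χ T2 m u x t ≤ Pt χ T2 m u x a :=
  setIntegral_mono_set (hχ.integrableOn hi)
    (Eventually.of_forall fun s => mul_nonneg (hχ.nonneg s) (Real.rpow_nonneg (h.nonneg x s) _))
    (Ioc_subset_Ioc_left ht).eventuallyLE

lemma Sol.slice_Ioc (h : Sol ρ m T u) (hχ : Cut χ T T1 T2) (x : Eu N) (ha : 0 < a) :
    IntegrableOn (fun s => u x s ^ m) (Ioc a T2) :=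
  (h.slice x a T2 ha hχ.lt2).mono_set Ioc_subset_Icc_self

/-- A smooth monotone step rising from `0` at `a` to `1` at `b`. -/
def ramp (a b t : ℝ) : ℝ := Real.smoothTransition ((t - a) / (b - a))

lemma ramp_smooth (a b : ℝ) : ContDiff ℝ ∞ (ramp a b) := by
  unfold ramp
  exact Real.smoothTransition.contDiff.comp ((contDiff_id.sub contDiff_const).div_const _)

lemma ramp_nonneg (a b t : ℝ) : 0 ≤ ramp a b t := Real.smoothTransition.nonneg _
lemma ramp_le_one (a b t : ℝ) : ramp a b t ≤ 1 := Real.smoothTransition.le_one _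

lemma ramp_zero (hab : a < b) (h : t ≤ a) : ramp a b t = 0 :=
  Real.smoothTransition.zero_of_nonpos (div_nonpos_of_nonpos_of_nonneg (by linarith) (by linarith))

lemma ramp_one (hab : a < b) (h : b ≤ t) : ramp a b t = 1 :=
  Real.smoothTransition.one_of_one_le ((one_le_div (by linarith)).2 (by linarith))

lemma smoothTransition_monotone : Monotone Real.smoothTransition := by
  intro x y hxy
  unfold Real.smoothTransition
  have h1 := expNegInvGlue.monotone hxy
  have h2 := expNegInvGlue.monotone (show 1 - y ≤ 1 - x by linarith)
  rw [div_le_div_iff₀ (Real.smoothTransition.pos_denom x) (Real.smoothTransition.pos_denom y)]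
  have h3 := expNegInvGlue.nonneg x
  have h4 := expNegInvGlue.nonneg y
  have h5 := expNegInvGlue.nonneg (1 - x)
  have h6 := expNegInvGlue.nonneg (1 - y)
  nlinarith [mul_le_mul h1 h2 h6 h4]

lemma ramp_monotone (hab : a < b) : Monotone (ramp a b) := fun x y hxy =>
  smoothTransition_monotone (by gcongr)

lemma ramp_deriv_nonneg (hab : a < b) (t : ℝ) : 0 ≤ deriv (ramp a b) t :=
  (ramp_monotone hab).deriv_nonneg

lemma ramp_deriv_zero (hab : a < b) (ht : t ∉ Icc a b) : deriv (ramp a b) t = 0 := by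
  rcases lt_or_lt_of_notMem_Icc ht with ht | ht
  · have : ramp a b =ᶠ[𝓝 t] fun _ => 0 := by
      filter_upwards [Iio_mem_nhds ht] with s hs using ramp_zero hab (le_of_lt hs)
    simpa using this.deriv_eq
  · have : ramp a b =ᶠ[𝓝 t] fun _ => 1 := by
      filter_upwards [Ioi_mem_nhds ht] with s hs using ramp_one hab (le_of_lt hs)
    simpa using this.deriv_eq

lemma ramp_deriv_bound (hab : a < b) : ∃ L, 0 ≤ L ∧ ∀ t, deriv (ramp a b) t ≤ L := by
  obtain ⟨L, hL⟩ := (isCompact_Icc (a := a) (b := b)).exists_bound_of_continuousOn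
    ((ramp_smooth a b).continuous_deriv (by simp)).continuousOn
  refine ⟨max L 0, le_max_right _ _, fun t => ?_⟩
  by_cases ht : t ∈ Icc a b
  · exact (le_abs_self _).trans ((hL t ht).trans (le_max_left _ _))
  · rw [ramp_deriv_zero hab ht]; exact le_max_right _ _

lemma exists_cut (h1 : 0 < T1) (h2 : T1 < T2) (h3 : T2 < T) (hm : 1 < m) :
    ∃ χ, Cut χ T T1 T2 ∧ (∀ t, deriv χ t ≤ 0) ∧ ∃ C, 0 ≤ C ∧ ∀ t, -deriv χ t ≤ C * χ t ^ (1 / m) := by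
  obtain ⟨L, hL0, hL⟩ := ramp_deriv_bound h2
  have hsm : ContDiff ℝ ∞ fun t => 1 - ramp T1 T2 t := contDiff_const.sub (ramp_smooth T1 T2)
  have hn : ∀ t, 0 ≤ 1 - ramp T1 T2 t := fun t => by linarith [ramp_le_one T1 T2 t]
  have hle : ∀ t, 1 - ramp T1 T2 t ≤ 1 := fun t => by linarith [ramp_nonneg T1 T2 t]
  obtain ⟨j, hj, C, hC, hd⟩ := exists_pow_cut hsm hn hle hm (L := L) fun t => by
    rw [deriv_const_sub, abs_neg, abs_of_nonneg (ramp_deriv_nonneg h2 t)]; exact hL t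
  refine ⟨fun t => (1 - ramp T1 T2 t) ^ j, ⟨hsm.pow j, h1, h2, h3, fun t ht => ?_, fun t ht => ?_,
    fun t => pow_nonneg (hn t) _, fun t => pow_le_one₀ (hn t) (hle t)⟩, fun t => ?_, C, hC,
    fun t => (neg_le_abs _).trans (hd t)⟩
  · simp [ramp_zero h2 ht]
  · simp [ramp_one h2 ht, show j ≠ 0 by omega]
  · have hanti : Antitone fun t => (1 - ramp T1 T2 t) ^ j := fun x y hxy =>
      pow_le_pow_left₀ (hn y) (by linarith [ramp_monotone h2 hxy]) j
    exact hanti.deriv_nonpos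

lemma exists_TW (h1 : 0 < a) (h3 : b < T) (hm : 1 < m) :
    ∃ κ, TW κ T m ∧ ∀ t ∈ Icc a b, κ t = 1 := by
  have ha : a / 2 < a := by linarith
  have hb : b < (b + T) / 2 := by linarith
  obtain ⟨L, hL0, hL⟩ := ramp_deriv_bound ha
  obtain ⟨L', hL0', hL'⟩ := ramp_deriv_bound hb
  set φ : ℝ → ℝ := fun t => ramp (a / 2) a t * (1 - ramp b ((b + T) / 2) t) with hφ
  have hr := ramp_smooth (a / 2) a
  have hr' : ContDiff ℝ ∞ fun t => 1 - ramp b ((b + T) / 2) t := contDiff_const.sub (ramp_smooth b ((b + T) / 2))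
  have hsm : ContDiff ℝ ∞ φ := hr.mul hr'
  have hn' : ∀ t, 0 ≤ 1 - ramp b ((b + T) / 2) t := fun t => by linarith [ramp_le_one b ((b + T) / 2) t]
  have hle' : ∀ t, 1 - ramp b ((b + T) / 2) t ≤ 1 := fun t => by linarith [ramp_nonneg b ((b + T) / 2) t]
  have hn : ∀ t, 0 ≤ φ t := fun t => mul_nonneg (ramp_nonneg _ _ t) (hn' t)
  have hle : ∀ t, φ t ≤ 1 := fun t => mul_le_one₀ (ramp_le_one _ _ t) (hn' t) (hle' t)
  obtain ⟨j, hj, C, hC, hd⟩ := exists_pow_cut hsm hn hle hm (L := L + L') fun t => by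
    have e : deriv φ t = deriv (ramp (a / 2) a) t * (1 - ramp b ((b + T) / 2) t) +
        ramp (a / 2) a t * -deriv (ramp b ((b + T) / 2)) t := by
      have d1 := ((hr.differentiable (by simp)) t).hasDerivAt
      have d2 := (((ramp_smooth b ((b + T) / 2)).differentiable (by simp)) t).hasDerivAt
      exact (d1.mul (d2.const_sub 1)).deriv
    rw [e]
    refine (abs_add_le _ _).trans (add_le_add ?_ ?_)
    · rw [abs_of_nonneg (mul_nonneg (ramp_deriv_nonneg ha t) (hn' t))]
      exact (mul_le_of_le_one_right (ramp_deriv_nonneg ha t) (hle' t)).trans (hL t)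
    · rw [mul_neg, abs_neg, abs_of_nonneg (mul_nonneg (ramp_nonneg _ _ t) (ramp_deriv_nonneg hb t))]
      exact (mul_le_of_le_one_left (ramp_deriv_nonneg hb t) (ramp_le_one _ _ t)).trans (hL' t)
  have hz : ∀ t, t ∉ Icc (a / 2) ((b + T) / 2) → φ t ^ j = 0 := by
    intro t ht
    rcases lt_or_lt_of_notMem_Icc ht with ht | ht
    · simp [hφ, ramp_zero ha ht.le, show j ≠ 0 by omega]
    · simp [hφ, ramp_one hb ht.le, show j ≠ 0 by omega]
  have hsupp : tsupport (fun t => φ t ^ j) ⊆ Icc (a / 2) ((b + T) / 2) := by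
    refine closure_minimal (fun t ht => ?_) isClosed_Icc
    by_contra hcon
    exact ht (hz t hcon)
  refine ⟨fun t => φ t ^ j, ⟨hsm.pow j, HasCompactSupport.intro isCompact_Icc hz,
    hsupp.trans (Icc_subset_Ioo (by linarith) (by linarith)), fun t => pow_nonneg (hn t) _,
    fun t => pow_le_one₀ (hn t) (hle t), C, hC, hd⟩, fun t ht => ?_⟩
  simp [hφ, ramp_one ha ht.1, ramp_zero hb ht.2]

lemma Sol.avg_bound_Icc (hN : 3 ≤ N) (hm : 1 < m) (hT : 0 < T) (hW : Wt N γ Cl Cu ρ) (h : Sol ρ m T u)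
    (ha : 0 < a) (hb : b < T) : ∃ C, 0 ≤ C ∧ ∀ᵐ x, ∀ C0, 0 ≤ C0 → ∀ κ : ℝ → ℝ,
      (∀ t, 0 ≤ κ t) → (∀ t, κ t ≤ C0) → (∀ t, t ∉ Icc a b → κ t = 0) →
      ∫ t, κ t * u x t ≤ C0 * C * (1 + ‖x‖) ^ (gexp γ m / m) := by
  obtain ⟨κ0, hκ0, h1⟩ := exists_TW ha hb hm
  obtain ⟨C, hC, hx⟩ := h.avg_bound hN hm hT hW hκ0
  refine ⟨C, hC, hx.mono fun x hx C0 hC0 κ hn hle hz => hx C0 hC0 κ hn fun t => ?_⟩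
  by_cases ht : t ∈ Icc a b
  · rw [h1 t ht]; simpa using hle t
  · rw [hz t ht]; exact mul_nonneg hC0 (Real.rpow_nonneg (hκ0.nonneg t) _)

lemma Sol.Om_bound (hN : 3 ≤ N) (hm : 1 < m) (hT : 0 < T) (hW : Wt N γ Cl Cu ρ) (h : Sol ρ m T u)
    (hχ : Cut χ T T1 T2) (hd : ∀ t, deriv χ t ≤ 0) : ∃ C, 0 ≤ C ∧ ∀ᵐ x, 0 ≤ Om χ u x ∧
      Om χ u x ≤ C * (1 + ‖x‖) ^ (gexp γ m / m) := by
  obtain ⟨C, hC, hx⟩ := h.avg_bound_Icc hN hm hT hW hχ.pos hχ.lt2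
  obtain ⟨L, hL0, hL⟩ := hχ.exists_deriv_bound
  refine ⟨L * C, by positivity, hx.mono fun x hx => ?_⟩
  have e : Om χ u x = ∫ t, -deriv χ t * u x t := by
    unfold Om; rw [← integral_neg]; simp
  rw [e]
  exact ⟨integral_nonneg fun t => mul_nonneg (by simpa using hd t) (h.nonneg x t),
    hx L hL0 _ (fun t => by simpa using hd t) (fun t => (neg_le_abs _).trans (hL t))
      fun t ht => by rw [hχ.deriv_zero ht, neg_zero]⟩

lemma rad_exp (a c G : ℝ) : Rad (fun q => G * (Real.exp (-(a * q)) - c)) (fun q => -(a * G) * Real.exp (-(a * q)))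
    (fun q => a ^ 2 * G * Real.exp (-(a * q))) where
  d1 q _ := by
    have h1 : HasDerivAt (fun q : ℝ => -(a * q)) (-(a * 1)) q := ((hasDerivAt_id q).const_mul a).neg
    exact ((h1.exp.sub_const c).const_mul G).congr_deriv (by ring)
  d2 q _ := by
    have h1 : HasDerivAt (fun q : ℝ => -(a * q)) (-(a * 1)) q := ((hasDerivAt_id q).const_mul a).neg
    exact (h1.exp.const_mul (-(a * G))).congr_deriv (by ring)
  c2 := by fun_prop

lemma radL_exp (n a G q : ℝ) : radL n (fun q => -(a * G) * Real.exp (-(a * q)))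
    (fun q => a ^ 2 * G * Real.exp (-(a * q))) q = 2 * a * G * Real.exp (-(a * q)) * (2 * a * q - n) := by
  unfold radL; ring

lemma exists_small_amplitude {c : ℝ} (hc : 0 < c) (hK : 0 < K) (hm : 1 < m) :
    ∃ A, 0 < A ∧ K * A ≤ c * A ^ (1 / m) := by
  have hm1 : 0 < m - 1 := by linarith
  have hX : 0 < c / K := by positivity
  refine ⟨(c / K) ^ (m / (m - 1)), by positivity, le_of_eq ?_⟩
  rw [← Real.rpow_mul hX.le, show m / (m - 1) * (1 / m) = m / (m - 1) - 1 by field_simp; ring, Real.rpow_sub_one hX.ne']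
  field_simp

lemma exists_small_time (h1 : 0 < T1) (hm : 1 < m) :
    ∃ τ, 0 < τ ∧ τ < T1 ∧ K ≤ (2 * τ) ^ (-(1 / (m - 1))) := by
  have hm1 : 0 < m - 1 := by linarith
  have hp : -(1 / (m - 1)) < 0 := neg_lt_zero.2 (by positivity)
  have h : Tendsto (fun τ : ℝ => (2 * τ) ^ (-(1 / (m - 1)))) (𝓝[>] 0) atTop := by
    refine (tendsto_rpow_neg_nhdsGT_zero hp).comp ?_
    refine tendsto_nhdsWithin_iff.2 ⟨?_, ?_⟩
    · have : Tendsto (fun τ : ℝ => 2 * τ) (𝓝 0) (𝓝 (2 * 0)) := by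
        exact (continuous_const.mul continuous_id).tendsto 0
      rw [mul_zero] at this
      exact this.mono_left nhdsWithin_le_nhds
    · filter_upwards [self_mem_nhdsWithin] with τ hτ
      have : (0:ℝ) < τ := hτ
      exact mem_Ioi.2 (by positivity)
  obtain ⟨τ, h4, h2, h3⟩ := ((h.eventually_ge_atTop K).and
    (show ∀ᶠ τ in 𝓝[>] (0:ℝ), τ ∈ Ioo 0 T1 from Ioo_mem_nhdsGT h1)).exists
  exact ⟨τ, h2, h3, h4⟩

lemma hasDerivAt_timeFactor (hm : 1 < m) (h : 0 < t + σ) :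
    HasDerivAt (fun t => (t + σ) ^ (-(1 / (m - 1)))) (-(1 / (m - 1)) * ((t + σ) ^ (-(1 / (m - 1)))) ^ m) t := by
  have hm1 : m - 1 ≠ 0 := by linarith
  have h1 : HasDerivAt (fun t : ℝ => t + σ) 1 t := (hasDerivAt_id t).add_const σ
  refine (h1.rpow_const (Or.inl h.ne')).congr_deriv ?_
  rw [← Real.rpow_mul h.le, show -(1 / (m - 1)) * m = -(1 / (m - 1)) - 1 by field_simp; ring]
  ring

set_option maxHeartbeats 800000 in
/-- Where the barrier rises faster than the pressure it is a subsolution. -/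
lemma barrier_point {uu om f A Cw p : ℝ} (hm : 1 < m) (h0 : 0 ≤ γ) (hl : lam / m - γ = lam - 2) (hl0 : 0 < lam)
    (hn : 2 < n) (hR : 1 ≤ R) (hx0 : 0 < q) (hxR : q < R) (hCl : 0 < Cl) (hlow : Cl * (1 + q) ^ (-γ) ≤ r)
    (hCu : 0 ≤ Cu) (hup : r ≤ Cu * q ^ (-γ)) (hu : 0 ≤ uu) (hCw : 0 ≤ Cw) (hom : om ≤ Cw * (1 + q) ^ (lam / m)) (hom0 : 0 ≤ om)
    (hp : 0 < p) (hA : 0 < A) (hf : 0 < f)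
    (c1 : Cu * 2 ^ γ * (Cw * 2 ^ (lam / m)) ≤ 4 * n ^ 2 * A * f * Real.exp (-(2 * n)))
    (c2 : Cw * 2 ^ (lam / m) ≤ (p * A * (Real.exp (-n) - Real.exp (-(2 * n)))) ^ (1 / m) / 2 * f)
    (c3 : 4 * n ^ 2 * A ≤ Cl * 2 ^ (-γ) * ((p * A * (Real.exp (-n) - Real.exp (-(2 * n)))) ^ (1 / m) / 2))
    (hz : p * (A * R ^ lam) * (Real.exp (-(2 * n / R ^ 2 * q ^ 2)) - Real.exp (-(2 * n))) * f ^ m < uu ^ m) :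
    -(2 * (2 * n / R ^ 2) * (A * R ^ lam * f) * Real.exp (-(2 * n / R ^ 2 * q ^ 2)) * (2 * (2 * n / R ^ 2) * q ^ 2 - n)) -
      r * (uu - om) ≤ 0 := by
  have hR0 : 0 < R := by linarith
  set y := q ^ 2 / R ^ 2 with hy
  have e1 : 2 * n / R ^ 2 * q ^ 2 = 2 * n * y := by rw [hy]; ring
  have hRl : R ^ lam = R ^ (lam - 2) * R ^ 2 := by
    rw [← Real.rpow_natCast R 2, ← Real.rpow_add hR0]; congr 1; push_cast; ring
  have e2 : 2 * (2 * n / R ^ 2) * (A * R ^ lam * f) * Real.exp (-(2 * n / R ^ 2 * q ^ 2)) * (2 * (2 * n / R ^ 2) * q ^ 2 - n)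
      = 4 * n ^ 2 * A * R ^ (lam - 2) * f * Real.exp (-(2 * n * y)) * (4 * y - 1) := by
    rw [e1, hRl, hy]; field_simp; ring
  rw [e2]
  rw [e1] at hz
  have hRp : 0 < R ^ (lam - 2) := by positivity
  have hRs : R ^ (-γ) * R ^ (lam / m) = R ^ (lam - 2) := by
    rw [← Real.rpow_add hR0]; congr 1; linarith
  have hr0 : 0 ≤ r := le_trans (by positivity) hlow
  have hy1 : y < 1 := by rw [hy, div_lt_one (by positivity)]; gcongr
  have hlm : 0 < lam / m := by positivity
  have hom' : om ≤ Cw * 2 ^ (lam / m) * R ^ (lam / m) := by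
    refine hom.trans ?_
    rw [mul_assoc, ← Real.mul_rpow (by norm_num) hR0.le]
    gcongr; linarith
  rcases le_or_gt (1 / 2) y with h2 | h2
  · have hqR : R / 2 ≤ q := by
      rw [hy, le_div_iff₀ (by positivity)] at h2
      nlinarith
    have hrq : r ≤ Cu * 2 ^ γ * R ^ (-γ) := by
      refine hup.trans ?_
      rw [mul_assoc]
      refine mul_le_mul_of_nonneg_left ?_ hCu
      calc q ^ (-γ) ≤ (R / 2) ^ (-γ) := Real.rpow_le_rpow_of_nonpos (by positivity) hqR (by linarith)
        _ = 2 ^ γ * R ^ (-γ) := by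
          rw [Real.div_rpow hR0.le (by norm_num), Real.rpow_neg (by norm_num : (0:ℝ) ≤ 2)]; field_simp
    have h3 : r * om ≤ Cu * 2 ^ γ * R ^ (-γ) * (Cw * 2 ^ (lam / m) * R ^ (lam / m)) :=
      mul_le_mul hrq hom' hom0 (by positivity)
    have h4 : Cu * 2 ^ γ * R ^ (-γ) * (Cw * 2 ^ (lam / m) * R ^ (lam / m)) = Cu * 2 ^ γ * (Cw * 2 ^ (lam / m)) * R ^ (lam - 2) := by
      rw [← hRs]; ring
    have h5 := mul_le_mul_of_nonneg_right c1 hRp.le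
    have h6 : Real.exp (-(2 * n)) * 1 ≤ Real.exp (-(2 * n * y)) * (4 * y - 1) := by
      refine mul_le_mul (Real.exp_le_exp.2 ?_) (by linarith) (by norm_num) (by positivity)
      nlinarith
    have h7 := mul_le_mul_of_nonneg_left h6 (show 0 ≤ 4 * n ^ 2 * A * R ^ (lam - 2) * f by positivity)
    have h8 : 0 ≤ r * uu := mul_nonneg hr0 hu
    linarith
  · set g0 := Real.exp (-n) - Real.exp (-(2 * n)) with hg0
    have hg0p : 0 < g0 := by rw [hg0, sub_pos]; exact Real.exp_lt_exp.2 (by linarith)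
    have h3 : g0 ≤ Real.exp (-(2 * n * y)) - Real.exp (-(2 * n)) := by
      rw [hg0]; gcongr; nlinarith
    set B := (p * A * g0) ^ (1 / m) / 2 with hB
    have hm0 : 0 < m := by linarith
    have hpow : (2 * B * R ^ (lam / m) * f) ^ m = p * (A * R ^ lam) * g0 * f ^ m := by
      have hB2 : 2 * B = (p * A * g0) ^ (1 / m) := by rw [hB]; ring
      rw [hB2, Real.mul_rpow (by positivity) hf.le, Real.mul_rpow (by positivity) (by positivity),
        ← Real.rpow_mul (by positivity), ← Real.rpow_mul hR0.le, one_div_mul_cancel hm0.ne', div_mul_cancel₀ _ hm0.ne', Real.rpow_one]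
      ring
    have h4 : 2 * B * R ^ (lam / m) * f < uu := by
      refine (Real.rpow_lt_rpow_iff (z := m) (by positivity) hu hm0).1 ?_
      rw [hpow]
      refine lt_of_le_of_lt ?_ hz
      gcongr
    have h5 : om ≤ B * R ^ (lam / m) * f := by
      refine hom'.trans ?_
      have := mul_le_mul_of_nonneg_right c2 (show 0 ≤ R ^ (lam / m) by positivity)
      linarith
    have h6 : Cl * 2 ^ (-γ) * R ^ (-γ) ≤ r := by
      refine le_trans ?_ hlow
      rw [mul_assoc, ← Real.mul_rpow (by norm_num) hR0.le]
      refine mul_le_mul_of_nonneg_left ?_ hCl.le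
      exact Real.rpow_le_rpow_of_nonpos (by positivity) (by linarith) (by linarith)
    have h7 : Cl * 2 ^ (-γ) * R ^ (-γ) * (B * R ^ (lam / m) * f) ≤ r * (uu - om) :=
      mul_le_mul h6 (by linarith) (by positivity) hr0
    have h8 : Cl * 2 ^ (-γ) * R ^ (-γ) * (B * R ^ (lam / m) * f) = Cl * 2 ^ (-γ) * B * (R ^ (lam - 2) * f) := by
      rw [← hRs]; ring
    have h9 := mul_le_mul_of_nonneg_right c3 (show 0 ≤ R ^ (lam - 2) * f by positivity)
    have h10 : -1 ≤ Real.exp (-(2 * n * y)) * (4 * y - 1) := by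
      have e0 : 0 ≤ y := by rw [hy]; positivity
      have e3 : Real.exp (-(2 * n * y)) ≤ 1 := Real.exp_le_one_iff.2 (by nlinarith)
      have e4 := Real.exp_pos (-(2 * n * y))
      nlinarith
    have h11 := mul_le_mul_of_nonneg_left h10 (show 0 ≤ 4 * n ^ 2 * A * R ^ (lam - 2) * f by positivity)
    linarith

lemma Wt.Cu_nonneg (hN : 3 ≤ N) (hW : Wt N γ Cl Cu ρ) : 0 ≤ Cu := by
  have := nontrivial_Eu hN
  obtain ⟨x, hx⟩ := exists_ne (0 : Eu N)
  have h1 := (hW.nonneg x).trans (hW.up x hx)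
  have h2 : 0 < ‖x‖ ^ (-γ) := by have := norm_pos_iff.2 hx; positivity
  exact nonneg_of_mul_nonneg_left h1 h2

set_option maxHeartbeats 1600000 in
/-- Once the pressure is large on a ball, it stays above a self-similar barrier. -/
lemma Sol.barrier (hN : 3 ≤ N) (hm : 1 < m) (hT : 0 < T) (hW : Wt N γ Cl Cu ρ) (h : Sol ρ m T u)
    (hχ : Cut χ T T1 T2) (hd : ∀ t, deriv χ t ≤ 0) : ∃ A τ, 0 < A ∧ 0 < τ ∧ τ < T1 ∧ ∀ R s, 1 ≤ R → 0 < s → s < τ →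
      (∀ᵐ x, ‖x‖ < R → A * R ^ gexp γ m * τ ^ (-(1 / (m - 1))) ≤ Pt χ T2 m u x s) →
      ∀ᵐ x, ‖x‖ < R → A * R ^ gexp γ m * (2 * τ) ^ (-(1 / (m - 1))) *
        (Real.exp (-(2 * N / R ^ 2 * ‖x‖ ^ 2)) - Real.exp (-(2 * N))) ≤ Pt χ T2 m u x τ := by
  have := nontrivial_Eu hN
  have hn : (2:ℝ) < N := three_le_cast hN
  set n : ℝ := (N : ℝ) with hnd
  set lam := gexp γ m with hlam
  have hl : 0 < lam := gexp_pos hW.g2 hm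
  obtain ⟨Cw, hCw, hom⟩ := h.Om_bound hN hm hT hW hχ hd
  rw [← hlam] at hom
  have hCu := hW.Cu_nonneg hN
  have hCl := hW.l0
  have hγ := hW.g0
  have hm1 : 0 < m - 1 := by linarith
  set p := 1 / (m - 1) with hp
  have hp0 : 0 < p := by positivity
  set g0 := Real.exp (-n) - Real.exp (-(2 * n)) with hg0
  have hg0p : 0 < g0 := by rw [hg0, sub_pos]; exact Real.exp_lt_exp.2 (by linarith)
  obtain ⟨A, hA, hA3⟩ := exists_small_amplitude (c := Cl * 2 ^ (-γ) * ((p * g0) ^ (1 / m) / 2)) (K := 4 * n ^ 2)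
    (by positivity) (by positivity) hm
  have c3 : 4 * n ^ 2 * A ≤ Cl * 2 ^ (-γ) * ((p * A * g0) ^ (1 / m) / 2) := by
    refine hA3.trans (le_of_eq ?_)
    rw [mul_right_comm p A g0, Real.mul_rpow (by positivity) hA.le]; ring
  set c1' := 4 * n ^ 2 * A * Real.exp (-(2 * n)) with hc1'
  set c2' := (p * A * g0) ^ (1 / m) / 2 with hc2'
  have hc1p : 0 < c1' := by positivity
  have hc2p : 0 < c2' := by positivity
  obtain ⟨τ, hτ0, hτ1, hτ⟩ := exists_small_time (T1 := T1) (m := m)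
    (K := max (Cu * 2 ^ γ * (Cw * 2 ^ (lam / m)) / c1') (Cw * 2 ^ (lam / m) / c2')) hχ.pos hm
  refine ⟨A, τ, hA, hτ0, hτ1, fun R s hR hs hsτ hPs => ?_⟩
  have hR0 : 0 < R := by linarith
  set F : ℝ → ℝ := fun t => (t + (τ - s)) ^ (-p) with hF
  have hpos : ∀ t ∈ Icc s τ, 0 < t + (τ - s) := fun t ht => by linarith [ht.1]
  have hF0 : ∀ t ∈ Icc s τ, 0 < F t := fun t ht => Real.rpow_pos_of_pos (hpos t ht) _
  have hFlow : ∀ t ∈ Icc s τ, (2 * τ) ^ (-p) ≤ F t := fun t ht =>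
    Real.rpow_le_rpow_of_nonpos (hpos t ht) (by linarith [ht.2]) (by linarith)
  have hFup : ∀ t ∈ Icc s τ, F t ≤ τ ^ (-p) := fun t ht =>
    Real.rpow_le_rpow_of_nonpos hτ0 (by linarith [ht.1]) (by linarith)
  have hFd : ∀ t ∈ Icc s τ, HasDerivAt F (-p * F t ^ m) t := fun t ht => hasDerivAt_timeFactor hm (hpos t ht)
  have hFc : ContinuousOn F (Icc s τ) := fun t ht => (hFd t ht).continuousAt.continuousWithinAt
  have hFmc : ContinuousOn (fun t => F t ^ m) (Icc s τ) := hFc.rpow_const fun t ht => Or.inl (hF0 t ht).ne'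
  have hFm : Measurable F := (by fun_prop : Measurable fun t : ℝ => t + (τ - s)).pow_const _
  set a := 2 * n / R ^ 2 with ha
  have ha0 : 0 < a := by positivity
  set E : Eu N → ℝ := fun x => Real.exp (-(a * ‖x‖ ^ 2)) - Real.exp (-(2 * n)) with hE
  have hEle : ∀ x, |E x| ≤ 1 := fun x => by
    have e1 : Real.exp (-(a * ‖x‖ ^ 2)) ≤ 1 := Real.exp_le_one_iff.2 (neg_nonpos.2 (by positivity))
    have e2 : Real.exp (-(2 * n)) ≤ 1 := Real.exp_le_one_iff.2 (by linarith)
    have e3 := Real.exp_pos (-(a * ‖x‖ ^ 2))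
    have e4 := Real.exp_pos (-(2 * n))
    rw [hE, abs_le]; constructor <;> linarith
  have hEm : Continuous E := by fun_prop
  set K := A * R ^ lam with hK
  have hK0 : 0 < K := by positivity
  have hτp : 0 < τ ^ (-p) := by positivity
  set D : Eu N → ℝ → ℝ := fun x t => K * F t * E x - Pt χ T2 m u x t with hD
  set f : Eu N → ℝ → ℝ := fun x t => -(2 * a * (K * F t) * Real.exp (-(a * ‖x‖ ^ 2)) * (2 * a * ‖x‖ ^ 2 - n)) -
    ρ x * (u x t - Om χ u x) with hf
  have hab : Icc s τ ⊆ Icc s T1 := Icc_subset_Icc_right hτ1.le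
  have hDc : ∀ x, ContinuousOn (D x) (Icc s τ) := fun x =>
    ((continuousOn_const.mul hFc).mul continuousOn_const).sub
      ((Pt_continuousOn hχ (h.slice_Ioc hχ x hs)).mono hab)
  have hDm : Measurable fun q : Eu N × ℝ => D q.1 q.2 :=
    ((measurable_const.mul (hFm.comp measurable_snd)).mul (hEm.measurable.comp measurable_fst)).sub (h.measurable_Pt hχ)
  have hPE : ∀ x, ∀ t ∈ Icc s τ, K * F t * E x ≤ K * τ ^ (-p) ∧ |K * F t * E x| ≤ K * τ ^ (-p) := fun x t ht => by
    have : |K * F t * E x| ≤ K * τ ^ (-p) := by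
      rw [abs_mul, abs_of_pos (mul_pos hK0 (hF0 t ht))]
      exact (mul_le_of_le_one_right (mul_pos hK0 (hF0 t ht)).le (hEle x)).trans
        (mul_le_mul_of_nonneg_left (hFup t ht) hK0.le)
    exact ⟨(le_abs_self _).trans this, this⟩
  set ζ : Eu N → ℝ → ℝ := fun x t => u x t ^ m - p * K * E x * F t ^ m with hζ
  have hζi : ∀ x, IntegrableOn (ζ x) (Icc s τ) := fun x =>
    (h.slice x s τ hs (hτ1.trans (hχ.lt12.trans hχ.lt2))).sub ((hFmc.integrableOn_Icc).const_mul (p * K * E x))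
  have hinc : ∀ x, ∀ t1 t2, t1 ∈ Icc s τ → t2 ∈ Icc s τ → t1 ≤ t2 → D x t2 - D x t1 = ∫ r in Ioc t1 t2, ζ x r := by
    intro x t1 t2 h1 h2 h12
    have hsub : Ioc t1 t2 ⊆ Icc s τ := fun r hr => ⟨h1.1.trans hr.1.le, hr.2.trans h2.2⟩
    have e1 := Pt_incr (m := m) hχ (h.slice_Ioc hχ x hs) h1.1 h12 (h2.2.trans hτ1.le)
    have e2 : F t2 - F t1 = ∫ r in Ioc t1 t2, -p * F r ^ m := by
      rw [← intervalIntegral.integral_of_le h12]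
      refine (intervalIntegral.integral_eq_sub_of_hasDerivAt (fun r hr => ?_) ?_).symm
      · rw [uIcc_of_le h12] at hr
        exact hFd r ⟨h1.1.trans hr.1, hr.2.trans h2.2⟩
      · rw [intervalIntegrable_iff_integrableOn_Ioc_of_le h12]
        exact ((hFmc.integrableOn_Icc).mono_set hsub).const_mul _
    have e3 : ∫ r in Ioc t1 t2, ζ x r = (∫ r in Ioc t1 t2, u x r ^ m) - ∫ r in Ioc t1 t2, p * K * E x * F r ^ m :=
      integral_sub ((h.slice x s τ hs (hτ1.trans (hχ.lt12.trans hχ.lt2))).mono_set hsub)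
        (((hFmc.integrableOn_Icc).mono_set hsub).const_mul _)
    rw [e3, integral_const_mul, ← e1]
    rw [integral_const_mul] at e2
    have e4 : D x t2 - D x t1 = K * E x * (F t2 - F t1) + (Pt χ T2 m u x t1 - Pt χ T2 m u x t2) := by
      simp only [hD]; ring
    rw [e4, e2]; ring
  have hcomp := comparison (N := N) hN (γ := γ) (R := R) (a := s) (b := τ) (C1 := K * τ ^ (-p))
    (Bc := 2 * a * n * (K * τ ^ (-p)) * (R + 2) ^ γ + Cu * (Cw * (R + 3) ^ (lam / m))) hγ hW.g2 hR0 hsτ (by positivity) (by positivity)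
    (D := D) (f := f) (z := fun x => posRate (D x) (ζ x)) (Ψ := fun x => K * τ ^ (-p) + Pt χ T2 m u x s)
    ((LI.of_continuous continuous_const).add (h.LI_Pt hχ hs)) hDm ?_ ?_ ?_ ?_ ?_ ?_ ?_ ?_
  · filter_upwards [hcomp] with x hx hxR
    have h1 := hx hxR
    simp only [hD] at h1
    have h2 : F τ = (2 * τ - s) ^ (-p) := by simp only [hF]; congr 1; ring
    have h3 : (2 * τ) ^ (-p) ≤ F τ := hFlow τ ⟨hsτ.le, le_rfl⟩
    have h4 : 0 ≤ E x := by
      simp only [hE]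
      rw [sub_nonneg]
      refine Real.exp_le_exp.2 (neg_le_neg ?_)
      rw [ha, div_mul_eq_mul_div, div_le_iff₀ (by positivity)]
      gcongr
    have h5 : K * (2 * τ) ^ (-p) * E x ≤ K * F τ * E x := by gcongr
    exact h5.trans (by linarith)
  · refine Measurable.sub (Measurable.neg ?_) ?_
    · have h2 : Measurable fun q : Eu N × ℝ => F q.2 := hFm.comp measurable_snd
      fun_prop
    · exact (hW.meas.comp measurable_fst).mul (h.meas.sub ((h.measurable_Om hχ).comp measurable_fst))
  · refine Eventually.of_forall fun x => ⟨hDc x, fun t ht => ?_⟩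
    refine (abs_sub _ _).trans (add_le_add (hPE x t ht).2 ?_)
    rw [abs_of_nonneg (h.Pt_nonneg hχ x t)]
    exact Pt_anti h hχ (h.slice_Ioc hχ x hs) ht.1
  · filter_upwards [hPs] with x hx hxR
    have hDx : Measurable (D x) := hDm.comp (measurable_const.prodMk measurable_id)
    refine ⟨?_, fun t ht => ?_, posRate_integrableOn hDx (hζi x), posRate_nonneg _ _, fun t1 t2 h1 h2 h12 =>
      posRate_incr hDx (hDc x) (hζi x) (hinc x) h1 h2 h12⟩
    · have := (hPE x s ⟨le_rfl, hsτ.le⟩).1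
      have h3 := hx hxR
      simp only [hD]; linarith
    · have := (hPE x t ht).1
      have h3 := h.Pt_nonneg hχ x t
      simp only [hD]; linarith
  · refine Eventually.of_forall fun x hx1 _ t ht => ?_
    have h3 := h.Pt_nonneg hχ x t
    have h4 : E x ≤ 0 := by
      simp only [hE]
      rw [sub_nonpos]
      refine Real.exp_le_exp.2 (neg_le_neg ?_)
      rw [ha, div_mul_eq_mul_div, le_div_iff₀ (by positivity)]
      gcongr
    have h5 := mul_nonpos_of_nonneg_of_nonpos (mul_pos hK0 (hF0 t ht)).le h4
    simp only [hD]; linarith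
  · filter_upwards [h.ae_LI hχ] with t ht hts
    exact (LI.of_continuous (by fun_prop)).sub (ht ⟨hs.trans hts.1, hts.2.trans (hτ1.trans (hχ.lt12.trans hχ.lt2))⟩)
  · refine Eventually.of_forall fun t ht => ?_
    have htI := Ioo_subset_Icc_self ht
    filter_upwards [hom, Measure.ae_ne volume (0 : Eu N)] with y hy hy0 hyR
    have hy00 : 0 < ‖y‖ := norm_pos_iff.2 hy0
    have h1 : ρ y * Om χ u y ≤ Cu * ‖y‖ ^ (-γ) * (Cw * (R + 3) ^ (lam / m)) := by
      refine mul_le_mul (hW.up y hy0) (hy.2.trans ?_) hy.1 (by positivity)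
      have : 0 < lam / m := by positivity
      exact mul_le_mul_of_nonneg_left (Real.rpow_le_rpow (by positivity) (by linarith) this.le) hCw
    have h2 : 0 ≤ ρ y * u y t := mul_nonneg (hW.nonneg y) (h.nonneg y t)
    have h3 : 1 ≤ (R + 2) ^ γ * ‖y‖ ^ (-γ) := by
      rw [Real.rpow_neg hy00.le, ← div_eq_mul_inv, ← Real.div_rpow (by linarith) hy00.le]
      exact Real.one_le_rpow ((one_le_div hy00).2 hyR.le) hγ
    have h4 : -(2 * a * (K * F t) * Real.exp (-(a * ‖y‖ ^ 2)) * (2 * a * ‖y‖ ^ 2 - n)) ≤ 2 * a * n * (K * τ ^ (-p)) := by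
      have e1 : Real.exp (-(a * ‖y‖ ^ 2)) ≤ 1 := Real.exp_le_one_iff.2 (neg_nonpos.2 (by positivity))
      have e2 := Real.exp_pos (-(a * ‖y‖ ^ 2))
      have e3 : -(Real.exp (-(a * ‖y‖ ^ 2)) * (2 * a * ‖y‖ ^ 2 - n)) ≤ n := by
        have e5 : 0 ≤ Real.exp (-(a * ‖y‖ ^ 2)) * (2 * a * ‖y‖ ^ 2) := by positivity
        have e6 := mul_le_mul_of_nonneg_right e1 (show 0 ≤ n by linarith)
        linarith
      have e4 := hF0 t htI
      calc _ = 2 * a * (K * F t) * -(Real.exp (-(a * ‖y‖ ^ 2)) * (2 * a * ‖y‖ ^ 2 - n)) := by ring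
        _ ≤ 2 * a * (K * F t) * n := mul_le_mul_of_nonneg_left e3 (by positivity)
        _ ≤ 2 * a * (K * τ ^ (-p)) * n := by
          have := hFup t htI
          gcongr
        _ = _ := by ring
    have h5 := mul_le_mul_of_nonneg_left h3 (show 0 ≤ 2 * a * n * (K * τ ^ (-p)) by positivity)
    simp only [hf]
    linarith
  · intro k
    filter_upwards [h.Pt_potAt hN hχ (1 / (k + 1 : ℝ)), h.ae_LI hχ] with t ht ht2 hts x
    have hts' : t ∈ Ioo 0 T1 := ⟨hs.trans hts.1, hts.2.trans hτ1⟩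
    have hR1 := (rad_exp a (Real.exp (-(2 * n))) (K * F t)).potAt hN (1 / (k + 1 : ℝ)) x
    have := hR1.sub (by positivity) (ht hts' x) (LI.of_continuous (by fun_prop)) (LI.of_continuous (by simp only [radL_exp]; fun_prop))
      (h.LI_Pt hχ hts'.1) (ht2 ⟨hts'.1, hts'.2.trans (hχ.lt12.trans hχ.lt2)⟩)
    simpa only [radL_exp] using this
  · filter_upwards [hom, Measure.ae_ne volume (0 : Eu N)] with x hx hx0 hxR
    refine Eventually.of_forall fun t ht hz => ?_
    have htI := Ioo_subset_Icc_self ht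
    have hz2 := (posRate_pos hz).2
    have hFt := hF0 t htI
    have hFb := (hτ.trans (hFlow t htI))
    refine barrier_point (γ := γ) (Cl := Cl) (Cu := Cu) (q := ‖x‖) (n := n) (lam := lam) (Cw := Cw) (p := p) hm hγ (by rw [hlam, gexp_div hm]; ring) hl hn hR (norm_pos_iff.2 hx0) hxR
      hCl (hW.low x) hCu (hW.up x hx0) (h.nonneg x t) hCw hx.2 hx.1 hp0 hA hFt ?_ ?_ c3 ?_
    · have := (le_max_left _ _).trans hFb
      rw [div_le_iff₀ hc1p] at this
      refine this.trans (le_of_eq ?_)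
      rw [hc1']; ring
    · have := (le_max_right _ _).trans hFb
      rw [div_le_iff₀ hc2p] at this
      exact this.trans (le_of_eq (mul_comm _ _))
    · simp only [hζ, hE] at hz2
      linarith

lemma Sol.large_of_mass (hN : 3 ≤ N) (hm : 1 < m) (hT : 0 < T) (hW : Wt N γ Cl Cu ρ) (h : Sol ρ m T u)
    (hχ : Cut χ T T1 T2) (hd : ∀ t, deriv χ t ≤ 0) {R0 : ℝ} (hR : 0 < R) (hRR : R0 ≤ R) (K : ℝ) :
    ∃ M, ∀ᵐ t, t ∈ Ioo 0 T1 → M < ∫ x in closedBall (0 : Eu N) R0, Pt χ T2 m u x t →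
      ∀ᵐ x, ‖x‖ < R → K ≤ Pt χ T2 m u x t := by
  have := nontrivial_Eu hN
  obtain ⟨Cw, hCw, hom⟩ := h.Om_bound hN hm hT hW hχ hd
  have hl : 0 < gexp γ m := gexp_pos hW.g2 hm
  set p := gexp γ m / m with hp
  have hp0 : 0 < p := by positivity
  have hCu := hW.Cu_nonneg hN
  have hcK := cK_pos hN
  obtain ⟨c, hc, hth⟩ := exists_le_thK hN
  obtain ⟨Cn, hCn, hnewt⟩ := exists_newton_rpow hN hW.g0 hW.g2
  set B := Cu * (Cw * (1 + 5 * R) ^ p) * (Cn * (4 * R) ^ (2 - γ)) / cK N with hB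
  set c4 := c * (4 * R) ^ (-N : ℝ) with hc4
  have hc40 : 0 < c4 := by positivity
  refine ⟨(K + B) / c4, ?_⟩
  filter_upwards [h.Pt_potAt hN hχ (4 * R), h.ae_LI hχ] with t ht ht2 htT hM
  have hP := h.LI_Pt hχ htT.1
  have hf := ht2 ⟨htT.1, htT.2.trans (hχ.lt12.trans hχ.lt2)⟩
  have hsub := submean hN (hP.const_mul (-1)) (hf.const_mul (-1)) (n := fun y => Cu * (Cw * (1 + ‖y‖) ^ p) * ‖y‖ ^ (-γ)) (by
    filter_upwards [hom, Measure.ae_ne volume (0 : Eu N)] with y hy hy0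
    have h1 : ρ y * Om χ u y ≤ Cu * ‖y‖ ^ (-γ) * (Cw * (1 + ‖y‖) ^ p) :=
      mul_le_mul (hW.up y hy0) hy.2 hy.1 (by positivity)
    have h2 : 0 ≤ ρ y * u y t := mul_nonneg (hW.nonneg y) (h.nonneg y t)
    linarith)
  filter_upwards [hsub] with x hx hxR
  have h1 := hx (4 * R) (by positivity) ((ht htT x).const_mul (-1))
  have h2 : ∫⁻ y in ball x (4 * R), ofReal (Cu * (Cw * (1 + ‖y‖) ^ p) * ‖y‖ ^ (-γ)) * ofReal (‖y - x‖ ^ (2 - N : ℝ))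
      ≤ ofReal (cK N * B) := by
    have e : cK N * B = Cu * (Cw * (1 + 5 * R) ^ p) * (Cn * (4 * R) ^ (2 - γ)) := by
      rw [hB]; field_simp
    rw [e, ENNReal.ofReal_mul (by positivity)]
    refine le_trans ?_ (mul_le_mul_right (hnewt x (4 * R) (by positivity)) _)
    rw [← lintegral_const_mul' _ _ ENNReal.ofReal_ne_top]
    refine setLIntegral_mono' measurableSet_ball fun y hy => ?_
    rw [ENNReal.ofReal_mul (p := Cu * (Cw * (1 + ‖y‖) ^ p)) (by positivity), mul_assoc]
    gcongr
    rw [mem_ball, dist_eq_norm] at hy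
    have := norm_sub_norm_le y x
    linarith
  have h3 := h1.trans h2
  have hB0 : 0 ≤ cK N * B := by rw [hB]; positivity
  rw [ENNReal.ofReal_le_ofReal_iff hB0] at h3
  have h4 := le_of_mul_le_mul_left h3 hcK
  have h5 : ∫ y, -1 * Pt χ T2 m u y t * thK (4 * R) (y - x) = -∫ y, Pt χ T2 m u y t * thK (4 * R) (y - x) := by
    rw [← integral_neg]; congr 1; ext y; ring
  rw [h5] at h4
  have hint := hP.integrable_thK (show 0 < 4 * R by positivity) x
  have h6 : c4 * ∫ y in closedBall (0 : Eu N) R0, Pt χ T2 m u y t ≤ ∫ y, Pt χ T2 m u y t * thK (4 * R) (y - x) := by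
    rw [← integral_const_mul]
    refine le_trans ?_ (setIntegral_le_integral (s := closedBall (0 : Eu N) R0) hint
      (Eventually.of_forall fun y => mul_nonneg (h.Pt_nonneg hχ y t) (thK_nonneg hN (by positivity) _)))
    refine setIntegral_mono_on ((hP R0).const_mul _) hint.integrableOn measurableSet_closedBall fun y hy => ?_
    rw [mul_comm]
    refine mul_le_mul_of_nonneg_left (hth _ (by positivity) _ ?_) (h.Pt_nonneg hχ y t)
    rw [mem_closedBall_zero_iff] at hy
    have := norm_sub_le y x
    linarith
  rw [div_lt_iff₀ hc40] at hM
  linarith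

lemma Sol.mass_bounded (hN : 3 ≤ N) (hm : 1 < m) (hT : 0 < T) (hW : Wt N γ Cl Cu ρ) (h : Sol ρ m T u)
    (hχ : Cut χ T T1 T2) (hd : ∀ t, deriv χ t ≤ 0) (R0 : ℝ) :
    ∃ M, ∀ t, 0 < t → ∫ x in closedBall (0 : Eu N) R0, Pt χ T2 m u x t ≤ M := by
  by_contra! hcon
  obtain ⟨A, τ, hA, hτ, hτ1, hbar⟩ := h.barrier hN hm hT hW hχ hd
  set lam := gexp γ m with hlam
  have hl : 0 < lam := gexp_pos hW.g2 hm
  have hn := three_le_cast hN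
  have key : ∀ k : ℕ, ∀ᵐ x : Eu N, R0 ≤ k → 2 ≤ k → ‖x‖ < 1 →
      A * (k : ℝ) ^ lam * (2 * τ) ^ (-(1 / (m - 1))) * (Real.exp (-N : ℝ) - Real.exp (-(2 * N))) ≤ Pt χ T2 m u x τ := by
    intro k
    by_cases hk : R0 ≤ k
    swap
    · exact Eventually.of_forall fun x h1 => absurd h1 hk
    by_cases hk2 : 2 ≤ k
    swap
    · exact Eventually.of_forall fun x _ h1 => absurd h1 hk2
    have hk2' : (2 : ℝ) ≤ k := by exact_mod_cast hk2
    obtain ⟨M, hM⟩ := h.large_of_mass hN hm hT hW hχ hd (R := k) (by linarith) hk (A * (k : ℝ) ^ lam * τ ^ (-(1 / (m - 1))))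
    obtain ⟨t0, ht0, ht0M⟩ := hcon M
    have hmono : ∀ s, 0 < s → s ≤ t0 → M < ∫ x in closedBall (0 : Eu N) R0, Pt χ T2 m u x s := fun s hs hst =>
      ht0M.trans_le (setIntegral_mono_on (h.LI_Pt hχ ht0 R0) (h.LI_Pt hχ hs R0) measurableSet_closedBall
        fun x _ => Pt_anti h hχ (h.slice_Ioc hχ x hs) hst)
    obtain ⟨s, hs, hsI⟩ : ∃ s, (s ∈ Ioo 0 T1 → M < ∫ x in closedBall (0 : Eu N) R0, Pt χ T2 m u x s →
      ∀ᵐ x, ‖x‖ < k → A * (k : ℝ) ^ lam * τ ^ (-(1 / (m - 1))) ≤ Pt χ T2 m u x s) ∧ s ∈ Ioo 0 (min t0 τ) := by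
      by_contra! hc
      have h0 : volume (Ioo 0 (min t0 τ)) = 0 :=
        measure_mono_null (fun s hs hcs => hc s hcs hs) (ae_iff.1 hM)
      rw [Real.volume_Ioo, ENNReal.ofReal_eq_zero] at h0
      have : 0 < min t0 τ := lt_min ht0 hτ
      linarith
    have hsτ := hsI.2.trans_le (min_le_right _ _)
    filter_upwards [hbar k s (by linarith) hsI.1 hsτ (hs ⟨hsI.1, hsτ.trans hτ1⟩
      (hmono s hsI.1 (hsI.2.le.trans (min_le_left _ _))))] with x hx _ _ hx1
    refine le_trans ?_ (hx (by linarith))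
    refine mul_le_mul_of_nonneg_left (sub_le_sub_right (Real.exp_le_exp.2 (neg_le_neg ?_)) _) (by positivity)
    rw [div_mul_eq_mul_div, div_le_iff₀ (by positivity)]
    have : ‖x‖ ^ 2 ≤ 1 := pow_le_one₀ (norm_nonneg x) hx1.le
    have e1 := mul_le_mul_of_nonneg_left this (show (0:ℝ) ≤ 2 * N by positivity)
    have e2 := mul_le_mul_of_nonneg_left (show (4:ℝ) ≤ (k:ℝ) ^ 2 by nlinarith) (show (0:ℝ) ≤ N by positivity)
    linarith
  obtain ⟨x, hx, hx1⟩ : ∃ x : Eu N, (∀ k : ℕ, R0 ≤ k → 2 ≤ k → ‖x‖ < 1 →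
      A * (k : ℝ) ^ lam * (2 * τ) ^ (-(1 / (m - 1))) * (Real.exp (-N : ℝ) - Real.exp (-(2 * N))) ≤ Pt χ T2 m u x τ) ∧ x ∈ ball (0 : Eu N) 1 := by
    by_contra! hc
    have h0 : volume (ball (0 : Eu N) 1) = 0 :=
      measure_mono_null (fun s hs hcs => hc s hcs hs) (ae_iff.1 (ae_all_iff.2 key))
    exact (measure_ball_pos volume (0 : Eu N) one_pos).ne' h0
  have hg : 0 < Real.exp (-N : ℝ) - Real.exp (-(2 * N)) := by
    rw [sub_pos]; exact Real.exp_lt_exp.2 (by linarith)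
  have hlim : Tendsto (fun k : ℕ => A * (k : ℝ) ^ lam * (2 * τ) ^ (-(1 / (m - 1))) * (Real.exp (-N : ℝ) - Real.exp (-(2 * N))))
      atTop atTop :=
    ((((tendsto_rpow_atTop hl).comp tendsto_natCast_atTop_atTop).const_mul_atTop hA).atTop_mul_const (by positivity)).atTop_mul_const hg
  obtain ⟨k, hk1, hk2, hk3⟩ := ((hlim.eventually_gt_atTop (Pt χ T2 m u x τ)).and
    ((eventually_ge_atTop 2).and (tendsto_natCast_atTop_atTop.eventually_ge_atTop R0))).exists
  exact absurd (hx k hk3 hk2 (by simpa using hx1)) (not_le.2 hk1)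

lemma le_one_add_rpow {w : ℝ} (hm : 1 < m) (hw : 0 ≤ w) : w ≤ 1 + w ^ m := by
  rcases le_or_gt w 1 with h | h
  · have : 0 ≤ w ^ m := Real.rpow_nonneg hw _
    linarith
  · have := Real.rpow_le_rpow_of_exponent_le h.le hm.le
    rw [Real.rpow_one] at this
    linarith

lemma Sol.meas_slice (h : Sol ρ m T u) (x : Eu N) : Measurable (u x) :=
  h.meas.comp (measurable_const.prodMk measurable_id)

lemma Sol.integrableOn_one (h : Sol ρ m T u) (hm : 1 < m) {S : Set ℝ} (hS : volume S ≠ ⊤)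
    (hi : IntegrableOn (fun t => u x t ^ m) S) : IntegrableOn (u x) S := by
  refine ((integrableOn_const (C := (1:ℝ)) hS).add hi).mono' (h.meas_slice x).aestronglyMeasurable (Eventually.of_forall fun t => ?_)
  rw [Real.norm_eq_abs, abs_of_nonneg (h.nonneg x t)]
  exact le_one_add_rpow hm (h.nonneg x t)

lemma Sol.integrable_time_one (h : Sol ρ m T u) (hm : 1 < m) {k : ℝ → ℝ} (hk : Measurable k)
    (hkC : ∀ t, |k t| ≤ C) (ha : 0 < a) (hb : b < T) (hk0 : ∀ t ∉ Icc a b, k t = 0) (x : Eu N) :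
    Integrable fun t => k t * u x t := by
  refine IntegrableOn.integrable_of_forall_notMem_eq_zero (s := Icc a b) ?_ fun t ht => by simp [hk0 t ht]
  exact (h.integrableOn_one hm (by simp) (h.slice x a b ha hb)).bdd_mul (c := C) hk.aestronglyMeasurable (Eventually.of_forall hkC)

lemma Sol.trace_growth (hN : 3 ≤ N) (hm : 1 < m) (hT : 0 < T) (hW : Wt N γ Cl Cu ρ) (h : Sol ρ m T u)
    (hχ : Cut χ T T1 T2) (hd : ∀ t, deriv χ t ≤ 0) (hC0 : 0 ≤ C0) (hdC : ∀ t, -deriv χ t ≤ C0 * χ t ^ (1 / m)) :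
    ∃ C, 0 ≤ C ∧ ∀ R s, 1 ≤ R → 0 < s → s < T1 →
      ∫ x in closedBall (0 : Eu N) R, Pt χ T2 m u x s ≤ C * R ^ (N + gexp γ m) := by
  obtain ⟨C, r0, hC, hr0, hgrow⟩ := growth hN hm hT hW hC0
  obtain ⟨M, hM⟩ := h.mass_bounded hN hm hT hW hχ hd r0
  set J := ∫ x in closedBall (0 : Eu N) r0, ρ x * Om χ u x with hJ
  have hM0 : 0 ≤ M := le_trans (integral_nonneg fun x => h.Pt_nonneg hχ x 1) (hM 1 one_pos)
  have hOm0 : ∀ x, 0 ≤ Om χ u x := fun x => by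
    unfold Om; rw [← integral_neg]
    refine integral_nonneg fun t => ?_
    rw [← neg_mul]
    exact mul_nonneg (by simpa using hd t) (h.nonneg x t)
  have hJ0 : 0 ≤ J := integral_nonneg fun x => mul_nonneg (hW.nonneg x) (hOm0 x)
  refine ⟨C * (1 + M + J), by positivity, fun R s hR hs hs1 => ?_⟩
  have hs2 : s / 2 < s := by linarith
  have hT12 := hχ.lt12
  set κ : ℝ → ℝ := fun t => ramp (s / 2) s t * χ t with hκ
  have hrs := ramp_smooth (s / 2) s
  have hsm : ContDiff ℝ ∞ κ := hrs.mul hχ.smooth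
  have hκ0 : ∀ t, 0 ≤ κ t := fun t => mul_nonneg (ramp_nonneg _ _ t) (hχ.nonneg t)
  have hκ1 : ∀ t, κ t ≤ 1 := fun t => mul_le_one₀ (ramp_le_one _ _ t) (hχ.nonneg t) (hχ.le_one t)
  have hκχ : ∀ t, κ t ≤ χ t := fun t => mul_le_of_le_one_left (hχ.nonneg t) (ramp_le_one _ _ t)
  have hz : ∀ t, t ∉ Icc (s / 2) T2 → κ t = 0 := by
    intro t ht
    rcases lt_or_lt_of_notMem_Icc ht with ht | ht
    · simp [hκ, ramp_zero hs2 ht.le]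
    · simp [hκ, hχ.zero t ht.le]
  have hsupp : tsupport κ ⊆ Icc (s / 2) T2 :=
    closure_minimal (fun t ht => by by_contra hcon; exact ht (hz t hcon)) isClosed_Icc
  have hcs : HasCompactSupport κ := HasCompactSupport.intro isCompact_Icc hz
  have hsI : tsupport κ ⊆ Ioo 0 T := hsupp.trans (Icc_subset_Ioo (by linarith) hχ.lt2)
  have hde : ∀ t, -deriv κ t ≤ -deriv χ t := by
    intro t
    have e : deriv κ t = deriv (ramp (s / 2) s) t * χ t + ramp (s / 2) s t * deriv χ t :=
      (((hrs.differentiable (by simp)) t).hasDerivAt.mul ((hχ.smooth.differentiable (by simp)) t).hasDerivAt).deriv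
    have e1 := mul_nonneg (ramp_deriv_nonneg hs2 t) (hχ.nonneg t)
    have e2 := mul_le_mul_of_nonneg_right (ramp_le_one (s / 2) s t) (show 0 ≤ -deriv χ t by linarith [hd t])
    rw [e]; linarith
  have hder : ∀ t, -deriv κ t ≤ C0 * κ t ^ (1 / m) := by
    intro t
    rcases lt_or_ge t T1 with ht | ht
    · refine (hde t).trans ?_
      rw [hχ.deriv_zero (fun hh => absurd hh.1 (not_le.2 ht)), neg_zero]
      exact mul_nonneg hC0 (Real.rpow_nonneg (hκ0 t) _)
    · refine (hde t).trans ((hdC t).trans (le_of_eq ?_))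
      simp [hκ, ramp_one hs2 (show s ≤ t by linarith)]
  have hg := hgrow u h κ hsm hcs hsI hκ0 hκ1 hder R hR
  have habs : ∀ t, |κ t| ≤ 1 := fun t => by rw [abs_of_nonneg (hκ0 t)]; exact hκ1 t
  have hiκ : ∀ x, Integrable fun t => κ t * u x t ^ m := fun x =>
    h.integrable_time hsm.continuous.measurable habs (by linarith) hχ.lt2 hz x
  have hiP : ∀ r, 0 < r → ∀ x, Integrable fun t => (Ioc r T2).indicator χ t * u x t ^ m := fun r hr x =>
    h.integrable_time (hχ.smooth.continuous.measurable.indicator measurableSet_Ioc) (hχ.abs_indicator_le r) hr hχ.lt2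
      (fun t ht => Cut.indicator_zero ht) x
  have h1 : ∫ x in closedBall (0 : Eu N) R, Pt χ T2 m u x s ≤ ∫ x in closedBall (0 : Eu N) R, (∫ t, κ t * u x t ^ m) := by
    refine setIntegral_mono_on (h.LI_Pt hχ hs R) (h.LI_F hsm hcs hsI R) measurableSet_closedBall fun x _ => ?_
    rw [Pt_eq]
    refine integral_mono (hiP s hs x) (hiκ x) fun t => mul_le_mul_of_nonneg_right ?_ (Real.rpow_nonneg (h.nonneg x t) _)
    by_cases ht : t ∈ Ioc s T2
    · rw [indicator_of_mem ht]; simp [hκ, ramp_one hs2 ht.1.le]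
    · rw [indicator_of_notMem ht]; exact hκ0 t
  have h2 : ∫ x in closedBall (0 : Eu N) r0, (∫ t, κ t * u x t ^ m) ≤ M := by
    refine le_trans ?_ (hM (s / 2) (by linarith))
    refine setIntegral_mono_on (h.LI_F hsm hcs hsI r0) (h.LI_Pt hχ (by linarith) r0) measurableSet_closedBall fun x _ => ?_
    rw [Pt_eq]
    refine integral_mono (hiκ x) (hiP (s / 2) (by linarith) x) fun t => mul_le_mul_of_nonneg_right ?_ (Real.rpow_nonneg (h.nonneg x t) _)
    by_cases ht : t ∈ Ioc (s / 2) T2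
    · rw [indicator_of_mem ht]; exact hκχ t
    · rw [indicator_of_notMem ht]
      by_cases ht2 : t ≤ s / 2
      · simp [hκ, ramp_zero hs2 ht2]
      · rw [hz t fun hh => ht ⟨not_le.1 ht2, hh.2⟩]
  have h3 : ∫ x in closedBall (0 : Eu N) r0, (∫ t, max (-deriv κ t) 0 * (ρ x * u x t)) ≤ J := by
    obtain ⟨L, hL0, hL⟩ := hχ.exists_deriv_bound
    have hmax : ∀ t, max (-deriv κ t) 0 ≤ -deriv χ t := fun t => max_le (hde t) (by linarith [hd t])
    refine integral_mono_of_nonneg (Eventually.of_forall fun x => integral_nonneg fun t =>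
      mul_nonneg (le_max_right _ _) (mul_nonneg (hW.nonneg x) (h.nonneg x t))) (h.LI_Om hχ r0) (Eventually.of_forall fun x => ?_)
    have hi := (h.integrable_time_one hm (hχ.smooth.continuous_deriv (by simp)).measurable hL hχ.pos hχ.lt2
      (fun t ht => hχ.deriv_zero ht) x).const_mul (-ρ x)
    have e : ρ x * Om χ u x = ∫ t, -ρ x * (deriv χ t * u x t) := by
      rw [integral_const_mul]; unfold Om; ring
    change (∫ t, max (-deriv κ t) 0 * (ρ x * u x t)) ≤ ρ x * Om χ u x
    rw [e]
    refine integral_mono_of_nonneg (Eventually.of_forall fun t =>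
      mul_nonneg (le_max_right _ _) (mul_nonneg (hW.nonneg x) (h.nonneg x t))) hi (Eventually.of_forall fun t => ?_)
    have := mul_le_mul_of_nonneg_right (hmax t) (mul_nonneg (hW.nonneg x) (h.nonneg x t))
    change max (-deriv κ t) 0 * (ρ x * u x t) ≤ -ρ x * (deriv χ t * u x t)
    linarith
  refine h1.trans (hg.trans ?_)
  have hRp : 0 ≤ R ^ ((N : ℝ) + gexp γ m) := Real.rpow_nonneg (by linarith) _
  exact mul_le_mul_of_nonneg_right (mul_le_mul_of_nonneg_left (by linarith) hC.le) hRp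

/-- The pressure is finite up to the initial time, with the critical growth. -/
lemma Sol.trace (hN : 3 ≤ N) (hm : 1 < m) (hT : 0 < T) (hW : Wt N γ Cl Cu ρ) (h : Sol ρ m T u)
    (hχ : Cut χ T T1 T2) (hd : ∀ t, deriv χ t ≤ 0) (hC0 : 0 ≤ C0) (hdC : ∀ t, -deriv χ t ≤ C0 * χ t ^ (1 / m)) :
    (∀ᵐ x, IntegrableOn (fun t => u x t ^ m) (Ioc 0 T2)) ∧ LI (fun x => Pt χ T2 m u x 0) ∧
    ∃ C, 0 ≤ C ∧ ∀ R, 1 ≤ R → ∫ x in closedBall (0 : Eu N) R, Pt χ T2 m u x 0 ≤ C * R ^ (N + gexp γ m) := by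
  obtain ⟨C, hC, hg⟩ := h.trace_growth hN hm hT hW hχ hd hC0 hdC
  have hT1 := hχ.pos
  have hT12 := hχ.lt12
  set s : ℕ → ℝ := fun k => T1 / (k + 2) with hs
  have hs0 : ∀ k, 0 < s k := fun k => by simp only [hs]; positivity
  have hs1 : ∀ k, s k < T1 := fun k => by
    simp only [hs]
    rw [div_lt_iff₀ (by positivity)]
    have : (0:ℝ) ≤ k := Nat.cast_nonneg k
    nlinarith
  have hsanti : ∀ i j, i ≤ j → s j ≤ s i := fun i j hij => by
    simp only [hs]
    gcongr
  have hslim : Tendsto s atTop (𝓝 0) := by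
    have h1 : Tendsto (fun k : ℕ => ((k : ℝ) + 2)) atTop atTop := tendsto_atTop_add_const_right _ _ tendsto_natCast_atTop_atTop
    exact h1.const_div_atTop T1
  set G : Eu N → ℝ≥0∞ := fun x => ⨆ k, ofReal (Pt χ T2 m u x (s k)) with hG
  have hPm : ∀ t, Measurable fun x => Pt χ T2 m u x t := fun t => (h.measurable_Pt hχ).comp (measurable_id.prodMk measurable_const)
  have hGm : Measurable G := Measurable.iSup fun k => (hPm (s k)).ennreal_ofReal
  have hGR : ∀ R, 1 ≤ R → ∫⁻ x in closedBall (0 : Eu N) R, G x ≤ ofReal (C * R ^ ((N : ℝ) + gexp γ m)) := by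
    intro R hR
    simp only [hG]
    rw [lintegral_iSup (fun k => (hPm (s k)).ennreal_ofReal) (fun i j hij x =>
      ENNReal.ofReal_le_ofReal (Pt_anti h hχ (h.slice_Ioc hχ x (hs0 j)) (hsanti i j hij)))]
    refine iSup_le fun k => ?_
    rw [← ofReal_integral_eq_lintegral_ofReal (h.LI_Pt hχ (hs0 k) R) (Eventually.of_forall fun x => h.Pt_nonneg hχ x (s k))]
    exact ENNReal.ofReal_le_ofReal (hg R (s k) hR (hs0 k) (hs1 k))
  have hfin : ∀ᵐ x, G x < ⊤ := by
    have h1 : ∀ k : ℕ, ∀ᵐ x : Eu N, x ∈ closedBall (0 : Eu N) (k + 1 : ℝ) → G x < ⊤ := fun k =>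
      (ae_restrict_iff' measurableSet_closedBall).1 (ae_lt_top hGm (lt_of_le_of_lt (hGR _ (by
        have : (0:ℝ) ≤ k := Nat.cast_nonneg k
        linarith)) ENNReal.ofReal_lt_top).ne)
    filter_upwards [ae_all_iff.2 h1] with x hx
    obtain ⟨k, hk⟩ := exists_nat_ge ‖x‖
    exact hx k (by rw [mem_closedBall_zero_iff]; linarith)
  have hint : ∀ᵐ x, IntegrableOn (fun t => u x t ^ m) (Ioc 0 T2) := by
    filter_upwards [hfin] with x hx
    rw [← Ioc_union_Ioc_eq_Ioc hT1.le hT12.le]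
    refine IntegrableOn.union ?_ (h.slice_Ioc hχ x hT1)
    refine integrableOn_Ioc_of_intervalIntegral_norm_bounded_left (l := atTop) (a := s) (I := (G x).toReal)
      (fun k => (h.slice_Ioc hχ x (hs0 k)).mono_set (Ioc_subset_Ioc_right hT12.le)) hslim (Eventually.of_forall fun k => ?_)
    have e1 := Pt_incr (m := m) hχ (h.slice_Ioc hχ x (hs0 k)) le_rfl (hs1 k).le le_rfl
    have e2 : ∫ t in Ioc (s k) T1, ‖u x t ^ m‖ = ∫ t in Ioc (s k) T1, u x t ^ m :=
      integral_congr_ae (Eventually.of_forall fun t => by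
        simp only [Real.norm_eq_abs]; rw [abs_of_nonneg (Real.rpow_nonneg (h.nonneg x t) _)])
    rw [e2, ← e1]
    have e3 := h.Pt_nonneg hχ x T1
    have e4 : Pt χ T2 m u x (s k) ≤ (G x).toReal := by
      rw [← ENNReal.ofReal_le_iff_le_toReal hx.ne]
      exact le_iSup (fun k => ofReal (Pt χ T2 m u x (s k))) k
    linarith
  have hle : ∀ᵐ x, ofReal (Pt χ T2 m u x 0) ≤ G x := by
    filter_upwards [hint] with x hx
    have hc := Pt_continuousOn (m := m) hχ hx
    have hl : Tendsto (fun k => Pt χ T2 m u x (s k)) atTop (𝓝 (Pt χ T2 m u x 0)) :=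
      (hc 0 ⟨le_rfl, hT1.le⟩).tendsto.comp (tendsto_nhdsWithin_iff.2 ⟨hslim, Eventually.of_forall fun k => ⟨(hs0 k).le, (hs1 k).le⟩⟩)
    exact le_of_tendsto (ENNReal.tendsto_ofReal hl) (Eventually.of_forall fun k => le_iSup (fun k => ofReal (Pt χ T2 m u x (s k))) k)
  have hP0 : ∀ R, 1 ≤ R → ∫⁻ x in closedBall (0 : Eu N) R, ofReal (Pt χ T2 m u x 0) ≤ ofReal (C * R ^ ((N : ℝ) + gexp γ m)) :=
    fun R hR => (lintegral_mono_ae (ae_restrict_of_ae hle)).trans (hGR R hR)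
  have hLI : LI (fun x => Pt χ T2 m u x 0) := by
    intro R
    have h1 : IntegrableOn (fun x => Pt χ T2 m u x 0) (closedBall (0 : Eu N) (max R 1)) := by
      refine ⟨(hPm 0).aestronglyMeasurable, ?_⟩
      rw [hasFiniteIntegral_iff_ofReal (Eventually.of_forall fun x => h.Pt_nonneg hχ x 0)]
      exact (hP0 _ (le_max_right _ _)).trans_lt ENNReal.ofReal_lt_top
    exact h1.mono_set (closedBall_subset_closedBall (le_max_left _ _))
  refine ⟨hint, hLI, C, hC, fun R hR => ?_⟩
  have hRp : 0 ≤ R ^ ((N : ℝ) + gexp γ m) := Real.rpow_nonneg (by linarith) _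
  rw [← ENNReal.ofReal_le_ofReal_iff (mul_nonneg hC hRp), ofReal_integral_eq_lintegral_ofReal (hLI R)
    (Eventually.of_forall fun x => h.Pt_nonneg hχ x 0)]
  exact hP0 R hR

lemma neBot_nhdsGT_inf_ae : ((𝓝[>] (0 : ℝ)) ⊓ ae (volume : Measure ℝ)).NeBot := by
  rw [inf_neBot_iff]
  intro s hs s' hs'
  obtain ⟨e, he, hsub⟩ := mem_nhdsGT_iff_exists_Ioo_subset.1 hs
  by_contra hc
  rw [not_nonempty_iff_eq_empty] at hc
  have h1 : Ioo 0 e ⊆ s'ᶜ := fun t ht ht' => by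
    have : t ∈ s ∩ s' := ⟨hsub ht, ht'⟩
    rw [hc] at this; exact this
  have h2 := measure_mono_null h1 (mem_ae_iff.1 hs')
  rw [Real.volume_Ioo, ENNReal.ofReal_eq_zero] at h2
  have : (0 : ℝ) < e := he
  linarith

lemma Sol.tendsto_Pt (h : Sol ρ m T u) (hχ : Cut χ T T1 T2)
    (hi : ∀ᵐ x, IntegrableOn (fun t => u x t ^ m) (Ioc 0 T2)) (hP : LI fun x => Pt χ T2 m u x 0)
    (hg : Continuous g) (hgc : HasCompactSupport g) :
    Tendsto (fun t => ∫ x, Pt χ T2 m u x t * g x) (𝓝[>] 0)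
      (𝓝 (∫ x, Pt χ T2 m u x 0 * g x)) := by
  have hmem : Ioo 0 T1 ∈ 𝓝[>] (0 : ℝ) := Ioo_mem_nhdsGT hχ.pos
  refine tendsto_integral_filter_of_dominated_convergence (fun x => |Pt χ T2 m u x 0 * g x|)
    ?_ ?_ (hP.integrable_mul hg hgc).abs ?_
  · refine Eventually.of_forall fun t => ?_
    exact (((h.measurable_Pt hχ).comp (measurable_id.prodMk measurable_const)).mul
      hg.measurable).aestronglyMeasurable
  · filter_upwards [hmem] with t ht
    filter_upwards [hi] with x hx
    rw [Real.norm_eq_abs, abs_mul, abs_mul]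
    refine mul_le_mul_of_nonneg_right ?_ (abs_nonneg _)
    rw [abs_of_nonneg (h.Pt_nonneg hχ x t), abs_of_nonneg (h.Pt_nonneg hχ x 0)]
    exact Pt_anti h hχ hx ht.1.le
  · filter_upwards [hi] with x hx
    have hc := Pt_continuousOn (m := m) hχ hx
    have := (hc 0 ⟨le_rfl, hχ.pos.le⟩).mono_left
      (nhdsWithin_mono (0 : ℝ) (s := Ioo 0 T1) Ioo_subset_Icc_self)
    rw [nhdsWithin_Ioo_eq_nhdsGT hχ.pos] at this
    exact this.mul_const _

/-- The difference of the potentials at time zero of two solutions with the same trace. -/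
lemma Sol.init_potAt (hN : 3 ≤ N) (h : Sol ρ m T u) (hv : Sol ρ m T v) (hχ : Cut χ T T1 T2)
    (hi : ∀ᵐ x, IntegrableOn (fun t => u x t ^ m) (Ioc 0 T2)) (hP : LI fun x => Pt χ T2 m u x 0)
    (hiv : ∀ᵐ x, IntegrableOn (fun t => v x t ^ m) (Ioc 0 T2)) (hPv : LI fun x => Pt χ T2 m v x 0)
    (hs : ∀ φ : Eu N → ℝ, Continuous φ → HasCompactSupport φ →
      Tendsto (fun t => ∫ x, (u x t - v x t) * φ x * ρ x) ((𝓝[>] 0) ⊓ ae volume) (𝓝 0))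
    (r : ℝ) (x : Eu N) : PotAt r (fun y => Pt χ T2 m u y 0 - Pt χ T2 m v y 0)
      (fun y => ρ y * (Om χ v y - Om χ u y)) x := by
  refine PotAt.of_prof hN (hP.sub hPv) fun k hk => ?_
  have hp := kB_prof (n := (N : ℝ)) (show 0 < 1 / (k + 1 : ℝ) by positivity) hk
  set b := fun q => kB N (1 / (k + 1 : ℝ)) q - kB N r q with hb
  set L := radL N (fun q => kB1 N (1 / (k + 1 : ℝ)) q - kB1 N r q)
        (fun q => kB2 N (1 / (k + 1 : ℝ)) q - kB2 N r q) with hL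
  have hbc := hp.cont_b x
  have hbk := hp.compact_b x
  have hLc := hp.cont_L N x
  have hLk := hp.compact_L N x
  have hne := neBot_nhdsGT_inf_ae
  have hA := hs _ hbc hbk
  have hB := ((h.tendsto_Pt hχ hi hP hLc hLk).sub (hv.tendsto_Pt hχ hiv hPv hLc hLk)).mono_left
    (inf_le_left (b := ae (volume : Measure ℝ)))
  have iO := (hv.LI_Om hχ).sub (h.LI_Om hχ)
  have hsum := (hB.add_const (∫ y, ρ y * (Om χ v y - Om χ u y) * b (‖y - x‖ ^ 2))).add hA
  have hz : (fun t => ((∫ y, Pt χ T2 m u y t * L (‖y - x‖ ^ 2)) -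
      ∫ y, Pt χ T2 m v y t * L (‖y - x‖ ^ 2)) +
      (∫ y, ρ y * (Om χ v y - Om χ u y) * b (‖y - x‖ ^ 2)) +
      ∫ y, (u y t - v y t) * b (‖y - x‖ ^ 2) * ρ y) =ᶠ[(𝓝[>] 0) ⊓ ae volume] fun _ => 0 := by
    have hae := (h.Pt_pot hχ hp x).and ((hv.Pt_pot hχ hp x).and
      ((ae_LI_slice h.int1).and (ae_LI_slice hv.int1)))
    have e1 : ∀ᶠ t in (𝓝[>] (0 : ℝ)) ⊓ ae volume, t ∈ Ioo 0 T1 :=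
      mem_inf_of_left (Ioo_mem_nhdsGT hχ.pos)
    filter_upwards [mem_inf_of_right hae, e1] with t ⟨h1, h2, h3, h4⟩ ht
    have htT : t ∈ Ioo 0 T := ⟨ht.1, ht.2.trans (hχ.lt12.trans hχ.lt2)⟩
    have g1 := h1 ht
    have g2 := h2 ht
    have i1 := (h3 htT).integrable_mul hbc hbk
    have i2 := (h4 htT).integrable_mul hbc hbk
    have i3 := (h.LI_Om hχ).integrable_mul hbc hbk
    have i4 := (hv.LI_Om hχ).integrable_mul hbc hbk
    have s1 : (∫ y, ρ y * (u y t - Om χ u y) * b (‖y - x‖ ^ 2)) =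
        (∫ y, ρ y * u y t * b (‖y - x‖ ^ 2)) - ∫ y, ρ y * Om χ u y * b (‖y - x‖ ^ 2) := by
      refine Eq.trans ?_ (integral_sub i1 i3)
      congr 1; ext y; ring
    have s2 : (∫ y, ρ y * (v y t - Om χ v y) * b (‖y - x‖ ^ 2)) =
        (∫ y, ρ y * v y t * b (‖y - x‖ ^ 2)) - ∫ y, ρ y * Om χ v y * b (‖y - x‖ ^ 2) := by
      refine Eq.trans ?_ (integral_sub i2 i4)
      congr 1; ext y; ring
    have s3 : (∫ y, ρ y * (Om χ v y - Om χ u y) * b (‖y - x‖ ^ 2)) =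
        (∫ y, ρ y * Om χ v y * b (‖y - x‖ ^ 2)) - ∫ y, ρ y * Om χ u y * b (‖y - x‖ ^ 2) := by
      refine Eq.trans ?_ (integral_sub i4 i3)
      congr 1; ext y; ring
    have s4 : (∫ y, (u y t - v y t) * b (‖y - x‖ ^ 2) * ρ y) =
        (∫ y, ρ y * u y t * b (‖y - x‖ ^ 2)) - ∫ y, ρ y * v y t * b (‖y - x‖ ^ 2) := by
      refine Eq.trans ?_ (integral_sub i1 i2)
      congr 1; ext y; ring
    rw [s1] at g1
    rw [s2] at g2
    simp only [s3, s4]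
    linarith
  have hlim := tendsto_nhds_unique hsum (tendsto_const_nhds.congr' hz.symm)
  rw [add_zero] at hlim
  have s5 : (∫ y, (Pt χ T2 m u y 0 - Pt χ T2 m v y 0) * L (‖y - x‖ ^ 2)) =
      (∫ y, Pt χ T2 m u y 0 * L (‖y - x‖ ^ 2)) - ∫ y, Pt χ T2 m v y 0 * L (‖y - x‖ ^ 2) := by
    refine Eq.trans ?_ (integral_sub (hP.integrable_mul hLc hLk) (hPv.integrable_mul hLc hLk))
    congr 1; ext y; ring
  rw [s5]
  exact hlim

/-- Averaging kernel of width `σ`, concentrated on `[σ, 2σ]`. -/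
def eta (σ t : ℝ) : ℝ := deriv (ramp σ (2 * σ)) t

/-- Cutoff switched on smoothly during `[τ + σ, τ + 2σ]`. -/
def kap (χ : ℝ → ℝ) (σ τ s : ℝ) : ℝ := χ s * ramp σ (2 * σ) (s - τ)

/-- Forward time average of `w` over `[τ + σ, τ + 2σ]`. -/
def favg (σ : ℝ) (w : ℝ → ℝ) (τ : ℝ) : ℝ := ∫ s, eta σ (s - τ) * w s

lemma eta_continuous (σ : ℝ) : Continuous (eta σ) := (ramp_smooth _ _).continuous_deriv (by simp)
lemma eta_nonneg (hσ : 0 < σ) (t : ℝ) : 0 ≤ eta σ t := ramp_deriv_nonneg (by linarith) t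
lemma eta_zero (hσ : 0 < σ) (h : t ∉ Icc σ (2 * σ)) : eta σ t = 0 := ramp_deriv_zero (by linarith) h

lemma exists_eta_le (hσ : 0 < σ) : ∃ L, 0 ≤ L ∧ ∀ t, eta σ t ≤ L := ramp_deriv_bound (by linarith)

lemma hasDerivAt_ramp (σ t : ℝ) : HasDerivAt (ramp σ (2 * σ)) (eta σ t) t :=
  ((ramp_smooth _ _).differentiable (by simp) t).hasDerivAt

lemma kap_zero (hσ : 0 < σ) (hτ : 0 ≤ τ) (hχ : Cut χ T T1 T2) (hs : s ∉ Icc σ T2) : kap χ σ τ s = 0 := by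
  rcases lt_or_lt_of_notMem_Icc hs with hs | hs
  · rw [kap, ramp_zero (by linarith) (by linarith), mul_zero]
  · rw [kap, hχ.zero s hs.le, zero_mul]

lemma kap_smooth (hχ : Cut χ T T1 T2) (σ τ : ℝ) : ContDiff ℝ ∞ (kap χ σ τ) :=
  hχ.smooth.mul ((ramp_smooth _ _).comp (contDiff_id.sub contDiff_const))

lemma kap_nonneg (hχ : Cut χ T T1 T2) (s : ℝ) : 0 ≤ kap χ σ τ s :=
  mul_nonneg (hχ.nonneg s) (ramp_nonneg _ _ _)

lemma kap_le (hχ : Cut χ T T1 T2) (s : ℝ) : kap χ σ τ s ≤ χ s :=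
  mul_le_of_le_one_right (hχ.nonneg s) (ramp_le_one _ _ _)

lemma kap_abs_le (hχ : Cut χ T T1 T2) (s : ℝ) : |kap χ σ τ s| ≤ 1 := by
  rw [abs_of_nonneg (kap_nonneg hχ s)]; exact (kap_le hχ s).trans (hχ.le_one s)

lemma kap_compact (hσ : 0 < σ) (hτ : 0 ≤ τ) (hχ : Cut χ T T1 T2) : HasCompactSupport (kap χ σ τ) :=
  HasCompactSupport.of_support_subset_isCompact (isCompact_Icc (a := σ) (b := T2)) fun s hs => by
    by_contra hc; exact hs (kap_zero hσ hτ hχ hc)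

lemma kap_tsupport (hσ : 0 < σ) (hτ : 0 ≤ τ) (hχ : Cut χ T T1 T2) : tsupport (kap χ σ τ) ⊆ Ioo 0 T := by
  have h1 : tsupport (kap χ σ τ) ⊆ Icc σ T2 := closure_minimal (fun s hs => by
    by_contra hc; exact hs (kap_zero hσ hτ hχ hc)) isClosed_Icc
  exact h1.trans fun s hs => ⟨hσ.trans_le hs.1, hs.2.trans_lt hχ.lt2⟩

lemma chi_mul_eta (hσ : 0 < σ) (hχ : Cut χ T T1 T2) (hτ1 : τ + 2 * σ ≤ T1) (s : ℝ) :
    χ s * eta σ (s - τ) = eta σ (s - τ) := by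
  by_cases hs : s - τ ∈ Icc σ (2 * σ)
  · rw [hχ.one s (by linarith [hs.2]), one_mul]
  · rw [eta_zero hσ hs, mul_zero]

lemma kap_deriv (hσ : 0 < σ) (hχ : Cut χ T T1 T2) (hτ1 : τ + 2 * σ ≤ T1) (s : ℝ) :
    deriv (kap χ σ τ) s = deriv χ s + eta σ (s - τ) := by
  have h1 : HasDerivAt χ (deriv χ s) s := (hχ.smooth.differentiable (by simp) s).hasDerivAt
  have h2 : HasDerivAt (fun s => ramp σ (2 * σ) (s - τ)) (eta σ (s - τ)) s :=
    (hasDerivAt_ramp σ (s - τ)).comp_sub_const s τ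
  have h3 : deriv (kap χ σ τ) s = deriv χ s * ramp σ (2 * σ) (s - τ) + χ s * eta σ (s - τ) := (h1.mul h2).deriv
  rw [h3, chi_mul_eta hσ hχ hτ1]
  congr 1
  by_cases hs : s ∈ Icc T1 T2
  · rw [ramp_one (by linarith) (by linarith [hs.1]), mul_one]
  · rw [hχ.deriv_zero hs, zero_mul]

lemma eta_shift_zero (hσ : 0 < σ) (hτ : 0 ≤ τ) (hτ1 : τ + 2 * σ ≤ T1) (hs : s ∉ Icc σ T1) :
    eta σ (s - τ) = 0 := by
  refine eta_zero hσ fun h => hs ⟨by linarith [h.1], by linarith [h.2]⟩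

lemma integral_eta (hσ : 0 < σ) (τ : ℝ) : ∫ s, eta σ (s - τ) = 1 := by
  rw [integral_sub_right_eq_self (eta σ)]
  have h1 : ∫ s, eta σ s = ∫ s in Ioc σ (2 * σ), eta σ s := by
    symm
    rw [← integral_Icc_eq_integral_Ioc]
    exact setIntegral_eq_integral_of_forall_compl_eq_zero fun s hs => eta_zero hσ hs
  rw [h1, ← intervalIntegral.integral_of_le (by linarith)]
  rw [intervalIntegral.integral_eq_sub_of_hasDerivAt (fun s _ => hasDerivAt_ramp σ s)
    ((eta_continuous σ).intervalIntegrable _ _), ramp_one (by linarith) le_rfl, ramp_zero (by linarith) le_rfl, sub_zero]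

lemma eta_abs_le {L : ℝ} (hσ : 0 < σ) (hL : ∀ t, eta σ t ≤ L) (s : ℝ) : |eta σ s| ≤ L := by
  rw [abs_of_nonneg (eta_nonneg hσ s)]; exact hL s

lemma eta_shift_measurable (σ τ : ℝ) : Measurable fun s => eta σ (s - τ) :=
  ((eta_continuous σ).comp (continuous_id.sub continuous_const)).measurable

lemma Sol.eta_integrable (h : Sol ρ m T v) (hσ : 0 < σ) (hτ : 0 ≤ τ) (hχ : Cut χ T T1 T2)
    (hτ1 : τ + 2 * σ ≤ T1) (x : Eu N) : Integrable fun s => eta σ (s - τ) * v x s ^ m := by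
  obtain ⟨L, _, hL⟩ := exists_eta_le hσ
  exact h.integrable_time (eta_shift_measurable σ τ) (fun s => eta_abs_le hσ hL _) hσ (hχ.lt12.trans hχ.lt2)
    (fun s hs => eta_shift_zero hσ hτ hτ1 hs) x

lemma Sol.eta_integrable_one (h : Sol ρ m T v) (hm : 1 < m) (hσ : 0 < σ) (hτ : 0 ≤ τ) (hχ : Cut χ T T1 T2)
    (hτ1 : τ + 2 * σ ≤ T1) (x : Eu N) : Integrable fun s => eta σ (s - τ) * v x s := by
  obtain ⟨L, _, hL⟩ := exists_eta_le hσ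
  exact h.integrable_time_one hm (eta_shift_measurable σ τ) (fun s => eta_abs_le hσ hL _) hσ (hχ.lt12.trans hχ.lt2)
    (fun s hs => eta_shift_zero hσ hτ hτ1 hs) x

lemma Sol.favg_nonneg (h : Sol ρ m T v) (hσ : 0 < σ) (x : Eu N) (τ : ℝ) : 0 ≤ favg σ (v x) τ :=
  integral_nonneg fun s => mul_nonneg (eta_nonneg hσ _) (h.nonneg x s)

lemma Sol.kap_potAt (hN : 3 ≤ N) (hm : 1 < m) (h : Sol ρ m T v) (hσ : 0 < σ) (hτ : 0 ≤ τ) (hχ : Cut χ T T1 T2)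
    (hτ1 : τ + 2 * σ ≤ T1) (r : ℝ) (x : Eu N) :
    PotAt r (fun y => ∫ s, kap χ σ τ s * v y s ^ m) (fun y => ρ y * (favg σ (v y) τ - Om χ v y)) x ∧
      LI (fun y => ρ y * (favg σ (v y) τ - Om χ v y)) := by
  have h1 := h.potAt hN (kap_smooth hχ σ τ) (kap_compact hσ hτ hχ) (kap_tsupport hσ hτ hχ) r x
  have h2 := h.LI_F1 (kap_smooth hχ σ τ) (kap_compact hσ hτ hχ) (kap_tsupport hσ hτ hχ)
  have e : (fun y => ∫ t, deriv (kap χ σ τ) t * (ρ y * v y t)) = fun y => ρ y * (favg σ (v y) τ - Om χ v y) := by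
    ext y
    obtain ⟨C, _, hC⟩ := hχ.exists_deriv_bound
    have i1 := h.integrable_time_one hm (hχ.smooth.continuous_deriv (by simp)).measurable hC hχ.pos hχ.lt2
      (fun t ht => hχ.deriv_zero ht) y
    have i2 := h.eta_integrable_one hm hσ hτ hχ hτ1 y
    have e1 : favg σ (v y) τ - Om χ v y = ∫ t, deriv (kap χ σ τ) t * v y t := by
      rw [Om, favg, sub_neg_eq_add, ← integral_add i2 i1]
      congr 1; ext s; rw [kap_deriv hσ hχ hτ1]; ring
    rw [e1, ← integral_const_mul]
    congr 1; ext s; ring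
  rw [e] at h1 h2
  exact ⟨h1, h2⟩

lemma Sol.measurable_favg (h : Sol ρ m T v) : Measurable fun p : Eu N × ℝ => favg σ (v p.1) p.2 := by
  have h1 : Measurable fun q : (Eu N × ℝ) × ℝ => eta σ (q.2 - q.1.2) * v q.1.1 q.2 :=
    ((eta_continuous σ).measurable.comp (measurable_snd.sub (measurable_snd.comp measurable_fst))).mul
      (h.meas.comp ((measurable_fst.comp measurable_fst).prodMk measurable_snd))
  exact (h1.stronglyMeasurable.integral_prod_right').measurable

lemma Sol.kap_le_Pt (h : Sol ρ m T v) (hσ : 0 < σ) (hτ : 0 ≤ τ) (hχ : Cut χ T T1 T2)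
    (hi : IntegrableOn (fun t => v x t ^ m) (Ioc 0 T2)) :
    ∫ s, kap χ σ τ s * v x s ^ m ≤ Pt χ T2 m v x 0 := by
  rw [Pt_eq]
  refine integral_mono (h.integrable_time (kap_smooth hχ σ τ).continuous.measurable (kap_abs_le hχ) hσ hχ.lt2
    (fun s hs => kap_zero hσ hτ hχ hs) x) ?_ fun s => ?_
  · have := (integrable_indicator_iff measurableSet_Ioc).2 (hχ.integrableOn hi)
    refine this.congr (Eventually.of_forall fun s => ?_)
    by_cases hs : s ∈ Ioc 0 T2 <;> simp [hs]
  · refine mul_le_mul_of_nonneg_right ?_ (Real.rpow_nonneg (h.nonneg x s) _)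
    by_cases hs : s ∈ Ioc 0 T2
    · simpa [hs] using kap_le hχ s
    · rw [kap_zero hσ hτ hχ (fun h => hs ⟨hσ.trans_le h.1, h.2⟩)]; simp [hs]

lemma Sol.Pt_le_kap (h : Sol ρ m T v) (hσ : 0 < σ) (hτ : 0 ≤ τ) (hχ : Cut χ T T1 T2) (x : Eu N) :
    Pt χ T2 m v x (τ + 2 * σ) ≤ ∫ s, kap χ σ τ s * v x s ^ m := by
  rw [Pt_eq]
  refine integral_mono (h.integrable_time (hχ.smooth.continuous.measurable.indicator measurableSet_Ioc)
    (hχ.abs_indicator_le (τ + 2 * σ)) (by positivity) hχ.lt2 (fun s hs => Cut.indicator_zero hs) x)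
    (h.integrable_time (kap_smooth hχ σ τ).continuous.measurable (kap_abs_le hχ) hσ hχ.lt2
    (fun s hs => kap_zero hσ hτ hχ hs) x) fun s => ?_
  refine mul_le_mul_of_nonneg_right ?_ (Real.rpow_nonneg (h.nonneg x s) _)
  by_cases hs : s ∈ Ioc (τ + 2 * σ) T2
  · rw [indicator_of_mem hs, kap, ramp_one (by linarith) (by linarith [hs.1]), mul_one]
  · rw [indicator_of_notMem hs]; exact kap_nonneg hχ s

lemma Sol.kap_hasDerivAt (h : Sol ρ m T v) (hσ : 0 < σ) (hτ : 0 ≤ τ) (hχ : Cut χ T T1 T2)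
    (hτ1 : τ + 2 * σ ≤ T1) (x : Eu N) :
    HasDerivAt (fun τ => ∫ s, kap χ σ τ s * v x s ^ m) (-favg σ (fun s => v x s ^ m) τ) τ := by
  obtain ⟨L, hL0, hL⟩ := exists_eta_le hσ
  have hT2 : T2 < T := hχ.lt2
  have hi := h.slice x (σ / 2) T2 (by positivity) hT2
  have hiI : Integrable ((Icc (σ / 2) T2).indicator fun s => v x s ^ m) := (integrable_indicator_iff measurableSet_Icc).2 hi
  have hvm : Measurable fun s => v x s ^ m := (h.meas_slice x).pow_const m
  have hk : ∀ t, Measurable fun s => kap χ σ t s := fun t => (kap_smooth hχ σ t).continuous.measurable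
  have key := hasDerivAt_integral_of_dominated_loc_of_deriv_le (μ := volume) (x₀ := τ) (s := Ioi (-(σ / 2)))
    (F := fun t s => kap χ σ t s * v x s ^ m) (F' := fun t s => -(χ s * eta σ (s - t) * v x s ^ m))
    (bound := fun s => L * (Icc (σ / 2) T2).indicator (fun s => v x s ^ m) s)
    (Ioi_mem_nhds (by linarith)) (Eventually.of_forall fun t => ((hk t).mul hvm).aestronglyMeasurable)
    (h.integrable_time (kap_smooth hχ σ τ).continuous.measurable (kap_abs_le hχ) hσ hχ.lt2
      (fun s hs => kap_zero hσ hτ hχ hs) x)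
    (((hχ.smooth.continuous.measurable.mul (eta_shift_measurable σ τ)).mul hvm).neg.aestronglyMeasurable)
    (Eventually.of_forall fun s t ht => ?_) (hiI.const_mul L) (Eventually.of_forall fun s t ht => ?_)
  · refine key.2.congr_deriv ?_
    rw [integral_neg, favg]
    congr 2; ext s; rw [chi_mul_eta hσ hχ hτ1]
  · have hv0 : 0 ≤ v x s ^ m := Real.rpow_nonneg (h.nonneg x s) _
    have h0 : 0 ≤ χ s * eta σ (s - t) := mul_nonneg (hχ.nonneg s) (eta_nonneg hσ _)
    rw [norm_neg, Real.norm_eq_abs, abs_of_nonneg (mul_nonneg h0 hv0)]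
    by_cases hs : s ∈ Icc (σ / 2) T2
    · rw [indicator_of_mem hs]
      refine mul_le_mul_of_nonneg_right ?_ hv0
      exact (mul_le_of_le_one_left (eta_nonneg hσ _) (hχ.le_one s)).trans (hL _)
    · have hz : χ s * eta σ (s - t) = 0 := by
        rcases lt_or_lt_of_notMem_Icc hs with hs | hs
        · rw [eta_zero hσ (fun h => by have := h.1; have : -(σ/2) < t := ht; linarith), mul_zero]
        · rw [hχ.zero s hs.le, zero_mul]
      rw [hz, zero_mul, indicator_of_notMem hs, mul_zero]
  · have h2 : HasDerivAt (fun t => ramp σ (2 * σ) (s - t)) (-eta σ (s - t)) t :=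
      (hasDerivAt_ramp σ (s - t)).comp_const_sub s t
    exact ((h2.const_mul (χ s)).mul_const (v x s ^ m)).congr_deriv (by ring)

lemma Sol.favg_continuousOn (h : Sol ρ m T v) (hσ : 0 < σ) (hχ : Cut χ T T1 T2) (x : Eu N) :
    ContinuousOn (favg σ (fun s => v x s ^ m)) (Icc 0 (T1 - 2 * σ)) := by
  obtain ⟨L, hL0, hL⟩ := exists_eta_le hσ
  have hi := h.slice x σ T2 hσ hχ.lt2
  have hiI : Integrable ((Icc σ T2).indicator fun s => v x s ^ m) := (integrable_indicator_iff measurableSet_Icc).2 hi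
  have hvm : Measurable fun s => v x s ^ m := (h.meas_slice x).pow_const m
  refine continuousOn_of_dominated (F := fun τ s => eta σ (s - τ) * v x s ^ m)
    (bound := fun s => L * (Icc σ T2).indicator (fun s => v x s ^ m) s)
    (fun t _ => ((eta_shift_measurable σ t).mul hvm).aestronglyMeasurable) (fun t ht => Eventually.of_forall fun s => ?_)
    (hiI.const_mul L) (Eventually.of_forall fun s => ?_)
  · have hv0 : 0 ≤ v x s ^ m := Real.rpow_nonneg (h.nonneg x s) _
    rw [Real.norm_eq_abs, abs_of_nonneg (mul_nonneg (eta_nonneg hσ _) hv0)]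
    by_cases hs : s ∈ Icc σ T2
    · rw [indicator_of_mem hs]
      exact mul_le_mul_of_nonneg_right (hL _) hv0
    · rw [eta_shift_zero (T1 := T1) hσ ht.1 (by linarith [ht.2]) (fun h => hs ⟨h.1, h.2.trans hχ.lt12.le⟩), zero_mul]
      exact mul_nonneg hL0 (indicator_nonneg (fun s _ => Real.rpow_nonneg (h.nonneg x s) _) s)
  · exact ((((eta_continuous σ).comp (continuous_const.sub continuous_id))).mul continuous_const).continuousOn

lemma tangent_le_rpow (hm : 1 < m) {y : ℝ} (ha : 0 < a) (hy : 0 ≤ y) : a ^ m + m * a ^ (m - 1) * (y - a) ≤ y ^ m := by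
  have h1 := one_add_mul_self_le_rpow_one_add (s := y / a - 1) (by have : 0 ≤ y / a := by positivity
                                                                   linarith) hm.le
  have h2 : 1 + (y / a - 1) = y / a := by ring
  rw [h2, Real.div_rpow hy ha.le, le_div_iff₀ (by positivity)] at h1
  refine le_trans (le_of_eq ?_) h1
  rw [Real.rpow_sub_one ha.ne']
  field_simp

/-- Jensen's inequality for the forward average. -/
lemma Sol.favg_rpow_le (h : Sol ρ m T v) (hm : 1 < m) (hσ : 0 < σ) (hτ : 0 ≤ τ) (hχ : Cut χ T T1 T2)
    (hτ1 : τ + 2 * σ ≤ T1) (x : Eu N) : favg σ (v x) τ ^ m ≤ favg σ (fun s => v x s ^ m) τ := by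
  have hn := h.favg_nonneg hσ x τ
  have i1 := h.eta_integrable_one hm hσ hτ hχ hτ1 x
  have i2 := h.eta_integrable hσ hτ hχ hτ1 x
  have i0 : Integrable fun s => eta σ (s - τ) := by
    by_contra hc
    have := integral_eta hσ τ
    rw [integral_undef hc] at this
    exact zero_ne_one this
  rcases hn.eq_or_lt with h0 | h0
  · rw [← h0, Real.zero_rpow (by linarith)]
    exact integral_nonneg fun s => mul_nonneg (eta_nonneg hσ _) (Real.rpow_nonneg (h.nonneg x s) _)
  set a := favg σ (v x) τ with ha
  have h1 : ∫ s, (a ^ m - m * a ^ (m - 1) * a) * eta σ (s - τ) + m * a ^ (m - 1) * (eta σ (s - τ) * v x s) ≤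
      favg σ (fun s => v x s ^ m) τ := by
    refine integral_mono ((i0.const_mul _).add (i1.const_mul _)) i2 fun s => ?_
    have := mul_le_mul_of_nonneg_left (tangent_le_rpow hm h0 (h.nonneg x s)) (eta_nonneg hσ (s - τ))
    refine le_trans (le_of_eq ?_) this
    ring
  rw [integral_add (i0.const_mul _) (i1.const_mul _), integral_const_mul, integral_const_mul, integral_eta hσ] at h1
  have e : ∫ s, eta σ (s - τ) * v x s = a := rfl
  rw [e] at h1
  linarith

lemma Sol.favg_bound (hN : 3 ≤ N) (hm : 1 < m) (hT : 0 < T) (hW : Wt N γ Cl Cu ρ) (h : Sol ρ m T v)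
    (hσ : 0 < σ) (hχ : Cut χ T T1 T2) : ∃ C, 0 ≤ C ∧ ∀ᵐ x, ∀ τ, 0 ≤ τ → τ + 2 * σ ≤ T1 →
      favg σ (v x) τ ≤ C * (1 + ‖x‖) ^ (gexp γ m / m) := by
  obtain ⟨L, hL0, hL⟩ := exists_eta_le hσ
  obtain ⟨C, hC, hx⟩ := h.avg_bound_Icc hN hm hT hW hσ (hχ.lt12.trans hχ.lt2)
  exact ⟨L * C, by positivity, hx.mono fun x hx τ hτ hτ1 => hx L hL0 (fun s => eta σ (s - τ)) (fun s => eta_nonneg hσ _)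
    (fun s => hL _) fun s hs => eta_shift_zero hσ hτ hτ1 hs⟩

/-- Two solutions with finite initial potentials whose difference solves the stationary equation. -/
structure Pair (N : ℕ) (γ Cl Cu : ℝ) (ρ : Eu N → ℝ) (m T T1 T2 : ℝ) (χ : ℝ → ℝ) (u v : Eu N → ℝ → ℝ) : Prop where
  hN : 3 ≤ N
  hm : 1 < m
  hT : 0 < T
  hW : Wt N γ Cl Cu ρ
  hu : Sol ρ m T u
  hv : Sol ρ m T v
  hχ : Cut χ T T1 T2
  iu : ∀ᵐ x, IntegrableOn (fun t => u x t ^ m) (Ioc 0 T2)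
  iv : ∀ᵐ x, IntegrableOn (fun t => v x t ^ m) (Ioc 0 T2)
  pu : LI fun x => Pt χ T2 m u x 0
  pv : LI fun x => Pt χ T2 m v x 0
  gu : ∃ C, 0 ≤ C ∧ ∀ R, 1 ≤ R → ∫ x in closedBall 0 R, Pt χ T2 m u x 0 ≤ C * R ^ (N + gexp γ m)
  pot : ∀ r x, PotAt r (fun y => Pt χ T2 m u y 0 - Pt χ T2 m v y 0)
      (fun y => ρ y * (Om χ v y - Om χ u y)) x

/-- Admissible averaging width and time dilation. -/
structure Adm (T1 T3 σ μ : ℝ) : Prop where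
  hσ : 0 < σ
  hμ : 1 < μ
  h3 : 0 < T3
  le : μ * T3 + 2 * σ ≤ T1

lemma Adm.arg_nonneg (h : Adm T1 T3 σ μ) (ht : t ∈ Icc 0 T3) : 0 ≤ μ * t :=
  mul_nonneg (zero_lt_one.trans h.hμ).le ht.1

lemma Adm.arg_le (h : Adm T1 T3 σ μ) (ht : t ∈ Icc 0 T3) : μ * t + 2 * σ ≤ T1 := by
  have := mul_le_mul_of_nonneg_left ht.2 (zero_lt_one.trans h.hμ).le
  linarith [h.le]

lemma Adm.lt (h : Adm T1 T3 σ μ) : T3 < T1 := by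
  have := mul_lt_mul_of_pos_right h.hμ h.h3
  linarith [h.le, h.hσ]

/-- Defect between the accumulated pressures of `u` and of a dilated forward average of `v`. -/
def defect (χ : ℝ → ℝ) (T2 m σ μ : ℝ) (u v : Eu N → ℝ → ℝ) (x : Eu N) (t : ℝ) : ℝ :=
  Pt χ T2 m u x 0 - Pt χ T2 m v x 0 - Pt χ T2 m u x t + ∫ s, kap χ σ (μ * t) s * v x s ^ m

lemma Sol.measurable_Pt_zero (h : Sol ρ m T u) (hχ : Cut χ T T1 T2) : Measurable fun x => Pt χ T2 m u x 0 :=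
  (h.measurable_Pt hχ).comp (g := fun p : Eu N × ℝ => Pt χ T2 m u p.1 p.2) (f := fun x => (x, (0 : ℝ))) (by fun_prop)

lemma Sol.measurable_kap_mul (h : Sol ρ m T v) (hχ : Cut χ T T1 T2) (σ μ : ℝ) :
    Measurable fun p : Eu N × ℝ => ∫ s, kap χ σ (μ * p.2) s * v p.1 s ^ m := by
  refine h.measurable_kernel (k := fun t s => kap χ σ (μ * t) s) ?_
  exact (hχ.smooth.continuous.measurable.comp measurable_snd).mul
    ((ramp_smooth _ _).continuous.measurable.comp (measurable_snd.sub (measurable_fst.const_mul μ)))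

lemma measurable_defect (hu : Sol ρ m T u) (hv : Sol ρ m T v) (hχ : Cut χ T T1 T2) :
    Measurable fun p : Eu N × ℝ => defect χ T2 m σ μ u v p.1 p.2 := by
  have h2 : Measurable fun p : Eu N × ℝ => Pt χ T2 m u p.1 0 := (hu.measurable_Pt_zero hχ).comp measurable_fst
  have h3 : Measurable fun p : Eu N × ℝ => Pt χ T2 m v p.1 0 := (hv.measurable_Pt_zero hχ).comp measurable_fst
  exact ((h2.sub h3).sub (hu.measurable_Pt hχ)).add (hv.measurable_kap_mul hχ σ μ)

lemma Pair.defect_bounds (h : Pair N γ Cl Cu ρ m T T1 T2 χ u v) (ha : Adm T1 T3 σ μ) :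
    ∀ᵐ x, ∀ t ∈ Icc 0 T3, defect χ T2 m σ μ u v x t ≤ Pt χ T2 m u x 0 ∧
      |defect χ T2 m σ μ u v x t| ≤ Pt χ T2 m u x 0 + Pt χ T2 m v x 0 := by
  filter_upwards [h.iu, h.iv] with x hx hy t ht
  have h1 := h.hv.kap_le_Pt ha.hσ (ha.arg_nonneg ht) h.hχ hy
  have h2 := h.hu.Pt_nonneg h.hχ x t
  have h3 := Pt_anti h.hu h.hχ hx ht.1
  have h4 : 0 ≤ ∫ s, kap χ σ (μ * t) s * v x s ^ m :=
    integral_nonneg fun s => mul_nonneg (kap_nonneg h.hχ s) (Real.rpow_nonneg (h.hv.nonneg x s) _)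
  have h5 := h.hu.Pt_nonneg h.hχ x 0
  have h6 := h.hv.Pt_nonneg h.hχ x 0
  unfold defect
  refine ⟨by linarith, abs_le.2 ⟨by linarith, by linarith⟩⟩

lemma Pair.defect_zero (h : Pair N γ Cl Cu ρ m T T1 T2 χ u v) (ha : Adm T1 T3 σ μ) :
    ∀ᵐ x, defect χ T2 m σ μ u v x 0 ≤ 0 := by
  filter_upwards [h.iv] with x hy
  have h1 := h.hv.kap_le_Pt (τ := μ * 0) ha.hσ (by simp) h.hχ hy
  unfold defect; linarith

lemma Pair.defect_continuousOn (h : Pair N γ Cl Cu ρ m T T1 T2 χ u v) (ha : Adm T1 T3 σ μ) :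
    ∀ᵐ x, ContinuousOn (defect χ T2 m σ μ u v x) (Icc 0 T3) := by
  filter_upwards [h.iu] with x hx
  refine ((continuousOn_const.sub continuousOn_const).sub
    ((Pt_continuousOn h.hχ hx).mono (Icc_subset_Icc_right ha.lt.le))).add fun t ht => ?_
  have h1 := (h.hv.kap_hasDerivAt ha.hσ (ha.arg_nonneg ht) h.hχ (ha.arg_le ht) x).continuousAt
  exact (ContinuousAt.comp (f := fun t => μ * t) h1 (by fun_prop)).continuousWithinAt

lemma Sol.favg_mul_continuousOn (hv : Sol ρ m T v) (hχ : Cut χ T T1 T2) (ha : Adm T1 T3 σ μ) (x : Eu N) :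
    ContinuousOn (fun t => favg σ (fun s => v x s ^ m) (μ * t)) (Icc 0 T3) :=
  (hv.favg_continuousOn ha.hσ hχ x).comp (by fun_prop)
    fun t ht => ⟨ha.arg_nonneg ht, by linarith [ha.arg_le ht]⟩

lemma Pair.defect_incr (h : Pair N γ Cl Cu ρ m T T1 T2 χ u v) (ha : Adm T1 T3 σ μ) :
    ∀ᵐ x, IntegrableOn (fun r => u x r ^ m - μ * favg σ (fun s => v x s ^ m) (μ * r)) (Icc 0 T3) ∧
      ∀ t1 t2, t1 ∈ Icc 0 T3 → t2 ∈ Icc 0 T3 → t1 ≤ t2 →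
      defect χ T2 m σ μ u v x t2 - defect χ T2 m σ μ u v x t1 =
        ∫ r in Ioc t1 t2, (u x r ^ m - μ * favg σ (fun s => v x s ^ m) (μ * r)) := by
  filter_upwards [h.iu] with x hx
  have h3T : T3 ≤ T2 := (ha.lt.trans h.hχ.lt12).le
  have iU : IntegrableOn (fun r => u x r ^ m) (Icc 0 T3) :=
    (integrableOn_Icc_iff_integrableOn_Ioc).2 (hx.mono_set (Ioc_subset_Ioc_right h3T))
  have hc : ContinuousOn (fun r => μ * favg σ (fun s => v x s ^ m) (μ * r)) (Icc 0 T3) :=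
    continuousOn_const.mul (h.hv.favg_mul_continuousOn h.hχ ha x)
  refine ⟨iU.sub hc.integrableOn_Icc, fun t1 t2 h1 h2 h12 => ?_⟩
  have hsub : Ioc t1 t2 ⊆ Icc 0 T3 := fun r hr => ⟨h1.1.trans hr.1.le, hr.2.trans h2.2⟩
  have e1 := Pt_incr (m := m) h.hχ hx h1.1 h12 (h2.2.trans ha.lt.le)
  have e2 : (∫ s, kap χ σ (μ * t2) s * v x s ^ m) - (∫ s, kap χ σ (μ * t1) s * v x s ^ m) =
      ∫ r in Ioc t1 t2, -(μ * favg σ (fun s => v x s ^ m) (μ * r)) := by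
    rw [← intervalIntegral.integral_of_le h12]
    refine (intervalIntegral.integral_eq_sub_of_hasDerivAt (f := fun t => ∫ s, kap χ σ (μ * t) s * v x s ^ m)
      (fun r hr => ?_) ?_).symm
    · rw [uIcc_of_le h12] at hr
      have hr' : r ∈ Icc 0 T3 := ⟨h1.1.trans hr.1, hr.2.trans h2.2⟩
      have hd := h.hv.kap_hasDerivAt ha.hσ (ha.arg_nonneg hr') h.hχ (ha.arg_le hr') x
      exact (HasDerivAt.comp r hd ((hasDerivAt_id r).const_mul μ)).congr_deriv (by simp; ring)
    · rw [intervalIntegrable_iff_integrableOn_Ioc_of_le h12]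
      exact (hc.integrableOn_Icc.mono_set hsub).neg
  have e3 : ∫ r in Ioc t1 t2, (u x r ^ m - μ * favg σ (fun s => v x s ^ m) (μ * r)) =
      (∫ r in Ioc t1 t2, u x r ^ m) - ∫ r in Ioc t1 t2, μ * favg σ (fun s => v x s ^ m) (μ * r) :=
    integral_sub (iU.mono_set hsub) (hc.integrableOn_Icc.mono_set hsub)
  rw [integral_neg] at e2
  rw [e3, ← e1]
  unfold defect; linarith

lemma Pair.defect_potAt (h : Pair N γ Cl Cu ρ m T T1 T2 χ u v) (ha : Adm T1 T3 σ μ) (hr : 0 < r) :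
    ∀ᵐ t, t ∈ Ioo 0 T3 → ∀ x, PotAt r (fun y => defect χ T2 m σ μ u v y t)
      (fun y => ρ y * (favg σ (v y) (μ * t) - u y t)) x := by
  filter_upwards [h.hu.Pt_potAt h.hN h.hχ r, h.hu.ae_LI h.hχ] with t ht ht2 ht3 x
  have htI := Ioo_subset_Icc_self ht3
  have ht1 : t ∈ Ioo 0 T1 := ⟨ht3.1, ht3.2.trans ha.lt⟩
  have hf := ht2 ⟨ht1.1, ht1.2.trans (h.hχ.lt12.trans h.hχ.lt2)⟩
  have hk := h.hv.kap_potAt h.hN h.hm ha.hσ (ha.arg_nonneg htI) h.hχ (ha.arg_le htI) r x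
  have hE : LI fun y => ρ y * (Om χ v y - Om χ u y) := by
    have := (h.hv.LI_Om h.hχ).sub (h.hu.LI_Om h.hχ)
    simpa only [mul_sub] using this
  have hF := h.hv.LI_F (kap_smooth h.hχ σ (μ * t)) (kap_compact ha.hσ (ha.arg_nonneg htI) h.hχ)
    (kap_tsupport ha.hσ (ha.arg_nonneg htI) h.hχ)
  have h1 := (h.pot r x).sub hr (ht ht1 x) (h.pu.sub h.pv) hE (h.hu.LI_Pt h.hχ ht1.1) hf
  have h2 := h1.add hr hk.1 ((h.pu.sub h.pv).sub (h.hu.LI_Pt h.hχ ht1.1)) (hE.sub hf) hF hk.2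
  have e : (fun y => ρ y * (favg σ (v y) (μ * t) - u y t)) = fun y =>
      ρ y * (Om χ v y - Om χ u y) - ρ y * (u y t - Om χ u y) + ρ y * (favg σ (v y) (μ * t) - Om χ v y) := by
    ext y; ring
  rw [e]
  exact h2

lemma Pair.defect_LI (h : Pair N γ Cl Cu ρ m T T1 T2 χ u v) (ha : Adm T1 T3 σ μ) :
    ∀ᵐ t, t ∈ Ioo 0 T3 → LI (fun y => defect χ T2 m σ μ u v y t) ∧
      LI fun y => ρ y * (favg σ (v y) (μ * t) - u y t) := by
  filter_upwards [h.hu.ae_LI h.hχ] with t ht2 ht3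
  have htI := Ioo_subset_Icc_self ht3
  have ht1 : t ∈ Ioo 0 T1 := ⟨ht3.1, ht3.2.trans ha.lt⟩
  have hf := ht2 ⟨ht1.1, ht1.2.trans (h.hχ.lt12.trans h.hχ.lt2)⟩
  have hk := (h.hv.kap_potAt h.hN h.hm ha.hσ (ha.arg_nonneg htI) h.hχ (ha.arg_le htI) 1 0).2
  have hE : LI fun y => ρ y * (Om χ v y - Om χ u y) := by
    have := (h.hv.LI_Om h.hχ).sub (h.hu.LI_Om h.hχ)
    simpa only [mul_sub] using this
  have hF := h.hv.LI_F (kap_smooth h.hχ σ (μ * t)) (kap_compact ha.hσ (ha.arg_nonneg htI) h.hχ)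
    (kap_tsupport ha.hσ (ha.arg_nonneg htI) h.hχ)
  refine ⟨((h.pu.sub h.pv).sub (h.hu.LI_Pt h.hχ ht1.1)).add hF, ?_⟩
  have e : (fun y => ρ y * (favg σ (v y) (μ * t) - u y t)) = fun y =>
      ρ y * (Om χ v y - Om χ u y) - ρ y * (u y t - Om χ u y) + ρ y * (favg σ (v y) (μ * t) - Om χ v y) := by
    ext y; ring
  rw [e]
  exact (hE.sub hf).add hk

lemma le_of_ae_Ioo_continuousOn {g : ℝ → ℝ} (hab : a < b) (hg : ContinuousOn g (Icc a b))
    (h : ∀ᵐ t : ℝ, t ∈ Ioo a b → g t ≤ K) : ∀ t ∈ Icc a b, g t ≤ K := by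
  have hc : Continuous (IccExtend hab.le ((Icc a b).domRestrict g)) :=
    (continuousOn_iff_continuous_domRestrict.1 hg).Icc_extend'
  have h1 := le_of_ae_Ioo hab hc (K := K) (h.mono fun t ht ht' => by
    rw [IccExtend_of_mem _ _ (Ioo_subset_Icc_self ht')]; exact ht ht')
  intro t ht
  have := h1 t ht
  rwa [IccExtend_of_mem _ _ ht] at this

lemma Pair.defect_growth (h : Pair N γ Cl Cu ρ m T T1 T2 χ u v) (ha : Adm T1 T3 σ μ) :
    ∃ C, 0 ≤ C ∧ ∀ᵐ x, ∀ t ∈ Icc 0 T3, defect χ T2 m σ μ u v x t ≤ C * (1 + ‖x‖) ^ gexp γ m := by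
  have := nontrivial_Eu h.hN
  obtain ⟨Cv, hCv, hvb⟩ := h.hv.favg_bound h.hN h.hm h.hT h.hW ha.hσ h.hχ
  obtain ⟨A, hA, hgA⟩ := h.gu
  obtain ⟨Cm, hCm, hmean⟩ := exists_mean_le h.hN
  set lam := gexp γ m with hlam
  obtain ⟨Cn, hCn, hnewt⟩ := newton_weight_le h.hN h.hW.g0 h.hW.g2 (lam / m)
  have hl : 0 < lam := gexp_pos h.hW.g2 h.hm
  have hCu := h.hW.Cu_nonneg h.hN
  have hcK := cK_pos h.hN
  have hg2 := h.hW.g2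
  have hexp : lam / m + (2 - γ) = lam := by rw [hlam, gexp_div h.hm]; ring
  set C1 := Cm * A * 4 ^ (N : ℝ) * 2 ^ ((N : ℝ) + lam) with hC1
  set C2 := Cu * Cv * Cn / cK N with hC2
  refine ⟨C1 + C2, by positivity, ?_⟩
  have hq : ∀ᵐ t, ∀ q : ℚ, 0 < (q : ℝ) → t ∈ Ioo 0 T3 → ∀ x, PotAt (q : ℝ) (fun y => defect χ T2 m σ μ u v y t)
      (fun y => ρ y * (favg σ (v y) (μ * t) - u y t)) x := by
    rw [ae_all_iff]; intro q
    by_cases hq : 0 < (q : ℝ)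
    · exact (h.defect_potAt ha hq).mono fun t ht _ => ht
    · exact Eventually.of_forall fun t h1 => absurd h1 hq
  have hae : ∀ᵐ t, ∀ᵐ x : Eu N, t ∈ Ioo 0 T3 → defect χ T2 m σ μ u v x t ≤ (C1 + C2) * (1 + ‖x‖) ^ lam := by
    filter_upwards [hq, h.defect_LI ha] with t ht hLI
    by_cases ht3 : t ∈ Ioo 0 T3
    swap
    · exact Eventually.of_forall fun x h1 => absurd h1 ht3
    have htI := Ioo_subset_Icc_self ht3
    obtain ⟨hD, hf⟩ := hLI ht3
    have hsub := submean h.hN hD hf (n := fun y => Cu * Cv * (‖y‖ ^ (-γ) * (1 + ‖y‖) ^ (lam / m))) (by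
      filter_upwards [hvb, Measure.ae_ne volume (0 : Eu N)] with y hy hy0
      have h1 : ρ y * favg σ (v y) (μ * t) ≤ Cu * ‖y‖ ^ (-γ) * (Cv * (1 + ‖y‖) ^ (lam / m)) :=
        mul_le_mul (h.hW.up y hy0) (hy _ (ha.arg_nonneg htI) (ha.arg_le htI)) (h.hv.favg_nonneg ha.hσ _ _) (by positivity)
      have h2 : 0 ≤ ρ y * u y t := mul_nonneg (h.hW.nonneg y) (h.hu.nonneg y t)
      linarith)
    have hdb := h.defect_bounds ha
    filter_upwards [hsub] with x hx _
    obtain ⟨q, hq1, hq2⟩ := exists_rat_btwn (show (1 + ‖x‖) / 4 < (1 + ‖x‖) / 2 by have := norm_nonneg x; linarith)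
    have hx0 : 0 < 1 + ‖x‖ := by positivity
    have hq0 : 0 < (q : ℝ) := lt_trans (by positivity) hq1
    have h1 := hx q hq0 (ht q hq0 ht3 x)
    set ε := (q : ℝ) / (1 + ‖x‖) with hε
    have hqe : (q : ℝ) = ε * (1 + ‖x‖) := by rw [hε]; field_simp
    have he1 : 1 / 4 ≤ ε := by rw [hε, le_div_iff₀ hx0]; linarith
    have he2 : ε ≤ 1 / 2 := by rw [hε, div_le_iff₀ hx0]; linarith
    have he0 : 0 < ε := by linarith
    have h2 : ∫⁻ y in ball x q, ofReal (Cu * Cv * (‖y‖ ^ (-γ) * (1 + ‖y‖) ^ (lam / m))) * ofReal (‖y - x‖ ^ (2 - N : ℝ))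
        ≤ ofReal (cK N * (C2 * (1 + ‖x‖) ^ lam)) := by
      have e : cK N * (C2 * (1 + ‖x‖) ^ lam) = Cu * Cv * (Cn * (1 + ‖x‖) ^ lam) := by
        rw [hC2]; field_simp
      rw [e, ENNReal.ofReal_mul (by positivity)]
      have h5 := hnewt ε he0 he2 x
      rw [hexp, ← hqe] at h5
      have h6 : Cn * ε ^ (2 - γ) * (1 + ‖x‖) ^ lam ≤ Cn * (1 + ‖x‖) ^ lam := by
        refine mul_le_mul_of_nonneg_right ?_ (by positivity)
        exact mul_le_of_le_one_right hCn.le (Real.rpow_le_one he0.le (by linarith) (by linarith))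
      refine le_trans ?_ (mul_le_mul_right (h5.trans (ENNReal.ofReal_le_ofReal h6)) _)
      rw [← lintegral_const_mul' _ _ ENNReal.ofReal_ne_top]
      refine setLIntegral_mono' measurableSet_ball fun y hy => ?_
      rw [ENNReal.ofReal_mul (p := Cu * Cv) (by positivity), mul_assoc]
    have h3 := h1.trans h2
    rw [ENNReal.ofReal_le_ofReal_iff (by positivity)] at h3
    have h4 := le_of_mul_le_mul_left h3 hcK
    have h5 : ∫ y, defect χ T2 m σ μ u v y t * thK q (y - x) ≤ ∫ y, Pt χ T2 m u y 0 * thK q (y - x) := by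
      refine integral_mono_ae (hD.integrable_thK hq0 x) (h.pu.integrable_thK hq0 x) ?_
      filter_upwards [hdb] with y hy
      exact mul_le_mul_of_nonneg_right (hy t htI).1 (thK_nonneg h.hN hq0 _)
    have h6 := hmean _ A lam h.pu (fun y => h.hu.Pt_nonneg h.hχ y 0) hgA ε he0 (by linarith) x
    rw [← hqe] at h6
    have h7 : ε ^ (-N : ℝ) ≤ 4 ^ (N : ℝ) := by
      have : (4 : ℝ) ^ (N : ℝ) = (1 / 4) ^ (-N : ℝ) := by
        rw [Real.rpow_neg (by norm_num), ← Real.inv_rpow (by norm_num)]; norm_num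
      rw [this]
      exact Real.rpow_le_rpow_of_nonpos (by norm_num) he1 (by simp)
    have h8 : Cm * A * ε ^ (-N : ℝ) * 2 ^ ((N : ℝ) + lam) * (1 + ‖x‖) ^ lam ≤ C1 * (1 + ‖x‖) ^ lam := by
      refine mul_le_mul_of_nonneg_right ?_ (by positivity)
      refine mul_le_mul_of_nonneg_right ?_ (by positivity)
      exact mul_le_mul_of_nonneg_left h7 (by positivity)
    rw [add_mul]
    linarith
  have hswap := (Measure.ae_ae_comm (μ := (volume : Measure ℝ)) (ν := (volume : Measure (Eu N)))
    (p := fun t x => t ∈ Ioo 0 T3 → defect χ T2 m σ μ u v x t ≤ (C1 + C2) * (1 + ‖x‖) ^ lam) (by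
      have hm1 : MeasurableSet {p : ℝ × Eu N | p.1 ∈ Ioo 0 T3} := measurable_fst measurableSet_Ioo
      have hm2 : MeasurableSet {p : ℝ × Eu N | defect χ T2 m σ μ u v p.2 p.1 ≤ (C1 + C2) * (1 + ‖p.2‖) ^ lam} := by
        refine measurableSet_le ((measurable_defect (σ := σ) (μ := μ) h.hu h.hv h.hχ).comp measurable_swap) ?_
        fun_prop
      exact hm1.imp hm2)).1 hae
  filter_upwards [hswap, h.defect_continuousOn ha] with x hx hc
  exact le_of_ae_Ioo_continuousOn ha.h3 hc hx

lemma exists_add_rpow_le (hm : 1 < m) (hμ : 1 < μ) :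
    ∃ C, 0 < C ∧ ∀ a b, 0 ≤ a → 0 ≤ b → (a + b) ^ m ≤ μ * a ^ m + C * b ^ m := by
  have hm0 : 0 < m := by linarith
  set ε := μ ^ (1 / m) - 1 with hε
  have hε0 : 0 < ε := by rw [hε, sub_pos]; exact Real.one_lt_rpow hμ (by positivity)
  have hεm : (1 + ε) ^ m = μ := by
    rw [hε, add_sub_cancel, ← Real.rpow_mul (by linarith), one_div_mul_cancel hm0.ne', Real.rpow_one]
  refine ⟨(1 / ε + 1) ^ m, by positivity, fun a b ha hb => ?_⟩
  rcases le_total b (ε * a) with h | h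
  · have : (a + b) ^ m ≤ ((1 + ε) * a) ^ m := Real.rpow_le_rpow (by positivity) (by linarith) hm0.le
    rw [Real.mul_rpow (by positivity) ha, hεm] at this
    have h2 : 0 ≤ (1 / ε + 1) ^ m * b ^ m := by positivity
    linarith
  · have h1 : a ≤ 1 / ε * b := by rw [one_div_mul_eq_div, le_div_iff₀ hε0]; linarith
    have : (a + b) ^ m ≤ ((1 / ε + 1) * b) ^ m := Real.rpow_le_rpow (by positivity) (by linarith) hm0.le
    rw [Real.mul_rpow (by positivity) hb] at this
    have h2 : 0 ≤ μ * a ^ m := mul_nonneg (by linarith) (by positivity)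
    linarith

lemma rad_pow (j G : ℝ) : Rad (fun q => G * (1 + q) ^ j) (fun q => G * (j * (1 + q) ^ (j - 1)))
    (fun q => G * (j * ((j - 1) * (1 + q) ^ (j - 1 - 1)))) where
  d1 q hq := by
    have h1 : HasDerivAt (fun q : ℝ => 1 + q) 1 q := (hasDerivAt_id q).const_add 1
    exact ((h1.rpow_const (p := j) (Or.inl (by linarith))).const_mul G).congr_deriv (by ring)
  d2 q hq := by
    have h1 : HasDerivAt (fun q : ℝ => 1 + q) 1 q := (hasDerivAt_id q).const_add 1
    exact (((h1.rpow_const (p := j - 1) (Or.inl (by linarith))).const_mul j).const_mul G).congr_deriv (by ring)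
  c2 := by
    refine continuousOn_const.mul (continuousOn_const.mul (continuousOn_const.mul ?_))
    exact (continuousOn_const.add continuousOn_id).rpow_const fun q hq => Or.inl (by simp at hq ⊢; linarith)

/-- The Laplacian of `G (1 + ‖x‖²) ^ j` as a function of `q = ‖x‖²`. -/
def radLpow (n j G q : ℝ) : ℝ :=
  radL n (fun q => G * (j * (1 + q) ^ (j - 1))) (fun q => G * (j * ((j - 1) * (1 + q) ^ (j - 1 - 1)))) q

lemma radLpow_le {j G : ℝ} (hj : 0 ≤ j) (hG : 0 ≤ G) (hq : 0 ≤ q) :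
    radLpow n j G q ≤ (4 * j * |j - 1| + 2 * n * j) * (G * (1 + q) ^ (j - 1)) := by
  have h0 : 0 < 1 + q := by linarith
  have h1 : q * (1 + q) ^ (j - 1 - 1) ≤ (1 + q) ^ (j - 1) := by
    rw [Real.rpow_sub_one h0.ne', mul_div_assoc', div_le_iff₀ h0, mul_comm]
    exact mul_le_mul_of_nonneg_left (by linarith) (by positivity)
  have h2 : (j - 1) * (q * (1 + q) ^ (j - 1 - 1)) ≤ |j - 1| * (1 + q) ^ (j - 1) :=
    mul_le_mul (le_abs_self _) h1 (by positivity) (abs_nonneg _)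
  have h3 := mul_le_mul_of_nonneg_left h2 (show 0 ≤ 4 * G * j by positivity)
  unfold radLpow radL
  linarith

/-- Pointwise sign of the source of the dilated difference. -/
lemma source_nonpos {rho U V W Lr Ck Cμ H : ℝ} (hm : 1 < m) (hCl : 0 < Cl) (hCk : 0 ≤ Ck)
    (hC1 : 0 ≤ C1) (hCμ : 0 < Cμ) (hadd : ∀ a b, 0 ≤ a → 0 ≤ b → (a + b) ^ m ≤ μ * a ^ m + Cμ * b ^ m) (hμ : 1 < μ)
    (hlam : lam = gexp γ m) (hq : 0 ≤ q) (hlow : Cl * (1 + q) ^ (-γ) ≤ rho) (hU : 0 ≤ U) (hV : 0 ≤ V) (hVW : V ^ m ≤ W)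
    (hH : 0 ≤ H) (hHC : H ≤ C1 * (1 + q) ^ lam) (hL : Lr ≤ Ck * (H / (1 + q ^ 2)))
    (hζ : 0 < U ^ m - μ * W - Cμ * (2 * Ck / Cl) ^ m * C1 ^ (m - 1) * H) : rho * (V - U) + Lr ≤ 0 := by
  by_contra! hc
  have hm0 : 0 < m := by linarith
  have hq1 : 0 < 1 + q := by linarith
  have hm1 : 0 < m - 1 := by linarith
  set w := 2 * Ck / Cl * ((1 + q) ^ (-(2 - γ)) * H) with hw
  have hw0 : 0 ≤ w := by positivity
  have hUV : U ≤ V + w := by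
    by_contra! hlt
    have h3 : Cl * (1 + q) ^ (-γ) * (U - V) ≤ rho * (U - V) := mul_le_mul_of_nonneg_right hlow (by linarith)
    have h4 : Cl * (1 + q) ^ (-γ) * w < Cl * (1 + q) ^ (-γ) * (U - V) :=
      mul_lt_mul_of_pos_left (by linarith) (by positivity)
    have h5 : Cl * (1 + q) ^ (-γ) * w = Ck * (H * (2 / (1 + q) ^ 2)) := by
      have e : (1 + q) ^ (-γ) * (1 + q) ^ (-(2 - γ)) = 1 / (1 + q) ^ 2 := by
        rw [← Real.rpow_add hq1, show -γ + -(2 - γ) = -((2 : ℕ) : ℝ) by push_cast; ring, Real.rpow_neg hq1.le,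
          Real.rpow_natCast, one_div]
      calc _ = Cl * (2 * Ck / Cl) * H * ((1 + q) ^ (-γ) * (1 + q) ^ (-(2 - γ))) := by rw [hw]; ring
        _ = _ := by rw [e, mul_div_cancel₀ _ hCl.ne']; ring
    have h6 : H / (1 + q ^ 2) ≤ H * (2 / (1 + q) ^ 2) := by
      rw [div_eq_mul_one_div H]
      refine mul_le_mul_of_nonneg_left ?_ hH
      rw [div_le_div_iff₀ (by positivity) (by positivity)]
      nlinarith [sq_nonneg (1 - q)]
    have h7 := mul_le_mul_of_nonneg_left h6 hCk
    linarith
  have h3 : w ^ m ≤ (2 * Ck / Cl) ^ m * C1 ^ (m - 1) * H := by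
    have e1 : H ^ m ≤ (C1 * (1 + q) ^ lam) ^ (m - 1) * H := by
      rcases hH.eq_or_lt with h0 | h0
      · rw [← h0, Real.zero_rpow hm0.ne', mul_zero]
      · rw [show H ^ m = H ^ (m - 1) * H by rw [Real.rpow_sub_one h0.ne', div_mul_cancel₀ _ h0.ne']]
        exact mul_le_mul_of_nonneg_right (Real.rpow_le_rpow hH hHC hm1.le) hH
    have e2 : ((1 + q) ^ (-(2 - γ))) ^ m * ((1 + q) ^ lam) ^ (m - 1) = 1 := by
      rw [← Real.rpow_mul hq1.le, ← Real.rpow_mul hq1.le, ← Real.rpow_add hq1, hlam, gexp,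
        div_mul_cancel₀ _ hm1.ne', neg_mul, neg_add_cancel, Real.rpow_zero]
    rw [hw, Real.mul_rpow (by positivity) (by positivity), Real.mul_rpow (by positivity) hH, mul_assoc]
    refine mul_le_mul_of_nonneg_left ?_ (by positivity)
    calc _ ≤ ((1 + q) ^ (-(2 - γ))) ^ m * ((C1 * (1 + q) ^ lam) ^ (m - 1) * H) :=
          mul_le_mul_of_nonneg_left e1 (by positivity)
      _ = C1 ^ (m - 1) * H * (((1 + q) ^ (-(2 - γ))) ^ m * ((1 + q) ^ lam) ^ (m - 1)) := by
          rw [Real.mul_rpow hC1 (by positivity)]; ring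
      _ = _ := by rw [e2, mul_one]
  have h4 := Real.rpow_le_rpow hU hUV hm0.le
  have h5 := hadd V w hV hw0
  have h6 := mul_le_mul_of_nonneg_left hVW (show 0 ≤ μ by linarith)
  have h7 := mul_le_mul_of_nonneg_left h3 hCμ.le
  linarith

lemma growth_le {δ : ℝ} (hδ : 0 < δ) (hl : 0 < lam) (hq : 0 ≤ q)
    (h : C * 2 ^ ((lam + 1) / 2) / δ ≤ q) : C * (1 + q) ^ lam ≤ δ * (1 + q ^ 2) ^ ((lam + 1) / 2) := by
  have hq1 : 0 < 1 + q := by linarith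
  have h1 : (1 + q) ^ (lam + 1) ≤ 2 ^ ((lam + 1) / 2) * (1 + q ^ 2) ^ ((lam + 1) / 2) := by
    rw [← Real.mul_rpow (by positivity) (by positivity), show lam + 1 = ((2 : ℕ) : ℝ) * ((lam + 1) / 2) by push_cast; ring,
      Real.rpow_mul hq1.le, Real.rpow_natCast, ← show lam + 1 = ((2 : ℕ) : ℝ) * ((lam + 1) / 2) by push_cast; ring]
    refine Real.rpow_le_rpow (by positivity) ?_ (by positivity)
    nlinarith [sq_nonneg (1 - q)]
  rw [div_le_iff₀ hδ] at h
  have h2 : 0 < (2 : ℝ) ^ ((lam + 1) / 2) := by positivity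
  refine le_of_mul_le_mul_left ?_ h2
  calc 2 ^ ((lam + 1) / 2) * (C * (1 + q) ^ lam) = C * 2 ^ ((lam + 1) / 2) * (1 + q) ^ lam := by ring
    _ ≤ (δ * (1 + q)) * (1 + q) ^ lam := by
      refine mul_le_mul_of_nonneg_right ?_ (by positivity)
      linarith
    _ = δ * (1 + q) ^ (lam + 1) := by rw [Real.rpow_add_one hq1.ne']; ring
    _ ≤ δ * (2 ^ ((lam + 1) / 2) * (1 + q ^ 2) ^ ((lam + 1) / 2)) := mul_le_mul_of_nonneg_left h1 hδ.le
    _ = _ := by ring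

set_option maxHeartbeats 1600000 in
/-- The defect lies below every multiple of a growing supersolution. -/
lemma Pair.defect_le_mul (h : Pair N γ Cl Cu ρ m T T1 T2 χ u v) (ha : Adm T1 T3 σ μ) :
    ∃ c, ∀ δ, 0 < δ → ∀ᵐ x, defect χ T2 m σ μ u v x T3 ≤
      δ * Real.exp (c * T3) * (1 + ‖x‖ ^ 2) ^ ((gexp γ m + 1) / 2) := by
  have := nontrivial_Eu h.hN
  have hn : (2:ℝ) < N := three_le_cast h.hN
  have hm := h.hm
  have hW := h.hW
  have hCu := hW.Cu_nonneg h.hN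
  obtain ⟨C1, hC1, hgr⟩ := h.defect_growth ha
  obtain ⟨Cv, hCv, hvb⟩ := h.hv.favg_bound h.hN hm h.hT hW ha.hσ h.hχ
  obtain ⟨Cμ, hCμ, hadd⟩ := exists_add_rpow_le hm ha.hμ
  set lam := gexp γ m with hlam
  have hl : 0 < lam := gexp_pos hW.g2 hm
  set j := (lam + 1) / 2 with hj
  have hj0 : 0 < j := by positivity
  set Ck := 4 * j * |j - 1| + 2 * (N : ℝ) * j with hCk
  have hCk0 : 0 ≤ Ck := by positivity
  have hCl := hW.l0
  have hl0 : 0 < lam / m := by positivity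
  have hγ0 := hW.g0
  set c := Cμ * (2 * Ck / Cl) ^ m * C1 ^ (m - 1) with hc
  have hc0 : 0 ≤ c := by positivity
  refine ⟨c, fun δ hδ => ?_⟩
  set R := max (C1 * 2 ^ j / δ) 1 with hR
  have hR0 : 0 < R := lt_of_lt_of_le one_pos (le_max_right _ _)
  set G : ℝ → ℝ := fun t => δ * Real.exp (c * t) with hG
  have hGc : Continuous G := by fun_prop
  have hG0 : ∀ t, 0 < G t := fun t => by simp only [hG]; positivity
  have hGδ : ∀ t ∈ Icc 0 T3, δ ≤ G t := fun t ht =>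
    le_mul_of_one_le_right hδ.le (Real.one_le_exp (mul_nonneg hc0 ht.1))
  have hGT : ∀ t ∈ Icc 0 T3, G t ≤ G T3 := fun t ht =>
    mul_le_mul_of_nonneg_left (Real.exp_le_exp.2 (mul_le_mul_of_nonneg_left ht.2 hc0)) hδ.le
  have hGd : ∀ t, HasDerivAt G (c * G t) t := fun t =>
    ((((hasDerivAt_id t).const_mul c).exp).const_mul δ).congr_deriv (by simp only [hG, id]; ring)
  set P : Eu N → ℝ := fun x => (1 + ‖x‖ ^ 2) ^ j with hP
  have hPc : Continuous P := (by fun_prop : Continuous fun x : Eu N => 1 + ‖x‖ ^ 2).rpow_const fun x => Or.inl (by positivity)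
  have hP0 : ∀ x, 0 < P x := fun x => by simp only [hP]; positivity
  set D : Eu N → ℝ → ℝ := fun x t => defect χ T2 m σ μ u v x t - G t * P x with hD
  set f : Eu N → ℝ → ℝ := fun x t => ρ x * (favg σ (v x) (μ * t) - u x t) - -radLpow N j (G t) (‖x‖ ^ 2) with hf
  set ζ : Eu N → ℝ → ℝ := fun x t => u x t ^ m - μ * favg σ (fun s => v x s ^ m) (μ * t) - c * (G t * P x) with hζ
  have hDm : Measurable fun q : Eu N × ℝ => D q.1 q.2 :=
    (measurable_defect h.hu h.hv h.hχ).sub ((hGc.measurable.comp measurable_snd).mul (hPc.measurable.comp measurable_fst))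
  have hRm : Measurable fun q : Eu N × ℝ => radLpow N j (G q.2) (‖q.1‖ ^ 2) := by
    have h2 : Measurable fun q : Eu N × ℝ => G q.2 := hGc.measurable.comp measurable_snd
    unfold radLpow radL
    fun_prop
  have hfm : Measurable fun q : Eu N × ℝ => f q.1 q.2 :=
    ((hW.meas.comp measurable_fst).mul ((h.hv.measurable_favg.comp (measurable_fst.prodMk (measurable_snd.const_mul μ))).sub
      h.hu.meas)).sub hRm.neg
  have hLc : ∀ t, Continuous fun y : Eu N => radLpow N j (G t) (‖y‖ ^ 2) := fun t => by
    simpa [radLpow] using (rad_pow j (G t)).contL N 0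
  have hcomp := comparison (N := N) h.hN (γ := γ) (R := R) (a := 0) (b := T3) (C1 := C1 * (1 + R) ^ lam)
    (Bc := Cu * (Cv * (R + 3) ^ (lam / m)) + Ck * (G T3 * (1 + (R + 2) ^ 2) ^ j) * (R + 2) ^ γ) hγ0 hW.g2 hR0 ha.h3
    (by positivity) (by have := hG0 T3; positivity)
    (D := D) (f := f) (z := fun x => posRate (D x) (ζ x))
    (Ψ := fun x => Pt χ T2 m u x 0 + Pt χ T2 m v x 0 + G T3 * P x)
    ((h.pu.add h.pv).add (LI.of_continuous (continuous_const.mul hPc))) hDm hfm ?_ ?_ ?_ ?_ ?_ ?_ ?_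
  · filter_upwards [hcomp, hgr] with x hx hx2
    rcases lt_or_ge ‖x‖ R with hxR | hxR
    · have h1 := hx hxR
      simp only [hD] at h1
      linarith
    · refine (hx2 T3 ⟨ha.h3.le, le_rfl⟩).trans ((growth_le hδ hl (norm_nonneg _) ((le_max_left _ _).trans hxR)).trans ?_)
      exact mul_le_mul_of_nonneg_right (hGδ T3 ⟨ha.h3.le, le_rfl⟩) (hP0 x).le
  · filter_upwards [h.defect_continuousOn ha, h.defect_bounds ha] with x hx hx2
    refine ⟨hx.sub (hGc.mul continuous_const).continuousOn, fun t ht => ?_⟩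
    refine (abs_sub _ _).trans (add_le_add (hx2 t ht).2 ?_)
    rw [abs_of_pos (mul_pos (hG0 t) (hP0 x))]
    exact mul_le_mul_of_nonneg_right (hGT t ht) (hP0 x).le
  · filter_upwards [h.defect_zero ha, hgr, h.defect_continuousOn ha, h.defect_incr ha] with x h0 h1 h2 h3 hxR
    have hDx : Measurable (D x) := hDm.comp (measurable_const.prodMk measurable_id)
    have hGi : ContinuousOn (fun t => c * (G t * P x)) (Icc 0 T3) := by fun_prop
    have hζi : IntegrableOn (ζ x) (Icc 0 T3) := h3.1.sub hGi.integrableOn_Icc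
    have hDc : ContinuousOn (D x) (Icc 0 T3) := h2.sub (hGc.mul continuous_const).continuousOn
    refine ⟨?_, fun t ht => ?_, posRate_integrableOn hDx hζi, posRate_nonneg _ _, fun t1 t2 g1 g2 g12 =>
      posRate_incr hDx hDc hζi (fun s t hs ht hst => ?_) g1 g2 g12⟩
    · have := mul_pos (hG0 0) (hP0 x)
      simp only [hD]; linarith
    · have := mul_pos (hG0 t) (hP0 x)
      have h5 : C1 * (1 + ‖x‖) ^ lam ≤ C1 * (1 + R) ^ lam :=
        mul_le_mul_of_nonneg_left (Real.rpow_le_rpow (by positivity) (by linarith) hl.le) hC1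
      have := h1 t ht
      simp only [hD]; linarith
    · have hsub : Ioc s t ⊆ Icc 0 T3 := fun r hr => ⟨hs.1.trans hr.1.le, hr.2.trans ht.2⟩
      have e2 : G t * P x - G s * P x = ∫ r in Ioc s t, c * (G r * P x) := by
        rw [← intervalIntegral.integral_of_le hst]
        refine (intervalIntegral.integral_eq_sub_of_hasDerivAt (f := fun t => G t * P x) (fun r _ => ?_) ?_).symm
        · exact ((hGd r).mul_const (P x)).congr_deriv (by ring)
        · exact (by fun_prop : Continuous fun t => c * (G t * P x)).intervalIntegrable _ _
      have e3 : ∫ r in Ioc s t, ζ x r = (∫ r in Ioc s t, (u x r ^ m - μ * favg σ (fun s => v x s ^ m) (μ * r))) -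
          ∫ r in Ioc s t, c * (G r * P x) := integral_sub (h3.1.mono_set hsub) (hGi.integrableOn_Icc.mono_set hsub)
      rw [e3, ← e2, ← h3.2 s t hs ht hst]
      simp only [hD]; ring
  · filter_upwards [hgr] with x hx hxR _ t ht
    have h1 := hx t ht
    have h2 := growth_le hδ hl (norm_nonneg x) ((le_max_left _ _).trans hxR)
    have h3 : δ * P x ≤ G t * P x := mul_le_mul_of_nonneg_right (hGδ t ht) (hP0 x).le
    simp only [hD]; linarith
  · filter_upwards [h.defect_LI ha] with t ht hts
    exact (ht hts).2.sub (LI.of_continuous (hLc t).neg)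
  · refine Eventually.of_forall fun t ht => ?_
    have htI := Ioo_subset_Icc_self ht
    filter_upwards [hvb, Measure.ae_ne volume (0 : Eu N)] with y hy hy0 hyR
    have hy00 : 0 < ‖y‖ := norm_pos_iff.2 hy0
    have hv0 := h.hv.favg_nonneg ha.hσ y (μ * t)
    have h1 : ρ y * favg σ (v y) (μ * t) ≤ Cu * ‖y‖ ^ (-γ) * (Cv * (R + 3) ^ (lam / m)) := by
      refine mul_le_mul (hW.up y hy0) ((hy _ (ha.arg_nonneg htI) (ha.arg_le htI)).trans ?_) hv0 (by positivity)
      exact mul_le_mul_of_nonneg_left (Real.rpow_le_rpow (by positivity) (by linarith) hl0.le) hCv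
    have h2 : 0 ≤ ρ y * u y t := mul_nonneg (hW.nonneg y) (h.hu.nonneg y t)
    have h3 : 1 ≤ (R + 2) ^ γ * ‖y‖ ^ (-γ) := by
      rw [Real.rpow_neg hy00.le, ← div_eq_mul_inv, ← Real.div_rpow (by linarith) hy00.le]
      exact Real.one_le_rpow ((one_le_div hy00).2 hyR.le) hγ0
    have h4 : radLpow N j (G t) (‖y‖ ^ 2) ≤ Ck * (G T3 * (1 + (R + 2) ^ 2) ^ j) := by
      refine (radLpow_le hj0.le (hG0 t).le (by positivity)).trans (mul_le_mul_of_nonneg_left ?_ hCk0)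
      refine mul_le_mul (hGT t htI) ?_ (by positivity) (hG0 _).le
      have e1 : (1:ℝ) ≤ 1 + ‖y‖ ^ 2 := by have := sq_nonneg ‖y‖; linarith
      refine (Real.rpow_le_rpow_of_exponent_le e1 (by linarith)).trans (Real.rpow_le_rpow (by positivity) ?_ hj0.le)
      have := pow_le_pow_left₀ hy00.le hyR.le 2
      linarith
    have h5 := mul_le_mul_of_nonneg_left h3 (show 0 ≤ Ck * (G T3 * (1 + (R + 2) ^ 2) ^ j) by have := hG0 T3; positivity)
    simp only [hf]
    linarith
  · intro k
    filter_upwards [h.defect_potAt ha (r := 1 / (k + 1 : ℝ)) (by positivity), h.defect_LI ha] with t ht ht2 hts x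
    have hR1 := (rad_pow j (G t)).potAt h.hN (1 / (k + 1 : ℝ)) x
    exact (ht hts x).sub (by positivity) hR1 (ht2 hts).1 (ht2 hts).2
      (LI.of_continuous (continuous_const.mul hPc)) (LI.of_continuous (hLc t).neg)
  · filter_upwards [hgr] with x hx hxR
    refine Eventually.of_forall fun t ht hz => ?_
    have htI := Ioo_subset_Icc_self ht
    have hz1 := (posRate_pos hz).1
    have hz2 := (posRate_pos hz).2
    simp only [hD] at hz1
    have hH := mul_pos (hG0 t) (hP0 x)
    have := source_nonpos (γ := γ) (rho := ρ x) (U := u x t) (V := favg σ (v x) (μ * t)) (q := ‖x‖) (Ck := Ck)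
      (Lr := radLpow N j (G t) (‖x‖ ^ 2)) (W := favg σ (fun s => v x s ^ m) (μ * t)) (H := G t * P x)
      hm hCl hCk0 hC1 hCμ hadd ha.hμ hlam
      (norm_nonneg x) (hW.low x) (h.hu.nonneg x t) (h.hv.favg_nonneg ha.hσ x _)
      (h.hv.favg_rpow_le hm ha.hσ (ha.arg_nonneg htI) h.hχ (ha.arg_le htI) x) hH.le
      (by have := hx t htI; linarith) ?_ hz2
    · simp only [hf]; linarith
    · refine (radLpow_le hj0.le (hG0 t).le (by positivity)).trans (le_of_eq ?_)
      rw [Real.rpow_sub_one (by positivity), mul_div_assoc]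

lemma Pair.defect_nonpos (h : Pair N γ Cl Cu ρ m T T1 T2 χ u v) (ha : Adm T1 T3 σ μ) :
    ∀ᵐ x, defect χ T2 m σ μ u v x T3 ≤ 0 := by
  obtain ⟨c, hc⟩ := h.defect_le_mul ha
  have h1 := ae_all_iff.2 fun k : ℕ => hc (1 / (k + 1 : ℝ)) (by positivity)
  filter_upwards [h1] with x hx
  have h2 : Tendsto (fun k : ℕ => 1 / (k + 1 : ℝ) * Real.exp (c * T3) * (1 + ‖x‖ ^ 2) ^ ((gexp γ m + 1) / 2)) atTop (𝓝 0) := by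
    have := (tendsto_one_div_add_atTop_nhds_zero_nat (𝕜 := ℝ)).mul_const
      (Real.exp (c * T3) * (1 + ‖x‖ ^ 2) ^ ((gexp γ m + 1) / 2))
    simpa only [zero_mul, mul_assoc] using this
  exact ge_of_tendsto' h2 hx

lemma Pair.Pt_sub_le (h : Pair N γ Cl Cu ρ m T T1 T2 χ u v) (h0 : 0 < T3) (h1 : T3 < T1) :
    ∀ᵐ x, Pt χ T2 m u x 0 - Pt χ T2 m u x T3 ≤ Pt χ T2 m v x 0 - Pt χ T2 m v x T3 := by
  set ε : ℕ → ℝ := fun k => (T1 - T3) / (T3 + 2) * (1 / (k + 1 : ℝ)) with hε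
  have hd : 0 < T1 - T3 := by linarith
  have hε0 : ∀ k, 0 < ε k := fun k => by simp only [hε]; positivity
  have hε1 : ∀ k, T3 + ε k * (T3 + 2) ≤ T1 := fun k => by
    have e1 : ε k * (T3 + 2) = (T1 - T3) * (1 / (k + 1 : ℝ)) := by simp only [hε]; field_simp
    have e2 : 1 / (k + 1 : ℝ) ≤ 1 := by
      rw [div_le_one (by positivity)]
      have := Nat.cast_nonneg (α := ℝ) k
      linarith
    have := mul_le_mul_of_nonneg_left e2 hd.le
    linarith
  have ha : ∀ k, Adm T1 T3 (ε k) (1 + ε k) := fun k =>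
    ⟨hε0 k, by linarith [hε0 k], h0, by linarith [hε1 k]⟩
  filter_upwards [ae_all_iff.2 fun k => h.defect_nonpos (ha k), h.iv] with x hx hi
  have hc := Pt_continuousOn (m := m) h.hχ hi
  have hle : ∀ k, Pt χ T2 m u x 0 - Pt χ T2 m u x T3 ≤ Pt χ T2 m v x 0 - Pt χ T2 m v x (T3 + ε k * (T3 + 2)) := fun k => by
    have e1 := h.hv.Pt_le_kap (τ := (1 + ε k) * T3) (hε0 k) (by have := hε0 k; positivity) h.hχ x
    have e2 := hx k
    rw [show (1 + ε k) * T3 + 2 * ε k = T3 + ε k * (T3 + 2) by ring] at e1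
    unfold defect at e2
    linarith
  have hlim : Tendsto (fun k => T3 + ε k * (T3 + 2)) atTop (𝓝[Icc 0 T1] T3) := by
    refine tendsto_nhdsWithin_iff.2 ⟨?_, Eventually.of_forall fun k => ⟨?_, hε1 k⟩⟩
    · have := (((tendsto_one_div_add_atTop_nhds_zero_nat (𝕜 := ℝ)).const_mul ((T1 - T3) / (T3 + 2))).mul_const (T3 + 2)).const_add T3
      simpa only [mul_zero, zero_mul, add_zero] using this
    · have := hε0 k
      positivity
  exact ge_of_tendsto' (tendsto_const_nhds.sub ((hc T3 ⟨h0.le, h1.le⟩).tendsto.comp hlim)) hle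

lemma Pair.eq_slice (h : Pair N γ Cl Cu ρ m T T1 T2 χ u v) (h' : Pair N γ Cl Cu ρ m T T1 T2 χ v u) :
    ∀ᵐ x, ∀ᵐ t, t ∈ Ioo 0 T1 → u x t = v x t := by
  obtain ⟨S, hS, hSd⟩ := TopologicalSpace.exists_countable_dense ℝ
  have h12 : ∀ᵐ x, ∀ t ∈ S, t ∈ Ioo 0 T1 →
      Pt χ T2 m u x 0 - Pt χ T2 m u x t = Pt χ T2 m v x 0 - Pt χ T2 m v x t := by
    refine (ae_ball_iff hS).2 fun t _ => ?_
    by_cases ht : t ∈ Ioo 0 T1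
    · filter_upwards [h.Pt_sub_le ht.1 ht.2, h'.Pt_sub_le ht.1 ht.2] with x e1 e2 _ using le_antisymm e1 e2
    · exact Eventually.of_forall fun x hx => absurd hx ht
  filter_upwards [h12, h.iu, h.iv] with x hx hi hi'
  have hT1 := h.hχ.pos
  have hc := (Pt_continuousOn (m := m) h.hχ hi).mono Ioo_subset_Icc_self
  have hc' := (Pt_continuousOn (m := m) h.hχ hi').mono Ioo_subset_Icc_self
  have hall : EqOn (fun t => Pt χ T2 m u x 0 - Pt χ T2 m u x t) (fun t => Pt χ T2 m v x 0 - Pt χ T2 m v x t) (Ioo 0 T1) := by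
    have hd : Ioo 0 T1 ⊆ closure (Ioo 0 T1 ∩ S) := hSd.open_subset_closure_inter isOpen_Ioo
    refine EqOn.of_subset_closure (s := Ioo 0 T1 ∩ S) (fun t ht => hx t ht.2 ht.1)
      (continuousOn_const.sub hc) (continuousOn_const.sub hc') inter_subset_left hd
  have hsub : Ioc 0 T1 ⊆ Ioc 0 T2 := Ioc_subset_Ioc_right h.hχ.lt12.le
  have iU := (intervalIntegrable_iff_integrableOn_Ioc_of_le hT1.le).2 (hi.mono_set hsub)
  have iV := (intervalIntegrable_iff_integrableOn_Ioc_of_le hT1.le).2 (hi'.mono_set hsub)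
  filter_upwards [iU.ae_hasDerivAt_integral, iV.ae_hasDerivAt_integral] with t d1 d2 ht
  have htu : t ∈ uIcc 0 T1 := by rw [uIcc_of_le hT1.le]; exact Ioo_subset_Icc_self ht
  have e1 := d1 htu 0 left_mem_uIcc
  have e2 := d2 htu 0 left_mem_uIcc
  have e3 : (fun s => ∫ r in (0 : ℝ)..s, u x r ^ m) =ᶠ[𝓝 t] fun s => ∫ r in (0 : ℝ)..s, v x r ^ m := by
    filter_upwards [isOpen_Ioo.mem_nhds ht] with s hs
    rw [intervalIntegral.integral_of_le hs.1.le, intervalIntegral.integral_of_le hs.1.le,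
      ← Pt_incr h.hχ hi le_rfl hs.1.le hs.2.le, ← Pt_incr h.hχ hi' le_rfl hs.1.le hs.2.le]
    exact hall hs
  have e4 := (e2.congr_of_eventuallyEq e3).unique e1
  exact (Real.rpow_left_injOn (by linarith [h.hm] : m ≠ 0)) (h.hu.nonneg x t) (h.hv.nonneg x t) e4.symm

lemma Sol.eq_ae (hN : 3 ≤ N) (hm : 1 < m) (hT : 0 < T) (hW : Wt N γ Cl Cu ρ) (hu : Sol ρ m T u) (hv : Sol ρ m T v)
    (hs : ∀ φ : Eu N → ℝ, Continuous φ → HasCompactSupport φ →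
      Tendsto (fun t => ∫ x, (u x t - v x t) * φ x * ρ x) ((𝓝[>] 0) ⊓ ae volume) (𝓝 0)) :
    ∀ᵐ x, ∀ᵐ t, t ∈ Ioo 0 T → u x t = v x t := by
  have hs' : ∀ φ : Eu N → ℝ, Continuous φ → HasCompactSupport φ →
      Tendsto (fun t => ∫ x, (v x t - u x t) * φ x * ρ x) ((𝓝[>] 0) ⊓ ae volume) (𝓝 0) := fun φ hφ hφc => by
    have := (hs φ hφ hφc).neg
    rw [neg_zero] at this
    refine this.congr fun t => ?_
    rw [← integral_neg]
    exact integral_congr_ae (Eventually.of_forall fun x => by ring)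
  have hk : ∀ k : ℕ, ∀ᵐ x, ∀ᵐ t, t ∈ Ioo 0 (T * (1 - 1 / ((k : ℝ) + 2))) → u x t = v x t := fun k => by
    have hk0 : (0 : ℝ) < 1 / ((k : ℝ) + 2) := by positivity
    have hk1 : 1 / ((k : ℝ) + 2) < 1 := by
      rw [div_lt_one (by positivity)]
      have := Nat.cast_nonneg (α := ℝ) k
      linarith
    set T1 := T * (1 - 1 / ((k : ℝ) + 2)) with hT1
    have h1 : 0 < T1 := mul_pos hT (by linarith)
    have h2 : T1 < T := mul_lt_of_lt_one_right hT (by linarith)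
    obtain ⟨χ, hχ, hd, C, hC, hdC⟩ := exists_cut (m := m) h1 (show T1 < (T1 + T) / 2 by linarith)
      (show (T1 + T) / 2 < T by linarith) hm
    obtain ⟨iu, pu, gu⟩ := hu.trace hN hm hT hW hχ hd hC hdC
    obtain ⟨iv, pv, gv⟩ := hv.trace hN hm hT hW hχ hd hC hdC
    exact Pair.eq_slice ⟨hN, hm, hT, hW, hu, hv, hχ, iu, iv, pu, pv, gu, hu.init_potAt hN hv hχ iu pu iv pv hs⟩
      ⟨hN, hm, hT, hW, hv, hu, hχ, iv, iu, pv, pu, gv, hv.init_potAt hN hu hχ iv pv iu pu hs'⟩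
  filter_upwards [ae_all_iff.2 hk] with x hx
  filter_upwards [ae_all_iff.2 hx] with t ht htT
  obtain ⟨k, hk⟩ := exists_nat_gt (T / (T - t))
  have hTt : 0 < T - t := by linarith [htT.2]
  refine ht k ⟨htT.1, ?_⟩
  rw [div_lt_iff₀ hTt] at hk
  have e1 : T * (1 / ((k : ℝ) + 2)) < T - t := by
    rw [mul_one_div, div_lt_iff₀ (by positivity)]
    linarith
  linarith

lemma ae_ae_of_strip {p : Eu N → ℝ → Prop}
    (h : ∀ᵐ q ∂(volume.restrict ((univ : Set (Eu N)) ×ˢ Ioo 0 T) : Measure (Eu N × ℝ)), p q.1 q.2) :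
    ∀ᵐ t, t ∈ Ioo 0 T → ∀ᵐ x, p x t := by
  rw [ae_restrict_iff' (MeasurableSet.univ.prod measurableSet_Ioo)] at h
  have h1 : ∀ᵐ q ∂((volume : Measure ℝ).prod (volume : Measure (Eu N))), q.1 ∈ Ioo 0 T → p q.2 q.1 := by
    have := (Measure.measurePreserving_swap (μ := (volume : Measure ℝ)) (ν := (volume : Measure (Eu N)))).quasiMeasurePreserving.ae
      (p := fun q : Eu N × ℝ => q ∈ univ ×ˢ Ioo 0 T → p q.1 q.2) h
    filter_upwards [this] with q hq hq1 using hq ⟨trivial, hq1⟩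
  filter_upwards [Measure.ae_ae_of_ae_prod h1] with t ht htT
  filter_upwards [ht] with x hx using hx htT

end

/-- **Uniqueness without global assumptions** (Theorem 2.9): two non-negative very weak
solutions of the WPME in `ℝ^N × (0,T)` having the same initial trace (in the essential-limit
sense) coincide. -/
theorem stmt_2 {N : ℕ} (hN : 3 ≤ N) (m γ Cl Cu : ℝ) (hm : 1 < m) (T : ℝ) (hT : 0 < T)
    (ρ : Eu N → ℝ) (hρ : WeightCond N γ Cl Cu ρ)
    (u v : Eu N → ℝ → ℝ)
    (hu : VWS ρ m univ 0 T u) (hv : VWS ρ m univ 0 T v)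
    (hupos : ∀ᵐ p ∂(volume.restrict ((univ : Set (Eu N)) ×ˢ Ioo 0 T) : Measure (Eu N × ℝ)),
      0 ≤ u p.1 p.2)
    (hvpos : ∀ᵐ p ∂(volume.restrict ((univ : Set (Eu N)) ×ˢ Ioo 0 T) : Measure (Eu N × ℝ)),
      0 ≤ v p.1 p.2)
    (hsame : ∀ φ : Eu N → ℝ, Continuous φ → HasCompactSupport φ →
      Tendsto (fun t => ∫ x, (u x t - v x t) * φ x * ρ x)
        ((𝓝[>] (0:ℝ)) ⊓ ae (volume : Measure ℝ)) (𝓝 0)) :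
    ∀ᵐ p ∂(volume.restrict ((univ : Set (Eu N)) ×ˢ Ioo 0 T) : Measure (Eu N × ℝ)),
      u p.1 p.2 = v p.1 p.2 := by
  obtain ⟨ρ', hW, hρ'⟩ := exists_wt hρ
  obtain ⟨u', hu', hue⟩ := hu.exists_sol hm hρ' hupos
  obtain ⟨v', hv', hve⟩ := hv.exists_sol hm hρ' hvpos
  have hs : ∀ φ : Eu N → ℝ, Continuous φ → HasCompactSupport φ →
      Tendsto (fun t => ∫ x, (u' x t - v' x t) * φ x * ρ' x) ((𝓝[>] (0 : ℝ)) ⊓ ae volume) (𝓝 0) := fun φ hφ hφc => by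
    refine (hsame φ hφ hφc).congr' ?_
    have h1 : ∀ᶠ t in (𝓝[>] (0 : ℝ)) ⊓ ae volume, t ∈ Ioo 0 T :=
      mem_inf_of_left (Ioo_mem_nhdsGT hT)
    have h2 := (ae_ae_of_strip (p := fun x t => u' x t = u x t) hue).filter_mono
      (inf_le_right : (𝓝[>] (0 : ℝ)) ⊓ ae volume ≤ ae volume)
    have h3 := (ae_ae_of_strip (p := fun x t => v' x t = v x t) hve).filter_mono
      (inf_le_right : (𝓝[>] (0 : ℝ)) ⊓ ae volume ≤ ae volume)
    filter_upwards [h1, h2, h3] with t e1 e2 e3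
    refine integral_congr_ae ?_
    filter_upwards [e2 e1, e3 e1, hρ'] with x g1 g2 g3
    rw [g1, g2, g3]
  have h1 := hu'.eq_ae hN hm hT hW hv' hs
  have h2 : ∀ᵐ p : Eu N × ℝ, p.2 ∈ Ioo 0 T → u' p.1 p.2 = v' p.1 p.2 := by
    have hm1 : MeasurableSet {p : Eu N × ℝ | p.2 ∈ Ioo 0 T} := measurable_snd measurableSet_Ioo
    exact (Measure.ae_prod_iff_ae_ae (hm1.imp (measurableSet_eq_fun hu'.meas hv'.meas))).2 h1
  filter_upwards [hue, hve, ae_restrict_of_ae h2,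
    ae_restrict_mem (MeasurableSet.univ.prod measurableSet_Ioo)] with p e1 e2 e3 e4
  rw [← e1, ← e2, e3 e4.2]
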